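/- Let Ω ⊂ ℝⁿ be an open domain with compact boundary of class C³, let p ∈ [1,∞), and suppose ρ satisfies Assumptions (A1) and (A2). Then for every u ∈ W^{2,p}_M(Ω), L_ε^Ω u → L^Ω u strongly in L^p(Ω) as ε → 0, where L^Ω u := −div(M∇u). -/

import Mathlib

open MeasureTheory Filter Topology ENNReal Matrix

noncomputable section

abbrev EV (n : ℕ) := EuclideanSpace ℝ (Fin n)

/-- The kernel `J(x) = ρ(x)/|x|²`. -/
def kernelJ {n : ℕ} (ρ : EV n → ℝ) (x : EV n) : ℝ := ρ x / ‖x‖ ^ 2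

/-- The rescaled density `ρ_ε(x) = ε^{-n} ρ(x/ε)`. -/
def scaled {n : ℕ} (ρ : EV n → ℝ) (ε : ℝ) (x : EV n) : ℝ := (ε ^ n)⁻¹ * ρ (ε⁻¹ • x)

/-- Assumption (A1): `ρ` is measurable, nonnegative, not a.e. zero, even,
and `∫ ρ(x)(1+|x|) dx < ∞`. -/
def A1 {n : ℕ} (ρ : EV n → ℝ) : Prop :=
  Measurable ρ ∧ (∀ x, 0 ≤ ρ x) ∧ ¬ (ρ =ᵐ[volume] (fun _ => (0 : ℝ))) ∧
  (∀ᵐ x : EV n ∂volume, ρ (-x) = ρ x) ∧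
  Integrable (fun x : EV n => ρ x * (1 + ‖x‖)) volume

/-- `L_ε u (x) = ∫_{ℝⁿ} J_ε(x-y) (u(x) - u(y) - ∇u(x)·(x-y)) dy`. -/
def nlOp {n : ℕ} (ρ : EV n → ℝ) (ε : ℝ) (u : EV n → ℝ) (x : EV n) : ℝ :=
  ∫ y : EV n, kernelJ (scaled ρ ε) (x - y) * (u x - u y - fderiv ℝ u x (x - y))

/-- The classical partial derivative `∂ᵢ u`. -/
def partialD {n : ℕ} (i : Fin n) (u : EV n → ℝ) : EV n → ℝ :=
  fun x => fderiv ℝ u x (EuclideanSpace.single i 1)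

/-- Iterated classical partial derivatives along a list of directions. -/
def partialDList {n : ℕ} : List (Fin n) → (EV n → ℝ) → (EV n → ℝ)
  | [], u => u
  | i :: l, u => partialD i (partialDList l u)

/-- The momentum matrix `M = (1/2)∫_{ℝⁿ} J(z) z ⊗ z dz`. -/
def momentum {n : ℕ} (ρ : EV n → ℝ) : Matrix (Fin n) (Fin n) ℝ :=
  Matrix.of fun i j => (1 / 2 : ℝ) * ∫ z : EV n, kernelJ ρ z * z i * z j

/-- Multiplication of a vector of `ℝⁿ` by a matrix. -/
def mulVecE {m : ℕ} (Q : Matrix (Fin m) (Fin m) ℝ) (x : EV m) : EV m :=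
  (WithLp.equiv 2 (Fin m → ℝ)).symm (Q.mulVec ((WithLp.equiv 2 (Fin m → ℝ)) x))

/-- The point `(z', zₙ) ∈ ℝⁿ` with first coordinates `z' ∈ ℝ^{n-1}` and last coordinate `zₙ`. -/
def snocE {n : ℕ} (z' : EV n) (t : ℝ) : EV (n + 1) :=
  (WithLp.equiv 2 (Fin (n + 1) → ℝ)).symm
    (Fin.snoc ((WithLp.equiv 2 (Fin n → ℝ)) z') t)

/-- `v = ∂ᵢ u` weakly on `Ω`. -/
def WeakDerivOn {n : ℕ} (Ω : Set (EV n)) (i : Fin n) (u v : EV n → ℝ) : Prop :=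
  ∀ φ : EV n → ℝ, ContDiff ℝ (⊤ : ℕ∞) φ → HasCompactSupport φ → tsupport φ ⊆ Ω →
    ∫ x in Ω, u x * partialD i φ x = - ∫ x in Ω, v x * φ x

/-- `D` is a system of weak partial derivatives of `u` on `Ω` up to order `k`,
all lying in `L^p(Ω)`; i.e. `D` witnesses that `u ∈ W^{k,p}(Ω)`. -/
def IsSobDerivs {n : ℕ} (Ω : Set (EV n)) (k : ℕ) (p : ℝ≥0∞) (u : EV n → ℝ)
    (D : List (Fin n) → EV n → ℝ) : Prop :=
  D [] = u ∧
  (∀ l : List (Fin n), l.length < k → ∀ i : Fin n, WeakDerivOn Ω i (D l) (D (i :: l))) ∧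
  (∀ l : List (Fin n), l.length ≤ k → MemLp (D l) p (volume.restrict Ω))

/-- `u ∈ W^{k,p}(Ω)`. -/
def MemW {n : ℕ} (Ω : Set (EV n)) (k : ℕ) (p : ℝ≥0∞) (u : EV n → ℝ) : Prop :=
  ∃ D, IsSobDerivs Ω k p u D

/-- The `W^{k,p}`-norm computed from a system `D` of weak derivatives:
the sum of the `L^p` norms of all weak derivatives of order at most `k`. -/
def WNormD {n : ℕ} (k : ℕ) (p : ℝ≥0∞) (μ : Measure (EV n))
    (D : List (Fin n) → EV n → ℝ) : ℝ≥0∞ :=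
  ∑' l : List (Fin n), if l.length ≤ k then eLpNorm (D l) p μ else 0

/-- The first `n` coordinates of a point of `ℝ^{n+1}`. -/
def firstCoords {n : ℕ} (x : EV (n + 1)) : EV n :=
  (WithLp.equiv 2 (Fin n → ℝ)).symm (fun i => x i.castSucc)

/-- The curved half space `ℝⁿ_γ = {x : xₙ > γ(x₁,…,x_{n-1})}`. -/
def halfSpace {n : ℕ} (γ : EV n → ℝ) : Set (EV (n + 1)) :=
  {x : EV (n + 1) | γ (firstCoords x) < x (Fin.last n)}

/-- `γ ∈ C^k_b`: `γ` is `k` times continuously differentiable with bounded derivatives. -/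
def Ckb {n : ℕ} (k : ℕ) (γ : EV n → ℝ) : Prop :=
  ContDiff ℝ k γ ∧ ∀ m : ℕ, m ≤ k → ∃ C : ℝ, ∀ x, ‖iteratedFDeriv ℝ m γ x‖ ≤ C

/-- Assumption (A2): `ρ ∈ C¹(ℝⁿ∖{0})` with singularity bounds
`|ρ(x)| ≤ c₀|x|^{2-α-n}(1+|x|)^{-N}`, `|∇ρ(x)| ≤ c₁|x|^{1-α-n}(1+|x|)^{-N}` for some
`c₀, c₁ > 0`, `α ∈ (0,2)`, `N > 3-α`; and, with `A := √M`, the kernel satisfies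
`∫_{ℝ^{n-1}} J(AQ(z', zₙ)) z' dz' = 0` for all `zₙ ∈ ℝ` and `Q ∈ SO(n)`.
(The ambient dimension is `n + 1`.) -/
def A2 {n : ℕ} (ρ : EV (n + 1) → ℝ) : Prop :=
  ContDiffOn ℝ 1 ρ {(0 : EV (n + 1))}ᶜ ∧
  (∃ c₀ c₁ α N : ℝ, 0 < c₀ ∧ 0 < c₁ ∧ 0 < α ∧ α < 2 ∧ 3 - α < N ∧
    ∀ x : EV (n + 1), x ≠ 0 →
      |ρ x| ≤ c₀ * ‖x‖ ^ ((2 : ℝ) - α - (n + 1 : ℝ)) * (1 + ‖x‖) ^ (-N) ∧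
      ‖fderiv ℝ ρ x‖ ≤ c₁ * ‖x‖ ^ ((1 : ℝ) - α - (n + 1 : ℝ)) * (1 + ‖x‖) ^ (-N)) ∧
  (∃ A : Matrix (Fin (n + 1)) (Fin (n + 1)) ℝ, A.PosDef ∧ A * A = momentum ρ ∧
    ∀ t : ℝ, ∀ Q : Matrix (Fin (n + 1)) (Fin (n + 1)) ℝ, Qᵀ * Q = 1 → Q.det = 1 →
      (∫ z' : EV n, kernelJ ρ (mulVecE (A * Q) (snocE z' t)) • z') = 0)

/-- The homogeneous conormal boundary condition `M∇u · n = 0` on `∂Ω`, formulated weakly: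
for any system of weak derivatives of `u ∈ W^{2,p}(Ω)` and any test function
`φ ∈ C_c^∞(ℝⁿ)`, Green's formula holds on `Ω` with no boundary contribution. -/
def NeumannBC {m : ℕ} (Ω : Set (EV m)) (Mm : Matrix (Fin m) (Fin m) ℝ) (p : ℝ≥0∞)
    (u : EV m → ℝ) : Prop :=
  ∀ D : List (Fin m) → EV m → ℝ, IsSobDerivs Ω 2 p u D →
    ∀ φ : EV m → ℝ, ContDiff ℝ (⊤ : ℕ∞) φ → HasCompactSupport φ →
      (∑ i : Fin m, ∑ j : Fin m, Mm i j * ∫ x in Ω, D [i, j] x * φ x)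
        = - ∑ i : Fin m, ∑ j : Fin m, Mm i j * ∫ x in Ω, D [j] x * partialD i φ x

/-- `u ∈ W^{k,p}(Ω)` together with the boundary condition `M∇u · n = 0` on `∂Ω`. -/
def MemWN {m : ℕ} (Ω : Set (EV m)) (Mm : Matrix (Fin m) (Fin m) ℝ) (k : ℕ) (p : ℝ≥0∞)
    (u : EV m → ℝ) : Prop :=
  MemW Ω k p u ∧ NeumannBC Ω Mm p u

/-- `l` is the principal value `P.V. ∫_Ω J_ε(x-y)(u(x)-u(y)) dy` at the point `x`. -/
def pvAt {m : ℕ} (Ω : Set (EV m)) (ρ : EV m → ℝ) (ε : ℝ) (u : EV m → ℝ) (x : EV m)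
    (l : ℝ) : Prop :=
  Tendsto
    (fun r : ℝ =>
      ∫ y in Ω ∩ {y : EV m | r ≤ dist x y}, kernelJ (scaled ρ ε) (x - y) * (u x - u y))
    (𝓝[>] 0) (𝓝 l)

/-- `L` is a bounded linear extension to `W^{2,p}_M(Ω)` (Sobolev functions with the
boundary condition `M∇u · n = 0`), with operator bound `C`, of the nonlocal operator
`P.V. ∫_Ω J_ε(·-y)(u(·)-u(y)) dy` defined on `C_c²(cl Ω) ∩ W^{2,p}_M(Ω)`. -/
def IsNLExtOn {m : ℕ} (Ω : Set (EV m)) (Mm : Matrix (Fin m) (Fin m) ℝ) (ρ : EV m → ℝ)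
    (p : ℝ≥0∞) (ε C : ℝ) (L : (EV m → ℝ) → EV m → ℝ) : Prop :=
  (∀ u : EV m → ℝ, ContDiff ℝ 2 u → HasCompactSupport u → MemWN Ω Mm 2 p u →
    ∀ᵐ x ∂(volume.restrict Ω), pvAt Ω ρ ε u x (L u x)) ∧
  (∀ u v : EV m → ℝ, MemWN Ω Mm 2 p u → MemWN Ω Mm 2 p v → ∀ a b : ℝ,
    L (fun x => a * u x + b * v x) =ᵐ[volume.restrict Ω] fun x => a * L u x + b * L v x) ∧
  (∀ u : EV m → ℝ, MemWN Ω Mm 2 p u → MemLp (L u) p (volume.restrict Ω)) ∧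
  (∀ u D, MemWN Ω Mm 2 p u → IsSobDerivs Ω 2 p u D →
    eLpNorm (L u) p (volume.restrict Ω)
      ≤ ENNReal.ofReal C * WNormD 2 p (volume.restrict Ω) D)

/-- `Ω ⊆ ℝ^{n+1}` is an open set whose boundary is locally, up to a rotation, the region
above the graph of a `C^k` function with bounded derivatives (a domain of class `C^k`). -/
def IsGraphDomain {n : ℕ} (k : ℕ) (Ω : Set (EV (n + 1))) : Prop :=
  IsOpen Ω ∧ ∀ z ∈ frontier Ω,
    ∃ (U : Set (EV (n + 1))) (Q : Matrix (Fin (n + 1)) (Fin (n + 1)) ℝ) (γ : EV n → ℝ),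
      IsOpen U ∧ z ∈ U ∧ Qᵀ * Q = 1 ∧ Q.det = 1 ∧ Ckb k γ ∧
      Ω ∩ U = (mulVecE Q '' halfSpace γ) ∩ U

section Part1

/-! ### General measure-theoretic tools -/

lemma lint_jensen {Z : Type*} [MeasurableSpace Z] (μ : Measure Z) [IsFiniteMeasure μ]
    (F : Z → ℝ≥0∞) (hF : AEMeasurable F μ) (p : ℝ) (hp : 1 ≤ p) :
    (∫⁻ z, F z ∂μ) ^ p ≤ μ Set.univ ^ (p - 1) * ∫⁻ z, F z ^ p ∂μ := by
  have hp0 : 0 < p := by linarith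
  rcases eq_or_lt_of_le hp with h1 | h1
  · subst h1; simp
  have hpq : p.HolderConjugate (p / (p - 1)) := Real.HolderConjugate.conjExponent h1
  have := ENNReal.lintegral_mul_le_Lp_mul_Lq μ hpq hF (aemeasurable_const (b := (1 : ℝ≥0∞)))
  simp only [Pi.mul_apply, mul_one, ENNReal.one_rpow, lintegral_const, one_mul] at this
  calc (∫⁻ z, F z ∂μ) ^ p ≤ ((∫⁻ z, F z ^ p ∂μ) ^ (1 / p) * μ Set.univ ^ (1 / (p / (p - 1)))) ^ p := by
        gcongr
    _ = _ := by
        rw [ENNReal.mul_rpow_of_nonneg _ _ hp0.le, ← ENNReal.rpow_mul, ← ENNReal.rpow_mul, mul_comm]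
        have e1 : 1 / p * p = 1 := by field_simp
        have e2 : 1 / (p / (p - 1)) * p = p - 1 := by
          have : p - 1 ≠ 0 := by linarith
          field_simp
        rw [e1, e2, ENNReal.rpow_one]

lemma lint_mink {X Z : Type*} [MeasurableSpace X] [MeasurableSpace Z] (μ : Measure Z)
    [IsFiniteMeasure μ] (ν : Measure X) [SFinite ν]
    (F : X → Z → ℝ≥0∞) (hF : AEMeasurable (Function.uncurry F) (ν.prod μ)) (p : ℝ) (hp : 1 ≤ p) :
    ∫⁻ x, (∫⁻ z, F x z ∂μ) ^ p ∂ν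
      ≤ μ Set.univ ^ (p - 1) * ∫⁻ z, ∫⁻ x, F x z ^ p ∂ν ∂μ := by
  have hFp : AEMeasurable (Function.uncurry fun x z => F x z ^ p) (ν.prod μ) := hF.pow_const p
  rw [lintegral_lintegral_swap (by
    have := hFp.prod_swap
    exact this)]
  rw [← lintegral_const_mul'' _ (f := fun x => ∫⁻ z, F x z ^ p ∂μ) hFp.lintegral_prod_right']
  refine lintegral_mono_ae ?_
  filter_upwards [hF.aestronglyMeasurable.prodMk_left] with x hx
  exact lint_jensen μ _ hx.aemeasurable p hp

/-- uniform version in terms of sup over the parameter -/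
lemma lint_mink_sup {X Z : Type*} [MeasurableSpace X] [MeasurableSpace Z] (μ : Measure Z)
    [IsFiniteMeasure μ] (ν : Measure X) [SFinite ν]
    (F : X → Z → ℝ≥0∞) (hF : AEMeasurable (Function.uncurry F) (ν.prod μ)) (p : ℝ) (hp : 1 ≤ p)
    (K : ℝ≥0∞) (hK : ∀ᵐ z ∂μ, ∫⁻ x, F x z ^ p ∂ν ≤ K ^ p) :
    (∫⁻ x, (∫⁻ z, F x z ∂μ) ^ p ∂ν) ^ (1 / p) ≤ μ Set.univ * K := by
  have hp0 : 0 < p := by linarith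
  have h1 : ∫⁻ x, (∫⁻ z, F x z ∂μ) ^ p ∂ν ≤ (μ Set.univ * K) ^ p := by
    refine (lint_mink μ ν F hF p hp).trans ?_
    calc _ ≤ μ Set.univ ^ (p - 1) * ∫⁻ z, K ^ p ∂μ := by
          gcongr 1
          exact lintegral_mono_ae hK
      _ = _ := by
          rw [lintegral_const, ENNReal.mul_rpow_of_nonneg _ _ hp0.le]
          have : μ Set.univ ^ p = μ Set.univ ^ (p - 1) * μ Set.univ := by
            rcases eq_or_ne (μ Set.univ) 0 with h | h
            · rw [h]; simp [hp0]
            · nth_rewrite 3 [← ENNReal.rpow_one (μ Set.univ)]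
              rw [← ENNReal.rpow_add _ _ h (measure_ne_top _ _)]; simp
          rw [this]; ring
  calc _ ≤ ((μ Set.univ * K) ^ p) ^ (1 / p) := by gcongr
    _ = _ := by rw [← ENNReal.rpow_mul]; simp [hp0.ne']

lemma eLpNorm_eq_lint {X : Type*} [MeasurableSpace X] {G : Type*} [NormedAddCommGroup G]
    (μ : Measure X) (f : X → G) (p : ℝ≥0∞) (hp1 : 1 ≤ p) (hp : p ≠ ⊤) :
    eLpNorm f p μ = (∫⁻ x, ‖f x‖ₑ ^ p.toReal ∂μ) ^ (1 / p.toReal) :=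
  eLpNorm_eq_lintegral_rpow_enorm_toReal (by positivity) hp

lemma one_le_toReal' {p : ℝ≥0∞} (hp1 : 1 ≤ p) (hp : p ≠ ⊤) : 1 ≤ p.toReal := by
  simpa using (ENNReal.toReal_le_toReal (by simp) hp).2 hp1

section moll
variable {G : Type*} [NormedAddCommGroup G] [NormedSpace ℝ G] [FiniteDimensional ℝ G]
  [MeasurableSpace G] [BorelSpace G] (μ : Measure G) [μ.IsAddHaarMeasure]

variable {X : Type*} [NormedAddCommGroup X] [NormedSpace ℝ X] [CompleteSpace X]

lemma translation_cont (p : ℝ≥0∞) (hp1 : 1 ≤ p) (hp : p ≠ ⊤) (f : G → X) (hf : MemLp f p μ)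
    (η : ℝ≥0∞) (hη : 0 < η) :
    ∃ r > 0, ∀ z : G, ‖z‖ < r → eLpNorm (fun x => f (x - z) - f x) p μ ≤ η := by
  have : Fact (1 ≤ p) := ⟨hp1⟩
  have : Fact (p ≠ ⊤) := ⟨hp⟩
  have hc : Continuous fun z : Gᵈᵃᵃ => z +ᵥ hf.toLp f := by fun_prop
  have ht := (hc.tendsto 0)
  rw [zero_vadd] at ht
  have ht' : Tendsto (fun z : G => (DomAddAct.mk (-z)) +ᵥ hf.toLp f) (𝓝 0) (𝓝 (hf.toLp f)) := by
    refine ht.comp ?_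
    have : Continuous fun z : G => DomAddAct.mk (-z) :=
      (DomAddAct.continuous_mk).comp continuous_neg
    simpa using this.tendsto 0
  have h2 := ((Lp.tendsto_Lp_iff_tendsto_eLpNorm' _ _).1 ht').eventually (Iic_mem_nhds hη)
  obtain ⟨r, hr, h⟩ := Metric.eventually_nhds_iff.1 h2
  refine ⟨r, hr, fun z hz => ?_⟩
  have h3 := h (y := z) (by simpa using hz)
  refine le_of_eq_of_le (eLpNorm_congr_ae ?_) h3
  have q : (fun x => (DomAddAct.mk (-z) +ᵥ hf.toLp f) x) =ᵐ[μ] fun x => (hf.toLp f) (-z + x) := by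
    exact DomAddAct.vadd_Lp_ae_eq _ _
  have q2 : (fun x => (hf.toLp f) (-z + x)) =ᵐ[μ] fun x => f (-z + x) :=
    (measurePreserving_add_left μ (-z)).quasiMeasurePreserving.ae_eq_comp hf.coeFn_toLp
  filter_upwards [q, q2, hf.coeFn_toLp] with x a b c
  simp only [Pi.sub_apply]
  rw [a, b, c]
  congr 2; abel

lemma moll_conv (p : ℝ≥0∞) (hp1 : 1 ≤ p) (hp : p ≠ ⊤) (f : G → X) (hf : MemLp f p μ)
    (η : ℝ≥0∞) (hη : 0 < η) :
    ∃ r > 0, ∀ κ : G → ℝ, Continuous κ → (∀ z, 0 ≤ κ z) → HasCompactSupport κ → ∫ z, κ z ∂μ = 1 →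
      (∀ z, r ≤ ‖z‖ → κ z = 0) →
      eLpNorm (fun x => (∫ z, κ z • f (x - z) ∂μ) - f x) p μ ≤ η := by
  obtain ⟨r, hr, h⟩ := translation_cont μ p hp1 hp f hf η hη
  refine ⟨r, hr, fun κ hκ hκ0 hκc hκ1 hκr => ?_⟩
  have hκi : Integrable κ μ := hκ.integrable_of_hasCompactSupport hκc
  set m : Measure G := μ.withDensity (fun z => ENNReal.ofReal (κ z)) with hm
  have hm1 : m Set.univ = 1 := by
    rw [hm, withDensity_apply _ MeasurableSet.univ, Measure.restrict_univ,
      ← ofReal_integral_eq_lintegral_ofReal hκi (Eventually.of_forall hκ0), hκ1]; simp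
  have : IsFiniteMeasure m := ⟨by rw [hm1]; simp⟩
  have hpr := one_le_toReal' hp1 hp
  have hfl : LocallyIntegrable f μ := hf.locallyIntegrable hp1
  have hconv : ∀ x, (∫ z, κ z • f (x - z) ∂μ) - f x = ∫ z, κ z • (f (x - z) - f x) ∂μ := by
    intro x
    have hi : Integrable (fun z => κ z • f (x - z)) μ := by
      have := (hκc.convolutionExists_left (ContinuousLinearMap.lsmul ℝ ℝ) hκ hfl (μ := μ) x)
      simpa [ConvolutionExistsAt] using this
    simp_rw [smul_sub]
    rw [integral_sub hi (hκi.smul_const _), integral_smul_const, hκ1, one_smul]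
  have hmeas : AEMeasurable (Function.uncurry fun x z => ‖f (x - z) - f x‖ₑ) (μ.prod m) := by
    have hac : μ.prod m ≪ μ.prod μ :=
      Measure.AbsolutelyContinuous.rfl.prod (withDensity_absolutelyContinuous _ _)
    refine AEMeasurable.mono_ac ?_ hac
    refine AEStronglyMeasurable.enorm ?_
    refine AEStronglyMeasurable.sub ?_ ?_
    · exact hf.1.comp_quasiMeasurePreserving (quasiMeasurePreserving_sub_of_right_invariant μ μ)
    · exact hf.1.comp_fst
  rw [eLpNorm_eq_lint μ _ p hp1 hp]
  calc _ ≤ (∫⁻ x, (∫⁻ z, ‖f (x - z) - f x‖ₑ ∂m) ^ p.toReal ∂μ) ^ (1 / p.toReal) := by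
        gcongr with x
        rw [hconv]
        refine (enorm_integral_le_lintegral_enorm _).trans ?_
        rw [hm, lintegral_withDensity_eq_lintegral_mul_non_measurable₀]
        · refine lintegral_mono fun z => ?_
          simp only [Pi.mul_apply, enorm_smul]
          gcongr
          rw [Real.enorm_eq_ofReal (hκ0 z)]
        · exact hκ.measurable.ennreal_ofReal.aemeasurable
        · simp
    _ ≤ m Set.univ * η := by
        refine lint_mink_sup m μ _ hmeas _ hpr η ?_
        rw [hm, ae_withDensity_iff hκ.measurable.ennreal_ofReal]
        refine Eventually.of_forall fun z hz => ?_
        have hzr : ‖z‖ < r := by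
          by_contra hc
          exact hz (by simp [hκr z (not_lt.1 hc)])
        have := h z hzr
        rw [eLpNorm_eq_lint μ _ p hp1 hp] at this
        rw [one_div, ENNReal.rpow_inv_le_iff (by linarith)] at this
        exact this
    _ = η := by rw [hm1, one_mul]

lemma moll_le (p : ℝ≥0∞) (hp1 : 1 ≤ p) (hp : p ≠ ⊤) (f : G → X) (hf : AEStronglyMeasurable f μ)
    (κ : G → ℝ) (hκ : Continuous κ) (hκ0 : ∀ z, 0 ≤ κ z) (hκc : HasCompactSupport κ)
    (hκ1 : ∫ z, κ z ∂μ = 1) :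
    eLpNorm (fun x => ∫ z, κ z • f (x - z) ∂μ) p μ ≤ eLpNorm f p μ := by
  have hκi : Integrable κ μ := hκ.integrable_of_hasCompactSupport hκc
  set m : Measure G := μ.withDensity (fun z => ENNReal.ofReal (κ z)) with hm
  have hm1 : m Set.univ = 1 := by
    rw [hm, withDensity_apply _ MeasurableSet.univ, Measure.restrict_univ,
      ← ofReal_integral_eq_lintegral_ofReal hκi (Eventually.of_forall hκ0), hκ1]; simp
  have : IsFiniteMeasure m := ⟨by rw [hm1]; simp⟩
  have hpr := one_le_toReal' hp1 hp
  have hmeas : AEMeasurable (Function.uncurry fun x z => ‖f (x - z)‖ₑ) (μ.prod m) := by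
    have hac : μ.prod m ≪ μ.prod μ :=
      Measure.AbsolutelyContinuous.rfl.prod (withDensity_absolutelyContinuous _ _)
    refine AEMeasurable.mono_ac ?_ hac
    refine AEStronglyMeasurable.enorm ?_
    exact hf.comp_quasiMeasurePreserving (quasiMeasurePreserving_sub_of_right_invariant μ μ)
  rw [eLpNorm_eq_lint μ (fun x => ∫ z, κ z • f (x - z) ∂μ) p hp1 hp]
  calc _ ≤ (∫⁻ x, (∫⁻ z, ‖f (x - z)‖ₑ ∂m) ^ p.toReal ∂μ) ^ (1 / p.toReal) := by
        gcongr with x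
        refine (enorm_integral_le_lintegral_enorm _).trans ?_
        rw [hm, lintegral_withDensity_eq_lintegral_mul_non_measurable₀]
        · refine lintegral_mono fun z => ?_
          simp only [Pi.mul_apply, enorm_smul]
          gcongr
          rw [Real.enorm_eq_ofReal (hκ0 z)]
        · exact hκ.measurable.ennreal_ofReal.aemeasurable
        · simp
    _ ≤ m Set.univ * eLpNorm f p μ := by
        refine lint_mink_sup m μ _ hmeas _ hpr _ ?_
        refine Eventually.of_forall fun z => ?_
        rw [eLpNorm_eq_lint μ _ p hp1 hp, ← ENNReal.rpow_mul, one_div,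
          inv_mul_cancel₀ (by linarith), ENNReal.rpow_one]
        rw [lintegral_sub_right_eq_self (μ := μ) (fun x => ‖f x‖ₑ ^ p.toReal) z]
    _ = _ := by rw [hm1, one_mul]

end moll

end Part1

section Part2

/-! ### Kernel facts -/

section kern
variable {m : ℕ} {ρ : EV m → ℝ}

lemma A1.integrable (h : A1 ρ) : Integrable ρ volume := by
  refine h.2.2.2.2.mono' h.1.aestronglyMeasurable (Eventually.of_forall fun x => ?_)
  rw [Real.norm_of_nonneg (h.2.1 x)]
  nlinarith [h.2.1 x, norm_nonneg x, mul_nonneg (h.2.1 x) (norm_nonneg x)]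

/-- total mass -/
def massI (ρ : EV m → ℝ) : ℝ≥0∞ := ∫⁻ x, ENNReal.ofReal (ρ x)

lemma massI_lt_top (h : A1 ρ) : massI ρ < ⊤ := by
  have := h.integrable.lintegral_lt_top
  exact this

lemma scaled_meas (h : A1 ρ) (ε : ℝ) : Measurable (scaled ρ ε) := by
  unfold scaled
  exact (h.1.comp (measurable_const_smul _)).const_mul _

lemma kern_meas (h : A1 ρ) (ε : ℝ) : Measurable (kernelJ (scaled ρ ε)) := by
  unfold kernelJ
  exact (scaled_meas h ε).div (measurable_norm.pow_const 2)

lemma scaled_nonneg (h : A1 ρ) {ε : ℝ} (hε : 0 < ε) (z : EV m) : 0 ≤ scaled ρ ε z :=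
  mul_nonneg (by positivity) (h.2.1 _)

lemma kern_nonneg (h : A1 ρ) {ε : ℝ} (hε : 0 < ε) (z : EV m) : 0 ≤ kernelJ (scaled ρ ε) z :=
  div_nonneg (scaled_nonneg h hε z) (by positivity)

lemma kern_mul_sq_le (h : A1 ρ) {ε : ℝ} (hε : 0 < ε) (z : EV m) :
    kernelJ (scaled ρ ε) z * ‖z‖ ^ 2 ≤ scaled ρ ε z := by
  unfold kernelJ
  rcases eq_or_ne (‖z‖ ^ 2) 0 with h0 | h0
  · rw [h0]; simpa using scaled_nonneg h hε z
  · rw [div_mul_cancel₀ _ h0]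

lemma lint_scaled {ε : ℝ} (hε : 0 < ε) (F : EV m → ℝ≥0∞) :
    ∫⁻ z, ENNReal.ofReal (scaled ρ ε z) * F (ε⁻¹ • z) = ∫⁻ z, ENNReal.ofReal (ρ z) * F z := by
  have hd : Module.finrank ℝ (EV m) = m := by simp
  have h1 : ∫⁻ z : EV m, ENNReal.ofReal (ρ (ε⁻¹ • z)) * F (ε⁻¹ • z)
      = ENNReal.ofReal |(ε⁻¹ ^ Module.finrank ℝ (EV m))⁻¹| * ∫⁻ z, ENNReal.ofReal (ρ z) * F z := by
    have h2 := lintegral_map_equiv (μ := (volume : Measure (EV m)))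
      (fun z => ENNReal.ofReal (ρ z) * F z)
      (Homeomorph.smulOfNeZero (α := EV m) ε⁻¹ (inv_ne_zero hε.ne')).toMeasurableEquiv
    have h3 := Measure.map_addHaar_smul (volume : Measure (EV m)) (inv_ne_zero hε.ne')
    have h4 : ⇑(Homeomorph.smulOfNeZero (α := EV m) ε⁻¹ (inv_ne_zero hε.ne')).toMeasurableEquiv
      = fun z : EV m => ε⁻¹ • z := rfl
    rw [h4, h3, lintegral_smul_measure] at h2
    exact h2.symm
  have e : ∀ z : EV m, ENNReal.ofReal (scaled ρ ε z) * F (ε⁻¹ • z)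
      = ENNReal.ofReal ((ε ^ m)⁻¹) * (ENNReal.ofReal (ρ (ε⁻¹ • z)) * F (ε⁻¹ • z)) := by
    intro z
    unfold scaled
    rw [ENNReal.ofReal_mul (by positivity), mul_assoc]
  simp_rw [e]
  rw [lintegral_const_mul' _ _ (by simp), h1, hd, ← mul_assoc, ← ENNReal.ofReal_mul (by positivity)]
  have : (ε ^ m)⁻¹ * |(ε⁻¹ ^ m)⁻¹| = 1 := by
    rw [abs_of_pos (by positivity), inv_pow, inv_inv, inv_mul_cancel₀ (by positivity)]
  rw [this]; simp

lemma lint_scaled_one {ε : ℝ} (hε : 0 < ε) :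
    ∫⁻ z, ENNReal.ofReal (scaled ρ ε z) = massI ρ := by
  simpa [massI] using lint_scaled (ρ := ρ) hε (fun _ => 1)

/-- `∫_{|z| ≥ s} J_ε |z|` -/
def GG (ρ : EV m → ℝ) (ε s : ℝ) : ℝ≥0∞ :=
  ∫⁻ z in {z : EV m | s ≤ ‖z‖}, ENNReal.ofReal (kernelJ (scaled ρ ε) z * ‖z‖)

lemma GG_anti (ε : ℝ) : Antitone (GG ρ ε) := by
  intro a b hab
  exact lintegral_mono_set fun z hz => le_trans hab hz

lemma GG_mul_le' (h : A1 ρ) {ε : ℝ} (hε : 0 < ε) (s : ℝ) :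
    ENNReal.ofReal s * GG ρ ε s ≤ ∫⁻ z in {z : EV m | s ≤ ‖z‖}, ENNReal.ofReal (scaled ρ ε z) := by
  unfold GG
  rw [← lintegral_const_mul' _ _ (by simp)]
  refine setLIntegral_mono' (measurableSet_le measurable_const measurable_norm) fun z hz => ?_
  have hz' : s ≤ ‖z‖ := hz
  rcases le_total s 0 with h0 | h0
  · rw [ENNReal.ofReal_of_nonpos h0]; simp
  rw [← ENNReal.ofReal_mul h0]
  refine ENNReal.ofReal_le_ofReal ((?_ : _ ≤ kernelJ (scaled ρ ε) z * ‖z‖ ^ 2).trans (kern_mul_sq_le h hε z))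
  have := kern_nonneg h hε z
  nlinarith [mul_nonneg this (norm_nonneg z)]

lemma GG_mul_le (h : A1 ρ) {ε : ℝ} (hε : 0 < ε) (s : ℝ) :
    ENNReal.ofReal s * GG ρ ε s ≤ massI ρ := by
  refine (GG_mul_le' h hε s).trans ?_
  rw [← lint_scaled_one (ρ := ρ) hε]
  exact setLIntegral_le_lintegral _ _

lemma GG_le (h : A1 ρ) {ε : ℝ} (hε : 0 < ε) {s : ℝ} (hs : 0 < s) :
    GG ρ ε s ≤ massI ρ / ENNReal.ofReal s := by
  rw [ENNReal.le_div_iff_mul_le (by simp [hs]) (by simp), mul_comm]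
  exact GG_mul_le h hε s

lemma GG_int (h : A1 ρ) {ε : ℝ} (hε : 0 < ε) {c : ℝ} (hc : 0 < c) :
    ∫⁻ s in Set.Ioi (0 : ℝ), GG ρ ε (c * s) ≤ ENNReal.ofReal c⁻¹ * massI ρ := by
  have hk := kern_meas h ε
  have e : ∀ s, GG ρ ε (c * s) = ∫⁻ z, Set.indicator {q : ℝ × EV m | c * q.1 ≤ ‖q.2‖}
      (fun q => ENNReal.ofReal (kernelJ (scaled ρ ε) q.2 * ‖q.2‖)) (s, z) := by
    intro s
    unfold GG
    rw [← lintegral_indicator (measurableSet_le measurable_const measurable_norm)]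
    rfl
  simp_rw [e]
  rw [lintegral_lintegral_swap]
  · rw [← lint_scaled_one (ρ := ρ) hε, ← lintegral_const_mul' _ _ (by simp)]
    refine lintegral_mono fun z => ?_
    calc _ ≤ ∫⁻ s in Set.Ioi (0:ℝ), Set.indicator (Set.Iic (c⁻¹ * ‖z‖))
          (fun _ => ENNReal.ofReal (kernelJ (scaled ρ ε) z * ‖z‖)) s := by
          refine lintegral_mono fun s => ?_
          by_cases hs : c * s ≤ ‖z‖
          · rw [Set.indicator_of_mem (by exact hs), Set.indicator_of_mem]
            simp only [Set.mem_Iic]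
            rw [← div_eq_inv_mul, le_div_iff₀ hc]; linarith
          · rw [Set.indicator_of_notMem (by exact hs)]; simp
      _ = ENNReal.ofReal (kernelJ (scaled ρ ε) z * ‖z‖) * ENNReal.ofReal (c⁻¹ * ‖z‖) := by
          rw [lintegral_indicator_const measurableSet_Iic, Measure.restrict_apply measurableSet_Iic,
            Set.Iic_inter_Ioi, Real.volume_Ioc, sub_zero]
      _ ≤ _ := by
          have k0 := kern_nonneg h hε z
          rw [← ENNReal.ofReal_mul (by positivity), ← ENNReal.ofReal_mul (by positivity)]
          refine ENNReal.ofReal_le_ofReal ?_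
          have := kern_mul_sq_le h hε z
          calc _ = c⁻¹ * (kernelJ (scaled ρ ε) z * ‖z‖ ^ 2) := by ring
            _ ≤ _ := by gcongr
  · refine Measurable.aemeasurable ?_
    refine Measurable.indicator ?_ ?_
    · exact ((hk.comp measurable_snd).mul (measurable_norm.comp measurable_snd)).ennreal_ofReal
    · exact measurableSet_le (measurable_const.mul measurable_fst) (measurable_norm.comp measurable_snd)

lemma GG_tendsto (h : A1 ρ) {δ : ℝ} (hδ : 0 < δ) :
    Tendsto (fun ε => GG ρ ε δ) (𝓝[>] 0) (𝓝 0) := by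
  have h1 : Tendsto (fun ε : ℝ => ∫⁻ z in {z : EV m | δ / ε ≤ ‖z‖}, ENNReal.ofReal (ρ z))
      (𝓝[>] 0) (𝓝 0) := by
    have hms : ∀ ε : ℝ, MeasurableSet {z : EV m | δ / ε ≤ ‖z‖} := fun ε =>
      measurableSet_le measurable_const measurable_norm
    have e0 : ∀ ε : ℝ, ∫⁻ z in {z : EV m | δ / ε ≤ ‖z‖}, ENNReal.ofReal (ρ z)
        = ∫⁻ z, Set.indicator {z : EV m | δ / ε ≤ ‖z‖} (fun z => ENNReal.ofReal (ρ z)) z :=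
      fun ε => (lintegral_indicator (hms ε) _).symm
    simp_rw [e0]
    have := tendsto_lintegral_filter_of_dominated_convergence (μ := (volume : Measure (EV m)))
      (l := 𝓝[>] (0 : ℝ))
      (F := fun ε => Set.indicator {z : EV m | δ / ε ≤ ‖z‖} fun z => ENNReal.ofReal (ρ z))
      (f := fun _ => 0) (fun z => ENNReal.ofReal (ρ z)) ?_ ?_ ?_ ?_
    · simpa using this
    · exact Eventually.of_forall fun ε => h.1.ennreal_ofReal.indicator (hms ε)
    · exact Eventually.of_forall fun ε => Eventually.of_forall fun z =>
        Set.indicator_le_self _ _ z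
    · exact (massI_lt_top h).ne
    · refine Eventually.of_forall fun z => ?_
      refine tendsto_const_nhds.congr' ?_
      have : Tendsto (fun ε : ℝ => δ / ε) (𝓝[>] 0) atTop :=
        tendsto_inv_nhdsGT_zero.const_mul_atTop hδ
      filter_upwards [this.eventually_gt_atTop ‖z‖] with ε hε
      rw [Set.indicator_of_notMem]
      simpa using hε
  have h2 : Tendsto (fun ε : ℝ => (∫⁻ z in {z : EV m | δ / ε ≤ ‖z‖}, ENNReal.ofReal (ρ z))
      / ENNReal.ofReal δ) (𝓝[>] 0) (𝓝 (0 / ENNReal.ofReal δ)) :=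
    ENNReal.Tendsto.div_const h1 (Or.inr (by simp [hδ]))
  rw [ENNReal.zero_div] at h2
  refine tendsto_of_tendsto_of_tendsto_of_le_of_le' tendsto_const_nhds h2
    (Eventually.of_forall fun _ => zero_le) ?_
  filter_upwards [self_mem_nhdsWithin] with ε hε
  have hε : 0 < ε := hε
  rw [ENNReal.le_div_iff_mul_le (by simp [hδ]) (by simp), mul_comm]
  refine (GG_mul_le' h hε δ).trans ?_
  rw [← lintegral_indicator (measurableSet_le measurable_const measurable_norm),
    ← lintegral_indicator (measurableSet_le measurable_const measurable_norm)]
  have := lint_scaled (ρ := ρ) hε (Set.indicator {z : EV m | δ / ε ≤ ‖z‖} fun _ => 1)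
  refine le_of_eq ?_
  calc _ = ∫⁻ z, ENNReal.ofReal (scaled ρ ε z) *
        (Set.indicator {z : EV m | δ / ε ≤ ‖z‖} fun _ => 1) (ε⁻¹ • z) := by
        refine lintegral_congr fun z => ?_
        have : z ∈ {z : EV m | δ ≤ ‖z‖} ↔ ε⁻¹ • z ∈ {z : EV m | δ / ε ≤ ‖z‖} := by
          simp only [Set.mem_ofPred_eq, norm_smul, norm_inv, Real.norm_of_nonneg hε.le]
          rw [div_eq_inv_mul]
          exact (mul_le_mul_iff_right₀ (by positivity)).symm
        by_cases hz : z ∈ {z : EV m | δ ≤ ‖z‖}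
        · rw [Set.indicator_of_mem hz, Set.indicator_of_mem (this.1 hz), mul_one]
        · rw [Set.indicator_of_notMem hz, Set.indicator_of_notMem (fun h => hz (this.2 h)), mul_zero]
    _ = _ := this
    _ = _ := by
        refine lintegral_congr fun z => ?_
        by_cases hz : z ∈ {z : EV m | δ / ε ≤ ‖z‖}
        · rw [Set.indicator_of_mem hz, Set.indicator_of_mem hz, mul_one]
        · rw [Set.indicator_of_notMem hz, Set.indicator_of_notMem hz, mul_zero]

lemma kern_even (h : A1 ρ) {ε : ℝ} (hε : 0 < ε) :
    ∀ᵐ z : EV m, kernelJ (scaled ρ ε) (-z) = kernelJ (scaled ρ ε) z := by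
  have h1 := h.2.2.2.1
  have : Measure.QuasiMeasurePreserving (fun z : EV m => ε⁻¹ • z) volume volume := by
    refine ⟨measurable_const_smul _, ?_⟩
    have := Measure.map_addHaar_smul (volume : Measure (EV m)) (inv_ne_zero hε.ne')
    rw [this]
    exact Measure.smul_absolutelyContinuous
  filter_upwards [this.ae h1] with z hz
  simp only [kernelJ, scaled, norm_neg, smul_neg, hz]

end kern

/-! ### Taylor -/
section taylor
variable {G : Type*} [NormedAddCommGroup G] [NormedSpace ℝ G]

lemma taylor_exact {v : G → ℝ} (hv : ContDiff ℝ 2 v) (x z : G) :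
    v x - v (x - z) - fderiv ℝ v x z
      = - ∫ τ in (0:ℝ)..1, (1 - τ) * fderiv ℝ (fderiv ℝ v) (x - τ • z) z z := by
  have hd : ContDiff ℝ 1 (fderiv ℝ v) := hv.fderiv_right (by norm_num)
  have hl : ∀ τ : ℝ, HasDerivAt (fun τ : ℝ => x - τ • z) (-z) τ := fun τ => by
    simpa using ((hasDerivAt_id τ).smul_const z).const_sub x
  have h1 : ∀ τ : ℝ, HasDerivAt (fun τ : ℝ => v (x - τ • z)) (fderiv ℝ v (x - τ • z) (-z)) τ :=
    fun τ => ((hv.differentiable (by norm_num)) _).hasFDerivAt.comp_hasDerivAt τ (hl τ)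
  have h2 : ∀ τ : ℝ, HasDerivAt (fun τ : ℝ => fderiv ℝ v (x - τ • z))
      (fderiv ℝ (fderiv ℝ v) (x - τ • z) (-z)) τ :=
    fun τ => ((hd.differentiable (by norm_num)) _).hasFDerivAt.comp_hasDerivAt τ (hl τ)
  have h3 : ∀ τ : ℝ, HasDerivAt (fun τ : ℝ => fderiv ℝ v (x - τ • z) (-z))
      (fderiv ℝ (fderiv ℝ v) (x - τ • z) (-z) (-z)) τ := fun τ => by
    simpa using (h2 τ).clm_apply (hasDerivAt_const τ (-z))
  have h4 : ∀ τ : ℝ, HasDerivAt (fun τ : ℝ => v (x - τ • z) + (1 - τ) * fderiv ℝ v (x - τ • z) (-z))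
      ((1 - τ) * fderiv ℝ (fderiv ℝ v) (x - τ • z) z z) τ := fun τ => by
    have := (h1 τ).add (((hasDerivAt_id τ).const_sub 1).mul (h3 τ))
    refine this.congr_deriv ?_
    simp
  have hc : Continuous fun τ : ℝ => (1 - τ) * fderiv ℝ (fderiv ℝ v) (x - τ • z) z z := by
    have : Continuous (fderiv ℝ (fderiv ℝ v)) := hd.continuous_fderiv (by norm_num)
    fun_prop
  rw [intervalIntegral.integral_eq_sub_of_hasDerivAt (fun τ _ => h4 τ) (hc.intervalIntegrable _ _)]
  simp
  ring

lemma taylor_bound {v : G → ℝ} (hv : ContDiff ℝ 2 v) (x z : G) :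
    ENNReal.ofReal |v x - v (x - z) - fderiv ℝ v x z|
      ≤ ENNReal.ofReal (‖z‖ ^ 2) *
        ∫⁻ τ in Set.Ioc (0:ℝ) 1, ‖fderiv ℝ (fderiv ℝ v) (x - τ • z)‖ₑ := by
  rw [taylor_exact hv, abs_neg, intervalIntegral.integral_of_le zero_le_one, ← Real.enorm_eq_ofReal_abs,
    ← lintegral_const_mul' _ _ (by simp)]
  refine (enorm_integral_le_lintegral_enorm _).trans ?_
  refine setLIntegral_mono' measurableSet_Ioc fun τ hτ => ?_
  rw [← ofReal_norm, ← ofReal_norm, ← ENNReal.ofReal_mul (by positivity)]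
  refine ENNReal.ofReal_le_ofReal ?_
  rw [norm_mul]
  have h1 : ‖1 - τ‖ ≤ 1 := by
    rw [Real.norm_eq_abs, abs_le]; constructor <;> linarith [hτ.1, hτ.2]
  have h2 : ‖fderiv ℝ (fderiv ℝ v) (x - τ • z) z z‖ ≤ ‖fderiv ℝ (fderiv ℝ v) (x - τ • z)‖ * ‖z‖ * ‖z‖ :=
    (ContinuousLinearMap.le_opNorm₂ _ _ _)
  calc _ ≤ 1 * (‖fderiv ℝ (fderiv ℝ v) (x - τ • z)‖ * ‖z‖ * ‖z‖) := by gcongr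
    _ = _ := by ring

lemma cc_bdd {X H : Type*} [TopologicalSpace X] [NormedAddCommGroup H] {f : X → H}
    (hf : Continuous f) (hc : HasCompactSupport f) : ∃ C : ℝ, ∀ x, ‖f x‖ ≤ C :=
  hc.exists_bound_of_continuous hf

lemma cc_fderiv {H : Type*} [NormedAddCommGroup H] [NormedSpace ℝ H] {f : G → H}
    (hc : HasCompactSupport f) : HasCompactSupport (fderiv ℝ f) := hc.fderiv ℝ

lemma d2_bdd {v : G → ℝ} (hv : ContDiff ℝ 2 v) (hc : HasCompactSupport v) :
    ∃ C : ℝ, 0 ≤ C ∧ ∀ x, |v x| ≤ C ∧ ‖fderiv ℝ v x‖ ≤ C ∧ ‖fderiv ℝ (fderiv ℝ v) x‖ ≤ C := by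
  have hd : ContDiff ℝ 1 (fderiv ℝ v) := hv.fderiv_right (by norm_num)
  have hd2 : Continuous (fderiv ℝ (fderiv ℝ v)) := hd.continuous_fderiv (by norm_num)
  have hc1 : HasCompactSupport (fderiv ℝ v) := cc_fderiv hc
  obtain ⟨C0, h0⟩ := cc_bdd hv.continuous hc
  obtain ⟨C1, h1⟩ := cc_bdd hd.continuous hc1
  obtain ⟨C2, h2⟩ := cc_bdd hd2 (cc_fderiv hc1)
  refine ⟨max (max C0 C1) (max C2 0), le_trans (le_max_right _ _) (le_max_right _ _), fun x => ⟨?_, ?_, ?_⟩⟩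
  · exact (h0 x).trans (le_trans (le_max_left _ _) (le_max_left _ _))
  · exact (h1 x).trans (le_trans (le_max_right _ _) (le_max_left _ _))
  · exact (h2 x).trans (le_trans (le_max_left _ _) (le_max_right _ _))

lemma taylor_bound_C {v : G → ℝ} (hv : ContDiff ℝ 2 v) {C : ℝ}
    (hC : ∀ x, ‖fderiv ℝ (fderiv ℝ v) x‖ ≤ C) (x z : G) :
    |v x - v (x - z) - fderiv ℝ v x z| ≤ C * ‖z‖ ^ 2 := by
  rw [taylor_exact hv, abs_neg]
  have := intervalIntegral.norm_integral_le_of_norm_le_const (a := 0) (b := 1) (C := C * ‖z‖ ^ 2)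
    (f := fun τ : ℝ => (1 - τ) * fderiv ℝ (fderiv ℝ v) (x - τ • z) z z) ?_
  · simpa using this
  intro τ hτ
  rw [Set.uIoc_of_le zero_le_one] at hτ
  rw [norm_mul]
  have h1 : ‖1 - τ‖ ≤ 1 := by
    rw [Real.norm_eq_abs, abs_le]; constructor <;> linarith [hτ.1, hτ.2]
  have h2 : ‖fderiv ℝ (fderiv ℝ v) (x - τ • z) z z‖ ≤ ‖fderiv ℝ (fderiv ℝ v) (x - τ • z)‖ * ‖z‖ * ‖z‖ :=
    (ContinuousLinearMap.le_opNorm₂ _ _ _)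
  calc _ ≤ 1 * (C * ‖z‖ * ‖z‖) := by
        gcongr
        exact h2.trans (by gcongr; exact hC _)
    _ = _ := by ring
end taylor

end Part2

section Part3

section pv
variable {m : ℕ} {ρ : EV m → ℝ}

def Rop (Ω : Set (EV m)) (ρ : EV m → ℝ) (ε : ℝ) (v : EV m → ℝ) (x : EV m) : ℝ :=
  ∫ z in {z | x - z ∈ Ω}, kernelJ (scaled ρ ε) z * (v x - v (x - z) - fderiv ℝ v x z)

def bvec (Ω : Set (EV m)) (ρ : EV m → ℝ) (ε : ℝ) (x : EV m) : EV m :=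
  ∫ z in {z | x - z ∉ Ω}, kernelJ (scaled ρ ε) z • z

lemma kz_enorm (h : A1 ρ) {ε : ℝ} (hε : 0 < ε) (z : EV m) :
    ‖kernelJ (scaled ρ ε) z • z‖ₑ = ENNReal.ofReal (kernelJ (scaled ρ ε) z * ‖z‖) := by
  rw [← ofReal_norm, norm_smul, Real.norm_of_nonneg (kern_nonneg h hε z)]

lemma kz_meas (h : A1 ρ) (ε : ℝ) : Measurable fun z => kernelJ (scaled ρ ε) z • z :=
  (kern_meas h ε).smul measurable_id

lemma GG_lt_top (h : A1 ρ) {ε : ℝ} (hε : 0 < ε) {s : ℝ} (hs : 0 < s) : GG ρ ε s < ⊤ :=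
  (GG_le h hε hs).trans_lt (ENNReal.div_lt_top (massI_lt_top h).ne (by simp [hs]))

lemma kz_int (h : A1 ρ) {ε : ℝ} (hε : 0 < ε) {s : ℝ} (hs : 0 < s) :
    IntegrableOn (fun z => kernelJ (scaled ρ ε) z • z) {z : EV m | s ≤ ‖z‖} := by
  refine ⟨(kz_meas h ε).aestronglyMeasurable, ?_⟩
  simp only [HasFiniteIntegral, kz_enorm h hε]
  exact GG_lt_top h hε hs

lemma scaled_integrable (h : A1 ρ) {ε : ℝ} (hε : 0 < ε) : Integrable (scaled ρ ε) volume := by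
  refine ⟨(scaled_meas h ε).aestronglyMeasurable, ?_⟩
  have : ∀ z, ‖scaled ρ ε z‖ₑ = ENNReal.ofReal (scaled ρ ε z) := fun z => by
    rw [← ofReal_norm, Real.norm_of_nonneg (scaled_nonneg h hε z)]
  simp only [HasFiniteIntegral, this]
  rw [lint_scaled_one hε]; exact massI_lt_top h

lemma kz_full (h : A1 ρ) {ε : ℝ} (hε : 0 < ε) (r : ℝ) :
    ∫ z in {z : EV m | r ≤ ‖z‖}, kernelJ (scaled ρ ε) z • z = 0 := by
  have hms : MeasurableSet {z : EV m | r ≤ ‖z‖} := measurableSet_le measurable_const measurable_norm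
  rw [← integral_indicator hms]
  set f := Set.indicator {z : EV m | r ≤ ‖z‖} fun z => kernelJ (scaled ρ ε) z • z with hf
  have h1 : ∫ z, f (-z) = ∫ z, f z := integral_neg_eq_self f volume
  have h2 : ∫ z, f (-z) = ∫ z, - f z := by
    refine integral_congr_ae ?_
    filter_upwards [kern_even h hε] with z hz
    by_cases hr : r ≤ ‖z‖
    · simp [hf, Set.indicator, hr, hz]
    · simp [hf, Set.indicator, hr]
  rw [integral_neg] at h2
  have h3 : ∫ z, f z = - ∫ z, f z := h1.symm.trans h2
  have h4 : (2 : ℝ) • ∫ z, f z = 0 := by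
    rw [two_smul]; nth_rewrite 1 [h3]; simp
  simpa using h4

lemma Rop_bound (h : A1 ρ) {ε : ℝ} (hε : 0 < ε) {v : EV m → ℝ}
    (hv : ContDiff ℝ 2 v) {C : ℝ} (hC : ∀ x, ‖fderiv ℝ (fderiv ℝ v) x‖ ≤ C) (x z : EV m) :
    ‖kernelJ (scaled ρ ε) z * (v x - v (x - z) - fderiv ℝ v x z)‖ ≤ C * scaled ρ ε z := by
  have C0 : 0 ≤ C := (norm_nonneg (fderiv ℝ (fderiv ℝ v) x)).trans (hC x)
  rw [norm_mul, Real.norm_of_nonneg (kern_nonneg h hε z), Real.norm_eq_abs]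
  calc _ ≤ kernelJ (scaled ρ ε) z * (C * ‖z‖ ^ 2) := by
        gcongr
        · exact kern_nonneg h hε z
        · exact taylor_bound_C hv hC x z
    _ = C * (kernelJ (scaled ρ ε) z * ‖z‖ ^ 2) := by ring
    _ ≤ _ := by gcongr; exact kern_mul_sq_le h hε z

lemma Rop_meas (h : A1 ρ) (ε : ℝ) {v : EV m → ℝ} (hv : ContDiff ℝ 2 v) :
    Measurable fun q : EV m × EV m =>
      kernelJ (scaled ρ ε) q.2 * (v q.1 - v (q.1 - q.2) - fderiv ℝ v q.1 q.2) := by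
  have hd : Continuous (fderiv ℝ v) := hv.continuous_fderiv (by norm_num)
  have : Continuous fun q : EV m × EV m => v q.1 - v (q.1 - q.2) - fderiv ℝ v q.1 q.2 := by
    have := hv.continuous
    fun_prop
  exact ((kern_meas h ε).comp measurable_snd).mul this.measurable

lemma Rop_integrable (h : A1 ρ) {ε : ℝ} (hε : 0 < ε) {v : EV m → ℝ}
    (hv : ContDiff ℝ 2 v) (hc : HasCompactSupport v) (x : EV m) :
    Integrable (fun z => kernelJ (scaled ρ ε) z * (v x - v (x - z) - fderiv ℝ v x z)) volume := by
  obtain ⟨C, C0, hC⟩ := d2_bdd hv hc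
  refine ((scaled_integrable h hε).const_mul C).mono' ?_ (Eventually.of_forall fun z =>
    Rop_bound h hε hv (fun x => (hC x).2.2) x z)
  exact ((Rop_meas h ε hv).comp (measurable_const.prodMk measurable_id)).aestronglyMeasurable

lemma pv_eq {Ω : Set (EV m)} (h : A1 ρ) {ε : ℝ} (hε : 0 < ε) (hΩ : IsOpen Ω) {v : EV m → ℝ}
    (hv : ContDiff ℝ 2 v) (hc : HasCompactSupport v) {x : EV m} (hx : x ∈ Ω) {l : ℝ}
    (hl : pvAt Ω ρ ε v x l) : l = Rop Ω ρ ε v x - fderiv ℝ v x (bvec Ω ρ ε x) := by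
  obtain ⟨δ, hδ, hball⟩ := Metric.isOpen_iff.1 hΩ x hx
  have hS : MeasurableSet {z : EV m | x - z ∈ Ω} :=
    (hΩ.preimage (continuous_const.sub continuous_id)).measurableSet
  have hSr : ∀ r : ℝ, MeasurableSet {z : EV m | r ≤ ‖z‖} := fun r =>
    measurableSet_le measurable_const measurable_norm
  have hRi := Rop_integrable h hε hv hc x
  refine tendsto_nhds_unique hl ?_
  have key : ∀ r, 0 < r → r < δ →
      ∫ y in Ω ∩ {y : EV m | r ≤ dist x y}, kernelJ (scaled ρ ε) (x - y) * (v x - v y)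
       = (∫ z, Set.indicator {z : EV m | r ≤ ‖z‖} (Set.indicator {z : EV m | x - z ∈ Ω} fun z =>
          kernelJ (scaled ρ ε) z * (v x - v (x - z) - fderiv ℝ v x z)) z)
          - fderiv ℝ v x (bvec Ω ρ ε x) := by
    intro r hr hrδ
    have e1 : ∫ y in Ω ∩ {y : EV m | r ≤ dist x y}, kernelJ (scaled ρ ε) (x - y) * (v x - v y)
        = ∫ z in {z : EV m | x - z ∈ Ω} ∩ {z : EV m | r ≤ ‖z‖},
          kernelJ (scaled ρ ε) z * (v x - v (x - z)) := by
      rw [← integral_indicator (hS.inter (hSr r)), ← integral_indicator (hΩ.measurableSet.inter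
        (show MeasurableSet {y : EV m | r ≤ dist x y} from
          measurableSet_le measurable_const (measurable_const.dist measurable_id)))]
      rw [← integral_sub_left_eq_self _ volume x]
      refine integral_congr_ae (Eventually.of_forall fun z => ?_)
      have hmem : x - z ∈ Ω ∩ {y : EV m | r ≤ dist x y} ↔
        z ∈ {z : EV m | x - z ∈ Ω} ∩ {z : EV m | r ≤ ‖z‖} := by simp [dist_eq_norm]
      by_cases hz : z ∈ {z : EV m | x - z ∈ Ω} ∩ {z : EV m | r ≤ ‖z‖}
      · simp only [Set.indicator_of_mem hz, Set.indicator_of_mem (hmem.2 hz)]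
        rw [show x - (x - z) = z by abel]
      · simp only [Set.indicator_of_notMem hz, Set.indicator_of_notMem (fun h => hz (hmem.1 h))]
    have hzi := kz_int h hε hr
    have e2 : ∫ z in {z : EV m | x - z ∈ Ω} ∩ {z : EV m | r ≤ ‖z‖}, kernelJ (scaled ρ ε) z • z
        = - bvec Ω ρ ε x := by
      have hu : {z : EV m | r ≤ ‖z‖} = ({z : EV m | x - z ∈ Ω} ∩ {z : EV m | r ≤ ‖z‖}) ∪
          {z : EV m | x - z ∉ Ω} := by
        ext z
        simp only [Set.mem_union, Set.mem_inter_iff, Set.mem_ofPred_eq]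
        constructor
        · intro hz; by_cases hh : x - z ∈ Ω
          · exact Or.inl ⟨hh, hz⟩
          · exact Or.inr hh
        · rintro (hz | hz)
          · exact hz.2
          · by_contra hlt
            push Not at hlt
            exact hz (hball (by simp [Metric.mem_ball, dist_eq_norm]; linarith))
      have hsub : {z : EV m | x - z ∉ Ω} ⊆ {z : EV m | r ≤ ‖z‖} := by
        rw [hu]; exact Set.subset_union_right
      have := kz_full h hε r
      rw [hu, setIntegral_union (by
        rw [Set.disjoint_left]; intro z hz hz'; exact hz' hz.1)
        (show MeasurableSet {z : EV m | x - z ∉ Ω} from hS.compl)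
        (hzi.mono_set Set.inter_subset_right) (hzi.mono_set hsub)] at this
      exact eq_neg_of_add_eq_zero_left this
    rw [e1]
    have hzi' : IntegrableOn (fun z => fderiv ℝ v x (kernelJ (scaled ρ ε) z • z))
        ({z : EV m | x - z ∈ Ω} ∩ {z : EV m | r ≤ ‖z‖}) :=
      (fderiv ℝ v x).integrable_comp (hzi.mono_set Set.inter_subset_right)
    have e3 : ∀ z, kernelJ (scaled ρ ε) z * (v x - v (x - z))
        = kernelJ (scaled ρ ε) z * (v x - v (x - z) - fderiv ℝ v x z)
          + fderiv ℝ v x (kernelJ (scaled ρ ε) z • z) := by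
      intro z; rw [map_smul, smul_eq_mul]; ring
    simp_rw [e3]
    rw [integral_add hRi.integrableOn hzi', ContinuousLinearMap.integral_comp_comm _
      (hzi.mono_set Set.inter_subset_right), e2, map_neg, ← sub_eq_add_neg]
    congr 1
    rw [← integral_indicator (hS.inter (hSr r)), Set.inter_comm, Set.indicator_indicator]
  have lim : Tendsto (fun r : ℝ => (∫ z, Set.indicator {z : EV m | r ≤ ‖z‖}
      (Set.indicator {z : EV m | x - z ∈ Ω} fun z =>
          kernelJ (scaled ρ ε) z * (v x - v (x - z) - fderiv ℝ v x z)) z)) (𝓝[>] 0)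
      (𝓝 (Rop Ω ρ ε v x)) := by
    unfold Rop
    rw [← integral_indicator hS]
    have hI := hRi.indicator hS
    refine tendsto_integral_filter_of_dominated_convergence (fun z => ‖Set.indicator {z : EV m | x - z ∈ Ω} (fun z =>
          kernelJ (scaled ρ ε) z * (v x - v (x - z) - fderiv ℝ v x z)) z‖) ?_ ?_ hI.norm ?_
    · exact Eventually.of_forall fun r => hI.aestronglyMeasurable.indicator (hSr r)
    · exact Eventually.of_forall fun r => Eventually.of_forall fun z => norm_indicator_le_norm_self _ _
    · refine Eventually.of_forall fun z => ?_
      refine tendsto_const_nhds.congr' ?_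
      rcases eq_or_ne z 0 with rfl | hz
      · filter_upwards with r
        by_cases hr : r ≤ ‖(0 : EV m)‖
        · rw [Set.indicator_of_mem (s := {z : EV m | r ≤ ‖z‖}) (by exact hr)]
        · rw [Set.indicator_of_notMem (s := {z : EV m | r ≤ ‖z‖}) (by exact hr)]
          simp [Set.indicator]
      · have : Set.Ioo 0 ‖z‖ ∈ 𝓝[>] (0:ℝ) := Ioo_mem_nhdsGT (norm_pos_iff.2 hz)
        filter_upwards [this] with r hr
        rw [Set.indicator_of_mem (s := {z : EV m | r ≤ ‖z‖})]
        exact hr.2.le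
  refine (lim.sub_const (fderiv ℝ v x (bvec Ω ρ ε x))).congr' ?_
  have : Set.Ioo 0 δ ∈ 𝓝[>] (0:ℝ) := Ioo_mem_nhdsGT hδ
  filter_upwards [this] with r hr
  exact (key r hr.1 hr.2).symm

end pv

end Part3

section Part4

/-! ### Charts -/

abbrev FV (n : ℕ) := EV n × ℝ

section charts
variable {n : ℕ}

def IsoP (P : FV n ≃L[ℝ] EV (n + 1)) : Prop := ∀ y, ‖P y‖ ^ 2 = ‖y.1‖ ^ 2 + y.2 ^ 2

lemma snocE_norm (z : EV n) (t : ℝ) : ‖snocE z t‖ ^ 2 = ‖z‖ ^ 2 + t ^ 2 := by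
  rw [EuclideanSpace.norm_sq_eq, EuclideanSpace.norm_sq_eq, Fin.sum_univ_castSucc]
  simp [snocE]

lemma mulVecE_norm {m : ℕ} {Q : Matrix (Fin m) (Fin m) ℝ} (hQ : Qᵀ * Q = 1) (x : EV m) :
    ‖mulVecE Q x‖ ^ 2 = ‖x‖ ^ 2 := by
  have e : ∀ y : EV m, ‖y‖ ^ 2 = (y.ofLp) ⬝ᵥ (y.ofLp) := by
    intro y; rw [EuclideanSpace.norm_sq_eq]; simp [dotProduct, sq]
  rw [e, e]
  simp only [mulVecE, WithLp.equiv_apply, WithLp.equiv_symm_apply]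
  rw [Matrix.dotProduct_mulVec, Matrix.vecMul_mulVec, hQ]
  simp

def snocL (n : ℕ) : FV n →ₗ[ℝ] EV (n + 1) where
  toFun y := snocE y.1 y.2
  map_add' x y := by
    ext i
    refine Fin.lastCases ?_ (fun j => ?_) i <;> simp [snocE]
  map_smul' c y := by
    ext i
    refine Fin.lastCases ?_ (fun j => ?_) i <;> simp [snocE]

def mulL {m : ℕ} (Q : Matrix (Fin m) (Fin m) ℝ) : EV m →ₗ[ℝ] EV m where
  toFun := mulVecE Q
  map_add' x y := by ext i; simp [mulVecE, Matrix.mulVec_add]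
  map_smul' c y := by ext i; simp [mulVecE, Matrix.mulVec_smul]

lemma isoP_of_lin (L : FV n →ₗ[ℝ] EV (n + 1)) (hL : ∀ y, ‖L y‖ ^ 2 = ‖y.1‖ ^ 2 + y.2 ^ 2) :
    ∃ P : FV n ≃L[ℝ] EV (n + 1), IsoP P ∧ ∀ y, P y = L y := by
  have inj : Function.Injective L := by
    rw [← LinearMap.ker_eq_bot, LinearMap.ker_eq_bot']
    intro y hy
    have := hL y
    rw [hy] at this
    simp only [norm_zero] at this
    have h1 : ‖y.1‖ ^ 2 = 0 := by nlinarith [sq_nonneg ‖y.1‖, sq_nonneg y.2]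
    have h2 : y.2 ^ 2 = 0 := by nlinarith [sq_nonneg ‖y.1‖, sq_nonneg y.2]
    ext1
    · simpa using h1
    · simpa using h2
  have hd : Module.finrank ℝ (FV n) = Module.finrank ℝ (EV (n + 1)) := by simp
  refine ⟨(LinearEquiv.ofInjectiveOfFinrankEq L inj hd).toContinuousLinearEquiv, ?_, fun y => rfl⟩
  intro y; exact hL y

lemma exists_P {Q : Matrix (Fin (n + 1)) (Fin (n + 1)) ℝ} (hQ : Qᵀ * Q = 1) :
    ∃ P : FV n ≃L[ℝ] EV (n + 1), IsoP P ∧ ∀ y, P y = mulVecE Q (snocE y.1 y.2) :=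
  isoP_of_lin ((mulL Q).comp (snocL n)) fun y => by
    have := mulVecE_norm hQ (snocE y.1 y.2)
    rw [snocE_norm] at this
    exact this

variable {P : FV n ≃L[ℝ] EV (n + 1)}

lemma IsoP.inner (hP : IsoP P) (y w : FV n) :
    inner ℝ (P y) (P w) = inner ℝ y.1 w.1 + y.2 * w.2 := by
  have h1 := hP (y + w)
  rw [map_add, norm_add_sq_real, hP, hP, Prod.fst_add, Prod.snd_add, norm_add_sq_real] at h1
  nlinarith

lemma IsoP.symm_sq (hP : IsoP P) (x : EV (n + 1)) :
    ‖x‖ ^ 2 = ‖(P.symm x).1‖ ^ 2 + (P.symm x).2 ^ 2 := by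
  have := hP (P.symm x); simpa using this

lemma IsoP.mp (hP : IsoP P) : MeasurePreserving P volume volume := by
  have h1 : MeasurePreserving (WithLp.toLp 2 : FV n → WithLp 2 (FV n)) :=
    WithLp.volume_preserving_toLp (EV n) ℝ
  let L : WithLp 2 (FV n) ≃ₗᵢ[ℝ] EV (n + 1) :=
    { (WithLp.linearEquiv 2 ℝ (FV n)).trans P.toLinearEquiv with
      norm_map' := by
        intro x
        have h2 : ‖x‖ ^ 2 = ‖x.fst‖ ^ 2 + ‖x.snd‖ ^ 2 := WithLp.prod_norm_sq_eq_of_L2 x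
        have h3 := hP (WithLp.ofLp x)
        have h4 : ‖P (WithLp.ofLp x)‖ ^ 2 = ‖x‖ ^ 2 := by
          rw [h2, h3]; simp
        exact (pow_left_inj₀ (norm_nonneg _) (norm_nonneg _) (by norm_num)).1 h4 }
  have h5 := L.measurePreserving
  exact h5.comp h1

lemma IsoP.mp_symm (hP : IsoP P) : MeasurePreserving P.symm volume volume :=
  hP.mp.symm P.toHomeomorph.toMeasurableEquiv

lemma IsoP.fst_le (hP : IsoP P) (x : EV (n + 1)) : ‖(P.symm x).1‖ ≤ ‖x‖ := by
  have := hP.symm_sq x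
  exact abs_le_of_sq_le_sq' (by nlinarith [sq_nonneg (P.symm x).2]) (norm_nonneg _) |>.2

lemma IsoP.snd_le (hP : IsoP P) (x : EV (n + 1)) : |(P.symm x).2| ≤ ‖x‖ := by
  have := hP.symm_sq x
  exact abs_le_of_sq_le_sq (by nlinarith [sq_nonneg ‖(P.symm x).1‖]) (norm_nonneg _)

lemma IsoP.norm_zero_snd (hP : IsoP P) (t : ℝ) : ‖P (0, t)‖ = |t| := by
  have := hP (0, t)
  rw [← sq_abs t] at this
  simp only [norm_zero] at this
  exact (pow_left_inj₀ (norm_nonneg _) (abs_nonneg _) two_ne_zero).1 (by linarith)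

lemma IsoP.norm_le (hP : IsoP P) (y : FV n) : ‖P y‖ ≤ ‖y.1‖ + |y.2| := by
  have := hP y
  rw [← sq_abs y.2] at this
  refine abs_le_of_sq_le_sq' ?_ (by positivity) |>.2
  nlinarith [norm_nonneg y.1, abs_nonneg y.2]

/-- chart -/
def IsCh (Ω U : Set (EV (n + 1))) (P : FV n ≃L[ℝ] EV (n + 1)) (γ : EV n → ℝ) : Prop :=
  IsOpen U ∧ IsoP P ∧ Ckb 3 γ ∧ ∀ x ∈ U, x ∈ Ω ↔ γ (P.symm x).1 < (P.symm x).2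

lemma exists_ch {Ω : Set (EV (n + 1))} (hΩ : IsGraphDomain 3 Ω) {z : EV (n + 1)}
    (hz : z ∈ frontier Ω) : ∃ U P γ, IsCh Ω U P γ ∧ z ∈ U := by
  obtain ⟨U, Q, γ, hU, hzU, hQ, -, hγ, he⟩ := hΩ.2 z hz
  obtain ⟨P, hP, hPe⟩ := exists_P hQ
  refine ⟨U, P, γ, ⟨hU, hP, hγ, fun x hx => ?_⟩, hzU⟩
  have h1 : x ∈ Ω ↔ x ∈ mulVecE Q '' halfSpace γ := by
    have := Set.ext_iff.1 he x
    simpa [hx] using this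
  have hsn : ∀ w : EV (n + 1), snocE (firstCoords w) (w (Fin.last n)) = w := by
    intro w; ext i
    refine Fin.lastCases ?_ (fun j => ?_) i <;> simp [snocE, firstCoords]
  have hfs : ∀ (a : EV n) (t : ℝ), firstCoords (snocE a t) = a ∧ snocE a t (Fin.last n) = t := by
    intro a t; constructor
    · ext i; simp [snocE, firstCoords]
    · simp [snocE]
  rw [h1]
  constructor
  · rintro ⟨w, hw, rfl⟩
    have : P.symm (mulVecE Q w) = (firstCoords w, w (Fin.last n)) := by
      rw [P.symm_apply_eq, hPe, hsn]
    rw [this]; exact hw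
  · intro hlt
    refine ⟨snocE (P.symm x).1 (P.symm x).2, ?_, ?_⟩
    · simp only [halfSpace, Set.mem_ofPred_eq, (hfs _ _).1, (hfs _ _).2]; exact hlt
    · rw [← hPe]; simp

def nuv (P : FV n ≃L[ℝ] EV (n + 1)) (γ : EV n → ℝ) (z' : EV n) : EV (n + 1) :=
  P (-(gradient γ z'), 1)

lemma nuv_inner (hP : IsoP P) {γ : EV n → ℝ} (z' : EV n) (y : FV n) :
    inner ℝ (nuv P γ z') (P y) = y.2 - fderiv ℝ γ z' y.1 := by
  rw [nuv, hP.inner]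
  simp only [inner_neg_left, one_mul]
  rw [gradient, InnerProductSpace.toDual_symm_apply]; ring

lemma nuv_norm (hP : IsoP P) {γ : EV n → ℝ} (z' : EV n) :
    ‖nuv P γ z'‖ ^ 2 = ‖gradient γ z'‖ ^ 2 + 1 := by
  rw [nuv, hP]; simp

lemma nuv_ne (hP : IsoP P) {γ : EV n → ℝ} (z' : EV n) : 1 ≤ ‖nuv P γ z'‖ := by
  have := nuv_norm hP (γ := γ) z'
  nlinarith [norm_nonneg (nuv P γ z'), sq_nonneg ‖gradient γ z'‖]

variable {γ : EV n → ℝ}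

lemma Ckb.fderiv_bdd {k : ℕ} (h : Ckb k γ) (hk : 1 ≤ k) :
    ∃ C, 0 ≤ C ∧ ∀ x, ‖fderiv ℝ γ x‖ ≤ C := by
  obtain ⟨C, hC⟩ := h.2 1 hk
  refine ⟨C, (norm_nonneg _).trans (hC 0), fun x => ?_⟩
  rw [← norm_iteratedFDeriv_one]; exact hC x

lemma Ckb.fderiv2_bdd {k : ℕ} (h : Ckb k γ) (hk : 2 ≤ k) :
    ∃ C, 0 ≤ C ∧ ∀ x, ‖fderiv ℝ (fderiv ℝ γ) x‖ ≤ C := by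
  obtain ⟨C, hC⟩ := h.2 2 hk
  refine ⟨C, (norm_nonneg _).trans (hC 0), fun x => ?_⟩
  rw [← norm_iteratedFDeriv_one, norm_iteratedFDeriv_fderiv]; exact hC x

lemma grad_norm (z : EV n) : ‖gradient γ z‖ = ‖fderiv ℝ γ z‖ := by
  rw [gradient, LinearIsometryEquiv.norm_map]

/-- the defining function -/
def ff (P : FV n ≃L[ℝ] EV (n + 1)) (γ : EV n → ℝ) (x : EV (n + 1)) : ℝ :=
  (P.symm x).2 - γ (P.symm x).1

lemma ff_hasFDerivAt (hγ : Differentiable ℝ γ) (x : EV (n + 1)) :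
    HasFDerivAt (ff P γ) ((ContinuousLinearMap.snd ℝ (EV n) ℝ).comp (P.symm : EV (n+1) →L[ℝ] FV n)
      - (fderiv ℝ γ (P.symm x).1).comp ((ContinuousLinearMap.fst ℝ (EV n) ℝ).comp
        (P.symm : EV (n+1) →L[ℝ] FV n))) x := by
  have h1 : HasFDerivAt (fun x => (P.symm x).2) ((ContinuousLinearMap.snd ℝ (EV n) ℝ).comp
    (P.symm : EV (n+1) →L[ℝ] FV n)) x :=
    ((ContinuousLinearMap.snd ℝ (EV n) ℝ).comp (P.symm : EV (n+1) →L[ℝ] FV n)).hasFDerivAt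
  have h2 : HasFDerivAt (fun x => (P.symm x).1) ((ContinuousLinearMap.fst ℝ (EV n) ℝ).comp
    (P.symm : EV (n+1) →L[ℝ] FV n)) x :=
    ((ContinuousLinearMap.fst ℝ (EV n) ℝ).comp (P.symm : EV (n+1) →L[ℝ] FV n)).hasFDerivAt
  exact h1.sub ((hγ _).hasFDerivAt.comp x h2)

lemma ff_contDiff (hγ : ContDiff ℝ 3 γ) : ContDiff ℝ 3 (ff P γ) := by
  unfold ff
  exact (contDiff_snd.comp P.symm.contDiff).sub
    (hγ.comp (contDiff_fst.comp P.symm.contDiff))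

lemma ff_fderiv (hP : IsoP P) (hγ : Differentiable ℝ γ) (x w : EV (n + 1)) :
    fderiv ℝ (ff P γ) x w = inner ℝ (nuv P γ (P.symm x).1) w := by
  rw [(ff_hasFDerivAt hγ x).fderiv]
  have := nuv_inner hP (γ := γ) (P.symm x).1 (P.symm w)
  rw [P.apply_symm_apply] at this
  rw [this]; simp

lemma Ckb.diff {k : ℕ} (h : Ckb k γ) (hk : 1 ≤ k) : Differentiable ℝ γ :=
  h.1.differentiable (by exact_mod_cast (by omega : k ≠ 0))

lemma IsCh.mem_iff {Ω U : Set (EV (n + 1))} (h : IsCh Ω U P γ) {x : EV (n + 1)} (hx : x ∈ U) :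
    x ∈ Ω ↔ 0 < ff P γ x := by
  rw [h.2.2.2 x hx, ff, sub_pos]

/-- sign propagation -/
lemma ff_pos_of_inner (hP : IsoP P) (hγ : Differentiable ℝ γ) {x w : EV (n + 1)}
    (hx : ff P γ x = 0) (hw : 0 < inner ℝ (nuv P γ (P.symm x).1) w) :
    ∀ᶠ t in 𝓝[>] (0:ℝ), 0 < ff P γ (x + t • w) := by
  have hd : HasDerivAt (fun t : ℝ => ff P γ (x + t • w)) (inner ℝ (nuv P γ (P.symm x).1) w) 0 := by
    rw [← ff_fderiv hP hγ]
    have hl : HasDerivAt (fun t : ℝ => x + t • w) w 0 := by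
      simpa using ((hasDerivAt_id (0:ℝ)).smul_const w).const_add x
    have h0 : HasFDerivAt (ff P γ) (fderiv ℝ (ff P γ) x) (x + (0:ℝ) • w) := by
      simpa using (ff_hasFDerivAt hγ x).differentiableAt.hasFDerivAt
    exact h0.comp_hasDerivAt 0 hl
  have h2 := hd.tendsto_slope_zero_right
  filter_upwards [h2.eventually (lt_mem_nhds hw), self_mem_nhdsWithin] with t ht ht0
  have ht0 : 0 < t := ht0
  simp only [zero_add, zero_smul, add_zero, hx, sub_zero, smul_eq_mul] at ht
  exact (pos_iff_pos_of_mul_pos ht).1 (inv_pos.2 ht0)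

lemma IsCh.frontier_iff {Ω U : Set (EV (n + 1))} (h : IsCh Ω U P γ) (hΩ : IsOpen Ω)
    {x : EV (n + 1)} (hx : x ∈ U) : x ∈ frontier Ω ↔ ff P γ x = 0 := by
  have hγ := h.2.2.1.diff (by norm_num)
  have hfc : Continuous (ff P γ) := (ff_contDiff h.2.2.1.1).continuous
  have hev : ∀ᶠ y in 𝓝 x, y ∈ U := h.1.mem_nhds hx
  rw [hΩ.frontier_eq]
  constructor
  · rintro ⟨h1, h2⟩
    rw [h.mem_iff hx, not_lt] at h2
    refine le_antisymm h2 ?_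
    by_contra hlt
    push Not at hlt
    have h3 : ∀ᶠ y in 𝓝 x, ff P γ y < 0 := hfc.continuousAt.eventually (gt_mem_nhds hlt)
    have h4 := (mem_closure_iff_frequently.1 h1).and_eventually (hev.and h3)
    obtain ⟨y, hy, hyU, hy0⟩ := h4.exists
    rw [h.mem_iff hyU] at hy; linarith
  · intro h0
    refine ⟨?_, by rw [h.mem_iff hx, h0]; simp⟩
    rw [mem_closure_iff_frequently]
    have hpos : 0 < inner ℝ (nuv P γ (P.symm x).1) (nuv P γ (P.symm x).1) := by
      rw [real_inner_self_eq_norm_sq]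
      have := nuv_ne h.2.1 (γ := γ) (P.symm x).1
      positivity
    have h1 := ff_pos_of_inner h.2.1 hγ h0 hpos
    have ht : Tendsto (fun t : ℝ => x + t • nuv P γ (P.symm x).1) (𝓝[>] 0) (𝓝 x) := by
      have : Continuous fun t : ℝ => x + t • nuv P γ (P.symm x).1 := by fun_prop
      have := this.tendsto 0
      simp only [zero_smul, add_zero] at this
      exact this.mono_left nhdsWithin_le_nhds
    have h2 : ∀ᶠ t in 𝓝[>] (0:ℝ), x + t • nuv P γ (P.symm x).1 ∈ Ω := by
      filter_upwards [h1, ht.eventually hev] with t ht1 ht2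
      exact (h.mem_iff ht2).2 ht1
    exact ht.frequently h2.frequently

lemma nuv_parallel {Ω U1 U2 : Set (EV (n + 1))} {P1 P2 : FV n ≃L[ℝ] EV (n + 1)}
    {γ1 γ2 : EV n → ℝ} (h1 : IsCh Ω U1 P1 γ1) (h2 : IsCh Ω U2 P2 γ2)
    {x : EV (n + 1)} (hx1 : x ∈ U1) (hx2 : x ∈ U2) (e1 : ff P1 γ1 x = 0) (e2 : ff P2 γ2 x = 0) :
    ∃ c : ℝ, nuv P2 γ2 (P2.symm x).1 = c • nuv P1 γ1 (P1.symm x).1 := by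
  set a := nuv P1 γ1 (P1.symm x).1 with ha
  set b := nuv P2 γ2 (P2.symm x).1 with hb
  have hev : ∀ᶠ y in 𝓝 x, y ∈ U1 ∩ U2 := (h1.1.inter h2.1).mem_nhds ⟨hx1, hx2⟩
  have key : ∀ w, 0 < inner ℝ a w → 0 ≤ inner ℝ b w := by
    intro w hw
    by_contra hlt
    push Not at hlt
    have k1 := ff_pos_of_inner h1.2.1 (h1.2.2.1.diff (by norm_num)) e1 hw
    have hd : HasDerivAt (fun t : ℝ => ff P2 γ2 (x + t • w)) (inner ℝ b w) 0 := by
      rw [hb, ← ff_fderiv h2.2.1 (h2.2.2.1.diff (by norm_num))]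
      have hl : HasDerivAt (fun t : ℝ => x + t • w) w 0 := by
        simpa using ((hasDerivAt_id (0:ℝ)).smul_const w).const_add x
      have h0 : HasFDerivAt (ff P2 γ2) (fderiv ℝ (ff P2 γ2) x) (x + (0:ℝ) • w) := by
        simpa using (ff_hasFDerivAt (h2.2.2.1.diff (by norm_num)) x).differentiableAt.hasFDerivAt
      exact h0.comp_hasDerivAt 0 hl
    have hsl := hd.tendsto_slope_zero_right
    have ht : Tendsto (fun t : ℝ => x + t • w) (𝓝[>] 0) (𝓝 x) := by
      have : Continuous fun t : ℝ => x + t • w := by fun_prop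
      have := this.tendsto 0
      simp only [zero_smul, add_zero] at this
      exact this.mono_left nhdsWithin_le_nhds
    obtain ⟨t, ht1, ht2, ht3, ht4⟩ :=
      (k1.and ((ht.eventually hev).and ((hsl.eventually (gt_mem_nhds hlt)).and
        (self_mem_nhdsWithin (s := Set.Ioi (0:ℝ)))))).exists
    have ht4 : 0 < t := ht4
    simp only [zero_add, zero_smul, add_zero, e2, sub_zero, smul_eq_mul] at ht3
    have := (h2.mem_iff ht2.2).1 ((h1.mem_iff ht2.1).2 ht1)
    have := mul_pos (inv_pos.2 ht4) this
    linarith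
  have ha0 : 0 < inner ℝ a a := by
    rw [real_inner_self_eq_norm_sq]
    have := nuv_ne h1.2.1 (γ := γ1) (P1.symm x).1
    positivity
  have key0 : ∀ w, inner ℝ a w = 0 → 0 ≤ inner ℝ b w := by
    intro w hw
    have : ∀ δ > 0, 0 ≤ inner ℝ b w + δ * inner ℝ b a := by
      intro δ hδ
      have := key (w + δ • a) (by rw [inner_add_right, hw, inner_smul_right]; positivity)
      rwa [inner_add_right, inner_smul_right] at this
    have ht : Tendsto (fun δ : ℝ => inner ℝ b w + δ * inner ℝ b a) (𝓝[>] 0) (𝓝 (inner ℝ b w)) := by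
      have : Continuous fun δ : ℝ => inner ℝ b w + δ * inner ℝ b a := by fun_prop
      have := this.tendsto 0
      simp only [zero_mul, add_zero] at this
      exact this.mono_left nhdsWithin_le_nhds
    exact ge_of_tendsto ht (by filter_upwards [self_mem_nhdsWithin] with δ hδ using this δ hδ)
  have key1 : ∀ w, inner ℝ a w = 0 → inner ℝ b w = 0 := by
    intro w hw
    refine le_antisymm ?_ (key0 w hw)
    have := key0 (-w) (by simp [hw])
    rw [inner_neg_right] at this; linarith
  refine ⟨inner ℝ a b / inner ℝ a a, ?_⟩
  have hw : inner ℝ a (b - (inner ℝ a b / inner ℝ a a) • a) = 0 := by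
    rw [inner_sub_right, inner_smul_right]; field_simp; ring
  have hb' := key1 _ hw
  rw [← sub_eq_zero, ← inner_self_eq_zero (𝕜 := ℝ), inner_sub_left, hb', inner_smul_left, hw]
  simp

/-- classical Neumann condition -/
def NBC (Ω : Set (EV (n + 1))) (M : Matrix (Fin (n + 1)) (Fin (n + 1)) ℝ) (v : EV (n + 1) → ℝ) :
    Prop :=
  ∀ U P γ, IsCh Ω U P γ → ∀ x ∈ U, ff P γ x = 0 →
    fderiv ℝ v x (mulVecE M (nuv P γ (P.symm x).1)) = 0

end charts

end Part4

section Part5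

section halfspace
variable {n : ℕ}

instance FV_haar : (volume : Measure (FV n)).IsAddHaarMeasure := by
  rw [Measure.volume_eq_prod]; infer_instance

lemma mulVecE_mul {m : ℕ} (A B : Matrix (Fin m) (Fin m) ℝ) (x : EV m) :
    mulVecE (A * B) x = mulVecE A (mulVecE B x) := by
  simp [mulVecE, Matrix.mulVec_mulVec]

lemma mulVecE_inner {m : ℕ} (A : Matrix (Fin m) (Fin m) ℝ) (x y : EV m) :
    inner ℝ x (mulVecE A y) = inner ℝ (mulVecE Aᵀ x) y := by
  simp only [mulVecE, EuclideanSpace.inner_eq_star_dotProduct, WithLp.equiv_apply,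
    WithLp.equiv_symm_apply, star_trivial]
  rw [dotProduct_comm, Matrix.dotProduct_mulVec, dotProduct_comm, Matrix.mulVec_transpose]

lemma exists_rot (hn : 1 ≤ n) (e : EV (n + 1)) (he : ‖e‖ = 1) :
    ∃ Q : Matrix (Fin (n + 1)) (Fin (n + 1)) ℝ, Qᵀ * Q = 1 ∧ Q.det = 1 ∧
      mulVecE Q (snocE 0 1) = e := by
  have hon : Orthonormal ℝ (Set.restrict {Fin.last n} fun _ : Fin (n + 1) => e) := by
    refine ⟨fun i => he, fun i j hij => ?_⟩
    exact absurd (Subsingleton.elim i j) hij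
  obtain ⟨b, hb⟩ := hon.exists_orthonormalBasis_extension_of_card_eq (by simp)
  have hb := hb (Fin.last n) rfl
  set Q : Matrix (Fin (n + 1)) (Fin (n + 1)) ℝ := Matrix.of fun i j => b j i with hQdef
  have hQ : Qᵀ * Q = 1 := by
    ext i j
    have := orthonormal_iff_ite.1 b.orthonormal i j
    rw [Matrix.mul_apply, Matrix.one_apply, ← this]
    simp [hQdef, PiLp.inner_apply, mul_comm]
  have hdet : Q.det * Q.det = 1 := by
    have := congrArg Matrix.det hQ
    simpa using this
  set dd : Fin (n + 1) → ℝ := fun j => if j = 0 then Q.det else 1 with hdd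
  have hl : Fin.last n ≠ 0 := by
    intro h; have := congrArg Fin.val h; simp at this; omega
  refine ⟨Q * Matrix.diagonal dd, ?_, ?_, ?_⟩
  · rw [Matrix.transpose_mul, Matrix.diagonal_transpose, Matrix.mul_assoc, ← Matrix.mul_assoc Qᵀ, hQ,
      Matrix.one_mul, Matrix.diagonal_mul_diagonal, ← Matrix.diagonal_one]
    congr 1; funext j
    by_cases hj : j = 0 <;> simp [hdd, hj, hdet]
  · rw [Matrix.det_mul, Matrix.det_diagonal]
    have : ∏ i, dd i = Q.det := by simp [hdd]
    rw [this, hdet]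
  · ext i
    have : ((WithLp.equiv 2 (Fin (n + 1) → ℝ)) (snocE (0 : EV n) 1)) = Pi.single (Fin.last n) 1 := by
      funext j
      refine Fin.lastCases ?_ (fun k => ?_) j
      · simp [snocE]
      · simp [snocE]
    rw [mulVecE, this, Matrix.mulVec_single_one]
    simp [hdd, hl, hQdef, Matrix.col, hb]

lemma kern_scale {m : ℕ} (ρ : EV m → ℝ) {ε : ℝ} (hε : 0 < ε) (x : EV m) :
    kernelJ (scaled ρ ε) x = ((ε ^ m)⁻¹ * (ε ^ 2)⁻¹) * kernelJ ρ (ε⁻¹ • x) := by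
  simp only [kernelJ, scaled, norm_smul, norm_inv, Real.norm_of_nonneg hε.le]
  rw [mul_pow, inv_pow]
  rcases eq_or_ne (‖x‖ ^ 2) 0 with h0 | h0
  · simp [h0]
  · field_simp

lemma half_space {ρ : EV (n + 1) → ℝ} (h1 : A1 ρ) (h2 : A2 ρ) {ε : ℝ} (hε : 0 < ε)
    {ν : EV (n + 1)} (hν : ν ≠ 0) {s : ℝ} (hs : 0 < s) :
    ∃ c : ℝ, ∫ z in {z : EV (n + 1) | s ≤ inner ℝ ν z}, kernelJ (scaled ρ ε) z • z
      = c • mulVecE (momentum ρ) ν := by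
  obtain ⟨-, -, A, hA, hAM, hAQ⟩ := h2
  have hAT : Aᵀ = A := by
    have := hA.isHermitian
    rwa [Matrix.IsHermitian, Matrix.conjTranspose_eq_transpose_of_trivial] at this
  have hAu : IsUnit A.det := hA.det_pos.ne'.isUnit
  have hinj : ∀ w : EV (n + 1), w ≠ 0 → mulVecE A w ≠ 0 := by
    intro w hw h0
    apply hw
    have : mulVecE A⁻¹ (mulVecE A w) = w := by
      rw [← mulVecE_mul, Matrix.nonsing_inv_mul _ hAu]; simp [mulVecE]
    rw [← this, h0]; simp [mulVecE]
  have hMν : mulVecE (momentum ρ) ν ≠ 0 := by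
    rw [← hAM, mulVecE_mul]; exact hinj _ (hinj _ hν)
  rcases Nat.eq_zero_or_pos n with hn | hn
  · subst hn
    obtain ⟨c, hc⟩ := exists_smul_eq_of_finrank_eq_one (K := ℝ) (V := EV (0 + 1)) (by simp) hMν
      (∫ z in {z : EV (0 + 1) | s ≤ inner ℝ ν z}, kernelJ (scaled ρ ε) z • z)
    exact ⟨c, hc.symm⟩
  set a := ‖mulVecE A ν‖ with ha
  have ha0 : 0 < a := norm_pos_iff.2 (hinj _ hν)
  obtain ⟨Q, hQ, hQd, hQe⟩ := exists_rot hn (a⁻¹ • mulVecE A ν) (by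
    rw [norm_smul, norm_inv, Real.norm_of_nonneg ha0.le, ← ha, inv_mul_cancel₀ ha0.ne'])
  obtain ⟨P, hP, hPe⟩ := exists_P hQ
  have hPe1 : P (0, 1) = a⁻¹ • mulVecE A ν := by rw [hPe, hQe]
  let AE : EV (n + 1) ≃ₗ[ℝ] EV (n + 1) := LinearEquiv.ofInjectiveEndo (mulL A) (by
    rw [← LinearMap.ker_eq_bot, LinearMap.ker_eq_bot']
    intro w hw; by_contra hne; exact hinj w hne hw)
  let T : FV n ≃L[ℝ] EV (n + 1) := P.trans AE.toContinuousLinearEquiv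
  have hT : ∀ y, T y = mulVecE A (P y) := fun y => rfl
  have hTi : ∀ y : FV n, inner ℝ ν (T y) = a * y.2 := by
    intro y
    rw [hT, mulVecE_inner, hAT]
    have : mulVecE A ν = a • P (0, 1) := by rw [hPe1, smul_smul, mul_inv_cancel₀ ha0.ne', one_smul]
    rw [this, inner_smul_left, hP.inner]; simp
  have hTm : MeasurableEmbedding T := T.toHomeomorph.measurableEmbedding
  have : (Measure.map T (volume : Measure (FV n))).IsAddHaarMeasure :=
    T.isAddHaarMeasure_map volume
  set S := {z : EV (n + 1) | s ≤ inner ℝ ν z} with hSdef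
  have hS : MeasurableSet S := (isClosed_le continuous_const (by fun_prop)).measurableSet
  have hnt : IntegrableOn (fun z => kernelJ (scaled ρ ε) z • z) S := by
    refine (kz_int h1 hε (s := s / ‖ν‖) (by have := norm_pos_iff.2 hν; positivity)).mono_set ?_
    intro z hz
    have hz : s ≤ inner ℝ ν z := hz
    change s / ‖ν‖ ≤ ‖z‖
    rw [div_le_iff₀ (norm_pos_iff.2 hν), mul_comm]
    exact hz.trans (real_inner_le_norm _ _)
  have hm1 := Measure.isAddLeftInvariant_eq_smul (volume : Measure (EV (n + 1)))
    (Measure.map T (volume : Measure (FV n)))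
  have hm2 := Measure.isAddLeftInvariant_eq_smul (Measure.map T (volume : Measure (FV n)))
    (volume : Measure (EV (n + 1)))
  set c1 := (volume : Measure (EV (n + 1))).addHaarScalarFactor (Measure.map T (volume : Measure (FV n)))
  set c2 := (Measure.map T (volume : Measure (FV n))).addHaarScalarFactor (volume : Measure (EV (n + 1)))
  have hnt' := (integrable_indicator_iff hS).2 hnt
  have hint2 : Integrable (fun y : FV n => S.indicator (fun z => kernelJ (scaled ρ ε) z • z) (T y)) := by
    have : Integrable (S.indicator fun z => kernelJ (scaled ρ ε) z • z)
        (Measure.map T (volume : Measure (FV n))) := by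
      rw [hm2]; exact hnt'.smul_measure_nnreal
    exact (hTm.integrable_map_iff).1 this
  rw [← integral_indicator hS, hm1, integral_smul_nnreal_measure, hTm.integral_map]
  set g : FV n → FV n := fun y => T.symm (S.indicator (fun z => kernelJ (scaled ρ ε) z • z) (T y)) with hg
  have hgi : Integrable g := (T.symm : EV (n+1) →L[ℝ] FV n).integrable_comp hint2
  have hTg : ∀ y, S.indicator (fun z => kernelJ (scaled ρ ε) z • z) (T y) = T (g y) := by
    intro y; simp [hg]
  have hgv : ∀ y : FV n, g y = if s ≤ a * y.2 then kernelJ (scaled ρ ε) (T y) • y else 0 := by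
    intro y
    simp only [hg]
    by_cases hy : s ≤ a * y.2
    · rw [Set.indicator_of_mem (by rw [hSdef, Set.mem_ofPred_eq, hTi]; exact hy), if_pos hy]; simp
    · rw [Set.indicator_of_notMem (by rw [hSdef, Set.mem_ofPred_eq, hTi]; exact hy), if_neg hy]; simp
  simp_rw [hTg]
  have e1 : ∫ y, T (g y) = T (∫ y, g y) :=
    (T : FV n →L[ℝ] EV (n+1)).integral_comp_comm hgi
  have e2 : (∫ y, g y).1 = 0 := by
    have e3 : ∫ y, (g y).1 = (∫ y, g y).1 :=
      (ContinuousLinearMap.fst ℝ (EV n) ℝ).integral_comp_comm hgi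
    rw [← e3]
    have hgi1 : Integrable (fun y => (g y).1) :=
      (ContinuousLinearMap.fst ℝ (EV n) ℝ).integrable_comp hgi
    rw [Measure.volume_eq_prod, integral_prod_symm _ hgi1]
    refine integral_eq_zero_of_ae (Eventually.of_forall fun t => ?_)
    simp only [hgv, Pi.zero_apply]
    by_cases ht : s ≤ a * t
    · simp only [ht, if_true, Prod.smul_fst]
      have h3 := hAQ (ε⁻¹ * t) Q hQ hQd
      have h4 := Measure.integral_comp_smul (volume : Measure (EV n))
        (fun z' => kernelJ ρ (mulVecE (A * Q) (snocE z' (ε⁻¹ * t))) • z') ε⁻¹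
      rw [h3, smul_zero] at h4
      have h5 : ∀ z' : EV n, kernelJ (scaled ρ ε) (T (z', t)) • z' =
          (((ε ^ (n + 1))⁻¹ * (ε ^ 2)⁻¹) * ε) • (kernelJ ρ (mulVecE (A * Q) (snocE (ε⁻¹ • z') (ε⁻¹ * t)))
            • (ε⁻¹ • z')) := by
        intro z'
        rw [kern_scale ρ hε, ← map_smul, hT, hPe, mulVecE_mul]
        simp only [smul_smul, Prod.smul_mk, smul_eq_mul]
        congr 1
        field_simp
      simp_rw [h5]
      rw [integral_smul, h4, smul_zero]
    · simp [ht]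
  rw [e1]
  refine ⟨c1 * ((∫ y, g y).2 * a⁻¹), ?_⟩
  have e4 : (∫ y, g y) = (∫ y, g y).2 • ((0 : EV n), (1 : ℝ)) := by
    ext1
    · rw [e2]; simp
    · simp
  rw [e4, map_smul, hT, hPe1]
  have : mulVecE A (a⁻¹ • mulVecE A ν) = a⁻¹ • mulVecE (momentum ρ) ν := by
    rw [← hAM, mulVecE_mul]; exact map_smul (mulL A) _ _
  rw [this, mul_smul, mul_smul]
  simp [NNReal.smul_def]

end halfspace

end Part5

section Part6

section strip
variable {n : ℕ} {P : FV n ≃L[ℝ] EV (n + 1)} {γ : EV n → ℝ}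

lemma radial_int {α N : ℝ} (hα : α < 2) (hα0 : 0 < α) (hN : 3 - α < N) (n : ℕ) :
    massI (fun ζ : EV n => ‖ζ‖ ^ ((2:ℝ) - α - n) * (1 + ‖ζ‖) ^ (-N)) < ⊤ := by
  have hI : Integrable (fun ζ : EV n => ‖ζ‖ ^ ((2:ℝ) - α - n) * (1 + ‖ζ‖) ^ (-N)) := by
    rcases Nat.eq_zero_or_pos n with hn | hn
    · subst hn
      have : (fun ζ : EV 0 => ‖ζ‖ ^ ((2:ℝ) - α - (0:ℕ)) * (1 + ‖ζ‖) ^ (-N))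
          = fun _ => ‖(0 : EV 0)‖ ^ ((2:ℝ) - α - (0:ℕ)) * (1 + ‖(0 : EV 0)‖) ^ (-N) := by
        funext z; rw [Subsingleton.elim z 0]
      rw [this]
      have hfin : IsFiniteMeasure (volume : Measure (EV 0)) := by
        refine ⟨?_⟩
        have : (Set.univ : Set (EV 0)) = {0} := by ext z; simp [Subsingleton.elim z 0]
        rw [this]; exact isCompact_singleton.measure_lt_top
      exact integrable_const _
    have : Nontrivial (EV n) := by
      have : Nonempty (Fin n) := ⟨⟨0, hn⟩⟩
      infer_instance
    have := (integrable_fun_norm_addHaar (E := EV n) volume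
      (f := fun r : ℝ => r ^ ((2:ℝ) - α - n) * (1 + r) ^ (-N))).2 ?_
    · exact this
    have hd : Module.finrank ℝ (EV n) = n := by simp
    rw [hd]
    have e : ∀ r ∈ Set.Ioi (0:ℝ), r ^ (n - 1) • (r ^ ((2:ℝ) - α - n) * (1 + r) ^ (-N))
        = r ^ (1 - α) * (1 + r) ^ (-N) := by
      intro r hr
      have hr : 0 < r := hr
      rw [smul_eq_mul, ← mul_assoc, ← Real.rpow_natCast, ← Real.rpow_add hr]
      congr 2
      rw [Nat.cast_sub hn]; push_cast; ring
    have hm : Measurable fun r : ℝ => r ^ (1 - α) * (1 + r) ^ (-N) :=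
      (measurable_id.pow_const _).mul ((measurable_const.add measurable_id).pow_const _)
    rw [integrableOn_congr_fun e measurableSet_Ioi, ← Set.Ioc_union_Ioi_eq_Ioi (zero_le_one (α := ℝ))]
    refine IntegrableOn.union ?_ ?_
    · have h1 : IntegrableOn (fun r : ℝ => r ^ (1 - α)) (Set.Ioc 0 1) := by
        have := intervalIntegral.intervalIntegrable_rpow' (a := 0) (b := 1) (r := 1 - α) (by linarith)
        exact (intervalIntegrable_iff_integrableOn_Ioc_of_le zero_le_one).1 this
      refine h1.mono' hm.aestronglyMeasurable ?_
      filter_upwards [ae_restrict_mem measurableSet_Ioc] with r hr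
      have hr0 : 0 < r := hr.1
      rw [Real.norm_of_nonneg (by positivity)]
      refine mul_le_of_le_one_right (by positivity) ?_
      exact Real.rpow_le_one_of_one_le_of_nonpos (by linarith) (by linarith)
    · have h1 : IntegrableOn (fun r : ℝ => r ^ (1 - α - N)) (Set.Ioi 1) :=
        integrableOn_Ioi_rpow_of_lt (by linarith) zero_lt_one
      refine h1.mono' hm.aestronglyMeasurable ?_
      filter_upwards [ae_restrict_mem measurableSet_Ioi] with r hr
      have hr1 : 1 < r := hr
      have hr0 : 0 < r := by linarith
      rw [Real.norm_of_nonneg (by positivity), sub_eq_add_neg (1 - α) N, Real.rpow_add hr0]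
      gcongr ?_ * ?_
      exact Real.rpow_le_rpow_of_nonpos hr0 (by linarith) (by linarith)
  exact hI.lintegral_lt_top

lemma strip_bound {ρ : EV (n + 1) → ℝ} (h1 : A1 ρ) (h2 : A2 ρ) (C : ℝ) (hC : 0 ≤ C) :
    ∃ K : ℝ≥0∞, K < ⊤ ∧ ∀ P : FV n ≃L[ℝ] EV (n + 1), IsoP P → ∀ ε : ℝ, 0 < ε →
      ∀ (l : EV n →L[ℝ] ℝ) (s : ℝ),
      ∫⁻ z in {z : EV (n + 1) | |(P.symm z).2 - l (P.symm z).1 - s| ≤ C * ‖(P.symm z).1‖ ^ 2},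
        ENNReal.ofReal (kernelJ (scaled ρ ε) z * ‖z‖) ≤ K := by
  obtain ⟨-, ⟨c₀, c₁, α, N, hc0, -, hα0, hα2, hN, hb⟩, -⟩ := h2
  set Fr : EV n → ℝ := fun ζ => ‖ζ‖ ^ ((2:ℝ) - α - n) * (1 + ‖ζ‖) ^ (-N) with hFr
  refine ⟨ENNReal.ofReal (2 * C * c₀) * massI Fr,
    ENNReal.mul_lt_top (by simp) (radial_int hα2 hα0 hN n), ?_⟩
  intro P hP ε hε l s
  set S := {z : EV (n + 1) | |(P.symm z).2 - l (P.symm z).1 - s| ≤ C * ‖(P.symm z).1‖ ^ 2} with hSd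
  have hS : MeasurableSet S := (isClosed_le (by fun_prop) (by fun_prop)).measurableSet
  rw [← lintegral_indicator hS, ← hP.mp.lintegral_comp_emb P.toHomeomorph.measurableEmbedding,
    Measure.volume_eq_prod, lintegral_prod]
  swap
  · refine Measurable.aemeasurable ?_
    refine Measurable.comp (Measurable.indicator ?_ hS) P.continuous.measurable
    exact ((kern_meas h1 ε).mul measurable_norm).ennreal_ofReal
  rw [← lint_scaled_one (ρ := Fr) hε, ← lintegral_const_mul' _ _ (by simp)]
  refine lintegral_mono fun z' => ?_
  rcases eq_or_ne z' 0 with h0 | h0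
  · -- degenerate fibre
    subst h0
    refine le_of_eq_of_le ?_ zero_le
    rw [lintegral_eq_zero_iff']
    · have : ∀ᵐ t : ℝ, t ≠ s := by simp [ae_iff]
      filter_upwards [this] with t ht
      rw [Set.indicator_of_notMem]; · rfl
      simp only [hSd, Set.mem_ofPred_eq, P.symm_apply_apply, map_zero, norm_zero, sub_zero]
      simp only [ne_eq, OfNat.ofNat_ne_zero, not_false_eq_true, zero_pow, mul_zero, not_le, abs_pos]
      exact sub_ne_zero.2 ht
    · refine Measurable.aemeasurable ?_
      refine Measurable.comp (Measurable.indicator ?_ hS) (P.continuous.measurable.comp measurable_prodMk_left)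
      exact ((kern_meas h1 ε).mul measurable_norm).ennreal_ofReal
  have hz0 : 0 < ‖z'‖ := norm_pos_iff.2 h0
  set r := ‖ε⁻¹ • z'‖ with hr
  have hre : r = ε⁻¹ * ‖z'‖ := by rw [hr, norm_smul, norm_inv, Real.norm_of_nonneg hε.le]
  have hr0 : 0 < r := by rw [hre]; positivity
  have hpt : ∀ t : ℝ, kernelJ (scaled ρ ε) (P (z', t)) * ‖P (z', t)‖
      ≤ ((ε ^ n)⁻¹ * (ε ^ 2)⁻¹) * (c₀ * r ^ (-α - n) * (1 + r) ^ (-N)) := by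
    intro t
    set ζ := ε⁻¹ • P (z', t) with hζ
    have hζr : r ≤ ‖ζ‖ := by
      have := hP.fst_le ζ
      rw [hζ, ← map_smul, P.symm_apply_apply] at this
      rw [hζ, ← map_smul]; exact this
    have hζ0 : ζ ≠ 0 := norm_pos_iff.1 (hr0.trans_le hζr)
    have hζ1 : 0 < ‖ζ‖ := norm_pos_iff.2 hζ0
    have hPn : ‖P (z', t)‖ = ε * ‖ζ‖ := by
      rw [hζ, norm_smul, norm_inv, Real.norm_of_nonneg hε.le, mul_inv_cancel_left₀ hε.ne']
    have hJ : kernelJ ρ ζ * ‖ζ‖ ≤ c₀ * r ^ (-α - n) * (1 + r) ^ (-N) := by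
      calc kernelJ ρ ζ * ‖ζ‖ = ρ ζ * ‖ζ‖⁻¹ := by unfold kernelJ; field_simp
        _ ≤ (c₀ * ‖ζ‖ ^ ((2 : ℝ) - α - (n + 1 : ℝ)) * (1 + ‖ζ‖) ^ (-N)) * ‖ζ‖⁻¹ := by
            gcongr; exact (le_abs_self _).trans (hb ζ hζ0).1
        _ = c₀ * ‖ζ‖ ^ (-α - n) * (1 + ‖ζ‖) ^ (-N) := by
            have : ‖ζ‖ ^ (-α - n) = ‖ζ‖ ^ ((2 : ℝ) - α - (n + 1 : ℝ)) * ‖ζ‖⁻¹ := by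
              rw [← Real.rpow_neg_one, ← Real.rpow_add hζ1]; congr 1; ring
            rw [this]; ring
        _ ≤ _ := by
            gcongr ?_ * ?_ * ?_
            · exact Real.rpow_le_rpow_of_nonpos hr0 hζr (by have : (0:ℝ) ≤ n := by positivity
                                                            linarith)
            · exact Real.rpow_le_rpow_of_nonpos (by linarith) (by linarith) (by linarith)
    rw [kern_scale ρ hε, hPn]
    calc _ = ((ε ^ n)⁻¹ * (ε ^ 2)⁻¹) * (kernelJ ρ ζ * ‖ζ‖) := by
          rw [← hζ, pow_succ]; field_simp
      _ ≤ _ := by gcongr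
  set B := ((ε ^ n)⁻¹ * (ε ^ 2)⁻¹) * (c₀ * r ^ (-α - n) * (1 + r) ^ (-N)) with hB
  calc _ ≤ ∫⁻ t : ℝ, Set.indicator (Set.Icc (l z' + s - C * ‖z'‖ ^ 2) (l z' + s + C * ‖z'‖ ^ 2))
        (fun _ => ENNReal.ofReal B) t := by
        refine lintegral_mono fun t => ?_
        by_cases ht : P (z', t) ∈ S
        · rw [Set.indicator_of_mem ht, Set.indicator_of_mem]
          · exact ENNReal.ofReal_le_ofReal (hpt t)
          · simp only [hSd, Set.mem_ofPred_eq, P.symm_apply_apply] at ht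
            rw [abs_le] at ht
            constructor <;> linarith [ht.1, ht.2]
        · rw [Set.indicator_of_notMem ht]; exact zero_le
    _ = ENNReal.ofReal (B * (2 * C * ‖z'‖ ^ 2)) := by
        rw [lintegral_indicator_const measurableSet_Icc, Real.volume_Icc, ← ENNReal.ofReal_mul (by positivity)]
        congr 1; ring
    _ = _ := by
        rw [← ENNReal.ofReal_mul (by positivity)]
        congr 1
        rw [hB, scaled, hFr]
        simp only
        rw [← hr]
        have e1 : ‖z'‖ = ε * r := by rw [hre, mul_inv_cancel_left₀ hε.ne']
        have e2 : r ^ ((2:ℝ) - α - n) = r ^ (2:ℕ) * r ^ (-α - n) := by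
          rw [← Real.rpow_natCast, ← Real.rpow_add hr0]; congr 1; push_cast; ring
        rw [e1, e2]; field_simp

end strip

end Part6

section Part7

variable {n : ℕ}

lemma bvec_integrableOn {m : ℕ} {ρ : EV m → ℝ} (h : A1 ρ) {ε : ℝ} (hε : 0 < ε) {Ω : Set (EV m)} {x : EV m}
    {δ : ℝ} (hδ : 0 < δ) (hx : Metric.ball x δ ⊆ Ω) :
    {z : EV m | x - z ∉ Ω} ⊆ {z | δ ≤ ‖z‖} ∧
    IntegrableOn (fun z => kernelJ (scaled ρ ε) z • z) {z : EV m | x - z ∉ Ω} := by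
  have hs : {z : EV m | x - z ∉ Ω} ⊆ {z | δ ≤ ‖z‖} := by
    intro z hz
    by_contra hlt
    rw [Set.mem_ofPred_eq, not_le] at hlt
    exact hz (hx (by simpa [Metric.mem_ball, dist_eq_norm] using hlt))
  exact ⟨hs, (kz_int h hε hδ).mono_set hs⟩

lemma bvec_far {m : ℕ} {ρ : EV m → ℝ} (h : A1 ρ) {ε : ℝ} (hε : 0 < ε) {Ω : Set (EV m)} {x : EV m}
    {δ : ℝ} (hδ : 0 < δ) (hx : Metric.ball x δ ⊆ Ω) :
    ‖bvec Ω ρ ε x‖ₑ ≤ GG ρ ε δ := by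
  obtain ⟨hs, hi⟩ := bvec_integrableOn h hε hδ hx
  refine (enorm_integral_le_lintegral_enorm _).trans ?_
  simp_rw [kz_enorm h hε]
  exact lintegral_mono_set hs

lemma symm_diff_int {X G : Type*} [MeasurableSpace X] [NormedAddCommGroup G] [NormedSpace ℝ G]
    {μ : Measure X} {f : X → G} {A H S : Set X} (hA : MeasurableSet A) (hH : MeasurableSet H)
    (hS : MeasurableSet S)
    (fA : IntegrableOn f A μ) (fH : IntegrableOn f H μ) (h1 : A \ H ⊆ S) (h2 : H \ A ⊆ S) :
    ‖(∫ z in A, f z ∂μ) - ∫ z in H, f z ∂μ‖ₑ ≤ ∫⁻ z in S, ‖f z‖ₑ ∂μ := by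
  rw [← integral_indicator hA, ← integral_indicator hH, ← integral_sub
    (fA.integrable_indicator hA) (fH.integrable_indicator hH), ← lintegral_indicator hS]
  refine (enorm_integral_le_lintegral_enorm _).trans (lintegral_mono fun z => ?_)
  by_cases ha : z ∈ A <;> by_cases hh : z ∈ H
  · simp [ha, hh]
  · simp [ha, hh, h1 ⟨ha, hh⟩]
  · simp [ha, hh, h2 ⟨hh, ha⟩]
  · simp [ha, hh]

lemma near_bvec {ρ : EV (n + 1) → ℝ} (h1 : A1 ρ) (h2 : A2 ρ) {Ω U : Set (EV (n + 1))}
    {P : FV n ≃L[ℝ] EV (n + 1)} {γ : EV n → ℝ} (hΩ : IsOpen Ω) (hch : IsCh Ω U P γ)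
    {δ : ℝ} (hδ : 0 < δ) :
    ∃ K : ℝ≥0∞, K < ⊤ ∧ ∃ c : ℝ, 0 < c ∧ ∀ ε : ℝ, 0 < ε → ∀ x, Metric.ball x δ ⊆ U →
      0 < ff P γ x → ∃ V : EV (n + 1), ‖bvec Ω ρ ε x - V‖ₑ ≤ K ∧
        ‖V‖ₑ ≤ GG ρ ε (c * ff P γ x) ∧
        ∃ a : ℝ, V = a • mulVecE (momentum ρ) (nuv P γ (P.symm x).1) := by
  obtain ⟨hU, hP, hγ, hmem⟩ := id hch
  obtain ⟨C, hC0, hC⟩ := hγ.fderiv2_bdd (by norm_num)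
  obtain ⟨C1, hC10, hC1⟩ := hγ.fderiv_bdd (by norm_num)
  obtain ⟨K, hK, hKs⟩ := strip_bound h1 h2 C hC0
  refine ⟨K + massI ρ / ENNReal.ofReal δ, ENNReal.add_lt_top.2 ⟨hK, ENNReal.div_lt_top (massI_lt_top h1).ne (by simpa using hδ)⟩,
    (C1 + 1)⁻¹, by positivity, ?_⟩
  intro ε hε x hx hs
  set s := ff P γ x with hsdef
  set ν := nuv P γ (P.symm x).1 with hν
  have hν1 : 1 ≤ ‖ν‖ := nuv_ne hP _
  have hνC : ‖ν‖ ≤ C1 + 1 := by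
    have := nuv_norm (γ := γ) hP (P.symm x).1
    rw [grad_norm] at this
    have h3 := hC1 (P.symm x).1
    have h4 := norm_nonneg (fderiv ℝ γ (P.symm x).1)
    rw [← hν] at this
    nlinarith
  have hν0 : ν ≠ 0 := by
    intro h0; rw [h0, norm_zero] at hν1; linarith
  obtain ⟨a, ha⟩ := half_space h1 h2 hε hν0 hs
  have hxU : x ∈ U := hx (Metric.mem_ball_self hδ)
  have hxΩ : x ∈ Ω := (hch.mem_iff hxU).2 hs
  obtain ⟨r, hr, hball⟩ := Metric.isOpen_iff.1 hΩ x hxΩ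
  obtain ⟨-, hbi⟩ := bvec_integrableOn h1 hε hr hball
  have hHsub : {z : EV (n + 1) | s ≤ inner ℝ ν z} ⊆ {z | (C1 + 1)⁻¹ * s ≤ ‖z‖} := by
    intro z hz
    have h3 : s ≤ ‖ν‖ * ‖z‖ := le_trans hz (real_inner_le_norm _ _)
    rw [Set.mem_ofPred_eq, inv_mul_le_iff₀ (by positivity)]
    exact h3.trans (mul_le_mul_of_nonneg_right hνC (norm_nonneg _))
  have hcs : 0 < (C1 + 1)⁻¹ * s := by positivity
  have hHi : IntegrableOn (fun z => kernelJ (scaled ρ ε) z • z) {z : EV (n + 1) | s ≤ inner ℝ ν z} :=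
    (kz_int h1 hε hcs).mono_set hHsub
  refine ⟨∫ z in {z : EV (n + 1) | s ≤ inner ℝ ν z}, kernelJ (scaled ρ ε) z • z, ?_, ?_, a, ha⟩
  · have hmA : MeasurableSet {z : EV (n + 1) | x - z ∉ Ω} :=
      (hΩ.measurableSet.compl).preimage (measurable_const.sub measurable_id)
    have hmH : MeasurableSet {z : EV (n + 1) | s ≤ inner ℝ ν z} :=
      measurableSet_le measurable_const (by fun_prop)
    set l := fderiv ℝ γ (P.symm x).1 with hl
    have hmS1 : MeasurableSet {z : EV (n + 1) | |(P.symm z).2 - l (P.symm z).1 - s| ≤ C * ‖(P.symm z).1‖ ^ 2} :=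
      (isClosed_le (by fun_prop) (by fun_prop)).measurableSet
    have hmS2 : MeasurableSet {z : EV (n + 1) | δ ≤ ‖z‖} :=
      measurableSet_le measurable_const (by fun_prop)
    have key : ∀ z : EV (n + 1), ‖z‖ < δ → (x - z ∈ Ω ↔ 0 < s - inner ℝ ν z +
        (γ (P.symm x).1 - γ ((P.symm x).1 - (P.symm z).1) - l (P.symm z).1)) := by
      intro z hz
      have hzU : x - z ∈ U := hx (by simpa [Metric.mem_ball, dist_eq_norm] using hz)
      rw [hch.mem_iff hzU]
      have h5 := nuv_inner (γ := γ) hP (P.symm x).1 (P.symm z)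
      rw [P.apply_symm_apply] at h5
      rw [hν, h5, hsdef]
      simp only [ff, map_sub, Prod.fst_sub, Prod.snd_sub]
      rw [← hl]
      ring_nf
    have hin : ∀ z, inner ℝ ν z = (P.symm z).2 - l (P.symm z).1 := by
      intro z
      have h5 := nuv_inner (γ := γ) hP (P.symm x).1 (P.symm z)
      rwa [P.apply_symm_apply] at h5
    have htay : ∀ z : EV (n + 1), |γ (P.symm x).1 - γ ((P.symm x).1 - (P.symm z).1) - l (P.symm z).1|
        ≤ C * ‖(P.symm z).1‖ ^ 2 := fun z =>
      taylor_bound_C (hγ.1.of_le (by norm_num)) hC _ _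
    refine (symm_diff_int hmA hmH (hmS1.union hmS2) hbi hHi ?_ ?_).trans ?_
    · rintro z ⟨hz1, hz2⟩
      by_cases hz : ‖z‖ < δ
      · left
        rw [Set.mem_ofPred_eq, key z hz] at hz1
        rw [Set.mem_ofPred_eq] at hz2 ⊢
        refine le_trans ?_ (htay z)
        rw [hin] at hz1 hz2
        push Not at hz1 hz2
        rw [abs_of_neg (by linarith)]
        exact le_trans (by linarith) (neg_le_abs _)
      · right; exact not_lt.1 hz
    · rintro z ⟨hz1, hz2⟩
      by_cases hz : ‖z‖ < δ
      · left
        rw [Set.mem_ofPred_eq, key z hz] at hz2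
        rw [Set.mem_ofPred_eq] at hz1 ⊢
        refine le_trans ?_ (htay z)
        rw [hin] at hz1 hz2
        push Not at hz2
        rw [abs_of_nonneg (by linarith)]
        exact le_trans (by linarith) (le_abs_self _)
      · right; exact not_lt.1 hz
    · simp_rw [kz_enorm h1 hε]
      refine (lintegral_union_le _ _ _).trans (add_le_add (hKs P hP ε hε l s) ?_)
      exact GG_le h1 hε hδ
  · refine (enorm_integral_le_lintegral_enorm _).trans ?_
    simp_rw [kz_enorm h1 hε]
    exact lintegral_mono_set hHsub

end Part7

section Part8

variable {n : ℕ}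

/-- graph parametrization -/
def shear (P : FV n ≃L[ℝ] EV (n + 1)) (γ : EV n → ℝ) (y : FV n) : EV (n + 1) := P (y.1, γ y.1 + y.2)

lemma shear_cont {P : FV n ≃L[ℝ] EV (n + 1)} {γ : EV n → ℝ} (hγ : Continuous γ) :
    Continuous (shear P γ) := by
  unfold shear; fun_prop

lemma shear_mp {P : FV n ≃L[ℝ] EV (n + 1)} (hP : IsoP P) {γ : EV n → ℝ} (hγ : Continuous γ) :
    MeasurePreserving (shear P γ) volume volume := by
  have h : MeasurePreserving (fun y : FV n => (y.1, γ y.1 + y.2)) (volume : Measure (FV n)) volume := by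
    rw [Measure.volume_eq_prod]
    refine MeasurePreserving.skew_product (g := fun y s => γ y + s) (MeasurePreserving.id _) ?_ ?_
    · exact Continuous.measurable (by fun_prop)
    · exact Filter.Eventually.of_forall fun y => (measurePreserving_add_left volume (γ y)).map_eq
  exact hP.mp.comp h

lemma ff_shear {P : FV n ≃L[ℝ] EV (n + 1)} {γ : EV n → ℝ} (y : FV n) : ff P γ (shear P γ y) = y.2 := by
  simp [ff, shear]

lemma shear_ff {P : FV n ≃L[ℝ] EV (n + 1)} {γ : EV n → ℝ} (x : EV (n + 1)) :
    shear P γ ((P.symm x).1, ff P γ x) = x := by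
  simp [ff, shear]

lemma shear_lint {P : FV n ≃L[ℝ] EV (n + 1)} (hP : IsoP P) {γ : EV n → ℝ} (hγ : Continuous γ)
    {F : EV (n + 1) → ℝ≥0∞} (hF : Measurable F) :
    ∫⁻ x in {x | 0 < ff P γ x}, F x
      = ∫⁻ y' : EV n, ∫⁻ s in Set.Ioi (0:ℝ), F (shear P γ (y', s)) := by
  have hffm : Measurable (ff P γ) := by
    unfold ff; exact Continuous.measurable (by fun_prop)
  have hm : MeasurableSet {x | 0 < ff P γ x} := measurableSet_lt measurable_const hffm
  rw [← lintegral_indicator hm, ← (shear_mp hP hγ).lintegral_comp (hF.indicator hm),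
    Measure.volume_eq_prod, lintegral_prod (fun y => ({x | 0 < ff P γ x}.indicator F) (shear P γ y)) (((hF.indicator hm).comp (shear_cont hγ).measurable).aemeasurable)]
  refine lintegral_congr fun y => ?_
  rw [← lintegral_indicator measurableSet_Ioi]
  refine lintegral_congr fun s => ?_
  simp only [Set.indicator, Set.mem_ofPred_eq, ff_shear, Set.mem_Ioi]

lemma hardy {m : ℕ} {ρ : EV m → ℝ} (h : A1 ρ) {ε c : ℝ} (hε : 0 < ε) (hc : 0 < c) {p : ℝ} (hp : 1 ≤ p)
    {f : ℝ → ℝ≥0∞} (hf : Measurable f) :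
    ∫⁻ s in Set.Ioi (0:ℝ), (GG ρ ε (c * s) * ∫⁻ σ in Set.Ioc 0 s, f σ) ^ p
      ≤ (ENNReal.ofReal c⁻¹ * massI ρ) ^ p * ∫⁻ σ in Set.Ioi (0:ℝ), f σ ^ p := by
  have hGm : Measurable fun s => GG ρ ε (c * s) :=
    (GG_anti ε).measurable.comp (measurable_const_mul c)
  set A := ENNReal.ofReal c⁻¹ * massI ρ with hA
  have hp0 : 0 < p := by linarith
  have step : ∀ s ∈ Set.Ioi (0:ℝ), (GG ρ ε (c * s) * ∫⁻ σ in Set.Ioc 0 s, f σ) ^ p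
      ≤ A ^ (p - 1) * ∫⁻ σ in Set.Ioi (0:ℝ), (if σ ≤ s then GG ρ ε (c * s) else 0) * f σ ^ p := by
    intro s hs
    have hs0 : (0:ℝ) < s := hs
    have hJ := lint_jensen (volume.restrict (Set.Ioc 0 s)) f hf.aemeasurable p hp
    have hv : (volume.restrict (Set.Ioc 0 s)) Set.univ = ENNReal.ofReal s := by simp
    rw [hv] at hJ
    have hsG : ENNReal.ofReal s * GG ρ ε (c * s) ≤ A := by
      have := GG_mul_le h hε (c * s)
      rw [ENNReal.ofReal_mul hc.le] at this
      calc ENNReal.ofReal s * GG ρ ε (c * s)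
          = ENNReal.ofReal c⁻¹ * (ENNReal.ofReal c * ENNReal.ofReal s * GG ρ ε (c * s)) := by
            rw [← mul_assoc, ← mul_assoc, ← ENNReal.ofReal_mul (by positivity), inv_mul_cancel₀ hc.ne']
            simp
        _ ≤ A := by rw [hA]; gcongr
    have hrw : ∫⁻ σ in Set.Ioi (0:ℝ), (if σ ≤ s then GG ρ ε (c * s) else 0) * f σ ^ p
        = GG ρ ε (c * s) * ∫⁻ σ in Set.Ioc 0 s, f σ ^ p := by
      rw [← lintegral_const_mul _ (hf.pow_const p), ← lintegral_indicator measurableSet_Ioi,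
        ← lintegral_indicator measurableSet_Ioc]
      refine lintegral_congr fun σ => ?_
      by_cases h1 : 0 < σ <;> by_cases h2 : σ ≤ s <;> simp [Set.indicator, h1, h2]
    rw [hrw, ENNReal.mul_rpow_of_nonneg _ _ hp0.le]
    calc GG ρ ε (c * s) ^ p * (∫⁻ σ in Set.Ioc 0 s, f σ) ^ p
        ≤ GG ρ ε (c * s) ^ p * (ENNReal.ofReal s ^ (p - 1) * ∫⁻ σ in Set.Ioc 0 s, f σ ^ p) := by gcongr
      _ = (ENNReal.ofReal s * GG ρ ε (c * s)) ^ (p - 1) * (GG ρ ε (c * s) * ∫⁻ σ in Set.Ioc 0 s, f σ ^ p) := by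
          rw [ENNReal.mul_rpow_of_nonneg _ _ (by linarith)]
          have : GG ρ ε (c * s) ^ p = GG ρ ε (c * s) ^ (p - 1) * GG ρ ε (c * s) := by
            conv_rhs => rw [← ENNReal.rpow_one (GG ρ ε (c * s)), ← ENNReal.rpow_mul,
              ← ENNReal.rpow_add_of_nonneg _ _ (by linarith) (by norm_num)]
            ring_nf
          rw [this]; ring
      _ ≤ _ := by gcongr
  have hmeas : Measurable (Function.uncurry fun s σ : ℝ => (if σ ≤ s then GG ρ ε (c * s) else 0) * f σ ^ p) := by
    refine Measurable.mul (Measurable.ite (measurableSet_le measurable_snd measurable_fst) (hGm.comp measurable_fst) measurable_const) ((hf.comp measurable_snd).pow_const p)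
  calc ∫⁻ s in Set.Ioi (0:ℝ), (GG ρ ε (c * s) * ∫⁻ σ in Set.Ioc 0 s, f σ) ^ p
      ≤ ∫⁻ s in Set.Ioi (0:ℝ), A ^ (p - 1) * ∫⁻ σ in Set.Ioi (0:ℝ), (if σ ≤ s then GG ρ ε (c * s) else 0) * f σ ^ p :=
        setLIntegral_mono' measurableSet_Ioi step
    _ = A ^ (p - 1) * ∫⁻ s in Set.Ioi (0:ℝ), ∫⁻ σ in Set.Ioi (0:ℝ), (if σ ≤ s then GG ρ ε (c * s) else 0) * f σ ^ p :=
        lintegral_const_mul _ (Measurable.lintegral_prod_right' (f := Function.uncurry fun s σ : ℝ => (if σ ≤ s then GG ρ ε (c * s) else 0) * f σ ^ p) hmeas)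
    _ = A ^ (p - 1) * ∫⁻ σ in Set.Ioi (0:ℝ), ∫⁻ s in Set.Ioi (0:ℝ), (if σ ≤ s then GG ρ ε (c * s) else 0) * f σ ^ p := by
        rw [lintegral_lintegral_swap hmeas.aemeasurable]
    _ ≤ A ^ (p - 1) * ∫⁻ σ in Set.Ioi (0:ℝ), A * f σ ^ p := by
        gcongr with σ
        rw [lintegral_mul_const]
        · gcongr
          refine le_trans (lintegral_mono fun s => ?_) (GG_int h hε hc)
          split_ifs <;> simp
        · exact Measurable.ite (measurableSet_le measurable_const measurable_id) hGm measurable_const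
    _ = A ^ p * ∫⁻ σ in Set.Ioi (0:ℝ), f σ ^ p := by
        rw [lintegral_const_mul _ (hf.pow_const p), ← mul_assoc]
        congr 1
        conv_lhs => rw [← ENNReal.rpow_one A, ← ENNReal.rpow_mul,
              ← ENNReal.rpow_add_of_nonneg _ _ (by linarith) (by norm_num)]
        ring_nf

lemma line_bound {P : FV n ≃L[ℝ] EV (n + 1)} (hP : IsoP P) {γ : EV n → ℝ} {v : EV (n + 1) → ℝ}
    (hv : ContDiff ℝ 2 v) (y' : EV n) {s : ℝ} (hs : 0 ≤ s) :
    ‖fderiv ℝ v (shear P γ (y', s)) - fderiv ℝ v (shear P γ (y', 0))‖ₑ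
      ≤ ∫⁻ σ in Set.Ioc 0 s, ‖fderiv ℝ (fderiv ℝ v) (shear P γ (y', σ))‖ₑ := by
  have hc1 : ContDiff ℝ 1 (fderiv ℝ v) := hv.fderiv_right (by norm_num)
  have hline : ∀ σ : ℝ, HasDerivAt (fun σ : ℝ => shear P γ (y', σ)) (P (0, 1)) σ := by
    intro σ
    have h1 : HasDerivAt (fun σ : ℝ => ((y', γ y' + σ) : FV n)) ((0 : EV n), (1:ℝ)) σ :=
      (hasDerivAt_const σ y').prodMk ((hasDerivAt_id σ).const_add (γ y'))
    exact (P : FV n →L[ℝ] EV (n+1)).hasFDerivAt.comp_hasDerivAt σ h1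
  have hder : ∀ σ : ℝ, HasDerivAt (fun σ : ℝ => fderiv ℝ v (shear P γ (y', σ)))
      (fderiv ℝ (fderiv ℝ v) (shear P γ (y', σ)) (P (0, 1))) σ := fun σ =>
    ((hc1.differentiable (by norm_num) _).hasFDerivAt).comp_hasDerivAt σ (hline σ)
  have hlc : Continuous (fun σ : ℝ => shear P γ (y', σ)) :=
    continuous_iff_continuousAt.2 fun σ => (hline σ).continuousAt
  have hcont : Continuous fun σ => fderiv ℝ (fderiv ℝ v) (shear P γ (y', σ)) (P (0, 1)) :=
    ((hc1.continuous_fderiv (by norm_num)).comp hlc).clm_apply continuous_const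
  rw [← intervalIntegral.integral_eq_sub_of_hasDerivAt (a := 0) (b := s)
    (f := fun σ : ℝ => fderiv ℝ v (shear P γ (y', σ))) (fun σ _ => hder σ)
    (hcont.intervalIntegrable _ _), intervalIntegral.integral_of_le hs]
  refine (enorm_integral_le_lintegral_enorm _).trans (lintegral_mono fun σ => ?_)
  rw [← ofReal_norm, ← ofReal_norm]
  refine ENNReal.ofReal_le_ofReal ((ContinuousLinearMap.le_opNorm _ _).trans ?_)
  rw [hP.norm_zero_snd]; simp

end Part8

section Part9

variable {n : ℕ}

lemma near_Lp {ρ : EV (n + 1) → ℝ} (h1 : A1 ρ) (h2 : A2 ρ) {Ω U : Set (EV (n + 1))}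
    {P : FV n ≃L[ℝ] EV (n + 1)} {γ : EV n → ℝ} (hΩ : IsOpen Ω) (hch : IsCh Ω U P γ)
    {r : ℝ} (hr : 0 < r) {z : EV (n + 1)} (hz : Metric.ball z (2 * r) ⊆ U) {p : ℝ} (hp : 1 ≤ p) :
    ∃ K : ℝ≥0∞, K < ⊤ ∧ ∀ ε : ℝ, 0 < ε → ∀ v : EV (n + 1) → ℝ, ContDiff ℝ 2 v →
      NBC Ω (momentum ρ) v →
      ∫⁻ x in {x | x ∈ Metric.ball z r ∧ 0 < ff P γ x ∧ ff P γ x < r}, ‖fderiv ℝ v x (bvec Ω ρ ε x)‖ₑ ^ p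
        ≤ K * ((∫⁻ x, ‖fderiv ℝ v x‖ₑ ^ p) + ∫⁻ x, ‖fderiv ℝ (fderiv ℝ v) x‖ₑ ^ p) := by
  obtain ⟨hU, hP, hγ, hmem⟩ := id hch
  obtain ⟨K, hK, c, hc, hnb⟩ := near_bvec h1 h2 hΩ hch hr
  have hp0 : 0 < p := by linarith
  set A := ENNReal.ofReal c⁻¹ * massI ρ with hA
  have hAt : A < ⊤ := ENNReal.mul_lt_top ENNReal.ofReal_lt_top (massI_lt_top h1)
  have hT : ∀ a : ℝ≥0∞, a < ⊤ → a ^ p < ⊤ := fun a ha => ENNReal.rpow_lt_top_of_nonneg hp0.le ha.ne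
  refine ⟨2 ^ (p - 1) * (K ^ p + A ^ p), ENNReal.mul_lt_top (ENNReal.rpow_lt_top_of_nonneg (by linarith) (by simp))
    (ENNReal.add_lt_top.2 ⟨hT _ hK, hT _ hAt⟩), ?_⟩
  intro ε hε v hv hN
  have hγc : Continuous γ := hγ.1.continuous
  have hffm : Measurable (ff P γ) := by
    unfold ff; exact Continuous.measurable (by fun_prop)
  have hc1 : ContDiff ℝ 1 (fderiv ℝ v) := hv.fderiv_right (by norm_num)
  have hD1 : Measurable fun x => ‖fderiv ℝ v x‖ₑ := hc1.continuous.enorm.measurable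
  have hD2 : Measurable fun x => ‖fderiv ℝ (fderiv ℝ v) x‖ₑ :=
    (hc1.continuous_fderiv (by norm_num)).enorm.measurable
  have hmS : MeasurableSet {x | x ∈ Metric.ball z r ∧ 0 < ff P γ x ∧ ff P γ x < r} :=
    (measurableSet_ball).inter ((measurableSet_lt measurable_const hffm).inter (measurableSet_lt hffm measurable_const))
  set F : EV (n + 1) → ℝ≥0∞ := fun x => GG ρ ε (c * ff P γ x) *
    ∫⁻ σ in Set.Ioc 0 (ff P γ x), ‖fderiv ℝ (fderiv ℝ v) (shear P γ ((P.symm x).1, σ))‖ₑ with hF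
  have hGm : Measurable fun s => GG ρ ε (c * s) :=
    (GG_anti ε).measurable.comp (measurable_const_mul c)
  have hFm : Measurable F := by
    refine (hGm.comp hffm).mul ?_
    have e : ∀ x, ∫⁻ σ in Set.Ioc 0 (ff P γ x), ‖fderiv ℝ (fderiv ℝ v) (shear P γ ((P.symm x).1, σ))‖ₑ
      = ∫⁻ σ, if 0 < σ ∧ σ ≤ ff P γ x then ‖fderiv ℝ (fderiv ℝ v) (shear P γ ((P.symm x).1, σ))‖ₑ else 0 := by
      intro x
      rw [← lintegral_indicator measurableSet_Ioc]
      simp only [Set.indicator, Set.mem_Ioc]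
    simp_rw [e]
    refine Measurable.lintegral_prod_right' (f := fun q : EV (n+1) × ℝ => if 0 < q.2 ∧ q.2 ≤ ff P γ q.1 then ‖fderiv ℝ (fderiv ℝ v) (shear P γ ((P.symm q.1).1, q.2))‖ₑ else 0) ?_
    refine Measurable.ite ((measurableSet_lt measurable_const measurable_snd).inter (measurableSet_le measurable_snd (hffm.comp measurable_fst))) ?_ measurable_const
    exact hD2.comp ((shear_cont hγc).measurable.comp (Continuous.measurable (by fun_prop)))
  have pt : ∀ x ∈ {x | x ∈ Metric.ball z r ∧ 0 < ff P γ x ∧ ff P γ x < r},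
      ‖fderiv ℝ v x (bvec Ω ρ ε x)‖ₑ ^ p ≤ 2 ^ (p - 1) * ((K * ‖fderiv ℝ v x‖ₑ) ^ p + F x ^ p) := by
    rintro x ⟨hxz, hf0, hfr⟩
    have hxU : Metric.ball x r ⊆ U := (Metric.ball_subset_ball' (by
      have := Metric.mem_ball.1 hxz; linarith)).trans hz
    obtain ⟨V, hV1, hV2, a, hVa⟩ := hnb ε hε x hxU hf0
    set x0 := shear P γ ((P.symm x).1, 0) with hx0
    have hx0U : x0 ∈ U := by
      apply hxU
      have : x0 - x = P (0, - ff P γ x) := by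
        conv_lhs => rw [hx0, ← shear_ff (P := P) (γ := γ) x]
        simp only [shear]
        rw [← map_sub]; simp
      rw [Metric.mem_ball, dist_eq_norm, this, hP.norm_zero_snd, abs_neg, abs_of_pos hf0]
      exact hfr
    have hz0 : fderiv ℝ v x0 V = 0 := by
      have h3 := hN U P γ hch x0 hx0U (by rw [hx0, ff_shear])
      have : (P.symm x0).1 = (P.symm x).1 := by rw [hx0]; simp [shear]
      rw [this] at h3
      rw [hVa, map_smul, h3, smul_zero]
    have hdec : fderiv ℝ v x (bvec Ω ρ ε x) = fderiv ℝ v x (bvec Ω ρ ε x - V)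
        + (fderiv ℝ v x - fderiv ℝ v x0) V := by
      rw [map_sub, ContinuousLinearMap.sub_apply, hz0]; ring
    have hlb := line_bound hP (γ := γ) hv (P.symm x).1 hf0.le
    rw [shear_ff] at hlb
    have hle : ‖fderiv ℝ v x (bvec Ω ρ ε x)‖ₑ ≤ K * ‖fderiv ℝ v x‖ₑ + F x := by
      rw [hdec]
      refine (enorm_add_le _ _).trans (add_le_add ?_ ?_)
      · rw [mul_comm]
        exact (ContinuousLinearMap.le_opENorm _ _).trans (mul_le_mul_right hV1 _)
      · simp only [hF]; rw [mul_comm]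
        exact (ContinuousLinearMap.le_opENorm _ _).trans (mul_le_mul' hlb hV2)
    exact (ENNReal.rpow_le_rpow hle hp0.le).trans (ENNReal.rpow_add_le_mul_rpow_add_rpow _ _ hp)
  have hFb : ∫⁻ x in {x | 0 < ff P γ x}, F x ^ p ≤ A ^ p * ∫⁻ x, ‖fderiv ℝ (fderiv ℝ v) x‖ₑ ^ p := by
    rw [shear_lint hP hγc (hFm.pow_const p)]
    calc _ ≤ ∫⁻ y' : EV n, A ^ p * ∫⁻ s in Set.Ioi (0:ℝ), ‖fderiv ℝ (fderiv ℝ v) (shear P γ (y', s))‖ₑ ^ p := by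
          refine lintegral_mono fun y' => ?_
          have hh := hardy h1 hε hc hp (f := fun s => ‖fderiv ℝ (fderiv ℝ v) (shear P γ (y', s))‖ₑ)
            (hD2.comp ((shear_cont hγc).measurable.comp measurable_prodMk_left))
          refine le_trans (le_of_eq ?_) hh
          refine lintegral_congr fun s => ?_
          simp only [hF, ff_shear]
          simp [shear]
      _ = A ^ p * ∫⁻ x in {x | 0 < ff P γ x}, ‖fderiv ℝ (fderiv ℝ v) x‖ₑ ^ p := by
          rw [shear_lint hP hγc (hD2.pow_const p), lintegral_const_mul' _ _ (hT _ hAt).ne]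
      _ ≤ _ := by gcongr; exact Measure.restrict_le_self
  calc _ ≤ ∫⁻ x in {x | x ∈ Metric.ball z r ∧ 0 < ff P γ x ∧ ff P γ x < r},
        2 ^ (p - 1) * ((K * ‖fderiv ℝ v x‖ₑ) ^ p + F x ^ p) := setLIntegral_mono' hmS pt
    _ = 2 ^ (p - 1) * ((∫⁻ x in {x | x ∈ Metric.ball z r ∧ 0 < ff P γ x ∧ ff P γ x < r}, (K * ‖fderiv ℝ v x‖ₑ) ^ p)
        + ∫⁻ x in {x | x ∈ Metric.ball z r ∧ 0 < ff P γ x ∧ ff P γ x < r}, F x ^ p) := by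
        rw [lintegral_const_mul, lintegral_add_left ((hD1.const_mul _).pow_const _)]
        exact (((hD1.const_mul _).pow_const _).add (hFm.pow_const p))
    _ ≤ 2 ^ (p - 1) * (K ^ p * (∫⁻ x, ‖fderiv ℝ v x‖ₑ ^ p) + A ^ p * ∫⁻ x, ‖fderiv ℝ (fderiv ℝ v) x‖ₑ ^ p) := by
        gcongr
        · simp_rw [ENNReal.mul_rpow_of_nonneg _ _ hp0.le]
          rw [lintegral_const_mul _ (hD1.pow_const _)]
          gcongr; exact Measure.restrict_le_self
        · exact (lintegral_mono_set (fun x hx => hx.2.1)).trans hFb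
    _ ≤ _ := by
        rw [mul_assoc]
        gcongr
        rw [add_mul, mul_add, mul_add]
        exact add_le_add le_self_add le_add_self

lemma ball_sub_of_frontier {m : ℕ} {Ω : Set (EV m)} (hΩ : IsOpen Ω) {x : EV m} (hx : x ∈ Ω) {δ : ℝ}
    (hd : ∀ y ∈ frontier Ω, δ ≤ dist x y) : Metric.ball x δ ⊆ Ω := by
  by_contra hcon
  have hδ : 0 < δ := by
    by_contra h
    rw [Metric.ball_eq_empty.2 (not_lt.1 h)] at hcon
    exact hcon (Set.empty_subset _)
  obtain ⟨y, hy, hyΩ⟩ := Set.not_subset.1 hcon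
  have hpre : IsPreconnected (Metric.ball x δ) := (convex_ball x δ).isPreconnected
  obtain ⟨w, hw1, hw2⟩ : (Metric.ball x δ ∩ frontier Ω).Nonempty := by
    by_contra hem
    rw [Set.not_nonempty_iff_eq_empty] at hem
    have := hpre.subset_left_of_subset_union hΩ (isOpen_compl_iff.2 isClosed_closure : IsOpen (closure Ω)ᶜ)
      (disjoint_compl_right.mono_right (Set.compl_subset_compl.2 subset_closure)) (fun w hw => by
        by_cases h1 : w ∈ Ω
        · left; exact h1
        · right; intro h2
          have : w ∈ Metric.ball x δ ∩ frontier Ω := ⟨hw, by rw [hΩ.frontier_eq]; exact ⟨h2, h1⟩⟩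
          rw [hem] at this; exact this) ⟨x, Metric.mem_ball_self hδ, hx⟩
    exact hyΩ (this hy)
  have := hd w hw2
  rw [Metric.mem_ball, dist_comm] at hw1
  linarith

lemma lint_biUnion_le {X ι : Type*} [MeasurableSpace X] {μ : Measure X} (s : Finset ι) (A : ι → Set X)
    (f : X → ℝ≥0∞) : ∫⁻ x in ⋃ i ∈ s, A i, f x ∂μ ≤ ∑ i ∈ s, ∫⁻ x in A i, f x ∂μ := by
  classical
  induction s using Finset.induction_on with
  | empty => simp
  | insert a s ha ih =>
    rw [Finset.set_biUnion_insert, Finset.sum_insert ha]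
    exact (lintegral_union_le _ _ _).trans (by gcongr)

lemma bv_Lp {ρ : EV (n + 1) → ℝ} (h1 : A1 ρ) (h2 : A2 ρ) {Ω : Set (EV (n + 1))}
    (hΩ : IsGraphDomain 3 Ω) (hcpt : IsCompact (frontier Ω)) {p : ℝ} (hp : 1 ≤ p) :
    ∃ K : ℝ≥0∞, K < ⊤ ∧ ∀ ε : ℝ, 0 < ε → ∀ v : EV (n + 1) → ℝ, ContDiff ℝ 2 v →
      NBC Ω (momentum ρ) v →
      ∫⁻ x in Ω, ‖fderiv ℝ v x (bvec Ω ρ ε x)‖ₑ ^ p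
        ≤ K * ((∫⁻ x, ‖fderiv ℝ v x‖ₑ ^ p) + ∫⁻ x, ‖fderiv ℝ (fderiv ℝ v) x‖ₑ ^ p) := by
  have hp0 : 0 < p := by linarith
  have hch : ∀ z : frontier Ω, ∃ (U : Set (EV (n+1))) (P : FV n ≃L[ℝ] EV (n + 1)) (γ : EV n → ℝ) (r : ℝ), IsCh Ω U P γ ∧ 0 < r ∧ Metric.ball z.1 (2 * r) ⊆ U ∧ z.1 ∈ U := by
    intro z
    obtain ⟨U, P, γ, h, hz⟩ := exists_ch hΩ z.2
    obtain ⟨r, hr, hb⟩ := Metric.isOpen_iff.1 h.1 z.1 hz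
    exact ⟨U, P, γ, r / 2, h, by positivity, by rwa [mul_div_cancel₀ _ (by norm_num)], hz⟩
  choose U P γ r hch hr hb hzU using hch
  choose K hK hKb using fun z : frontier Ω => near_Lp h1 h2 hΩ.1 (hch z) (hr z) (hb z) hp
  have hffc : ∀ z, Continuous (ff (P z) (γ z)) := fun z => (ff_contDiff (hch z).2.2.1.1).continuous
  set O : frontier Ω → Set (EV (n + 1)) := fun z => {x | x ∈ Metric.ball z.1 (r z) ∧ ff (P z) (γ z) x < r z}
  have hO : ∀ z, IsOpen (O z) := fun z => Metric.isOpen_ball.inter (isOpen_lt (hffc z) continuous_const)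
  obtain ⟨t, ht⟩ := hcpt.elim_finite_subcover O hO (fun z hz => by
    refine Set.mem_iUnion.2 ⟨⟨z, hz⟩, Metric.mem_ball_self (hr _), ?_⟩
    rw [((hch ⟨z, hz⟩).frontier_iff hΩ.1 (hzU _)).1 hz]
    exact hr _)
  obtain ⟨δ, hδ, hth⟩ := hcpt.exists_thickening_subset_open (isOpen_biUnion fun z _ => hO z) ht
  refine ⟨∑ z ∈ t, K z + (massI ρ / ENNReal.ofReal δ) ^ p, ENNReal.add_lt_top.2 ⟨ENNReal.sum_lt_top.2 fun z _ => hK z,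
    ENNReal.rpow_lt_top_of_nonneg hp0.le (ENNReal.div_lt_top (massI_lt_top h1).ne (by simpa using hδ)).ne⟩, ?_⟩
  intro ε hε v hv hN
  have hc1 : ContDiff ℝ 1 (fderiv ℝ v) := hv.fderiv_right (by norm_num)
  have hD1 : Measurable fun x => ‖fderiv ℝ v x‖ₑ := hc1.continuous.enorm.measurable
  set Nn : frontier Ω → Set (EV (n + 1)) := fun z => {x | x ∈ Metric.ball z.1 (r z) ∧ 0 < ff (P z) (γ z) x ∧ ff (P z) (γ z) x < r z}
  set Fs : Set (EV (n + 1)) := Ω \ ⋃ z ∈ t, O z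
  have hcov : Ω ⊆ (⋃ z ∈ t, Nn z) ∪ Fs := by
    intro x hx
    by_cases hxO : x ∈ ⋃ z ∈ t, O z
    · left
      simp only [Set.mem_iUnion] at hxO ⊢
      obtain ⟨z, hz, hx1, hx2⟩ := hxO
      have hxU : x ∈ U z := hb z (Metric.ball_subset_ball (by linarith [hr z]) hx1)
      exact ⟨z, hz, hx1, ((hch z).mem_iff hxU).1 hx, hx2⟩
    · right; exact ⟨hx, hxO⟩
  set I := (∫⁻ x, ‖fderiv ℝ v x‖ₑ ^ p) + ∫⁻ x, ‖fderiv ℝ (fderiv ℝ v) x‖ₑ ^ p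
  refine (lintegral_mono_set hcov).trans ((lintegral_union_le _ _ _).trans ?_)
  rw [add_mul, Finset.sum_mul]
  refine add_le_add ((lint_biUnion_le _ _ _).trans (Finset.sum_le_sum fun z _ => hKb z ε hε v hv hN)) ?_
  have hmF : MeasurableSet Fs := hΩ.1.measurableSet.diff (isOpen_biUnion fun z _ => hO z).measurableSet
  calc _ ≤ ∫⁻ x in Fs, (massI ρ / ENNReal.ofReal δ) ^ p * ‖fderiv ℝ v x‖ₑ ^ p := by
        refine setLIntegral_mono' hmF fun x hx => ?_
        rw [← ENNReal.mul_rpow_of_nonneg _ _ hp0.le]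
        refine ENNReal.rpow_le_rpow ?_ hp0.le
        have hbs : Metric.ball x δ ⊆ Ω := by
          refine ball_sub_of_frontier hΩ.1 hx.1 fun y hy => ?_
          by_contra hlt
          exact hx.2 (hth (Metric.mem_thickening_iff.2 ⟨y, hy, not_le.1 hlt⟩))
        rw [mul_comm]
        exact (ContinuousLinearMap.le_opENorm _ _).trans (mul_le_mul_right ((bvec_far h1 hε hδ hbs).trans (GG_le h1 hε hδ)) _)
    _ = (massI ρ / ENNReal.ofReal δ) ^ p * ∫⁻ x in Fs, ‖fderiv ℝ v x‖ₑ ^ p :=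
        lintegral_const_mul _ (hD1.pow_const p)
    _ ≤ _ := by
        gcongr
        exact (lintegral_mono' Measure.restrict_le_self le_rfl).trans le_self_add

end Part9

section Part10

variable {n : ℕ}

lemma near_bdd {ρ : EV (n + 1) → ℝ} (h1 : A1 ρ) (h2 : A2 ρ) {Ω U : Set (EV (n + 1))}
    {P : FV n ≃L[ℝ] EV (n + 1)} {γ : EV n → ℝ} (hΩ : IsOpen Ω) (hch : IsCh Ω U P γ)
    {r : ℝ} (hr : 0 < r) {z : EV (n + 1)} (hz : Metric.ball z (2 * r) ⊆ U) :
    ∃ K : ℝ≥0∞, K < ⊤ ∧ ∀ ε : ℝ, 0 < ε → ∀ v : EV (n + 1) → ℝ, ContDiff ℝ 2 v →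
      NBC Ω (momentum ρ) v → ∀ C : ℝ≥0∞, (∀ x, ‖fderiv ℝ v x‖ₑ ≤ C) →
      (∀ x, ‖fderiv ℝ (fderiv ℝ v) x‖ₑ ≤ C) → ∀ x,
      x ∈ Metric.ball z r → 0 < ff P γ x → ff P γ x < r → ‖fderiv ℝ v x (bvec Ω ρ ε x)‖ₑ ≤ K * C := by
  obtain ⟨hU, hP, hγ, hmem⟩ := id hch
  obtain ⟨K, hK, c, hc, hnb⟩ := near_bvec h1 h2 hΩ hch hr
  set A := ENNReal.ofReal c⁻¹ * massI ρ with hA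
  have hAt : A < ⊤ := ENNReal.mul_lt_top ENNReal.ofReal_lt_top (massI_lt_top h1)
  refine ⟨K + A, ENNReal.add_lt_top.2 ⟨hK, hAt⟩, ?_⟩
  intro ε hε v hv hN C hC1 hC2 x hxz hf0 hfr
  have hxU : Metric.ball x r ⊆ U := (Metric.ball_subset_ball' (by
    have := Metric.mem_ball.1 hxz; linarith)).trans hz
  obtain ⟨V, hV1, hV2, a, hVa⟩ := hnb ε hε x hxU hf0
  set x0 := shear P γ ((P.symm x).1, 0) with hx0
  have hx0U : x0 ∈ U := by
    apply hxU
    have : x0 - x = P (0, - ff P γ x) := by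
      conv_lhs => rw [hx0, ← shear_ff (P := P) (γ := γ) x]
      simp only [shear]
      rw [← map_sub]; simp
    rw [Metric.mem_ball, dist_eq_norm, this, hP.norm_zero_snd, abs_neg, abs_of_pos hf0]
    exact hfr
  have hz0 : fderiv ℝ v x0 V = 0 := by
    have h3 := hN U P γ hch x0 hx0U (by rw [hx0, ff_shear])
    have : (P.symm x0).1 = (P.symm x).1 := by rw [hx0]; simp [shear]
    rw [this] at h3
    rw [hVa, map_smul, h3, smul_zero]
  have hdec : fderiv ℝ v x (bvec Ω ρ ε x) = fderiv ℝ v x (bvec Ω ρ ε x - V)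
      + (fderiv ℝ v x - fderiv ℝ v x0) V := by
    rw [map_sub, ContinuousLinearMap.sub_apply, hz0]; ring
  have hlb := line_bound hP (γ := γ) hv (P.symm x).1 hf0.le
  rw [shear_ff] at hlb
  have hlb2 := hlb.trans (lintegral_mono fun σ => hC2 _)
  rw [setLIntegral_const, Real.volume_Ioc, sub_zero] at hlb2
  rw [hdec, add_mul]
  refine (enorm_add_le _ _).trans (add_le_add ?_ ?_)
  · rw [mul_comm]
    exact (ContinuousLinearMap.le_opENorm _ _).trans (mul_le_mul' (hC1 x) hV1)
  · refine (ContinuousLinearMap.le_opENorm _ _).trans ((mul_le_mul' hlb2 hV2).trans ?_)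
    have hsG : ENNReal.ofReal (ff P γ x) * GG ρ ε (c * (ff P γ x)) ≤ A := by
      have := GG_mul_le h1 hε (c * (ff P γ x))
      rw [ENNReal.ofReal_mul hc.le] at this
      calc ENNReal.ofReal (ff P γ x) * GG ρ ε (c * (ff P γ x))
          = ENNReal.ofReal c⁻¹ * (ENNReal.ofReal c * ENNReal.ofReal (ff P γ x) * GG ρ ε (c * (ff P γ x))) := by
            rw [← mul_assoc, ← mul_assoc, ← ENNReal.ofReal_mul (by positivity), inv_mul_cancel₀ hc.ne']
            simp
        _ ≤ A := by rw [hA]; gcongr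
    calc _ = (ENNReal.ofReal (ff P γ x) * GG ρ ε (c * (ff P γ x))) * C := by ring
      _ ≤ A * C := by gcongr

lemma bv_bdd {ρ : EV (n + 1) → ℝ} (h1 : A1 ρ) (h2 : A2 ρ) {Ω : Set (EV (n + 1))}
    (hΩ : IsGraphDomain 3 Ω) (hcpt : IsCompact (frontier Ω)) :
    ∃ K : ℝ≥0∞, K < ⊤ ∧ ∀ ε : ℝ, 0 < ε → ∀ v : EV (n + 1) → ℝ, ContDiff ℝ 2 v →
      NBC Ω (momentum ρ) v → ∀ C : ℝ≥0∞, (∀ x, ‖fderiv ℝ v x‖ₑ ≤ C) →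
      (∀ x, ‖fderiv ℝ (fderiv ℝ v) x‖ₑ ≤ C) → ∀ x ∈ Ω, ‖fderiv ℝ v x (bvec Ω ρ ε x)‖ₑ ≤ K * C := by
  have hch : ∀ z : frontier Ω, ∃ (U : Set (EV (n+1))) (P : FV n ≃L[ℝ] EV (n + 1)) (γ : EV n → ℝ) (r : ℝ), IsCh Ω U P γ ∧ 0 < r ∧ Metric.ball z.1 (2 * r) ⊆ U ∧ z.1 ∈ U := by
    intro z
    obtain ⟨U, P, γ, h, hz⟩ := exists_ch hΩ z.2
    obtain ⟨r, hr, hb⟩ := Metric.isOpen_iff.1 h.1 z.1 hz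
    exact ⟨U, P, γ, r / 2, h, by positivity, by rwa [mul_div_cancel₀ _ (by norm_num)], hz⟩
  choose U P γ r hch hr hb hzU using hch
  choose K hK hKb using fun z : frontier Ω => near_bdd h1 h2 hΩ.1 (hch z) (hr z) (hb z)
  have hffc : ∀ z, Continuous (ff (P z) (γ z)) := fun z => (ff_contDiff (hch z).2.2.1.1).continuous
  set O : frontier Ω → Set (EV (n + 1)) := fun z => {x | x ∈ Metric.ball z.1 (r z) ∧ ff (P z) (γ z) x < r z}
  have hO : ∀ z, IsOpen (O z) := fun z => Metric.isOpen_ball.inter (isOpen_lt (hffc z) continuous_const)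
  obtain ⟨t, ht⟩ := hcpt.elim_finite_subcover O hO (fun z hz => by
    refine Set.mem_iUnion.2 ⟨⟨z, hz⟩, Metric.mem_ball_self (hr _), ?_⟩
    rw [((hch ⟨z, hz⟩).frontier_iff hΩ.1 (hzU _)).1 hz]
    exact hr _)
  obtain ⟨δ, hδ, hth⟩ := hcpt.exists_thickening_subset_open (isOpen_biUnion fun z _ => hO z) ht
  refine ⟨∑ z ∈ t, K z + (massI ρ / ENNReal.ofReal δ), ENNReal.add_lt_top.2 ⟨ENNReal.sum_lt_top.2 fun z _ => hK z,
    (ENNReal.div_lt_top (massI_lt_top h1).ne (by simpa using hδ))⟩, ?_⟩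
  intro ε hε v hv hN C hC1 hC2 x hx
  by_cases hxO : x ∈ ⋃ z ∈ t, O z
  · simp only [Set.mem_iUnion] at hxO
    obtain ⟨z, hz, hx1, hx2⟩ := hxO
    have hxU : x ∈ U z := hb z (Metric.ball_subset_ball (by linarith [hr z]) hx1)
    refine (hKb z ε hε v hv hN C hC1 hC2 x hx1 (((hch z).mem_iff hxU).1 hx) hx2).trans ?_
    gcongr
    exact (Finset.single_le_sum (f := K) (fun _ _ => zero_le) hz).trans le_self_add
  · have hbs : Metric.ball x δ ⊆ Ω := by
      refine ball_sub_of_frontier hΩ.1 hx fun y hy => ?_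
      by_contra hlt
      exact hxO (hth (Metric.mem_thickening_iff.2 ⟨y, hy, not_le.1 hlt⟩))
    rw [mul_comm]
    exact (ContinuousLinearMap.le_opENorm _ _).trans (mul_le_mul' (hC1 x) (((bvec_far h1 hε hδ hbs).trans (GG_le h1 hε hδ)).trans le_add_self))

lemma bvec_meas {m : ℕ} {ρ : EV m → ℝ} (h1 : A1 ρ) {Ω : Set (EV m)} (hΩ : IsOpen Ω) (ε : ℝ) :
    StronglyMeasurable (bvec Ω ρ ε) := by
  classical
  set S : Set (EV m × EV m) := {q | q.1 - q.2 ∉ Ω}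
  have hS : MeasurableSet S := (hΩ.measurableSet.compl).preimage (measurable_fst.sub measurable_snd)
  have e : bvec Ω ρ ε = fun x => ∫ z, S.indicator (fun q : EV m × EV m => kernelJ (scaled ρ ε) q.2 • q.2) (x, z) := by
    funext x
    rw [bvec, ← integral_indicator (show MeasurableSet {z | x - z ∉ Ω} from (hΩ.measurableSet.compl).preimage (measurable_const.sub measurable_id))]
    rfl
  rw [e]
  refine StronglyMeasurable.integral_prod_right' (f := fun q => S.indicator (fun q : EV m × EV m => kernelJ (scaled ρ ε) q.2 • q.2) q) ?_
  exact (((kz_meas h1 ε).comp measurable_snd).indicator hS).stronglyMeasurable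

lemma bv_cv {ρ : EV (n + 1) → ℝ} (h1 : A1 ρ) (h2 : A2 ρ) {Ω : Set (EV (n + 1))}
    (hΩ : IsGraphDomain 3 Ω) (hcpt : IsCompact (frontier Ω)) {p : ℝ} (hp : 1 ≤ p)
    {v : EV (n + 1) → ℝ} (hv : ContDiff ℝ 2 v) (hc : HasCompactSupport v)
    (hN : NBC Ω (momentum ρ) v) :
    Tendsto (fun ε => ∫⁻ x in Ω, ‖fderiv ℝ v x (bvec Ω ρ ε x)‖ₑ ^ p) (𝓝[>] 0) (𝓝 0) := by
  have hp0 : 0 < p := by linarith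
  obtain ⟨K, hK, hKb⟩ := bv_bdd h1 h2 hΩ hcpt
  obtain ⟨C, hC0, hC⟩ := d2_bdd hv hc
  have hc1 : ContDiff ℝ 1 (fderiv ℝ v) := hv.fderiv_right (by norm_num)
  set S := tsupport v
  have h0 : (0:ℝ≥0∞) = ∫⁻ x in Ω, 0 := by simp
  rw [h0]
  refine tendsto_lintegral_filter_of_dominated_convergence (S.indicator fun _ => (K * ENNReal.ofReal C) ^ p) ?_ ?_ ?_ ?_
  · refine Eventually.of_forall fun ε => ?_
    refine Measurable.pow_const ?_ p
    have : StronglyMeasurable fun x => fderiv ℝ v x (bvec Ω ρ ε x) :=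
      (isBoundedBilinearMap_apply (𝕜 := ℝ) (E := EV (n+1)) (F := ℝ)).continuous.comp_stronglyMeasurable
        (hc1.continuous.stronglyMeasurable.prodMk (bvec_meas h1 hΩ.1 ε))
    exact this.measurable.enorm
  · filter_upwards [self_mem_nhdsWithin] with ε hε
    refine (ae_restrict_iff' hΩ.1.measurableSet).2 (Eventually.of_forall fun x hx => ?_)
    by_cases hxS : x ∈ S
    · rw [Set.indicator_of_mem hxS]
      refine ENNReal.rpow_le_rpow ?_ hp0.le
      refine hKb ε hε v hv hN _ (fun x => ?_) (fun x => ?_) x hx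
      · rw [← ofReal_norm]; exact ENNReal.ofReal_le_ofReal (hC x).2.1
      · rw [← ofReal_norm]; exact ENNReal.ofReal_le_ofReal (hC x).2.2
    · have hz : fderiv ℝ v x = 0 := by
        by_contra h
        exact hxS (support_fderiv_subset ℝ h)
      rw [hz]; simp [hp0]
  · rw [lintegral_indicator hc.isCompact.measurableSet, setLIntegral_const]
    refine ENNReal.mul_ne_top (ENNReal.rpow_lt_top_of_nonneg hp0.le (ENNReal.mul_lt_top hK ENNReal.ofReal_lt_top).ne).ne ?_
    exact ((Measure.restrict_apply_le _ _).trans_lt hc.isCompact.measure_lt_top).ne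
  · refine (ae_restrict_iff' hΩ.1.measurableSet).2 (Eventually.of_forall fun x hx => ?_)
    obtain ⟨r, hr, hb⟩ := Metric.isOpen_iff.1 hΩ.1 x hx
    have h3 : Tendsto (fun ε => (‖fderiv ℝ v x‖ₑ * GG ρ ε r) ^ p) (𝓝[>] 0) (𝓝 0) := by
      have h4 := ENNReal.Tendsto.const_mul (a := ‖fderiv ℝ v x‖ₑ) (GG_tendsto h1 hr) (Or.inr enorm_ne_top)
      rw [mul_zero] at h4
      have := ((ENNReal.continuous_rpow_const (y := p)).tendsto 0).comp h4
      rw [ENNReal.zero_rpow_of_pos hp0] at this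
      exact this
    refine tendsto_of_tendsto_of_tendsto_of_le_of_le' tendsto_const_nhds h3 (Eventually.of_forall fun _ => zero_le) ?_
    filter_upwards [self_mem_nhdsWithin] with ε hε
    refine ENNReal.rpow_le_rpow ?_ hp0.le
    exact (ContinuousLinearMap.le_opENorm _ _).trans (mul_le_mul' le_rfl (bvec_far h1 hε hr hb))

end Part10

section Part11

variable {m : ℕ} {ρ : EV m → ℝ}

lemma avg_mink (h : A1 ρ) {ε : ℝ} (hε : 0 < ε) {p : ℝ} (hp : 1 ≤ p)
    {H : EV m × EV m → ℝ≥0∞} (hH : Measurable H) :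
    ∫⁻ x, (∫⁻ z, ENNReal.ofReal (scaled ρ ε z) * ∫⁻ τ in Set.Ioc (0:ℝ) 1, H (x, τ • z)) ^ p
      ≤ massI ρ ^ (p - 1) * ∫⁻ z, ENNReal.ofReal (scaled ρ ε z) *
          ∫⁻ τ in Set.Ioc (0:ℝ) 1, ∫⁻ x, H (x, τ • z) ^ p := by
  have hwm : Measurable fun z => ENNReal.ofReal (scaled ρ ε z) := (scaled_meas h ε).ennreal_ofReal
  set μ1 : Measure (EV m) := volume.withDensity fun z => ENNReal.ofReal (scaled ρ ε z) with hμ1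
  have hmass : μ1 Set.univ = massI ρ := by
    rw [hμ1, withDensity_apply _ MeasurableSet.univ, Measure.restrict_univ, lint_scaled_one hε]
  haveI : IsFiniteMeasure μ1 := ⟨by rw [hmass]; exact massI_lt_top h⟩
  set μ := μ1.prod (volume.restrict (Set.Ioc (0:ℝ) 1)) with hμ
  have hμu : μ Set.univ = massI ρ := by
    rw [hμ, ← Set.univ_prod_univ, Measure.prod_prod, hmass]; simp
  have hcm : Measurable fun q : EV m × (EV m × ℝ) => (q.1, q.2.2 • q.2.1) := by fun_prop
  have hFm : Measurable fun q : EV m × (EV m × ℝ) => H (q.1, q.2.2 • q.2.1) := hH.comp hcm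
  have := lint_mink μ (volume : Measure (EV m)) (fun x q => H (x, q.2 • q.1)) (by
    exact hFm.aemeasurable) p hp
  rw [hμu] at this
  convert this using 2
  · funext x
    congr 1
    have hm1 : Measurable fun q : EV m × ℝ => H (x, q.2 • q.1) := hFm.comp measurable_prodMk_left
    rw [hμ, lintegral_prod _ hm1.aemeasurable, hμ1,
      lintegral_withDensity_eq_lintegral_mul _ hwm hm1.lintegral_prod_right']
    rfl
  · have hm2 : Measurable fun q : EV m × ℝ => ∫⁻ x, H (x, q.2 • q.1) ^ p :=
      Measurable.lintegral_prod_left' (f := fun q : EV m × (EV m × ℝ) => H (q.1, q.2.2 • q.2.1) ^ p) (hFm.pow_const p)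
    rw [hμ, lintegral_prod _ hm2.aemeasurable, hμ1,
      lintegral_withDensity_eq_lintegral_mul _ hwm hm2.lintegral_prod_right']
    rfl

lemma Rop_Lp (h : A1 ρ) {ε : ℝ} (hε : 0 < ε) {p : ℝ} (hp : 1 ≤ p) {Ω : Set (EV m)}
    {v : EV m → ℝ} (hv : ContDiff ℝ 2 v) :
    ∫⁻ x in Ω, ‖Rop Ω ρ ε v x‖ₑ ^ p ≤ massI ρ ^ p * ∫⁻ x, ‖fderiv ℝ (fderiv ℝ v) x‖ₑ ^ p := by
  have hp0 : 0 < p := by linarith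
  have hc1 : ContDiff ℝ 1 (fderiv ℝ v) := hv.fderiv_right (by norm_num)
  have hGc := hc1.continuous_fderiv (by norm_num)
  have hD2 : Measurable fun x => ‖fderiv ℝ (fderiv ℝ v) x‖ₑ := hGc.enorm.measurable
  have pt : ∀ x, ‖Rop Ω ρ ε v x‖ₑ ≤ ∫⁻ z, ENNReal.ofReal (scaled ρ ε z) * ∫⁻ τ in Set.Ioc (0:ℝ) 1,
      ‖fderiv ℝ (fderiv ℝ v) (x - τ • z)‖ₑ := by
    intro x
    refine (enorm_integral_le_lintegral_enorm _).trans ((lintegral_mono' Measure.restrict_le_self le_rfl).trans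
      (lintegral_mono fun z => ?_))
    rw [enorm_mul, ← ofReal_norm, ← ofReal_norm, Real.norm_eq_abs, Real.norm_eq_abs, abs_of_nonneg (kern_nonneg h hε z)]
    calc _ ≤ ENNReal.ofReal (kernelJ (scaled ρ ε) z) * (ENNReal.ofReal (‖z‖ ^ 2) * _) := by
          gcongr; exact taylor_bound hv x z
      _ ≤ _ := by
          rw [← mul_assoc, ← ENNReal.ofReal_mul (kern_nonneg h hε z)]
          gcongr
          exact kern_mul_sq_le h hε z
  calc _ ≤ ∫⁻ x, (∫⁻ z, ENNReal.ofReal (scaled ρ ε z) * ∫⁻ τ in Set.Ioc (0:ℝ) 1,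
      ‖fderiv ℝ (fderiv ℝ v) (x - τ • z)‖ₑ) ^ p :=
        lintegral_mono' Measure.restrict_le_self fun x => ENNReal.rpow_le_rpow (pt x) hp0.le
    _ ≤ _ := avg_mink h hε hp (H := fun q => ‖fderiv ℝ (fderiv ℝ v) (q.1 - q.2)‖ₑ) (hD2.comp (measurable_fst.sub measurable_snd))
    _ = massI ρ ^ (p - 1) * ∫⁻ z, ENNReal.ofReal (scaled ρ ε z) * ∫⁻ x, ‖fderiv ℝ (fderiv ℝ v) x‖ₑ ^ p := by
        congr 1
        refine lintegral_congr fun z => ?_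
        congr 1
        have : ∀ τ : ℝ, ∫⁻ x, ‖fderiv ℝ (fderiv ℝ v) (x - τ • z)‖ₑ ^ p = ∫⁻ x, ‖fderiv ℝ (fderiv ℝ v) x‖ₑ ^ p :=
          fun τ => lintegral_sub_right_eq_self (fun x => ‖fderiv ℝ (fderiv ℝ v) x‖ₑ ^ p) (τ • z)
        simp_rw [this]
        simp
    _ = _ := by
        rw [lintegral_mul_const _ (scaled_meas h ε).ennreal_ofReal, lint_scaled_one hε, ← mul_assoc]
        congr 1
        conv_lhs => rw [← ENNReal.rpow_one (massI ρ), ← ENNReal.rpow_mul,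
              ← ENNReal.rpow_add_of_nonneg _ _ (by linarith) (by norm_num)]
        ring_nf

lemma kz2_bound (h : A1 ρ) {ε : ℝ} (hε : 0 < ε) (B : EV m →L[ℝ] EV m →L[ℝ] ℝ) (z : EV m) :
    |kernelJ (scaled ρ ε) z * B z z| ≤ ‖B‖ * scaled ρ ε z := by
  rw [abs_mul, abs_of_nonneg (kern_nonneg h hε z)]
  have h1 : |B z z| ≤ ‖B‖ * ‖z‖ * ‖z‖ := by
    simpa using B.le_opNorm₂ z z
  calc _ ≤ kernelJ (scaled ρ ε) z * (‖B‖ * ‖z‖ * ‖z‖) := mul_le_mul_of_nonneg_left h1 (kern_nonneg h hε z)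
    _ = ‖B‖ * (kernelJ (scaled ρ ε) z * ‖z‖ ^ 2) := by ring
    _ ≤ _ := mul_le_mul_of_nonneg_left (kern_mul_sq_le h hε z) (norm_nonneg B)

lemma kz2_integrable (h : A1 ρ) {ε : ℝ} (hε : 0 < ε) (B : EV m →L[ℝ] EV m →L[ℝ] ℝ) :
    Integrable (fun z => kernelJ (scaled ρ ε) z * B z z) volume := by
  refine Integrable.mono' ((scaled_integrable h hε).const_mul ‖B‖) ?_ (Eventually.of_forall fun z => ?_)
  · have : Continuous fun z => B z z := by fun_prop
    exact ((kern_meas h ε).mul this.measurable).aestronglyMeasurable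
  · rw [Real.norm_eq_abs]; exact kz2_bound h hε B z

/-- contraction of a bilinear form with a matrix -/
def contr (M : Matrix (Fin m) (Fin m) ℝ) (B : EV m →L[ℝ] EV m →L[ℝ] ℝ) : ℝ :=
  ∑ i, ∑ j, M i j * B (EuclideanSpace.single i 1) (EuclideanSpace.single j 1)

lemma scaled_one (z : EV m) : scaled ρ 1 z = ρ z := by simp [scaled]

lemma mom_eq (h : A1 ρ) {ε : ℝ} (hε : 0 < ε) (B : EV m →L[ℝ] EV m →L[ℝ] ℝ) :
    ∫ z, kernelJ (scaled ρ ε) z * B z z = 2 * contr (momentum ρ) B := by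
  have e1 : ∫ z, kernelJ (scaled ρ ε) z * B z z = ∫ z, kernelJ ρ z * B z z := by
    have e2 : ∀ z, kernelJ (scaled ρ ε) z * B z z
        = (ε ^ m)⁻¹ * (fun w => kernelJ ρ w * B w w) (ε⁻¹ • z) := by
      intro z
      rw [kern_scale ρ hε]
      simp only [map_smul, ContinuousLinearMap.smul_apply, smul_eq_mul]
      field_simp
    simp_rw [e2]
    rw [integral_const_mul, Measure.integral_comp_inv_smul volume (fun w => kernelJ ρ w * B w w) ε]
    simp [abs_of_pos hε, hε.ne']
  have hk : ∀ z, kernelJ (scaled ρ 1) z = kernelJ ρ z := by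
    intro z; simp [kernelJ, scaled_one]
  have e3 : ∀ z : EV m, B z z = ∑ i, ∑ j, z i * z j * B (EuclideanSpace.single i 1) (EuclideanSpace.single j 1) := by
    intro z
    have hz : z = ∑ i, z i • EuclideanSpace.single i (1:ℝ) := by
      conv_lhs => rw [← (EuclideanSpace.basisFun (Fin m) ℝ).sum_repr z]
      simp
    conv_lhs => rw [hz]
    simp only [map_sum, ContinuousLinearMap.sum_apply, map_smul, ContinuousLinearMap.smul_apply, smul_eq_mul, Finset.mul_sum]
    rw [Finset.sum_comm]
    refine Finset.sum_congr rfl fun i _ => Finset.sum_congr rfl fun j _ => ?_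
    ring
  rw [e1]
  have hnt : ∀ i j : Fin m, Integrable (fun z : EV m => kernelJ ρ z * z i * z j) volume := by
    intro i j
    have := kz2_integrable h one_pos (((EuclideanSpace.proj i : EV m →L[ℝ] ℝ)).smulRight (EuclideanSpace.proj j : EV m →L[ℝ] ℝ))
    refine this.congr (Eventually.of_forall fun z => ?_)
    simp [hk]; ring
  have e4 : ∀ z, kernelJ ρ z * B z z = ∑ i, ∑ j, (kernelJ ρ z * z i * z j) * B (EuclideanSpace.single i 1) (EuclideanSpace.single j 1) := by
    intro z
    rw [e3, Finset.mul_sum]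
    refine Finset.sum_congr rfl fun i _ => ?_
    rw [Finset.mul_sum]
    refine Finset.sum_congr rfl fun j _ => ?_
    ring
  simp_rw [e4]
  rw [integral_finset_sum _ fun i _ => integrable_finset_sum _ fun j _ => (hnt i j).mul_const _]
  simp_rw [integral_finset_sum _ fun j _ => (hnt _ j).mul_const _, integral_mul_const]
  rw [contr, Finset.mul_sum]
  refine Finset.sum_congr rfl fun i _ => ?_
  rw [Finset.mul_sum]
  refine Finset.sum_congr rfl fun j _ => ?_
  simp [momentum]; ring

end Part11

section Part12

variable {m : ℕ} {ρ : EV m → ℝ}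

lemma scaled_avg (h : A1 ρ) {Ψ : EV m → ℝ≥0∞} (hΨ : Measurable Ψ) {C : ℝ≥0∞} (hC : C ≠ ⊤)
    (hb : ∀ z, Ψ z ≤ C) (h0 : Tendsto Ψ (𝓝 0) (𝓝 0)) :
    Tendsto (fun ε => ∫⁻ z, ENNReal.ofReal (scaled ρ ε z) * Ψ z) (𝓝[>] 0) (𝓝 0) := by
  have key : Tendsto (fun ε : ℝ => ∫⁻ z, ENNReal.ofReal (ρ z) * Ψ (ε • z)) (𝓝[>] 0) (𝓝 (∫⁻ _ : EV m, 0)) := by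
    refine tendsto_lintegral_filter_of_dominated_convergence (fun z => ENNReal.ofReal (ρ z) * C) ?_ ?_ ?_ ?_
    · exact Eventually.of_forall fun ε => h.1.ennreal_ofReal.mul (hΨ.comp (measurable_const_smul ε))
    · exact Eventually.of_forall fun ε => Eventually.of_forall fun z => by gcongr; exact hb _
    · rw [lintegral_mul_const _ h.1.ennreal_ofReal]
      exact ENNReal.mul_ne_top (massI_lt_top h).ne hC
    · refine Eventually.of_forall fun z => ?_
      have h2 : Tendsto (fun ε : ℝ => ε • z) (𝓝[>] 0) (𝓝 0) := by
        have : Tendsto (fun ε : ℝ => ε • z) (𝓝 0) (𝓝 ((0:ℝ) • z)) := Continuous.tendsto (by fun_prop) 0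
        rw [zero_smul] at this
        exact this.mono_left nhdsWithin_le_nhds
      have := ENNReal.Tendsto.const_mul (a := ENNReal.ofReal (ρ z)) (h0.comp h2) (Or.inr ENNReal.ofReal_ne_top)
      rw [mul_zero] at this
      exact this
  rw [lintegral_zero] at key
  refine key.congr' ?_
  filter_upwards [self_mem_nhdsWithin] with ε hε
  have hε : 0 < ε := hε
  rw [← lint_scaled hε (fun z => Ψ (ε • z))]
  refine lintegral_congr fun z => ?_
  rw [smul_smul, mul_inv_cancel₀ hε.ne', one_smul]

lemma cc_translate {H : Type*} [NormedAddCommGroup H] {G : EV m → H} (hG : Continuous G) (hc : HasCompactSupport G)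
    {p : ℝ} (hp : 1 ≤ p) :
    (∃ C : ℝ≥0∞, C ≠ ⊤ ∧ ∀ w, ∫⁻ x, ‖G (x - w) - G x‖ₑ ^ p ≤ C) ∧
    Tendsto (fun w => ∫⁻ x, ‖G (x - w) - G x‖ₑ ^ p) (𝓝 0) (𝓝 0) := by
  have hp0 : 0 < p := by linarith
  obtain ⟨C, hC⟩ := cc_bdd hG hc
  have hCe : ∀ x, ‖G x‖ₑ ≤ ENNReal.ofReal C := fun x => by
    rw [← ofReal_norm]; exact ENNReal.ofReal_le_ofReal (hC x)
  have hm : Measurable fun x => ‖G x‖ₑ ^ p := hG.enorm.measurable.pow_const p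
  have hz : ∀ x, x ∉ tsupport G → G x = 0 := fun x hx => image_eq_zero_of_notMem_tsupport hx
  constructor
  · refine ⟨2 ^ (p - 1) * ((∫⁻ x, ‖G x‖ₑ ^ p) + ∫⁻ x, ‖G x‖ₑ ^ p), ?_, fun w => ?_⟩
    · have : (∫⁻ x, ‖G x‖ₑ ^ p) ≠ ⊤ := by
        refine ne_top_of_le_ne_top ?_ (lintegral_mono (g := (tsupport G).indicator fun _ => ENNReal.ofReal C ^ p) fun x => ?_)
        · rw [lintegral_indicator hc.isCompact.measurableSet, setLIntegral_const]
          exact ENNReal.mul_ne_top (by simp [hp0.le]) hc.isCompact.measure_lt_top.ne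
        · by_cases hx : x ∈ tsupport G
          · rw [Set.indicator_of_mem hx]; exact ENNReal.rpow_le_rpow (hCe x) hp0.le
          · simp [hz x hx, hp0]
      exact ENNReal.mul_ne_top (ENNReal.rpow_ne_top_of_nonneg (by linarith) (by simp)) (ENNReal.add_ne_top.2 ⟨this, this⟩)
    · calc _ ≤ ∫⁻ x, 2 ^ (p - 1) * (‖G (x - w)‖ₑ ^ p + ‖G x‖ₑ ^ p) := by
            refine lintegral_mono fun x => ?_
            exact (ENNReal.rpow_le_rpow enorm_sub_le hp0.le).trans (ENNReal.rpow_add_le_mul_rpow_add_rpow _ _ hp)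
        _ = _ := by
            rw [lintegral_const_mul' _ _ (ENNReal.rpow_ne_top_of_nonneg (by linarith) (by simp)), lintegral_add_right _ hm,
              lintegral_sub_right_eq_self (fun x => ‖G x‖ₑ ^ p) w]
  · have h0 : (0:ℝ≥0∞) = ∫⁻ x : EV m, 0 := by simp
    rw [h0]
    set T := Metric.cthickening 1 (tsupport G)
    have hT : IsCompact T := hc.isCompact.cthickening
    refine tendsto_lintegral_filter_of_dominated_convergence (T.indicator fun _ => (ENNReal.ofReal C + ENNReal.ofReal C) ^ p) ?_ ?_ ?_ ?_
    · refine Eventually.of_forall fun w => ?_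
      have : Continuous fun x => G (x - w) - G x := (hG.comp (continuous_id.sub continuous_const)).sub hG
      exact this.enorm.measurable.pow_const p
    · filter_upwards [Metric.ball_mem_nhds (0 : EV m) one_pos] with w hw
      refine Eventually.of_forall fun x => ?_
      by_cases hx : x ∈ T
      · rw [Set.indicator_of_mem hx]
        exact ENNReal.rpow_le_rpow (enorm_sub_le.trans (add_le_add (hCe _) (hCe _))) hp0.le
      · have h1 : G x = 0 := hz x fun h => hx (Metric.self_subset_cthickening _ h)
        have h2 : G (x - w) = 0 := hz _ fun h => hx (by
          refine Metric.mem_cthickening_of_dist_le x _ 1 _ h ?_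
          rw [dist_eq_norm]; simp
          have := Metric.mem_ball.1 hw
          rw [dist_zero_right] at this
          exact this.le)
        simp [h1, h2, hp0]
    · rw [lintegral_indicator hT.measurableSet, setLIntegral_const]
      exact ENNReal.mul_ne_top (by simp [hp0.le]) hT.measure_lt_top.ne
    · refine Eventually.of_forall fun x => ?_
      have : Continuous fun w => ‖G (x - w) - G x‖ₑ ^ p :=
        ENNReal.continuous_rpow_const.comp ((hG.comp (continuous_const.sub continuous_id)).sub continuous_const).enorm
      have := this.tendsto 0
      simpa [hp0] using this

lemma Rop_pt (h : A1 ρ) {ε : ℝ} (hε : 0 < ε) {Ω : Set (EV m)} (hΩ : IsOpen Ω)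
    {v : EV m → ℝ} (hv : ContDiff ℝ 2 v) (hc : HasCompactSupport v) (x : EV m) :
    ‖Rop Ω ρ ε v x + contr (momentum ρ) (fderiv ℝ (fderiv ℝ v) x)‖ₑ
      ≤ (∫⁻ z, ENNReal.ofReal (scaled ρ ε z) * ∫⁻ τ in Set.Ioc (0:ℝ) 1, ‖fderiv ℝ (fderiv ℝ v) (x - τ • z) - fderiv ℝ (fderiv ℝ v) x‖ₑ)
       + ‖fderiv ℝ (fderiv ℝ v) x‖ₑ * ∫⁻ z in {z | x - z ∉ Ω}, ENNReal.ofReal (scaled ρ ε z) := by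
  set G := fderiv ℝ (fderiv ℝ v) with hG
  have hc1 : ContDiff ℝ 1 (fderiv ℝ v) := hv.fderiv_right (by norm_num)
  have hGc : Continuous G := hc1.continuous_fderiv (by norm_num)
  set k := kernelJ (scaled ρ ε)
  have hmA : MeasurableSet {z : EV m | x - z ∈ Ω} := hΩ.measurableSet.preimage (measurable_const.sub measurable_id)
  have hcA : {z : EV m | x - z ∉ Ω} = {z : EV m | x - z ∈ Ω}ᶜ := rfl
  have hmB : MeasurableSet {z : EV m | x - z ∉ Ω} := by rw [hcA]; exact hmA.compl
  have hi1 := Rop_integrable h hε hv hc x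
  have hi2 : Integrable (fun z => (1/2 : ℝ) * (k z * G x z z)) volume := (kz2_integrable h hε (G x)).const_mul _
  have e1 : contr (momentum ρ) (G x) = ∫ z, (1/2 : ℝ) * (k z * G x z z) := by
    rw [integral_const_mul, mom_eq h hε]; ring
  have e2 : Rop Ω ρ ε v x + contr (momentum ρ) (G x)
      = (∫ z in {z | x - z ∈ Ω}, (k z * (v x - v (x - z) - fderiv ℝ v x z) + (1/2 : ℝ) * (k z * G x z z)))
        + ∫ z in {z | x - z ∉ Ω}, (1/2 : ℝ) * (k z * G x z z) := by
    rw [e1, ← integral_add_compl hmA hi2, integral_add hi1.integrableOn hi2.integrableOn, hcA, Rop, add_assoc]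
  rw [e2]
  refine (enorm_add_le _ _).trans (add_le_add ?_ ?_)
  · refine (enorm_integral_le_lintegral_enorm _).trans ((lintegral_mono' Measure.restrict_le_self le_rfl).trans
      (lintegral_mono fun z => ?_))
    have e3 : k z * (v x - v (x - z) - fderiv ℝ v x z) + (1/2 : ℝ) * (k z * G x z z)
        = - ∫ τ in (0:ℝ)..1, k z * ((1 - τ) * (G (x - τ • z) - G x) z z) := by
      rw [taylor_exact hv]
      have h1 : IntervalIntegrable (fun τ : ℝ => (1 - τ) * G (x - τ • z) z z) volume 0 1 :=
        Continuous.intervalIntegrable (by fun_prop) _ _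
      have h2 : IntervalIntegrable (fun τ : ℝ => (1 - τ) * G x z z) volume 0 1 :=
        Continuous.intervalIntegrable (by fun_prop) _ _
      have h3 : ∫ τ in (0:ℝ)..1, (1 - τ) * G x z z = (1/2) * G x z z := by
        rw [intervalIntegral.integral_mul_const]
        congr 1
        rw [intervalIntegral.integral_sub (by simp) (by simp)]
        norm_num
      rw [intervalIntegral.integral_const_mul]
      have h4 : ∀ τ : ℝ, (1 - τ) * (G (x - τ • z) - G x) z z = (1 - τ) * G (x - τ • z) z z - (1 - τ) * G x z z := by
        intro τ; simp only [ContinuousLinearMap.sub_apply]; ring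
      simp_rw [h4]
      rw [intervalIntegral.integral_sub h1 h2, h3]
      ring
    rw [e3, enorm_neg, intervalIntegral.integral_of_le zero_le_one]
    refine (enorm_integral_le_lintegral_enorm _).trans ?_
    rw [← lintegral_const_mul' _ _ ENNReal.ofReal_ne_top]
    refine setLIntegral_mono' measurableSet_Ioc fun τ hτ => ?_
    rw [← ofReal_norm, ← ofReal_norm, ← ENNReal.ofReal_mul (scaled_nonneg h hε z)]
    refine ENNReal.ofReal_le_ofReal ?_
    have hb := kz2_bound h hε (G (x - τ • z) - G x) z
    have : k z * ((1 - τ) * (G (x - τ • z) - G x) z z) = (1 - τ) * (k z * (G (x - τ • z) - G x) z z) := by ring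
    rw [this, norm_mul, Real.norm_eq_abs, Real.norm_eq_abs, mul_comm (scaled ρ ε z)]
    have h5 : |1 - τ| ≤ 1 := by rw [abs_le]; constructor <;> linarith [hτ.1, hτ.2]
    calc _ ≤ 1 * |k z * (G (x - τ • z) - G x) z z| := mul_le_mul_of_nonneg_right h5 (abs_nonneg _)
      _ ≤ _ := by rw [one_mul]; exact hb
  · refine (enorm_integral_le_lintegral_enorm _).trans ?_
    rw [← lintegral_const_mul' _ _ enorm_ne_top]
    refine lintegral_mono fun z => ?_
    rw [← ofReal_norm, ← ofReal_norm, ← ENNReal.ofReal_mul (norm_nonneg (G x))]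
    refine ENNReal.ofReal_le_ofReal ?_
    have hb := kz2_bound h hε (G x) z
    rw [norm_mul, Real.norm_eq_abs, Real.norm_eq_abs]
    have := abs_nonneg (k z * (G x z z))
    rw [abs_of_pos (by norm_num : (0:ℝ) < 1/2)]
    linarith

lemma cv_gen (h : A1 ρ) {X : Type*} [NormedAddCommGroup X] [NormedSpace ℝ X] {Ω : Set (EV m)} (hΩ : IsOpen Ω) {p : ℝ} (hp : 1 ≤ p)
    {G : EV m → X} (hGc : Continuous G) (hGs : HasCompactSupport G) {F : ℝ → EV m → ℝ}
    (hpt : ∀ ε : ℝ, 0 < ε → ∀ x, ‖F ε x‖ₑ ≤ (∫⁻ z, ENNReal.ofReal (scaled ρ ε z) * ∫⁻ τ in Set.Ioc (0:ℝ) 1, ‖G (x - τ • z) - G x‖ₑ)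
        + ‖G x‖ₑ * ∫⁻ z in {z | x - z ∉ Ω}, ENNReal.ofReal (scaled ρ ε z)) :
    Tendsto (fun ε => ∫⁻ x in Ω, ‖F ε x‖ₑ ^ p) (𝓝[>] 0) (𝓝 0) := by
  have hp0 : 0 < p := by linarith
  obtain ⟨⟨C, hC, hCb⟩, h0⟩ := cc_translate hGc hGs hp
  have hH : Measurable fun q : EV m × EV m => ‖G (q.1 - q.2) - G q.1‖ₑ := by
    have : Continuous fun q : EV m × EV m => G (q.1 - q.2) - G q.1 :=
      (hGc.comp (continuous_fst.sub continuous_snd)).sub (hGc.comp continuous_fst)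
    exact this.enorm.measurable
  have hΦm : Measurable fun w => ∫⁻ x, ‖G (x - w) - G x‖ₑ ^ p :=
    Measurable.lintegral_prod_left' (f := fun q : EV m × EV m => ‖G (q.1 - q.2) - G q.1‖ₑ ^ p) (hH.pow_const p)
  set Φ := fun w => ∫⁻ x, ‖G (x - w) - G x‖ₑ ^ p with hΦ
  have hT1 : Tendsto (fun ε => massI ρ ^ (p - 1) * ∫⁻ z, ENNReal.ofReal (scaled ρ ε z) * ∫⁻ τ in Set.Ioc (0:ℝ) 1, Φ (τ • z))
      (𝓝[>] 0) (𝓝 0) := by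
    have hts : Measurable fun q : EV m × ℝ => Φ (q.2 • q.1) := hΦm.comp (by fun_prop)
    have := scaled_avg h (Ψ := fun z => ∫⁻ τ in Set.Ioc (0:ℝ) 1, Φ (τ • z)) hts.lintegral_prod_right' hC (fun z => ?_) ?_
    · have := ENNReal.Tendsto.const_mul (a := massI ρ ^ (p - 1)) this (Or.inr (ENNReal.rpow_ne_top_of_nonneg (by linarith) (massI_lt_top h).ne))
      rwa [mul_zero] at this
    · refine (lintegral_mono fun τ => hCb _).trans ?_
      simp
    · have e0 : (0:ℝ≥0∞) = ∫⁻ τ in Set.Ioc (0:ℝ) 1, 0 := by simp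
      conv => arg 3; rw [e0]
      refine tendsto_lintegral_filter_of_dominated_convergence (fun _ => C) ?_ ?_ ?_ ?_
      · exact Eventually.of_forall fun z => hΦm.comp (by fun_prop)
      · exact Eventually.of_forall fun z => Eventually.of_forall fun τ => hCb _
      · simp [hC]
      · refine Eventually.of_forall fun τ => h0.comp ?_
        have : Tendsto (fun z : EV m => τ • z) (𝓝 0) (𝓝 (τ • (0 : EV m))) := Continuous.tendsto (by fun_prop) 0
        rwa [smul_zero] at this
  have hSm : MeasurableSet {q : EV m × EV m | q.1 - q.2 ∉ Ω} :=
    (hΩ.measurableSet.compl).preimage (measurable_fst.sub measurable_snd)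
  have hsec : ∀ x : EV m, MeasurableSet {z : EV m | x - z ∉ Ω} := fun x =>
    (hΩ.measurableSet.compl).preimage (measurable_const.sub measurable_id)
  have hT2m : ∀ ε, Measurable fun x => ∫⁻ z in {z | x - z ∉ Ω}, ENNReal.ofReal (scaled ρ ε z) := by
    intro ε
    have e : (fun x => ∫⁻ z in {z | x - z ∉ Ω}, ENNReal.ofReal (scaled ρ ε z))
      = fun x => ∫⁻ z, ({q : EV m × EV m | q.1 - q.2 ∉ Ω}.indicator fun q => ENNReal.ofReal (scaled ρ ε q.2)) (x, z) := by
      funext x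
      rw [← lintegral_indicator (hsec x)]
      rfl
    rw [e]
    exact Measurable.lintegral_prod_right' (f := {q : EV m × EV m | q.1 - q.2 ∉ Ω}.indicator fun q => ENNReal.ofReal (scaled ρ ε q.2))
      (((scaled_meas h ε).ennreal_ofReal.comp measurable_snd).indicator hSm)
  have hGe : Measurable fun x => ‖G x‖ₑ := hGc.enorm.measurable
  have hT2 : Tendsto (fun ε => ∫⁻ x in Ω, (‖G x‖ₑ * ∫⁻ z in {z | x - z ∉ Ω}, ENNReal.ofReal (scaled ρ ε z)) ^ p)
      (𝓝[>] 0) (𝓝 0) := by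
    have e0 : (0:ℝ≥0∞) = ∫⁻ x in Ω, 0 := by simp
    conv => arg 3; rw [e0]
    obtain ⟨B, hB⟩ := cc_bdd hGc hGs
    refine tendsto_lintegral_filter_of_dominated_convergence ((tsupport G).indicator fun _ => (ENNReal.ofReal B * massI ρ) ^ p) ?_ ?_ ?_ ?_
    · exact Eventually.of_forall fun ε => (hGe.mul (hT2m ε)).pow_const p
    · filter_upwards [self_mem_nhdsWithin] with ε hε
      refine Eventually.of_forall fun x => ?_
      by_cases hx : x ∈ tsupport G
      · rw [Set.indicator_of_mem hx]
        refine ENNReal.rpow_le_rpow (mul_le_mul' ?_ ?_) hp0.le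
        · rw [← ofReal_norm]; exact ENNReal.ofReal_le_ofReal (hB x)
        · rw [← lint_scaled_one (ρ := ρ) (ε := ε) hε]
          exact lintegral_mono' Measure.restrict_le_self le_rfl
      · simp [image_eq_zero_of_notMem_tsupport hx, hp0]
    · rw [lintegral_indicator hGs.isCompact.measurableSet, setLIntegral_const]
      refine ENNReal.mul_ne_top (ENNReal.rpow_ne_top_of_nonneg hp0.le (ENNReal.mul_ne_top ENNReal.ofReal_ne_top (massI_lt_top h).ne)) ?_
      exact ((Measure.restrict_apply_le _ _).trans_lt hGs.isCompact.measure_lt_top).ne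
    · refine (ae_restrict_iff' hΩ.measurableSet).2 (Eventually.of_forall fun x hx => ?_)
      have h3 := scaled_avg h (Ψ := {z | x - z ∉ Ω}.indicator fun _ => 1) (measurable_const.indicator (hsec x)) ENNReal.one_ne_top
        (fun z => Set.indicator_le_self _ _ z) (by
          refine tendsto_const_nhds.congr' ?_
          have : Tendsto (fun z : EV m => x - z) (𝓝 0) (𝓝 (x - 0)) := Continuous.tendsto (by fun_prop) 0
          rw [sub_zero] at this
          filter_upwards [this.eventually (hΩ.mem_nhds hx)] with z hz
          rw [Set.indicator_of_notMem]
          exact fun hn => hn hz)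
      have h4 : ∀ ε, ∫⁻ z in {z | x - z ∉ Ω}, ENNReal.ofReal (scaled ρ ε z)
          = ∫⁻ z, ENNReal.ofReal (scaled ρ ε z) * {z | x - z ∉ Ω}.indicator (fun _ => 1) z := by
        intro ε
        rw [← lintegral_indicator (hsec x)]
        refine lintegral_congr fun z => ?_
        by_cases hz : z ∈ {z | x - z ∉ Ω}
        · rw [Set.indicator_of_mem hz, Set.indicator_of_mem hz, mul_one]
        · rw [Set.indicator_of_notMem hz, Set.indicator_of_notMem hz, mul_zero]
      simp_rw [h4]
      have h5 := ENNReal.Tendsto.const_mul (a := ‖G x‖ₑ) h3 (Or.inr enorm_ne_top)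
      rw [mul_zero] at h5
      have := ((ENNReal.continuous_rpow_const (y := p)).tendsto 0).comp h5
      rw [ENNReal.zero_rpow_of_pos hp0] at this
      exact this
  have h2p : (2:ℝ≥0∞) ^ (p - 1) ≠ ⊤ := ENNReal.rpow_ne_top_of_nonneg (by linarith) (by simp)
  have hsum := ENNReal.Tendsto.const_mul (a := (2:ℝ≥0∞) ^ (p - 1)) (hT1.add hT2) (Or.inr h2p)
  rw [add_zero, mul_zero] at hsum
  refine tendsto_of_tendsto_of_tendsto_of_le_of_le' tendsto_const_nhds hsum (Eventually.of_forall fun _ => zero_le) ?_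
  filter_upwards [self_mem_nhdsWithin] with ε hε
  calc _ ≤ ∫⁻ x in Ω, 2 ^ (p - 1) * ((∫⁻ z, ENNReal.ofReal (scaled ρ ε z) * ∫⁻ τ in Set.Ioc (0:ℝ) 1, ‖G (x - τ • z) - G x‖ₑ) ^ p
        + (‖G x‖ₑ * ∫⁻ z in {z | x - z ∉ Ω}, ENNReal.ofReal (scaled ρ ε z)) ^ p) := by
        refine lintegral_mono fun x => ?_
        have := hpt ε hε x
        exact (ENNReal.rpow_le_rpow this hp0.le).trans (ENNReal.rpow_add_le_mul_rpow_add_rpow _ _ hp)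
    _ = 2 ^ (p - 1) * ((∫⁻ x in Ω, (∫⁻ z, ENNReal.ofReal (scaled ρ ε z) * ∫⁻ τ in Set.Ioc (0:ℝ) 1, ‖G (x - τ • z) - G x‖ₑ) ^ p)
        + ∫⁻ x in Ω, (‖G x‖ₑ * ∫⁻ z in {z | x - z ∉ Ω}, ENNReal.ofReal (scaled ρ ε z)) ^ p) := by
        rw [lintegral_const_mul' _ _ h2p, lintegral_add_right _ (show Measurable fun x => (‖G x‖ₑ * ∫⁻ z in {z | x - z ∉ Ω}, ENNReal.ofReal (scaled ρ ε z)) ^ p from (hGe.mul (hT2m ε)).pow_const p)]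
    _ ≤ _ := by
        gcongr
        exact (lintegral_mono' Measure.restrict_le_self le_rfl).trans (avg_mink h hε hp (H := fun q => ‖G (q.1 - q.2) - G q.1‖ₑ) hH)

lemma Rop_cv (h : A1 ρ) {Ω : Set (EV m)} (hΩ : IsOpen Ω) {p : ℝ} (hp : 1 ≤ p)
    {v : EV m → ℝ} (hv : ContDiff ℝ 2 v) (hc : HasCompactSupport v) :
    Tendsto (fun ε => ∫⁻ x in Ω, ‖Rop Ω ρ ε v x + contr (momentum ρ) (fderiv ℝ (fderiv ℝ v) x)‖ₑ ^ p)
      (𝓝[>] 0) (𝓝 0) := by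
  have hc1 : ContDiff ℝ 1 (fderiv ℝ v) := hv.fderiv_right (by norm_num)
  exact cv_gen h hΩ hp (hc1.continuous_fderiv (by norm_num)) (cc_fderiv (cc_fderiv hc))
    fun ε hε x => Rop_pt h hε hΩ hv hc x

end Part12

section Part13

variable {n : ℕ}

/-- Second order jets of real valued functions. -/
def Jet (X : Type*) [NormedAddCommGroup X] [NormedSpace ℝ X] := ℝ × (X →L[ℝ] ℝ) × (X →L[ℝ] X →L[ℝ] ℝ)

instance {X : Type*} [NormedAddCommGroup X] [NormedSpace ℝ X] : NormedAddCommGroup (Jet X) :=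
  inferInstanceAs (NormedAddCommGroup (ℝ × (X →L[ℝ] ℝ) × (X →L[ℝ] X →L[ℝ] ℝ)))

instance {X : Type*} [NormedAddCommGroup X] [NormedSpace ℝ X] : NormedSpace ℝ (Jet X) :=
  inferInstanceAs (NormedSpace ℝ (ℝ × (X →L[ℝ] ℝ) × (X →L[ℝ] X →L[ℝ] ℝ)))

instance {X : Type*} [NormedAddCommGroup X] [NormedSpace ℝ X] : CompleteSpace (Jet X) :=
  inferInstanceAs (CompleteSpace (ℝ × (X →L[ℝ] ℝ) × (X →L[ℝ] X →L[ℝ] ℝ)))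

/-- Build a jet. -/
def mkJ {X : Type*} [NormedAddCommGroup X] [NormedSpace ℝ X] (a : ℝ) (b : X →L[ℝ] ℝ) (c : X →L[ℝ] X →L[ℝ] ℝ) :
    Jet X := ((a, b, c) : ℝ × (X →L[ℝ] ℝ) × (X →L[ℝ] X →L[ℝ] ℝ))

/-- Zeroth order part. -/
def Jet.a {X : Type*} [NormedAddCommGroup X] [NormedSpace ℝ X] (s : Jet X) : ℝ := Prod.fst s
/-- First order part. -/
def Jet.b {X : Type*} [NormedAddCommGroup X] [NormedSpace ℝ X] (s : Jet X) : X →L[ℝ] ℝ := Prod.fst (Prod.snd s)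
/-- Second order part. -/
def Jet.c {X : Type*} [NormedAddCommGroup X] [NormedSpace ℝ X] (s : Jet X) : X →L[ℝ] X →L[ℝ] ℝ :=
  Prod.snd (Prod.snd s)

/-- The second order jet of a function. -/
def jj {X : Type*} [NormedAddCommGroup X] [NormedSpace ℝ X] (v : X → ℝ) (x : X) : Jet X :=
  mkJ (v x) (fderiv ℝ v x) (fderiv ℝ (fderiv ℝ v) x)

section
variable {X : Type*} [NormedAddCommGroup X] [NormedSpace ℝ X]

@[simp] lemma mkJ_a (a : ℝ) (b : X →L[ℝ] ℝ) (c : X →L[ℝ] X →L[ℝ] ℝ) : (mkJ a b c).a = a := rfl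
@[simp] lemma mkJ_b (a : ℝ) (b : X →L[ℝ] ℝ) (c : X →L[ℝ] X →L[ℝ] ℝ) : (mkJ a b c).b = b := rfl
@[simp] lemma mkJ_c (a : ℝ) (b : X →L[ℝ] ℝ) (c : X →L[ℝ] X →L[ℝ] ℝ) : (mkJ a b c).c = c := rfl
@[simp] lemma jj_a (v : X → ℝ) (x : X) : (jj v x).a = v x := rfl
@[simp] lemma jj_b (v : X → ℝ) (x : X) : (jj v x).b = fderiv ℝ v x := rfl
@[simp] lemma jj_c (v : X → ℝ) (x : X) : (jj v x).c = fderiv ℝ (fderiv ℝ v) x := rfl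
@[simp] lemma Jet.add_a (s t : Jet X) : (s + t).a = s.a + t.a := rfl
@[simp] lemma Jet.add_b (s t : Jet X) : (s + t).b = s.b + t.b := rfl
@[simp] lemma Jet.add_c (s t : Jet X) : (s + t).c = s.c + t.c := rfl
@[simp] lemma Jet.sub_a (s t : Jet X) : (s - t).a = s.a - t.a := rfl
@[simp] lemma Jet.sub_b (s t : Jet X) : (s - t).b = s.b - t.b := rfl
@[simp] lemma Jet.sub_c (s t : Jet X) : (s - t).c = s.c - t.c := rfl
@[simp] lemma Jet.neg_a (s : Jet X) : (-s).a = -s.a := rfl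
@[simp] lemma Jet.neg_b (s : Jet X) : (-s).b = -s.b := rfl
@[simp] lemma Jet.neg_c (s : Jet X) : (-s).c = -s.c := rfl
@[simp] lemma Jet.zero_a : (0 : Jet X).a = 0 := rfl
@[simp] lemma Jet.zero_b : (0 : Jet X).b = 0 := rfl
@[simp] lemma Jet.zero_c : (0 : Jet X).c = 0 := rfl
lemma Jet.ext' {s t : Jet X} (ha : s.a = t.a) (hb : s.b = t.b) (hc : s.c = t.c) : s = t :=
  Prod.ext ha (Prod.ext hb hc)

lemma Jet.norm_a (s : Jet X) : ‖s.a‖ ≤ ‖s‖ := norm_fst_le (E := ℝ) (F := (X →L[ℝ] ℝ) × (X →L[ℝ] X →L[ℝ] ℝ)) s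
lemma Jet.norm_b (s : Jet X) : ‖s.b‖ ≤ ‖s‖ :=
  (norm_fst_le (E := X →L[ℝ] ℝ) (F := X →L[ℝ] X →L[ℝ] ℝ) s.2).trans
    (norm_snd_le (E := ℝ) (F := (X →L[ℝ] ℝ) × (X →L[ℝ] X →L[ℝ] ℝ)) s)
lemma Jet.norm_c (s : Jet X) : ‖s.c‖ ≤ ‖s‖ :=
  (norm_snd_le (E := X →L[ℝ] ℝ) (F := X →L[ℝ] X →L[ℝ] ℝ) s.2).trans
    (norm_snd_le (E := ℝ) (F := (X →L[ℝ] ℝ) × (X →L[ℝ] X →L[ℝ] ℝ)) s)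

lemma jj_fst_le (v : X → ℝ) (x : X) : ‖v x‖ ≤ ‖jj v x‖ := (jj v x).norm_a
lemma jj_snd_le (v : X → ℝ) (x : X) : ‖fderiv ℝ v x‖ ≤ ‖jj v x‖ := (jj v x).norm_b
lemma jj_trd_le (v : X → ℝ) (x : X) : ‖fderiv ℝ (fderiv ℝ v) x‖ ≤ ‖jj v x‖ := (jj v x).norm_c

lemma Jet.norm_le {s : Jet X} {C : ℝ} (ha : ‖s.a‖ ≤ C) (hb : ‖s.b‖ ≤ C) (hc : ‖s.c‖ ≤ C) : ‖s‖ ≤ C := by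
  change max ‖s.a‖ (max ‖s.b‖ ‖s.c‖) ≤ C
  exact max_le ha (max_le hb hc)

lemma Jet.continuous_mk {Y : Type*} [TopologicalSpace Y] {f : Y → ℝ} {g : Y → X →L[ℝ] ℝ}
    {h : Y → X →L[ℝ] X →L[ℝ] ℝ} (hf : Continuous f) (hg : Continuous g) (hh : Continuous h) :
    Continuous fun y => mkJ (f y) (g y) (h y) := hf.prodMk (hg.prodMk hh)

lemma jj_continuous {v : X → ℝ} (hv : ContDiff ℝ 2 v) : Continuous (jj v) := by
  have hc1 : ContDiff ℝ 1 (fderiv ℝ v) := hv.fderiv_right (by norm_num)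
  exact Jet.continuous_mk hv.continuous (hv.continuous_fderiv (by norm_num)) (hc1.continuous_fderiv (by norm_num))

lemma jj_compact {v : X → ℝ} (hc : HasCompactSupport v) : HasCompactSupport (jj v) := by
  have h1 : HasCompactSupport (fderiv ℝ v) := hc.fderiv ℝ
  have h2 : HasCompactSupport (fderiv ℝ (fderiv ℝ v)) := h1.fderiv ℝ
  refine HasCompactSupport.intro (K := tsupport v) hc.isCompact fun x hx => ?_
  have e0 : v x = 0 := image_eq_zero_of_notMem_tsupport hx
  have e1 : fderiv ℝ v x = 0 := image_eq_zero_of_notMem_tsupport fun h => hx (tsupport_fderiv_subset ℝ h)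
  have e2 : fderiv ℝ (fderiv ℝ v) x = 0 := image_eq_zero_of_notMem_tsupport fun h =>
    hx (tsupport_fderiv_subset ℝ (tsupport_fderiv_subset ℝ h))
  simp only [jj, e0, e1, e2]
  rfl

lemma fderiv2_add {v w : X → ℝ} (hv : ContDiff ℝ 2 v) (hw : ContDiff ℝ 2 w) (x : X) :
    jj (fun y => v y + w y) x = jj v x + jj w x := by
  have e1 : fderiv ℝ (fun y => v y + w y) = fun y => fderiv ℝ v y + fderiv ℝ w y := by
    funext y
    exact fderiv_add (hv.differentiable (by norm_num) y) (hw.differentiable (by norm_num) y)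
  have hv1 : ContDiff ℝ 1 (fderiv ℝ v) := hv.fderiv_right (by norm_num)
  have hw1 : ContDiff ℝ 1 (fderiv ℝ w) := hw.fderiv_right (by norm_num)
  have e2 : fderiv ℝ (fun y => fderiv ℝ v y + fderiv ℝ w y) x = fderiv ℝ (fderiv ℝ v) x + fderiv ℝ (fderiv ℝ w) x :=
    fderiv_add (hv1.differentiable (by norm_num) x) (hw1.differentiable (by norm_num) x)
  simp only [jj, e1, e2]
  rfl

lemma jj_neg {v : X → ℝ} (x : X) :
    jj (fun y => - v y) x = - jj v x := by
  have e1 : fderiv ℝ (fun y => - v y) = fun y => - fderiv ℝ v y := by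
    funext y
    exact fderiv_fun_neg
  have e2 : fderiv ℝ (fun y => - fderiv ℝ v y) x = - fderiv ℝ (fderiv ℝ v) x := fderiv_fun_neg
  simp only [jj, e1, e2]
  rfl

lemma jj_sub {v w : X → ℝ} (hv : ContDiff ℝ 2 v) (hw : ContDiff ℝ 2 w) (x : X) :
    jj (fun y => v y - w y) x = jj v x - jj w x := by
  have := fderiv2_add hv hw.neg x
  rw [sub_eq_add_neg, ← jj_neg, ← this]
  simp only [sub_eq_add_neg]

lemma jj_congr {v w : X → ℝ} {x : X} (h : v =ᶠ[𝓝 x] w) : jj v x = jj w x := by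
  simp only [jj, h.eq_of_nhds, h.fderiv_eq, h.fderiv.fderiv_eq]

end

lemma UE {ρ : EV (n + 1) → ℝ} (h1 : A1 ρ) (h2 : A2 ρ) {Ω : Set (EV (n + 1))}
    (hΩ : IsGraphDomain 3 Ω) (hcpt : IsCompact (frontier Ω)) {p : ℝ≥0∞} (hp1 : 1 ≤ p) (hp : p ≠ ⊤) :
    ∃ K : ℝ≥0∞, K ≠ ⊤ ∧ ∀ ε : ℝ, 0 < ε → ∀ v : EV (n + 1) → ℝ, ContDiff ℝ 2 v → HasCompactSupport v →
      NBC Ω (momentum ρ) v →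
      eLpNorm (fun x => Rop Ω ρ ε v x - fderiv ℝ v x (bvec Ω ρ ε x)) p (volume.restrict Ω)
        ≤ K * eLpNorm (jj v) p volume := by
  have hq := one_le_toReal' hp1 hp
  set q := p.toReal with hqd
  have hq0 : 0 < q := by linarith
  obtain ⟨K, hK, hb⟩ := bv_Lp h1 h2 hΩ hcpt hq
  have h2p : (2:ℝ≥0∞) ^ (q - 1) ≠ ⊤ := ENNReal.rpow_ne_top_of_nonneg (by linarith) (by simp)
  refine ⟨(2 ^ (q - 1) * (massI ρ ^ q + 2 * K)) ^ (1 / q), ?_, fun ε hε v hv hc hN => ?_⟩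
  · refine ENNReal.rpow_ne_top_of_nonneg (by positivity) (ENNReal.mul_ne_top h2p (ENNReal.add_ne_top.2 ⟨?_, ?_⟩))
    · exact ENNReal.rpow_ne_top_of_nonneg hq0.le (massI_lt_top h1).ne
    · exact ENNReal.mul_ne_top (by simp) hK.ne
  · rw [eLpNorm_eq_lint _ _ _ hp1 hp, eLpNorm_eq_lint _ _ _ hp1 hp, ← ENNReal.mul_rpow_of_nonneg _ _ (by positivity)]
    refine ENNReal.rpow_le_rpow ?_ (by positivity)
    have hm : Measurable fun x => ‖fderiv ℝ v x (bvec Ω ρ ε x)‖ₑ ^ q := by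
      have h3 : Continuous (fderiv ℝ v) := hv.continuous_fderiv (by norm_num)
      have h4 : StronglyMeasurable fun x => fderiv ℝ v x (bvec Ω ρ ε x) :=
        (isBoundedBilinearMap_apply.continuous.comp_stronglyMeasurable (h3.stronglyMeasurable.prodMk (bvec_meas h1 hΩ.1 ε)))
      exact h4.measurable.enorm.pow_const q
    have hD1 : ∫⁻ x, ‖fderiv ℝ v x‖ₑ ^ q ≤ ∫⁻ x, ‖jj v x‖ₑ ^ q := lintegral_mono fun x => by
      refine ENNReal.rpow_le_rpow ?_ hq0.le
      rw [← ofReal_norm, ← ofReal_norm]; exact ENNReal.ofReal_le_ofReal (jj_snd_le v x)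
    have hD2 : ∫⁻ x, ‖fderiv ℝ (fderiv ℝ v) x‖ₑ ^ q ≤ ∫⁻ x, ‖jj v x‖ₑ ^ q := lintegral_mono fun x => by
      refine ENNReal.rpow_le_rpow ?_ hq0.le
      rw [← ofReal_norm, ← ofReal_norm]; exact ENNReal.ofReal_le_ofReal (jj_trd_le v x)
    calc _ ≤ ∫⁻ x in Ω, 2 ^ (q - 1) * (‖Rop Ω ρ ε v x‖ₑ ^ q + ‖fderiv ℝ v x (bvec Ω ρ ε x)‖ₑ ^ q) :=
          lintegral_mono fun x => (ENNReal.rpow_le_rpow (enorm_sub_le) hq0.le).trans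
            (ENNReal.rpow_add_le_mul_rpow_add_rpow _ _ hq)
      _ = 2 ^ (q - 1) * ((∫⁻ x in Ω, ‖Rop Ω ρ ε v x‖ₑ ^ q) + ∫⁻ x in Ω, ‖fderiv ℝ v x (bvec Ω ρ ε x)‖ₑ ^ q) := by
          rw [lintegral_const_mul' _ _ h2p, lintegral_add_right _ hm]
      _ ≤ 2 ^ (q - 1) * (massI ρ ^ q * (∫⁻ x, ‖jj v x‖ₑ ^ q) + K * ((∫⁻ x, ‖jj v x‖ₑ ^ q) + ∫⁻ x, ‖jj v x‖ₑ ^ q)) := by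
          gcongr
          · exact (Rop_Lp h1 hε hq hv).trans (by gcongr)
          · exact (hb ε hε v hv hN).trans (by gcongr)
      _ = _ := by ring

lemma CV {ρ : EV (n + 1) → ℝ} (h1 : A1 ρ) (h2 : A2 ρ) {Ω : Set (EV (n + 1))}
    (hΩ : IsGraphDomain 3 Ω) (hcpt : IsCompact (frontier Ω)) {p : ℝ≥0∞} (hp1 : 1 ≤ p) (hp : p ≠ ⊤)
    {v : EV (n + 1) → ℝ} (hv : ContDiff ℝ 2 v) (hc : HasCompactSupport v)
    (hN : NBC Ω (momentum ρ) v) :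
    Tendsto (fun ε => eLpNorm (fun x => Rop Ω ρ ε v x - fderiv ℝ v x (bvec Ω ρ ε x)
      + contr (momentum ρ) (fderiv ℝ (fderiv ℝ v) x)) p (volume.restrict Ω)) (𝓝[>] 0) (𝓝 0) := by
  have hq := one_le_toReal' hp1 hp
  set q := p.toReal with hqd
  have hq0 : 0 < q := by linarith
  have h2p : (2:ℝ≥0∞) ^ (q - 1) ≠ ⊤ := ENNReal.rpow_ne_top_of_nonneg (by linarith) (by simp)
  have hsum := ENNReal.Tendsto.const_mul (a := (2:ℝ≥0∞) ^ (q - 1)) ((Rop_cv h1 hΩ.1 hq hv hc).add (bv_cv h1 h2 hΩ hcpt hq hv hc hN)) (Or.inr h2p)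
  rw [add_zero, mul_zero] at hsum
  have hT := ((ENNReal.continuous_rpow_const (y := 1 / q)).tendsto 0).comp hsum
  rw [ENNReal.zero_rpow_of_pos (by positivity)] at hT
  refine tendsto_of_tendsto_of_tendsto_of_le_of_le tendsto_const_nhds hT (fun _ => zero_le) fun ε => ?_
  simp only [Function.comp]
  rw [eLpNorm_eq_lint _ _ _ hp1 hp]
  refine ENNReal.rpow_le_rpow ?_ (by positivity)
  have hm : Measurable fun x => ‖fderiv ℝ v x (bvec Ω ρ ε x)‖ₑ ^ q := by
    have h3 : Continuous (fderiv ℝ v) := hv.continuous_fderiv (by norm_num)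
    have h4 : StronglyMeasurable fun x => fderiv ℝ v x (bvec Ω ρ ε x) :=
      (isBoundedBilinearMap_apply.continuous.comp_stronglyMeasurable (h3.stronglyMeasurable.prodMk (bvec_meas h1 hΩ.1 ε)))
    exact h4.measurable.enorm.pow_const q
  rw [← lintegral_add_right _ hm, ← lintegral_const_mul' _ _ h2p]
  refine lintegral_mono fun x => ?_
  refine (ENNReal.rpow_le_rpow ?_ hq0.le).trans (ENNReal.rpow_add_le_mul_rpow_add_rpow _ _ hq)
  rw [show Rop Ω ρ ε v x - fderiv ℝ v x (bvec Ω ρ ε x) + contr (momentum ρ) (fderiv ℝ (fderiv ℝ v) x)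
    = (Rop Ω ρ ε v x + contr (momentum ρ) (fderiv ℝ (fderiv ℝ v) x)) - fderiv ℝ v x (bvec Ω ρ ε x) by ring]
  exact enorm_sub_le

end Part13

section Part14

variable {m : ℕ} {Ω : Set (EV m)} {p : ℝ≥0∞}

lemma int_mul_cc (hp1 : 1 ≤ p) {f g : EV m → ℝ} (hf : MemLp f p (volume.restrict Ω)) (hg : Continuous g)
    (hc : HasCompactSupport g) : Integrable (fun x => f x * g x) (volume.restrict Ω) := by
  have := (hf.locallyIntegrable hp1).integrable_smul_left_of_hasCompactSupport hg hc
  simpa [mul_comm] using this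

lemma pd_cont {i : Fin m} {φ : EV m → ℝ} (h : ContDiff ℝ 1 φ) : Continuous (partialD i φ) :=
  (h.continuous_fderiv (by norm_num)).clm_apply continuous_const

lemma pd_zero {i : Fin m} {φ : EV m → ℝ} {x : EV m} (hx : x ∉ tsupport φ) : partialD i φ x = 0 := by
  have e1 : fderiv ℝ φ x = 0 := image_eq_zero_of_notMem_tsupport fun h => hx (tsupport_fderiv_subset ℝ h)
  simp [partialD, e1]

lemma pd_cc {i : Fin m} {φ : EV m → ℝ} (h : HasCompactSupport φ) : HasCompactSupport (partialD i φ) :=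
  HasCompactSupport.intro (K := tsupport φ) h.isCompact fun _ hx => pd_zero hx

lemma pd_contDiff {i : Fin m} {φ : EV m → ℝ} (h : ContDiff ℝ 2 φ) : ContDiff ℝ 1 (partialD i φ) :=
  (h.fderiv_right (m := 1) (by norm_num)).clm_apply contDiff_const

lemma setInt_full {f : EV m → ℝ} (h : ∀ x, x ∉ Ω → f x = 0) : ∫ x in Ω, f x = ∫ x, f x :=
  setIntegral_eq_integral_of_forall_compl_eq_zero h

lemma weak_classical {v : EV m → ℝ} (hv : ContDiff ℝ 1 v) (i : Fin m) : WeakDerivOn Ω i v (partialD i v) := by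
  intro φ hφ hc hs
  have hφ1 : ContDiff ℝ 1 φ := hφ.of_le (by exact_mod_cast le_top)
  rw [setInt_full, setInt_full]
  · refine integral_mul_fderiv_eq_neg_fderiv_mul_of_integrable ?_ ?_ ?_ ?_ ?_
    · exact ((pd_cont hv).mul hφ.continuous).integrable_of_hasCompactSupport hc.mul_left
    · exact (hv.continuous.mul (pd_cont hφ1)).integrable_of_hasCompactSupport (pd_cc hc).mul_left
    · exact (hv.continuous.mul hφ.continuous).integrable_of_hasCompactSupport hc.mul_left
    · exact fun x _ => hv.differentiable (by norm_num) x
    · exact fun x _ => hφ1.differentiable (by norm_num) x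
  · intro x hx
    rw [image_eq_zero_of_notMem_tsupport fun h => hx (hs h), mul_zero]
  · intro x hx
    rw [pd_zero fun h => hx (hs h), mul_zero]

lemma sob_classical {v : EV m → ℝ} (hv : ContDiff ℝ 2 v) (hc : HasCompactSupport v) :
    IsSobDerivs Ω 2 p v (fun l => partialDList l v) := by
  have hv1 : ContDiff ℝ 1 v := hv.of_le (by norm_num)
  refine ⟨rfl, fun l hl i => ?_, fun l hl => ?_⟩
  · match l, hl with
    | [], _ => exact weak_classical hv1 i
    | [j], _ => exact weak_classical (pd_contDiff hv) i
  · match l, hl with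
    | [], _ => exact (hv.continuous.memLp_of_hasCompactSupport hc).restrict _
    | [j], _ => exact ((pd_cont hv1).memLp_of_hasCompactSupport (pd_cc hc)).restrict _
    | [i, j], _ => exact ((pd_cont (pd_contDiff hv)).memLp_of_hasCompactSupport (pd_cc (pd_cc hc))).restrict _

lemma weak_unique (hΩ : IsOpen Ω) (hp1 : 1 ≤ p) {i : Fin m} {f f' g g' : EV m → ℝ} (h : WeakDerivOn Ω i f g)
    (h' : WeakDerivOn Ω i f' g') (hf : f =ᵐ[volume.restrict Ω] f') (hg : MemLp g p (volume.restrict Ω))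
    (hg' : MemLp g' p (volume.restrict Ω)) : g =ᵐ[volume.restrict Ω] g' := by
  have hl : LocallyIntegrableOn (fun x => g x - g' x) Ω volume := by
    have h0 := (hg.sub hg').locallyIntegrable hp1
    intro x hx
    obtain ⟨V, hV, hi⟩ := h0 x
    refine ⟨V ∩ Ω, inter_mem (mem_nhdsWithin_of_mem_nhds hV) self_mem_nhdsWithin, ?_⟩
    rw [IntegrableOn, Measure.restrict_restrict' hΩ.measurableSet] at hi
    exact hi
  have := hΩ.ae_eq_zero_of_integral_contDiff_smul_eq_zero (μ := volume) hl ?_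
  · rw [EventuallyEq, ae_restrict_iff' hΩ.measurableSet]
    filter_upwards [this] with x hx hxΩ
    exact sub_eq_zero.1 (hx hxΩ)
  · intro φ hφ hc hs
    have e1 := h φ hφ hc hs
    have e2 := h' φ hφ hc hs
    have e3 : ∫ x in Ω, f x * partialD i φ x = ∫ x in Ω, f' x * partialD i φ x :=
      integral_congr_ae (hf.mono fun x hx => by simp only [hx])
    rw [← setInt_full (Ω := Ω)]
    · have : ∀ x, φ x • (g x - g' x) = g x * φ x - g' x * φ x := fun x => by rw [smul_eq_mul]; ring
      simp_rw [this]
      rw [integral_sub (int_mul_cc hp1 hg hφ.continuous hc) (int_mul_cc hp1 hg' hφ.continuous hc)]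
      linarith
    · intro x hx
      rw [image_eq_zero_of_notMem_tsupport fun h => hx (hs h), zero_smul]

lemma sob_unique (hΩ : IsOpen Ω) (hp1 : 1 ≤ p) {u : EV m → ℝ} {D D' : List (Fin m) → EV m → ℝ}
    (h : IsSobDerivs Ω 2 p u D) (h' : IsSobDerivs Ω 2 p u D') :
    ∀ l : List (Fin m), l.length ≤ 2 → D l =ᵐ[volume.restrict Ω] D' l := by
  intro l
  induction l with
  | nil => intro _; rw [h.1, h'.1]
  | cons i l ih =>
    intro hl
    have hl' : l.length < 2 := by simpa using hl
    exact weak_unique hΩ hp1 (h.2.1 l hl' i) (h'.2.1 l hl' i) (ih hl'.le) (h.2.2 _ hl) (h'.2.2 _ hl)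

lemma sob_lin (hp1 : 1 ≤ p) {u v : EV m → ℝ} {D D' : List (Fin m) → EV m → ℝ}
    (h : IsSobDerivs Ω 2 p u D) (h' : IsSobDerivs Ω 2 p v D') (a b : ℝ) :
    IsSobDerivs Ω 2 p (fun x => a * u x + b * v x) (fun l x => a * D l x + b * D' l x) := by
  refine ⟨by simp only [h.1, h'.1], fun l hl i φ hφ hc hs => ?_, fun l hl => ?_⟩
  · have hφ1 : ContDiff ℝ 1 φ := hφ.of_le (by exact_mod_cast le_top)
    have e1 := h.2.1 l hl i φ hφ hc hs
    have e2 := h'.2.1 l hl i φ hφ hc hs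
    have i1 := int_mul_cc hp1 (h.2.2 l hl.le) (pd_cont (i := i) hφ1) (pd_cc hc)
    have i2 := int_mul_cc hp1 (h'.2.2 l hl.le) (pd_cont (i := i) hφ1) (pd_cc hc)
    have i3 := int_mul_cc hp1 (h.2.2 (i :: l) hl) hφ.continuous hc
    have i4 := int_mul_cc hp1 (h'.2.2 (i :: l) hl) hφ.continuous hc
    have f1 : ∀ x, (a * D l x + b * D' l x) * partialD i φ x = a * (D l x * partialD i φ x) + b * (D' l x * partialD i φ x) :=
      fun x => by ring
    have f2 : ∀ x, (a * D (i :: l) x + b * D' (i :: l) x) * φ x = a * (D (i :: l) x * φ x) + b * (D' (i :: l) x * φ x) :=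
      fun x => by ring
    simp_rw [f1, f2]
    rw [integral_add (i1.const_mul a) (i2.const_mul b), integral_add (i3.const_mul a) (i4.const_mul b)]
    simp only [integral_const_mul]
    rw [e1, e2]; ring
  · exact ((h.2.2 l hl).const_mul a).add ((h'.2.2 l hl).const_mul b)

/-- Green form evaluated on a system of derivatives. -/
def ell (Ω : Set (EV m)) (M : Matrix (Fin m) (Fin m) ℝ) (D : List (Fin m) → EV m → ℝ) (φ : EV m → ℝ) : ℝ :=
  ∑ i : Fin m, ∑ j : Fin m, M i j * ∫ x in Ω, (D [i, j] x * φ x + D [j] x * partialD i φ x)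

lemma ell_eq (hp1 : 1 ≤ p) {M : Matrix (Fin m) (Fin m) ℝ} {D : List (Fin m) → EV m → ℝ}
    (hD : ∀ l : List (Fin m), l.length ≤ 2 → MemLp (D l) p (volume.restrict Ω))
    {φ : EV m → ℝ} (hφ : ContDiff ℝ 1 φ) (hc : HasCompactSupport φ) :
    ell Ω M D φ = (∑ i : Fin m, ∑ j : Fin m, M i j * ∫ x in Ω, D [i, j] x * φ x)
        + ∑ i : Fin m, ∑ j : Fin m, M i j * ∫ x in Ω, D [j] x * partialD i φ x := by
  rw [ell, ← Finset.sum_add_distrib]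
  refine Finset.sum_congr rfl fun i _ => ?_
  rw [← Finset.sum_add_distrib]
  refine Finset.sum_congr rfl fun j _ => ?_
  rw [integral_add (int_mul_cc hp1 (hD _ (by simp)) hφ.continuous hc) (int_mul_cc hp1 (hD _ (by simp)) (pd_cont hφ) (pd_cc hc))]
  ring

lemma ell_congr {M : Matrix (Fin m) (Fin m) ℝ} {D D' : List (Fin m) → EV m → ℝ}
    (h : ∀ l : List (Fin m), l.length ≤ 2 → D l =ᵐ[volume.restrict Ω] D' l) (φ : EV m → ℝ) :
    ell Ω M D φ = ell Ω M D' φ := by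
  rw [ell, ell]
  refine Finset.sum_congr rfl fun i _ => Finset.sum_congr rfl fun j _ => ?_
  congr 1
  refine integral_congr_ae ?_
  filter_upwards [h [i, j] (by simp), h [j] (by simp)] with x h1 h2
  rw [h1, h2]

/-- Characterisation of the Neumann condition by one system of derivatives. -/
lemma neumann_iff (hΩ : IsOpen Ω) (hp1 : 1 ≤ p) {M : Matrix (Fin m) (Fin m) ℝ} {u : EV m → ℝ}
    {D : List (Fin m) → EV m → ℝ} (hD : IsSobDerivs Ω 2 p u D) :
    NeumannBC Ω M p u ↔ ∀ φ : EV m → ℝ, ContDiff ℝ (⊤ : ℕ∞) φ → HasCompactSupport φ → ell Ω M D φ = 0 := by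
  constructor
  · intro h φ hφ hc
    have hφ1 : ContDiff ℝ 1 φ := hφ.of_le (by exact_mod_cast le_top)
    rw [ell_eq hp1 hD.2.2 hφ1 hc, h D hD φ hφ hc]; ring
  · intro h D' hD' φ hφ hc
    have hφ1 : ContDiff ℝ 1 φ := hφ.of_le (by exact_mod_cast le_top)
    have := h φ hφ hc
    rw [ell_congr (sob_unique hΩ hp1 hD hD'), ell_eq hp1 hD'.2.2 hφ1 hc] at this
    linarith

lemma neumann_lin (hΩ : IsOpen Ω) (hp1 : 1 ≤ p) {M : Matrix (Fin m) (Fin m) ℝ} {u v : EV m → ℝ}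
    (hu : MemWN Ω M 2 p u) (hv : MemWN Ω M 2 p v) (a b : ℝ) : MemWN Ω M 2 p (fun x => a * u x + b * v x) := by
  obtain ⟨⟨D, hD⟩, hN⟩ := hu
  obtain ⟨⟨D', hD'⟩, hN'⟩ := hv
  have hL := sob_lin hp1 hD hD' a b
  refine ⟨⟨_, hL⟩, (neumann_iff hΩ hp1 hL).2 fun φ hφ hc => ?_⟩
  have hφ1 : ContDiff ℝ 1 φ := hφ.of_le (by exact_mod_cast le_top)
  have e1 := (neumann_iff hΩ hp1 hD).1 hN φ hφ hc
  have e2 := (neumann_iff hΩ hp1 hD').1 hN' φ hφ hc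
  have : ell Ω M (fun l x => a * D l x + b * D' l x) φ = a * ell Ω M D φ + b * ell Ω M D' φ := by
    simp only [ell, Finset.mul_sum]
    rw [← Finset.sum_add_distrib]
    refine Finset.sum_congr rfl fun i _ => ?_
    rw [← Finset.sum_add_distrib]
    refine Finset.sum_congr rfl fun j _ => ?_
    have i1 := (int_mul_cc hp1 (hD.2.2 [i, j] (by simp)) hφ1.continuous hc).add
      (int_mul_cc hp1 (hD.2.2 [j] (by simp)) (pd_cont (i := i) hφ1) (pd_cc hc))
    have i2 := (int_mul_cc hp1 (hD'.2.2 [i, j] (by simp)) hφ1.continuous hc).add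
      (int_mul_cc hp1 (hD'.2.2 [j] (by simp)) (pd_cont (i := i) hφ1) (pd_cc hc))
    have f1 : ∀ x, (a * D [i, j] x + b * D' [i, j] x) * φ x + (a * D [j] x + b * D' [j] x) * partialD i φ x
      = a * (D [i, j] x * φ x + D [j] x * partialD i φ x) + b * (D' [i, j] x * φ x + D' [j] x * partialD i φ x) :=
      fun x => by ring
    simp_rw [f1]
    have i3 : Integrable (fun x => a * (D [i, j] x * φ x + D [j] x * partialD i φ x)) (volume.restrict Ω) := i1.const_mul a
    have i4 : Integrable (fun x => b * (D' [i, j] x * φ x + D' [j] x * partialD i φ x)) (volume.restrict Ω) := i2.const_mul b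
    rw [integral_add i3 i4, integral_const_mul, integral_const_mul]
    ring
  rw [this, e1, e2]; ring

end Part14

section Part15

section conv
variable {G : Type*} [NormedAddCommGroup G] [NormedSpace ℝ G] [FiniteDimensional ℝ G]
  [MeasureSpace G] [BorelSpace G] [(volume : Measure G).IsAddHaarMeasure]
variable {X : Type*} [NormedAddCommGroup X] [NormedSpace ℝ X] [CompleteSpace X]

/-- convolution -/
def cnv (κ : G → ℝ) (f : G → X) (x : G) : X := ∫ z, κ z • f (x - z)

lemma cnv_swap (κ : G → ℝ) (f : G → X) (x : G) : cnv κ f x = ∫ z, κ (x - z) • f z :=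
  convolution_lsmul_swap (μ := volume) (f := κ) (g := f) (x := x)

lemma cnv_contDiff {κ : G → ℝ} {f : G → X} {k : ℕ∞} (hκ : ContDiff ℝ k κ) (hc : HasCompactSupport κ)
    (hf : LocallyIntegrable f) : ContDiff ℝ k (cnv κ f) :=
  hc.contDiff_convolution_left (ContinuousLinearMap.lsmul ℝ ℝ) hκ hf

lemma cnv_int {κ : G → ℝ} {f : G → X} (hκ : Continuous κ) (hc : HasCompactSupport κ)
    (hf : LocallyIntegrable f) (x : G) : Integrable (fun z => κ (x - z) • f z) := by
  have := (hc.convolutionExists_left (ContinuousLinearMap.lsmul ℝ ℝ) hκ hf (μ := volume) x)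
  have h2 := this.integrable_swap
  simpa using h2

lemma clm_int_apply {μ : Measure G} {Y : Type*} [NormedAddCommGroup Y] [NormedSpace ℝ Y] {φ : G → Y →L[ℝ] X} (hi : Integrable φ μ) {η : Y} {ψ : G → X}
    (h : ∀ t, φ t η = ψ t) : (∫ t, φ t ∂μ) η = ∫ t, ψ t ∂μ := by
  rw [ContinuousLinearMap.integral_apply hi]; simp_rw [h]

lemma cnv_fderiv {κ : G → ℝ} {f : G → X} (hκ : ContDiff ℝ 1 κ) (hc : HasCompactSupport κ)
    (hf : LocallyIntegrable f) (x η : G) :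
    fderiv ℝ (cnv κ f) x η = ∫ z, (fderiv ℝ κ (x - z) η) • f z := by
  have h := hc.hasFDerivAt_convolution_left (ContinuousLinearMap.lsmul ℝ ℝ) hκ hf (μ := volume) x
  rw [convolution_eq_swap] at h
  have hi := ((hc.fderiv ℝ).convolutionExists_left ((ContinuousLinearMap.lsmul ℝ ℝ).precompL G)
      (hκ.continuous_fderiv one_ne_zero) hf (μ := volume) x).integrable_swap
  have h3 := clm_int_apply hi (η := η) (ψ := fun z => (fderiv ℝ κ (x - z) η) • f z) (fun t => rfl)
  rw [← h3]
  exact congrArg (fun T : G →L[ℝ] X => T η) h.fderiv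

lemma cnv_supp {κ : G → ℝ} {f : G → X} {r : ℝ} (hκ : ∀ z, r ≤ ‖z‖ → κ z = 0) {x : G}
    (h : ∀ z, ‖z‖ < r → f (x - z) = 0) : cnv κ f x = 0 := by
  unfold cnv
  rw [integral_eq_zero_of_ae]
  refine Eventually.of_forall fun z => ?_
  by_cases hz : r ≤ ‖z‖
  · simp [hκ z hz]
  · simp [h z (not_le.1 hz)]

lemma int_fderiv_zero {f : G → X} (hf : ContDiff ℝ 1 f) (hc : HasCompactSupport f) (η : G) :
    ∫ z, fderiv ℝ f z η = 0 := by
  have h := integral_smul_fderiv_eq_neg_fderiv_smul_of_integrable (μ := (volume : Measure G))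
    (f := fun _ : G => (1:ℝ)) (g := f) (v := η) (by simp)
    (by
      simp only [one_smul]
      exact ((hf.continuous_fderiv one_ne_zero).clm_apply continuous_const).integrable_of_hasCompactSupport
        (hc.fderiv_apply ℝ η))
    (by simpa using hf.continuous.integrable_of_hasCompactSupport hc) (by intro x _; fun_prop)
    (fun x _ => hf.differentiable one_ne_zero x)
  simpa using h

end conv

section half
variable {n : ℕ} {X : Type*} [NormedAddCommGroup X] [NormedSpace ℝ X] [CompleteSpace X]

/-- upper half space -/
def UH (n : ℕ) : Set (FV n) := {z | 0 < z.2}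

lemma UH_eq : UH n = (Set.univ : Set (EV n)) ×ˢ Set.Ioi (0:ℝ) := by
  ext z; simp [UH]

lemma UH_meas : MeasurableSet (UH n) := by
  rw [UH_eq]; exact MeasurableSet.univ.prod measurableSet_Ioi

lemma isClosedEmbedding_prodMk_right' {A B : Type*} [TopologicalSpace A] [TopologicalSpace B] [T2Space B] (s : B) :
    IsClosedEmbedding fun a : A => (a, s) := by
  refine ⟨isEmbedding_prodMkLeft s, ?_⟩
  have : Set.range (fun a : A => (a, s)) = (Prod.snd : A × B → B) ⁻¹' {s} := by
    ext ⟨a, b⟩; simp [eq_comm]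
  rw [this]; exact isClosed_singleton.preimage continuous_snd

lemma isClosedEmbedding_prodMk_left' {A B : Type*} [TopologicalSpace A] [TopologicalSpace B] [T2Space A] (s : A) :
    IsClosedEmbedding fun a : B => (s, a) := by
  refine ⟨isEmbedding_prodMkRight s, ?_⟩
  have : Set.range (fun a : B => (s, a)) = (Prod.fst : A × B → A) ⁻¹' {s} := by
    ext ⟨a, b⟩; simp [eq_comm]
  rw [this]; exact isClosed_singleton.preimage continuous_fst

lemma half_ibp {f : FV n → X} (hf : ContDiff ℝ 1 f) (hc : HasCompactSupport f) (η : FV n) :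
    ∫ z in UH n, fderiv ℝ f z η = -(η.2 • ∫ z' : EV n, f (z', 0)) := by
  have hnt : ∀ ζ : FV n, Integrable (fun z => fderiv ℝ f z ζ) := fun ζ =>
    ((hf.continuous_fderiv one_ne_zero).clm_apply continuous_const).integrable_of_hasCompactSupport
        (hc.fderiv_apply ℝ ζ)
  have hd := hf.differentiable one_ne_zero
  have e : ∀ z, fderiv ℝ f z η = fderiv ℝ f z (η.1, 0) + η.2 • fderiv ℝ f z (0, 1) := by
    intro z
    rw [← map_smul, ← map_add]; congr 1; ext <;> simp
  simp_rw [e]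
  have i2 : Integrable (fun z => η.2 • fderiv ℝ f z (0, 1)) (volume.restrict (UH n)) :=
    (hnt _).integrableOn.smul η.2
  rw [integral_add (hnt (η.1, 0)).integrableOn i2, integral_smul]
  have h1 : ∫ z in UH n, fderiv ℝ f z (η.1, 0) = 0 := by
    rw [UH_eq, Measure.volume_eq_prod, ← Measure.prod_restrict, Measure.restrict_univ, integral_prod_symm]
    · have : ∀ s : ℝ, ∫ z' : EV n, fderiv ℝ f (z', s) (η.1, 0) = 0 := by
        intro s
        have hg : ContDiff ℝ 1 fun z' : EV n => f (z', s) := by fun_prop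
        have hgc : HasCompactSupport fun z' : EV n => f (z', s) := by
          refine hc.comp_isClosedEmbedding (g := fun z' : EV n => (z', s)) ?_
          exact isClosedEmbedding_prodMk_right' s
        have := int_fderiv_zero hg hgc η.1
        rw [← this]
        congr 1 with z'
        have : HasFDerivAt (fun z' : EV n => f (z', s)) ((fderiv ℝ f (z', s)).comp
          (ContinuousLinearMap.inl ℝ (EV n) ℝ)) z' := by
          have h3 := HasFDerivAt.comp (g := f) (f := fun w : EV n => (w, s)) z' (hd (z', s)).hasFDerivAt (hasFDerivAt_prodMk_left z' s)
          exact h3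
        rw [this.fderiv]; simp
      simp [this]
    · have := (hnt (η.1, 0)).integrableOn (s := (Set.univ : Set (EV n)) ×ˢ Set.Ioi (0:ℝ))
      rw [IntegrableOn, Measure.volume_eq_prod, ← Measure.prod_restrict, Measure.restrict_univ] at this
      exact this
  have h2 : ∫ z in UH n, fderiv ℝ f z (0, 1) = -∫ z' : EV n, f (z', 0) := by
    rw [UH_eq, Measure.volume_eq_prod, setIntegral_prod _ ((hnt _).integrableOn), Measure.restrict_univ, ← integral_neg]
    congr 1 with z'
    have hg : ContDiff ℝ 1 fun s : ℝ => f (z', s) := by fun_prop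
    have hgc : HasCompactSupport fun s : ℝ => f (z', s) :=
      hc.comp_isClosedEmbedding (g := fun s : ℝ => (z', s)) (isClosedEmbedding_prodMk_left' z')
    rw [← hgc.integral_Ioi_deriv_eq hg 0]
    congr 1 with s
    have h3 := (hd (z', s)).hasFDerivAt.comp_hasDerivAt s
      (HasDerivAt.prodMk (hasDerivAt_const s z') (hasDerivAt_id s))
    exact h3.deriv.symm
  rw [h1, h2]; simp

/-- boundary integral -/
def bdI (κ : FV n → ℝ) (f : FV n → X) (y : FV n) : X := ∫ z' : EV n, κ (y - (z', 0)) • f (z', 0)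

/-- half-space convolution -/
def cnvp (κ : FV n → ℝ) (f : FV n → X) : FV n → X := cnv κ ((UH n).indicator f)

lemma ind_li {f : FV n → X} (hf : Continuous f) : LocallyIntegrable ((UH n).indicator f) :=
  hf.locallyIntegrable.indicator UH_meas

lemma cnvp_eq (κ : FV n → ℝ) (f : FV n → X) (y : FV n) :
    cnvp κ f y = ∫ z in UH n, κ (y - z) • f z := by
  unfold cnvp
  rw [cnv_swap, ← integral_indicator UH_meas]
  congr 1 with z
  by_cases hz : z ∈ UH n <;> simp [hz]

lemma cnvp_fderiv_apply {κ : FV n → ℝ} {f : FV n → X} (hκ : ContDiff ℝ 1 κ) (hc : HasCompactSupport κ)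
    (hf : ContDiff ℝ 1 f) (y η : FV n) :
    fderiv ℝ (cnvp κ f) y η = cnvp κ (fun z => fderiv ℝ f z η) y + η.2 • bdI κ f y := by
  have hcy : HasCompactSupport fun z => κ (y - z) :=
    hc.comp_homeomorph (Homeomorph.subLeft y)
  have hκy : ContDiff ℝ 1 fun z => κ (y - z) := by fun_prop
  have hF : ContDiff ℝ 1 fun z => κ (y - z) • f z := hκy.smul hf
  have hFc : HasCompactSupport fun z => κ (y - z) • f z := hcy.smul_right
  have h := half_ibp hF hFc η
  have e : ∀ z, fderiv ℝ (fun z => κ (y - z) • f z) z η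
      = κ (y - z) • fderiv ℝ f z η - (fderiv ℝ κ (y - z) η) • f z := by
    intro z
    have h1 : HasFDerivAt (fun z => κ (y - z)) ((fderiv ℝ κ (y - z)).comp (-ContinuousLinearMap.id ℝ (FV n))) z := by
      exact HasFDerivAt.comp (g := κ) (f := fun w => y - w) z
        (hκ.differentiable one_ne_zero (y - z)).hasFDerivAt ((hasFDerivAt_id z).const_sub y)
    rw [(h1.fun_smul (hf.differentiable one_ne_zero z).hasFDerivAt).fderiv]
    simp [sub_eq_add_neg]
  simp_rw [e] at h
  have hf' : Continuous fun z => fderiv ℝ f z η := (hf.continuous_fderiv one_ne_zero).clm_apply continuous_const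
  have hκ' : Continuous fun z => fderiv ℝ κ (y - z) η :=
    ((hκ.continuous_fderiv one_ne_zero).comp (continuous_const.sub continuous_id)).clm_apply continuous_const
  have hκc : HasCompactSupport fun z => fderiv ℝ κ (y - z) η :=
    ((hc.fderiv_apply ℝ η)).comp_homeomorph (Homeomorph.subLeft y)
  rw [integral_sub] at h
  · unfold cnvp at *
    rw [cnv_fderiv hκ hc (ind_li hf.continuous)]
    have e2 : ∫ z, fderiv ℝ κ (y - z) η • (UH n).indicator f z
        = ∫ z in UH n, fderiv ℝ κ (y - z) η • f z := by
      rw [← integral_indicator UH_meas]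
      congr 1 with z
      by_cases hz : z ∈ UH n <;> simp [hz]
    rw [e2]
    have := cnvp_eq κ (fun z => fderiv ℝ f z η) y
    unfold cnvp at this
    rw [this]
    unfold bdI
    rw [sub_eq_iff_eq_add] at h
    rw [h]; abel
  · exact ((hκy.continuous.smul hf').integrable_of_hasCompactSupport hcy.smul_right).integrableOn
  · exact ((hκ'.smul hf.continuous).integrable_of_hasCompactSupport hκc.smul_right).integrableOn

lemma cnvp_fderiv {κ : FV n → ℝ} {f : FV n → X} (hκ : ContDiff ℝ 1 κ) (hc : HasCompactSupport κ)
    (hf : ContDiff ℝ 1 f) (y : FV n) :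
    fderiv ℝ (cnvp κ f) y = cnvp κ (fderiv ℝ f) y
      + (ContinuousLinearMap.snd ℝ (EV n) ℝ).smulRight (bdI κ f y) := by
  refine ContinuousLinearMap.ext fun η => ?_
  rw [cnvp_fderiv_apply hκ hc hf]
  simp only [ContinuousLinearMap.add_apply, ContinuousLinearMap.smulRight_apply, ContinuousLinearMap.coe_snd']
  congr 1
  have hi := cnv_int hκ.continuous hc (ind_li (hf.continuous_fderiv one_ne_zero)) y
  unfold cnvp
  rw [cnv_swap, cnv_swap]
  refine (clm_int_apply hi ?_).symm
  intro z
  by_cases hz : z ∈ UH n <;> simp [hz]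

lemma cnvp_contDiff {κ : FV n → ℝ} {f : FV n → X} {k : ℕ∞} (hκ : ContDiff ℝ k κ) (hc : HasCompactSupport κ)
    (hf : Continuous f) : ContDiff ℝ k (cnvp κ f) := cnv_contDiff hκ hc (ind_li hf)

/-- reflection -/
def Rf (n : ℕ) : FV n →L[ℝ] FV n :=
  (ContinuousLinearMap.fst ℝ (EV n) ℝ).prod (-(ContinuousLinearMap.snd ℝ (EV n) ℝ))

@[simp] lemma Rf_apply (y : FV n) : Rf n y = (y.1, -y.2) := rfl

/-- even mollification -/
def evm (κ : FV n → ℝ) (g : FV n → ℝ) (y : FV n) : ℝ := cnvp κ g y + cnvp κ g (Rf n y)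

lemma bdI_even {κ : FV n → ℝ} (he : ∀ y, κ (Rf n y) = κ y) (f : FV n → X) (y : FV n) :
    bdI κ f (Rf n y) = bdI κ f y := by
  unfold bdI
  congr 1 with z'
  have := he (y - (z', 0))
  rw [← this]
  congr 2
  ext <;> simp

lemma evm_fderiv {κ g : FV n → ℝ} (hκ : ContDiff ℝ 1 κ) (hc : HasCompactSupport κ)
    (he : ∀ y, κ (Rf n y) = κ y) (hg : ContDiff ℝ 1 g) (y : FV n) :
    fderiv ℝ (evm κ g) y = cnvp κ (fderiv ℝ g) y + (cnvp κ (fderiv ℝ g) (Rf n y)).comp (Rf n) := by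
  have hd : Differentiable ℝ (cnvp κ g) := by
    have : ContDiff ℝ (1 : ℕ∞) (cnvp κ g) := cnvp_contDiff (by exact_mod_cast hκ) hc hg.continuous
    exact this.differentiable (by simp)
  have h1 := (hd (Rf n y)).hasFDerivAt.comp y (Rf n).hasFDerivAt
  have h2 := ((hd y).hasFDerivAt.add h1).fderiv
  have h3 : fderiv ℝ (evm κ g) y = fderiv ℝ (cnvp κ g) y + (fderiv ℝ (cnvp κ g) (Rf n y)).comp (Rf n) := h2
  rw [h3, cnvp_fderiv hκ hc hg, cnvp_fderiv hκ hc hg, bdI_even he]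
  refine ContinuousLinearMap.ext fun η => ?_
  simp
  ring

lemma evm_fderiv2 {κ g : FV n → ℝ} (hκ : ContDiff ℝ 1 κ) (hc : HasCompactSupport κ)
    (he : ∀ y, κ (Rf n y) = κ y) (hg : ContDiff ℝ 2 g) (y η ζ : FV n) :
    fderiv ℝ (fderiv ℝ (evm κ g)) y η ζ = cnvp κ (fderiv ℝ (fderiv ℝ g)) y η ζ
      + cnvp κ (fderiv ℝ (fderiv ℝ g)) (Rf n y) (Rf n η) (Rf n ζ)
      + 2 * (η.2 * ζ.2) * bdI κ (fderiv ℝ g) y (0, 1) := by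
  have hg1 : ContDiff ℝ 1 g := hg.of_le (by norm_num)
  have hg' : ContDiff ℝ 1 (fderiv ℝ g) := hg.fderiv_right (by norm_num)
  have hd : Differentiable ℝ (cnvp κ (fderiv ℝ g)) := by
    have : ContDiff ℝ (1 : ℕ∞) (cnvp κ (fderiv ℝ g)) :=
      cnvp_contDiff (by exact_mod_cast hκ) hc hg'.continuous
    exact this.differentiable (by simp)
  have h0 : fderiv ℝ (evm κ g) = fun y => cnvp κ (fderiv ℝ g) y + (cnvp κ (fderiv ℝ g) (Rf n y)).comp (Rf n) :=
    funext (evm_fderiv hκ hc he hg1)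
  rw [h0]
  have h1 := (hd (Rf n y)).hasFDerivAt.comp y (Rf n).hasFDerivAt
  have h2 := h1.clm_comp (hasFDerivAt_const (Rf n) y)
  have h3 := ((hd y).hasFDerivAt.add h2).fderiv
  have h4 := congrArg (fun T : FV n →L[ℝ] FV n →L[ℝ] ℝ => T η ζ) h3
  refine Eq.trans h4 ?_
  have e1 : ∀ y η, fderiv ℝ (cnvp κ (fderiv ℝ g)) y η = cnvp κ (fderiv ℝ (fderiv ℝ g)) y η
      + η.2 • bdI κ (fderiv ℝ g) y := by
    intro y η
    rw [cnvp_fderiv hκ hc hg']; rfl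
  have e2 : fderiv ℝ (cnvp κ (fderiv ℝ g)) (Rf n y) (Rf n η) (Rf n ζ) =
     cnvp κ (fderiv ℝ (fderiv ℝ g)) (Rf n y) (Rf n η) (Rf n ζ) + (-η.2) * bdI κ (fderiv ℝ g) y (Rf n ζ) := by
    rw [e1, bdI_even he]; rfl
  have e3 : bdI κ (fderiv ℝ g) y ζ = bdI κ (fderiv ℝ g) y (ζ.1, 0) + ζ.2 * bdI κ (fderiv ℝ g) y (0, 1) := by
    rw [← smul_eq_mul, ← map_smul, ← map_add]; congr 1; ext <;> simp
  have e4 : bdI κ (fderiv ℝ g) y (Rf n ζ) = bdI κ (fderiv ℝ g) y (ζ.1, 0) - ζ.2 * bdI κ (fderiv ℝ g) y (0, 1) := by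
    rw [← smul_eq_mul, ← map_smul, ← map_sub]; congr 1; ext <;> simp
  have e5 : fderiv ℝ (cnvp κ (fderiv ℝ g)) y η ζ = cnvp κ (fderiv ℝ (fderiv ℝ g)) y η ζ
      + η.2 * bdI κ (fderiv ℝ g) y ζ := by
    rw [e1]; rfl
  have e6 : (fderiv ℝ (cnvp κ (fderiv ℝ g)) y η ζ + fderiv ℝ (cnvp κ (fderiv ℝ g)) (Rf n y) (Rf n η) (Rf n ζ))
    = cnvp κ (fderiv ℝ (fderiv ℝ g)) y η ζ
      + cnvp κ (fderiv ℝ (fderiv ℝ g)) (Rf n y) (Rf n η) (Rf n ζ)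
      + 2 * (η.2 * ζ.2) * bdI κ (fderiv ℝ g) y (0, 1) := by
    rw [e5, e2, e3, e4]; ring
  rw [← e6]
  simp

end half

end Part15

section Part16

section jetL
variable {X : Type*} [NormedAddCommGroup X] [NormedSpace ℝ X]

@[simp] lemma Jet.smul_a (r : ℝ) (s : Jet X) : (r • s).a = r * s.a := rfl
@[simp] lemma Jet.smul_b (r : ℝ) (s : Jet X) : (r • s).b = r • s.b := rfl
@[simp] lemma Jet.smul_c (r : ℝ) (s : Jet X) : (r • s).c = r • s.c := rfl

def JLa : Jet X →L[ℝ] ℝ := LinearMap.mkContinuous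
  { toFun := fun s : Jet X => s.a, map_add' := fun _ _ => rfl, map_smul' := fun _ _ => rfl } 1
  (fun s => (Jet.norm_a s).trans_eq (one_mul _).symm)
def JLb : Jet X →L[ℝ] (X →L[ℝ] ℝ) := LinearMap.mkContinuous
  { toFun := fun s : Jet X => s.b, map_add' := fun _ _ => rfl, map_smul' := fun _ _ => rfl } 1
  (fun s => (Jet.norm_b s).trans_eq (one_mul _).symm)
def JLc : Jet X →L[ℝ] (X →L[ℝ] X →L[ℝ] ℝ) := LinearMap.mkContinuous
  { toFun := fun s : Jet X => s.c, map_add' := fun _ _ => rfl, map_smul' := fun _ _ => rfl } 1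
  (fun s => (Jet.norm_c s).trans_eq (one_mul _).symm)
lemma JLa_apply (s : Jet X) : JLa s = s.a := rfl
lemma JLb_apply (s : Jet X) : JLb s = s.b := rfl
lemma JLc_apply (s : Jet X) : JLc s = s.c := rfl
end jetL

section conv
variable {G : Type*} [NormedAddCommGroup G] [NormedSpace ℝ G] [FiniteDimensional ℝ G]
  [MeasureSpace G] [BorelSpace G] [(volume : Measure G).IsAddHaarMeasure]
variable {X : Type*} [NormedAddCommGroup X] [NormedSpace ℝ X] [CompleteSpace X]
variable {Y : Type*} [NormedAddCommGroup Y] [NormedSpace ℝ Y] [CompleteSpace Y]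

lemma cnv_clm (T : X →L[ℝ] Y) {κ : G → ℝ} {f : G → X} (hκ : Continuous κ) (hc : HasCompactSupport κ)
    (hf : LocallyIntegrable f) (x : G) : T (cnv κ f x) = cnv κ (fun z => T (f z)) x := by
  rw [cnv_swap, cnv_swap, ← ContinuousLinearMap.integral_comp_comm _ (cnv_int hκ hc hf x)]
  simp_rw [map_smul]

lemma cnvp_clm {n : ℕ} (T : X →L[ℝ] Y) {κ : FV n → ℝ} {f : FV n → X} (hκ : Continuous κ) (hc : HasCompactSupport κ)
    (hf : Continuous f) (x : FV n) : T (cnvp κ f x) = cnvp κ (fun z => T (f z)) x := by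
  unfold cnvp
  rw [cnv_clm T hκ hc (ind_li hf)]
  congr 1
  ext z
  by_cases hz : z ∈ UH n <;> simp [hz]
end conv

section rj
variable {n : ℕ}
lemma Rf_norm (y : FV n) : ‖Rf n y‖ = ‖y‖ := by
  simp [Prod.norm_def]

lemma Rf_op : ‖Rf n‖ ≤ 1 := ContinuousLinearMap.opNorm_le_bound _ zero_le_one (fun y => by rw [Rf_norm, one_mul])

lemma Rf_mp : MeasurePreserving (Rf n) volume volume := by
  have h := (MeasurePreserving.id (volume : Measure (EV n))).prod (Measure.measurePreserving_neg (volume : Measure ℝ))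
  exact h

lemma Rf_Rf (y : FV n) : Rf n (Rf n y) = y := by ext <;> simp

/-- reflected jet -/
def Rj (s : Jet (FV n)) : Jet (FV n) :=
  mkJ s.a (s.b.comp (Rf n)) ((((ContinuousLinearMap.compL ℝ (FV n) (FV n) ℝ).flip (Rf n)).comp s.c).comp (Rf n))

lemma Rj_c (s : Jet (FV n)) (η ζ : FV n) : (Rj s).c η ζ = s.c (Rf n η) (Rf n ζ) := rfl
lemma Rj_b (s : Jet (FV n)) (η : FV n) : (Rj s).b η = s.b (Rf n η) := rfl
lemma Rj_a (s : Jet (FV n)) : (Rj s).a = s.a := rfl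

lemma Rj_norm (s : Jet (FV n)) : ‖Rj s‖ ≤ ‖s‖ := by
  refine Jet.norm_le (Jet.norm_a s) ?_ ?_
  · refine ContinuousLinearMap.opNorm_le_bound _ (norm_nonneg _) fun η => ?_
    rw [Rj_b]
    refine (s.b.le_opNorm _).trans ?_
    rw [Rf_norm]
    gcongr; exact Jet.norm_b s
  · refine ContinuousLinearMap.opNorm_le_bound₂ _ (norm_nonneg _) fun η ζ => ?_
    rw [Rj_c]
    refine (s.c.le_opNorm₂ _ _).trans ?_
    rw [Rf_norm, Rf_norm]
    gcongr; exact Jet.norm_c s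

lemma Rj_sub (s t : Jet (FV n)) : Rj (s - t) = Rj s - Rj t := by
  refine Jet.ext' ?_ ?_ ?_
  · simp [Rj_a]
  · refine ContinuousLinearMap.ext fun η => ?_
    simp [Rj_b]
  · refine ContinuousLinearMap.ext fun η => ContinuousLinearMap.ext fun ζ => ?_
    simp [Rj_c]

lemma Rj_zero : Rj (0 : Jet (FV n)) = 0 := by
  have := Rj_sub (0 : Jet (FV n)) 0
  simpa using this

/-- upper half jet -/
def Gp (g : FV n → ℝ) : FV n → Jet (FV n) := (UH n).indicator (jj g)

/-- reflected jets -/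
def Jd (g : FV n → ℝ) (y : FV n) : Jet (FV n) := Gp g y + Rj (Gp g (Rf n y))

lemma Jd_UH (g : FV n → ℝ) {y : FV n} (hy : y ∈ UH n) : Jd g y = jj g y := by
  have h2 : Rf n y ∉ UH n := by
    simp only [UH, Set.mem_ofPred_eq, Rf_apply, not_lt] at *; linarith
  unfold Jd Gp
  rw [Set.indicator_of_mem hy, Set.indicator_of_notMem h2, Rj_zero, add_zero]

lemma evm_jet {κ g : FV n → ℝ} (hκ : ContDiff ℝ 1 κ) (hc : HasCompactSupport κ)
    (he : ∀ y, κ (Rf n y) = κ y) (hg : ContDiff ℝ 2 g) (y : FV n) :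
    ‖jj (evm κ g) y - Jd g y‖ ≤ ‖cnv κ (Gp g) y - Gp g y‖ + ‖cnv κ (Gp g) (Rf n y) - Gp g (Rf n y)‖
      + 2 * ‖bdI κ (fun z => fderiv ℝ g z (0, 1)) y‖ := by
  have hj := jj_continuous hg
  have hg1 : ContDiff ℝ 1 g := hg.of_le (by norm_num)
  have hg' : ContDiff ℝ 1 (fderiv ℝ g) := hg.fderiv_right (by norm_num)
  set K := cnvp κ (jj g) with hK
  have ka : ∀ y, (K y).a = cnvp κ g y := fun y => cnvp_clm JLa hκ.continuous hc hj y
  have kb : ∀ y, (K y).b = cnvp κ (fderiv ℝ g) y := fun y => cnvp_clm JLb hκ.continuous hc hj y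
  have kc : ∀ y, (K y).c = cnvp κ (fderiv ℝ (fderiv ℝ g)) y := by
    intro y
    have h := cnvp_clm (Y := FV n →L[ℝ] FV n →L[ℝ] ℝ) (JLc (X := FV n)) hκ.continuous hc hj y
    exact h
  have hbd : bdI κ (fderiv ℝ g) y (0, 1) = bdI κ (fun z => fderiv ℝ g z (0, 1)) y := by
    unfold bdI
    have hcl := isClosedEmbedding_prodMk_right' (A := EV n) (0:ℝ)
    have hi : Integrable fun z' : EV n => κ (y - (z', 0)) • fderiv ℝ g (z', 0) := by
      refine Continuous.integrable_of_hasCompactSupport ?_ ?_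
      · have := hκ.continuous
        have h2 := hg'.continuous
        fun_prop
      · have : HasCompactSupport fun z => κ (y - z) := hc.comp_homeomorph (Homeomorph.subLeft y)
        exact (this.comp_isClosedEmbedding hcl).smul_right
    exact clm_int_apply hi fun t => rfl
  set bb := bdI κ (fun z => fderiv ℝ g z (0, 1)) y with hbb
  set S : FV n →L[ℝ] FV n →L[ℝ] ℝ :=
    (ContinuousLinearMap.snd ℝ (EV n) ℝ).smulRight ((2 * bb) • ContinuousLinearMap.snd ℝ (EV n) ℝ) with hS
  have hSn : ‖S‖ ≤ 2 * ‖bb‖ := by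
    refine ContinuousLinearMap.opNorm_le_bound₂ _ (by positivity) fun η ζ => ?_
    have e : S η ζ = η.2 * (2 * bb * ζ.2) := rfl
    rw [e, norm_mul, norm_mul, norm_mul]
    have h1 : ‖η.2‖ ≤ ‖η‖ := norm_snd_le η
    have h2 : ‖ζ.2‖ ≤ ‖ζ‖ := norm_snd_le ζ
    calc ‖η.2‖ * (‖(2:ℝ)‖ * ‖bb‖ * ‖ζ.2‖) ≤ ‖η‖ * (‖(2:ℝ)‖ * ‖bb‖ * ‖ζ‖) := by gcongr
      _ = _ := by simp; ring
  have key : jj (evm κ g) y = K y + Rj (K (Rf n y)) + mkJ 0 0 S := by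
    refine Jet.ext' ?_ ?_ ?_
    · simp [Rj_a, ka, evm, jj]
    · refine ContinuousLinearMap.ext fun η => ?_
      have := congrArg (fun T : FV n →L[ℝ] ℝ => T η) (evm_fderiv hκ hc he hg1 y)
      simp only [Jet.add_b, ContinuousLinearMap.add_apply, Rj_b, kb] at *
      refine Eq.trans this ?_
      simp
    · refine ContinuousLinearMap.ext fun η => ContinuousLinearMap.ext fun ζ => ?_
      have := evm_fderiv2 hκ hc he hg y η ζ
      simp only [Jet.add_c, ContinuousLinearMap.add_apply, Rj_c, kc] at *
      refine Eq.trans this ?_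
      rw [hbd]
      have e : (mkJ (0:ℝ) (0 : FV n →L[ℝ] ℝ) S).c η ζ = η.2 * (2 * bb * ζ.2) := rfl
      rw [e]; ring
  have e : jj (evm κ g) y - Jd g y = (K y - Gp g y) + Rj (K (Rf n y) - Gp g (Rf n y)) + mkJ 0 0 S := by
    rw [key, Jd, Rj_sub]; abel
  rw [e]
  refine (norm_add_le _ _).trans (add_le_add ((norm_add_le _ _).trans (add_le_add le_rfl (Rj_norm _))) ?_)
  refine Jet.norm_le ?_ ?_ ?_
  · simp
  · simp
  · exact hSn

end rj

end Part16

section Part17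

/-- admissible mollifier -/
def Mol {G : Type*} [NormedAddCommGroup G] [NormedSpace ℝ G] [MeasureSpace G] (r : ℝ) (κ : G → ℝ) : Prop :=
  ContDiff ℝ (⊤ : ℕ∞) κ ∧ (∀ z, 0 ≤ κ z) ∧ HasCompactSupport κ ∧ ∫ z, κ z = 1 ∧ ∀ z, r ≤ ‖z‖ → κ z = 0

lemma exists_mol {m : ℕ} {r : ℝ} (hr : 0 < r) : ∃ κ : EV m → ℝ, Mol r κ := by
  let a : ContDiffBump (0 : EV m) := ⟨r / 2, r, by positivity, by linarith⟩
  refine ⟨a.normed volume, a.contDiff_normed, fun z => a.nonneg_normed z, a.hasCompactSupport_normed,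
    a.integral_normed, fun z hz => ?_⟩
  have : z ∉ Function.support (a.normed volume) := by
    rw [a.support_normed_eq]; simpa [a] using hz
  simpa using this

lemma exists_molF {n : ℕ} {r : ℝ} (hr : 0 < r) : ∃ κ : FV n → ℝ, Mol r κ ∧ ∀ y, κ (Rf n y) = κ y := by
  obtain ⟨a, a1, a2, a3, a4, a5⟩ := exists_mol (m := n) hr
  let b : ContDiffBump (0 : ℝ) := ⟨r / 2, r, by positivity, by linarith⟩
  have b5 : ∀ z, r ≤ ‖z‖ → b.normed volume z = 0 := by
    intro z hz
    have : z ∉ Function.support (b.normed volume) := by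
      rw [b.support_normed_eq]; simpa [b] using hz
    simpa using this
  refine ⟨fun y => a y.1 * b.normed volume y.2, ⟨?_, ?_, ?_, ?_, ?_⟩, ?_⟩
  · exact (a1.comp contDiff_fst).mul (b.contDiff_normed.comp contDiff_snd)
  · exact fun z => mul_nonneg (a2 _) (b.nonneg_normed _)
  · refine HasCompactSupport.intro (a3.isCompact.prod (b.hasCompactSupport_normed (μ := volume)).isCompact) fun x hx => ?_
    rw [Set.mem_prod, not_and_or] at hx
    rcases hx with h | h
    · simp [image_eq_zero_of_notMem_tsupport h]
    · rw [image_eq_zero_of_notMem_tsupport h, mul_zero]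
  · rw [Measure.volume_eq_prod, integral_prod_mul (f := a), a4, b.integral_normed, mul_one]
  · intro z hz
    rw [Prod.norm_def, le_max_iff] at hz
    rcases hz with h | h
    · simp [a5 _ h]
    · simp [b5 _ h]
  · intro y
    simp only [Rf_apply]
    congr 1
    exact b.normed_neg y.2

section sel
variable {n : ℕ} {p : ℝ≥0∞}

lemma Gp_meas {g : FV n → ℝ} (hg : ContDiff ℝ 2 g) : AEStronglyMeasurable (Gp g) volume :=
  ((jj_continuous hg).aestronglyMeasurable).indicator UH_meas

lemma Gp_norm (g : FV n → ℝ) : eLpNorm (Gp g) p volume = eLpNorm (jj g) p (volume.restrict (UH n)) :=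
  eLpNorm_indicator_eq_eLpNorm_restrict UH_meas

lemma Gp_sub {g h : FV n → ℝ} (hg : ContDiff ℝ 2 g) (hh : ContDiff ℝ 2 h) :
    Gp (fun y => g y - h y) = Gp g - Gp h := by
  ext1 y
  simp only [Gp, Pi.sub_apply]
  by_cases hy : y ∈ UH n
  · simp [hy, jj_sub hg hh]
  · simp [hy]

lemma Gp_memLp {g : FV n → ℝ} (hg : ContDiff ℝ 2 g) (hc : HasCompactSupport g) : MemLp (Gp g) p volume :=
  ((jj_continuous hg).memLp_of_hasCompactSupport (jj_compact hc)).indicator UH_meas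

lemma cnv_sub' {κ : FV n → ℝ} (hκ : Continuous κ) (hc : HasCompactSupport κ) {f g : FV n → Jet (FV n)}
    (hf : LocallyIntegrable f) (hg : LocallyIntegrable g) : cnv κ (f - g) = cnv κ f - cnv κ g := by
  ext1 x
  rw [Pi.sub_apply, cnv_swap, cnv_swap, cnv_swap, ← integral_sub (cnv_int hκ hc hf x) (cnv_int hκ hc hg x)]
  congr 1; ext1 z
  rw [Pi.sub_apply, smul_sub]

lemma evm_Lp (hp1 : 1 ≤ p) {κ g : FV n → ℝ} {r : ℝ} (hκ : Mol r κ)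
    (he : ∀ y, κ (Rf n y) = κ y) (hg : ContDiff ℝ 2 g) :
    eLpNorm (jj (evm κ g) - Jd g) p volume ≤ 2 * eLpNorm (cnv κ (Gp g) - Gp g) p volume
      + 2 * eLpNorm (bdI κ (fun z => fderiv ℝ g z (0, 1))) p volume := by
  have hκ1 : ContDiff ℝ 1 κ := hκ.1.of_le (by exact_mod_cast le_top)
  have hl : LocallyIntegrable (Gp g) := ind_li (jj_continuous hg)
  have hcm : Continuous (cnv κ (Gp g)) := by
    have : ContDiff ℝ (1 : ℕ∞) (cnv κ (Gp g)) := cnv_contDiff (by exact_mod_cast hκ1) hκ.2.2.1 hl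
    exact this.continuous
  have m1 : AEStronglyMeasurable (cnv κ (Gp g) - Gp g) volume := hcm.aestronglyMeasurable.sub (Gp_meas hg)
  have m2 : AEStronglyMeasurable (fun y => (cnv κ (Gp g) - Gp g) (Rf n y)) volume :=
    m1.comp_measurePreserving Rf_mp
  have hg' : Continuous (fun z => fderiv ℝ g z (0, 1)) :=
    ((hg.continuous_fderiv (by norm_num))).clm_apply continuous_const
  have m3 : AEStronglyMeasurable (bdI κ (fun z => fderiv ℝ g z (0, 1))) volume := by
    have : StronglyMeasurable (fun y => ∫ z' : EV n, κ (y - (z', 0)) • fderiv ℝ g (z', 0) (0, 1)) := by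
      refine StronglyMeasurable.integral_prod_right' (f := fun q : FV n × EV n => κ (q.1 - (q.2, 0)) • fderiv ℝ g (q.2, 0) (0, 1)) ?_
      refine Continuous.stronglyMeasurable ?_
      have := hκ.1.continuous
      have h2 : Continuous fun q : FV n × EV n => fderiv ℝ g (q.2, 0) (0, 1) :=
        hg'.comp (by fun_prop : Continuous fun q : FV n × EV n => ((q.2, 0) : FV n))
      exact (by fun_prop : Continuous fun q : FV n × EV n => κ (q.1 - (q.2, 0))).smul h2
    exact this.aestronglyMeasurable
  have hle : eLpNorm (jj (evm κ g) - Jd g) p volume ≤ eLpNorm (fun y => ‖(cnv κ (Gp g) - Gp g) y‖ +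
      ‖(cnv κ (Gp g) - Gp g) (Rf n y)‖ + 2 * ‖bdI κ (fun z => fderiv ℝ g z (0, 1)) y‖) p volume := by
    refine eLpNorm_mono_real fun y => ?_
    exact evm_jet hκ1 hκ.2.2.1 he hg y
  refine hle.trans ?_
  refine (eLpNorm_add_le (m1.norm.add m2.norm) (m3.norm.const_mul 2) hp1).trans ?_
  refine add_le_add ((eLpNorm_add_le m1.norm m2.norm hp1).trans ?_) ?_
  · rw [eLpNorm_norm, eLpNorm_norm, two_mul]
    refine add_le_add le_rfl ?_
    exact (eLpNorm_comp_measurePreserving m1 Rf_mp).le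
  · have : (fun y => 2 * ‖bdI κ (fun z => fderiv ℝ g z (0, 1)) y‖) = (2:ℝ) • fun y => ‖bdI κ (fun z => fderiv ℝ g z (0, 1)) y‖ := by
      ext y; simp
    rw [this, eLpNorm_const_smul, eLpNorm_norm]
    gcongr
    rw [← ofReal_norm]; simp

lemma Jd_sub_Lp (hp1 : 1 ≤ p) {g h : FV n → ℝ} (hg : ContDiff ℝ 2 g) (hh : ContDiff ℝ 2 h) :
    eLpNorm (Jd g - Jd h) p volume ≤ 2 * eLpNorm (fun y => jj g y - jj h y) p (volume.restrict (UH n)) := by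
  have m1 : AEStronglyMeasurable (Gp g - Gp h) volume := (Gp_meas hg).sub (Gp_meas hh)
  have m2 : AEStronglyMeasurable (fun y => (Gp g - Gp h) (Rf n y)) volume := m1.comp_measurePreserving Rf_mp
  have hle : eLpNorm (Jd g - Jd h) p volume ≤ eLpNorm (fun y => ‖(Gp g - Gp h) y‖ +
      ‖(Gp g - Gp h) (Rf n y)‖) p volume := by
    refine eLpNorm_mono_real fun y => ?_
    have : (Jd g - Jd h) y = (Gp g - Gp h) y + Rj ((Gp g - Gp h) (Rf n y)) := by
      simp only [Pi.sub_apply, Rj_sub, Jd]; abel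
    rw [this]
    exact (norm_add_le _ _).trans (add_le_add le_rfl (Rj_norm _))
  have e : eLpNorm (Gp g - Gp h) p volume = eLpNorm (fun y => jj g y - jj h y) p (volume.restrict (UH n)) := by
    rw [← Gp_sub hg hh, Gp_norm]
    congr 1; ext1 y; exact jj_sub hg hh y
  refine hle.trans ((eLpNorm_add_le m1.norm m2.norm hp1).trans ?_)
  rw [eLpNorm_norm, eLpNorm_norm, two_mul, ← e]
  refine add_le_add le_rfl ?_
  exact (eLpNorm_comp_measurePreserving m1 Rf_mp).le

lemma flat_select (hp1 : 1 ≤ p) (hp : p ≠ ⊤) {g : ℕ → FV n → ℝ} (hg : ∀ k, ContDiff ℝ 2 (g k))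
    (hc : ∀ k, HasCompactSupport (g k))
    (hCau : ∀ η : ℝ≥0∞, 0 < η → ∃ N, ∀ k ≥ N, ∀ l ≥ N,
      eLpNorm (fun y => jj (g k) y - jj (g l) y) p (volume.restrict (UH n)) ≤ η)
    (hbd : ∀ r κ, Mol r κ → Tendsto (fun k => eLpNorm (bdI κ (fun z => fderiv ℝ (g k) z (0, 1))) p volume) atTop (𝓝 0))
    {r0 : ℝ} (hr0 : 0 < r0) {η : ℝ≥0∞} (hη : 0 < η) (N : ℕ) :
    ∃ k ≥ N, ∃ κ : FV n → ℝ, Mol r0 κ ∧ (∀ y, κ (Rf n y) = κ y) ∧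
      eLpNorm (jj (evm κ (g k)) - Jd (g k)) p volume ≤ η := by
  set ζ := η / 8 with hζ
  have hζ0 : 0 < ζ := ENNReal.div_pos hη.ne' (by simp)
  obtain ⟨k0, hk0⟩ := hCau ζ hζ0
  obtain ⟨r, hr, hmo⟩ := moll_conv volume p hp1 hp (Gp (g k0)) (Gp_memLp (hg k0) (hc k0)) ζ hζ0
  obtain ⟨κ, hκ, he⟩ := exists_molF (n := n) (r := min r r0) (lt_min hr hr0)
  have h1 := hmo κ hκ.1.continuous hκ.2.1 hκ.2.2.1 hκ.2.2.2.1 fun z hz => hκ.2.2.2.2 z ((min_le_left _ _).trans hz)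
  have hκ0 : Mol r0 κ := ⟨hκ.1, hκ.2.1, hκ.2.2.1, hκ.2.2.2.1, fun z hz => hκ.2.2.2.2 z ((min_le_right _ _).trans hz)⟩
  obtain ⟨k, hkN, hkb⟩ := ((eventually_ge_atTop (max N k0)).and ((hbd _ κ hκ).eventually (Iic_mem_nhds hζ0))).exists
  refine ⟨k, (le_max_left _ _).trans hkN, κ, hκ0, he, ?_⟩
  refine (evm_Lp hp1 hκ he (hg k)).trans ?_
  have li : ∀ k, LocallyIntegrable (Gp (g k)) := fun k => ind_li (jj_continuous (hg k))
  have hcm : ∀ k, Continuous (cnv κ (Gp (g k))) := fun k => by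
    have : ContDiff ℝ (1 : ℕ∞) (cnv κ (Gp (g k))) := cnv_contDiff (hκ.1.of_le (by exact_mod_cast le_top)) hκ.2.2.1 (li k)
    exact this.continuous
  have hd : eLpNorm (Gp (g k) - Gp (g k0)) p volume ≤ ζ := by
    rw [← Gp_sub (hg k) (hg k0), Gp_norm]
    refine le_of_eq_of_le ?_ (hk0 k ((le_max_right _ _).trans hkN) k0 le_rfl)
    congr 1; ext1 y; exact jj_sub (hg k) (hg k0) y
  have m1 : AEStronglyMeasurable (Gp (g k) - Gp (g k0)) volume := (Gp_meas (hg k)).sub (Gp_meas (hg k0))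
  have e1 : cnv κ (Gp (g k)) - Gp (g k) = (cnv κ (Gp (g k) - Gp (g k0)) + (cnv κ (Gp (g k0)) - Gp (g k0)))
      - (Gp (g k) - Gp (g k0)) := by
    rw [cnv_sub' hκ.1.continuous hκ.2.2.1 (li k) (li k0)]; abel
  have hc2 : eLpNorm (cnv κ (Gp (g k) - Gp (g k0))) p volume ≤ ζ :=
    (moll_le volume p hp1 hp _ m1 κ hκ.1.continuous hκ.2.1 hκ.2.2.1 hκ.2.2.2.1).trans hd
  have m3 : AEStronglyMeasurable (cnv κ (Gp (g k) - Gp (g k0))) volume := by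
    rw [cnv_sub' hκ.1.continuous hκ.2.2.1 (li k) (li k0)]
    exact ((hcm k).sub (hcm k0)).aestronglyMeasurable
  have m4 : AEStronglyMeasurable (cnv κ (Gp (g k0)) - Gp (g k0)) volume :=
    (hcm k0).aestronglyMeasurable.sub (Gp_meas (hg k0))
  have h5 : eLpNorm (cnv κ (Gp (g k)) - Gp (g k)) p volume ≤ ζ + ζ + ζ := by
    rw [e1]
    refine (eLpNorm_sub_le (m3.add m4) m1 hp1).trans (add_le_add ((eLpNorm_add_le m3 m4 hp1).trans
      (add_le_add hc2 h1)) hd)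
  calc _ ≤ 2 * (ζ + ζ + ζ) + 2 * ζ := by gcongr
    _ = 8 * ζ := by ring
    _ = η := by rw [hζ]; exact ENNReal.mul_div_cancel (by simp) (by simp)
end sel

end Part17

section Part18

section P18
variable {n : ℕ} {P : FV n ≃L[ℝ] EV (n + 1)} {γ : EV n → ℝ}

lemma shear_me (hγ : Continuous γ) : MeasurableEmbedding (shear P γ) := by
  refine (shear_cont hγ).measurableEmbedding ?_
  intro y z h
  have h1 : y.2 = z.2 := by rw [← ff_shear (P := P) (γ := γ) y, h, ff_shear]
  have h2 := P.injective h
  exact Prod.ext (Prod.mk.inj h2).1 h1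

lemma ff_cont (hγ : Continuous γ) : Continuous (ff P γ) := by
  unfold ff; fun_prop

lemma shear_contDiff {k : WithTop ℕ∞} (hγ : ContDiff ℝ k γ) : ContDiff ℝ k (shear P γ) := by
  unfold shear
  refine P.contDiff.comp ?_
  exact contDiff_fst.prodMk ((hγ.comp contDiff_fst).add contDiff_snd)

lemma shear_fderiv (hγ : Differentiable ℝ γ) (y : FV n) :
    HasFDerivAt (shear P γ) ((P : FV n →L[ℝ] EV (n + 1)).comp
      ((ContinuousLinearMap.fst ℝ (EV n) ℝ).prod
        ((fderiv ℝ γ y.1).comp (ContinuousLinearMap.fst ℝ (EV n) ℝ) + ContinuousLinearMap.snd ℝ (EV n) ℝ))) y := by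
  unfold shear
  refine P.hasFDerivAt.comp y ?_
  refine HasFDerivAt.prodMk hasFDerivAt_fst ?_
  exact ((hγ y.1).hasFDerivAt.comp y hasFDerivAt_fst).add hasFDerivAt_snd

lemma shear_cc (hγ : Continuous γ) {X : Type*} [Zero X] {f : EV (n + 1) → X} (hc : HasCompactSupport f) :
    HasCompactSupport (fun y => f (shear P γ y)) := by
  have hK : IsCompact ((fun x => ((P.symm x).1, ff P γ x)) '' tsupport f) := by
    refine hc.isCompact.image ?_
    have := ff_cont (P := P) hγ
    fun_prop
  refine HasCompactSupport.intro hK fun y hy => ?_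
  by_contra h
  refine hy ⟨shear P γ y, subset_closure h, ?_⟩
  have : (P.symm (shear P γ y)).1 = y.1 := by simp [shear]
  exact Prod.ext this (ff_shear y)

lemma graph_green (hP : IsoP P) (hγ : ContDiff ℝ 2 γ) {X : EV (n + 1) → ℝ} (hX : ContDiff ℝ 1 X)
    (hc : HasCompactSupport X) (ξ : EV (n + 1)) :
    ∫ x in {x | 0 < ff P γ x}, fderiv ℝ X x ξ
      = - ∫ z' : EV n, X (shear P γ (z', 0)) * inner ℝ (nuv P γ z') ξ := by
  have hγc := hγ.continuous
  have hγd : Differentiable ℝ γ := hγ.differentiable (by norm_num)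
  obtain ⟨⟨a, t⟩, rfl⟩ := P.surjective ξ
  have e0 : (shear P γ) ⁻¹' {x | 0 < ff P γ x} = UH n := by
    ext y; simp [UH, ff_shear]
  rw [← (shear_mp hP hγc).setIntegral_preimage_emb (shear_me hγc), e0]
  set f : FV n → ℝ := fun y => X (shear P γ y) with hfdef
  have hf1 : ContDiff ℝ 1 f := hX.comp ((shear_contDiff hγ).of_le (by norm_num))
  have hfc : HasCompactSupport f := shear_cc hγc hc
  have hfd : ∀ y, HasFDerivAt f _ y := fun y =>
    HasFDerivAt.comp (g := X) (f := shear P γ) y ((hX.differentiable (by norm_num)) _).hasFDerivAt (shear_fderiv hγd y)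
  set τ : FV n → ℝ := fun y => t - fderiv ℝ γ y.1 a with hτ
  have hτ1 : ContDiff ℝ 1 τ := by
    refine contDiff_const.sub ?_
    have h1 : ContDiff ℝ 1 (fderiv ℝ γ) := hγ.fderiv_right (by norm_num)
    exact (h1.comp contDiff_fst).clm_apply contDiff_const
  have hτ0 : ∀ y, fderiv ℝ τ y (0, 1) = 0 := by
    intro y
    have h1 : HasFDerivAt τ (fderiv ℝ τ y) (y + (0:ℝ) • ((0, 1) : FV n)) := by
      simpa using (hτ1.differentiable (by norm_num) y).hasFDerivAt
    have h2 : HasDerivAt (fun s : ℝ => y + s • ((0, 1) : FV n)) ((0, 1) : FV n) 0 := by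
      simpa using ((hasDerivAt_id (0:ℝ)).smul_const ((0, 1) : FV n)).const_add y
    have h3 := h1.comp_hasDerivAt (0:ℝ) h2
    have h4 : (τ ∘ fun s : ℝ => y + s • ((0, 1) : FV n)) = fun _ => τ y := by
      funext s; simp [hτ]
    rw [h4] at h3
    exact h3.unique (hasDerivAt_const _ _)
  have e1 : ∀ y, fderiv ℝ X (shear P γ y) (P (a, t)) = fderiv ℝ f y (a, 0) + fderiv ℝ (fun z => τ z * f z) y (0, 1) := by
    intro y
    have h1 : fderiv ℝ (fun z => τ z * f z) y (0, 1) = τ y * fderiv ℝ f y (0, 1) := by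
      rw [fderiv_fun_mul (hτ1.differentiable (by norm_num) y) (hf1.differentiable (by norm_num) y)]
      simp [hτ0]
    rw [h1, (hfd y).fderiv]
    simp only [ContinuousLinearMap.comp_apply, ContinuousLinearMap.prod_apply, ContinuousLinearMap.coe_fst',
      ContinuousLinearMap.add_apply, ContinuousLinearMap.coe_snd', map_zero, zero_add, add_zero,
      ContinuousLinearEquiv.coe_coe]
    rw [← smul_eq_mul, ← map_smul, ← map_smul, ← map_add, ← map_add]
    congr 2
    refine Prod.ext ?_ ?_
    · simp
    · simp [hτ]
  have hτf : ContDiff ℝ 1 (fun z => τ z * f z) := hτ1.mul hf1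
  have hτc : HasCompactSupport (fun z => τ z * f z) := hfc.mul_left
  have i1 : Integrable (fun y => fderiv ℝ f y (a, 0)) :=
    ((hf1.continuous_fderiv (by norm_num)).clm_apply continuous_const).integrable_of_hasCompactSupport
      (hfc.fderiv_apply (𝕜 := ℝ) _)
  have i2 : Integrable (fun y => fderiv ℝ (fun z => τ z * f z) y (0, 1)) :=
    ((hτf.continuous_fderiv (by norm_num)).clm_apply continuous_const).integrable_of_hasCompactSupport
      (hτc.fderiv_apply (𝕜 := ℝ) _)
  simp_rw [e1]
  rw [integral_add i1.integrableOn i2.integrableOn, half_ibp hf1 hfc, half_ibp hτf hτc]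
  simp only [zero_smul, neg_zero, one_smul, zero_add]
  congr 1
  refine integral_congr_ae (Eventually.of_forall fun z => ?_)
  simp only [nuv_inner hP, hτ, hfdef]
  ring

lemma dir_mulVecE {m : ℕ} {M : Matrix (Fin m) (Fin m) ℝ} (hM : Mᵀ = M) (T : EV m →L[ℝ] ℝ) (ν : EV m) :
    T (mulVecE M ν) = ∑ i, ∑ j, M i j * (T (EuclideanSpace.single j 1) * inner ℝ ν (EuclideanSpace.single i 1)) := by
  have hz : ∀ z : EV m, z = ∑ i, z i • EuclideanSpace.single i (1:ℝ) := by
    intro z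
    conv_lhs => rw [← (EuclideanSpace.basisFun (Fin m) ℝ).sum_repr z]
    simp
  rw [hz (mulVecE M ν), map_sum, Finset.sum_comm]
  refine Finset.sum_congr rfl fun j _ => ?_
  rw [map_smul, smul_eq_mul]
  have : (mulVecE M ν) j = ∑ i, M j i * ν i := by
    simp [mulVecE, Matrix.mulVec, dotProduct]
  rw [this, Finset.sum_mul]
  refine Finset.sum_congr rfl fun i _ => ?_
  have : M j i = M i j := by conv_lhs => rw [← hM, Matrix.transpose_apply]
  rw [this, EuclideanSpace.inner_single_right]
  simp; ring

lemma green_ch {Ω U : Set (EV (n + 1))} (h : IsCh Ω U P γ) {M : Matrix (Fin (n + 1)) (Fin (n + 1)) ℝ} (hM : Mᵀ = M)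
    (hΩ : IsOpen Ω)
    {w φ : EV (n + 1) → ℝ} (hw : ContDiff ℝ 2 w) (hφ : ContDiff ℝ 1 φ) (hc : HasCompactSupport φ)
    (hs : ∀ x, x ∉ U → φ x = 0 ∧ fderiv ℝ φ x = 0) :
    ell Ω M (fun l => partialDList l w) φ
      = - ∫ z' : EV n, φ (shear P γ (z', 0)) * fderiv ℝ w (shear P γ (z', 0)) (mulVecE M (nuv P γ z')) := by
  have hP := h.2.1
  have hγ : ContDiff ℝ 2 γ := h.2.2.1.1.of_le (by norm_num)
  have hwd : ∀ j : Fin (n+1), ContDiff ℝ 1 (partialD j w) := fun j => pd_contDiff hw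
  have hX1 : ∀ j : Fin (n+1), ContDiff ℝ 1 (fun x => partialD j w x * φ x) := fun j => (hwd j).mul hφ
  have hXc : ∀ j : Fin (n+1), HasCompactSupport (fun x => partialD j w x * φ x) := fun j => hc.mul_left
  have hff : Measurable (ff P γ) := (ff_cont hγ.continuous).measurable
  have e1 : ∀ i j : Fin (n+1), ∫ x in Ω, (partialDList [i, j] w x * φ x + partialDList [j] w x * partialD i φ x)
      = - ∫ z' : EV n, (partialD j w (shear P γ (z', 0)) * φ (shear P γ (z', 0))) * inner ℝ (nuv P γ z') (EuclideanSpace.single i (1:ℝ)) := by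
    intro i j
    rw [← graph_green hP hγ (hX1 j) (hXc j)]
    have e2 : ∀ x, fderiv ℝ (fun x => partialD j w x * φ x) x (EuclideanSpace.single i (1:ℝ))
        = partialDList [i, j] w x * φ x + partialDList [j] w x * partialD i φ x := by
      intro x
      rw [fderiv_fun_mul ((hwd j).differentiable (by norm_num) x) (hφ.differentiable (by norm_num) x)]
      simp [partialDList, partialD]
      ring
    have e3 : ∀ x, x ∉ U → partialDList [i, j] w x * φ x + partialDList [j] w x * partialD i φ x = 0 := by
      intro x hx
      simp [hs x hx, partialD]
    simp_rw [e2]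
    rw [← integral_indicator hΩ.measurableSet, ← integral_indicator (measurableSet_lt measurable_const hff)]
    congr 1
    funext x
    by_cases hx : x ∈ U
    · have := h.mem_iff hx
      by_cases hx2 : x ∈ Ω
      · rw [Set.indicator_of_mem hx2, Set.indicator_of_mem (s := {a | 0 < ff P γ a}) (this.1 hx2)]
      · rw [Set.indicator_of_notMem hx2, Set.indicator_of_notMem (s := {a | 0 < ff P γ a}) (fun hh => hx2 (this.2 hh))]
    · trans (0:ℝ)
      · exact Set.indicator_apply_eq_zero.2 fun _ => e3 x hx
      · symm
        exact Set.indicator_apply_eq_zero.2 fun _ => e3 x hx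
  unfold ell
  simp_rw [e1]
  have hsc : Continuous fun z' : EV n => shear P γ (z', 0) := (shear_cont hγ.continuous).comp (by fun_prop)
  have hsf : HasCompactSupport fun z' : EV n => φ (shear P γ (z', 0)) :=
    (shear_cc hγ.continuous hc).comp_isClosedEmbedding (isClosedEmbedding_prodMk_right' (0:ℝ))
  have hnu : Continuous (nuv P γ) := by
    have : (nuv P γ) = fun z' => P (-(gradient γ z'), 1) := rfl
    rw [this]
    have hg : Continuous (gradient γ) := by
      unfold gradient
      exact (InnerProductSpace.toDual ℝ (EV n)).symm.continuous.comp (hγ.continuous_fderiv (by norm_num))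
    fun_prop
  have i1 : ∀ i j : Fin (n+1), Integrable fun z' : EV n => (partialD j w (shear P γ (z', 0)) * φ (shear P γ (z', 0))) * inner ℝ (nuv P γ z') (EuclideanSpace.single i (1:ℝ)) := by
    intro i j
    refine Continuous.integrable_of_hasCompactSupport ?_ ?_
    · have := (hwd j).continuous.comp hsc
      have h2 := hφ.continuous.comp hsc
      have h3 : Continuous fun z' => inner ℝ (nuv P γ z') (EuclideanSpace.single i (1:ℝ)) := hnu.inner continuous_const
      exact (this.mul h2).mul h3
    · exact (HasCompactSupport.mul_left hsf).mul_right
  simp_rw [mul_neg, Finset.sum_neg_distrib]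
  congr 1
  simp_rw [← integral_const_mul]
  have i2 := fun (i j : Fin (n+1)) => (i1 i j).const_mul (M i j)
  rw [Finset.sum_congr rfl fun i _ => (integral_finsetSum Finset.univ (fun j _ => i2 i j)).symm]
  rw [← integral_finsetSum Finset.univ (fun i _ => integrable_finsetSum Finset.univ (fun j _ => i2 i j))]
  refine integral_congr_ae (Eventually.of_forall fun z => ?_)
  simp only [dir_mulVecE hM, Finset.mul_sum, partialD]
  refine Finset.sum_congr rfl fun i _ => Finset.sum_congr rfl fun j _ => ?_
  ring

end P18

end Part18

section Part19

section P19

lemma tele {E : Type*} [TopologicalSpace E] {S : (E → ℝ) → Prop} {Q : (E → ℝ) → Prop}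
    (h1 : S (fun _ => (1:ℝ))) (hmul : ∀ f, S f → ∀ g, S g → S (fun x => f x * g x))
    (hsub : ∀ f, S f → S (fun x => 1 - f x))
    (hadd : ∀ f, S f → ∀ g, S g → Q f → Q g → Q (fun x => f x + g x)) {K : Set E} (hK : IsCompact K)
    (hloc : ∀ z ∈ K, ∃ ψ, S ψ ∧ (∀ᶠ x in 𝓝 z, ψ x = 1) ∧ ∀ χ, S χ → Q (fun x => ψ x * χ x))
    (hout : ∀ χ, S χ → (∃ V, IsOpen V ∧ K ⊆ V ∧ ∀ x ∈ V, χ x = 0) → Q χ) : Q (fun _ => 1) := by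
  have hloc' : ∀ z : E, ∃ ψ : E → ℝ, z ∈ K → (S ψ ∧ (∀ᶠ x in 𝓝 z, ψ x = 1) ∧ ∀ χ, S χ → Q (fun x => ψ x * χ x)) := by
    intro z
    by_cases hz : z ∈ K
    · obtain ⟨ψ, h1, h2, h3⟩ := hloc z hz; exact ⟨ψ, fun _ => ⟨h1, h2, h3⟩⟩
    · exact ⟨0, fun h => absurd h hz⟩
  choose ψ hψ using hloc'
  have hop : ∀ z : E, ∃ V : Set E, z ∈ K → (IsOpen V ∧ z ∈ V ∧ ∀ x ∈ V, ψ z x = 1) := by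
    intro z
    by_cases hz : z ∈ K
    · obtain ⟨V, h1, h2, h3⟩ := eventually_nhds_iff.1 (hψ z hz).2.1
      exact ⟨V, fun _ => ⟨h2, h3, h1⟩⟩
    · exact ⟨∅, fun h => absurd h hz⟩
  choose V hV using hop
  obtain ⟨t, htK, ht⟩ := hK.elim_nhds_subcover V (fun z hz => (hV z hz).1.mem_nhds (hV z hz).2.1)
  have key : ∀ l : List E, (∀ z ∈ l, z ∈ K) → ∀ χ, S χ →
      Q (fun x => χ x * (l.map fun z => 1 - ψ z x).prod) → Q χ := by
    intro l
    induction l with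
    | nil => intro _ χ _ h; simpa using h
    | cons z l ih =>
      intro hl χ hχ h
      have hz := hψ z (hl z (by simp))
      have hχ' := hmul _ hχ _ (hsub _ hz.1)
      have h2 := ih (fun w hw => hl w (by simp [hw])) _ hχ' (by
        simpa only [List.map_cons, List.prod_cons, mul_assoc] using h)
      have h3 := hadd _ (hmul _ hz.1 _ hχ) _ hχ' (hz.2.2 χ hχ) h2
      convert h3 using 2
      ring
  have keyS : ∀ l : List E, (∀ z ∈ l, z ∈ K) → S (fun x => (l.map fun z => 1 - ψ z x).prod) := by
    intro l
    induction l with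
    | nil => intro _; simpa using h1
    | cons z l ih =>
      intro hl
      simp only [List.map_cons, List.prod_cons]
      exact hmul _ (hsub _ (hψ z (hl z (by simp))).1) _ (ih (fun w hw => hl w (by simp [hw])))
  have htl : ∀ z ∈ t.toList, z ∈ K := fun z hz => htK z (by simpa using hz)
  refine key t.toList htl _ h1 ?_
  simp only [one_mul]
  refine hout _ (keyS _ htl) ⟨⋃ z ∈ t, V z, isOpen_biUnion fun z hz => (hV z (htK z hz)).1, ht, ?_⟩
  intro x hx
  obtain ⟨z, hz, hxz⟩ := Set.mem_iUnion₂.1 hx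
  refine List.prod_eq_zero (List.mem_map.2 ⟨z, by simpa using hz, ?_⟩)
  rw [(hV z (htK z hz)).2.2 x hxz, sub_self]

lemma loc_ind {E X : Type*} [TopologicalSpace E] [Zero X] {Ω : Set E} (hΩ : IsOpen Ω) {f : E → X}
    {V : Set E} (hV : IsOpen V) (hVf : frontier Ω ⊆ V) (hf : ∀ x ∈ V, f x = 0) (x : E) :
    (x ∈ Ω ∧ Ω.indicator f =ᶠ[𝓝 x] f) ∨ (x ∉ Ω ∧ Ω.indicator f =ᶠ[𝓝 x] fun _ => 0) := by
  by_cases hx : x ∈ Ω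
  · left
    refine ⟨hx, ?_⟩
    filter_upwards [hΩ.mem_nhds hx] with y hy
    rw [Set.indicator_of_mem hy]
  · right
    refine ⟨hx, ?_⟩
    by_cases hx2 : x ∈ closure Ω
    · have : x ∈ frontier Ω := by rw [hΩ.frontier_eq]; exact ⟨hx2, hx⟩
      filter_upwards [hV.mem_nhds (hVf this)] with y hy
      exact Set.indicator_apply_eq_zero.2 fun _ => hf y hy
    · filter_upwards [isClosed_closure.isOpen_compl.mem_nhds hx2] with y hy
      exact Set.indicator_of_notMem (fun h => hy (subset_closure h)) _

lemma ind_contDiff {E X : Type*} [NormedAddCommGroup E] [NormedSpace ℝ E] [NormedAddCommGroup X] [NormedSpace ℝ X] {k : WithTop ℕ∞}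
    {Ω : Set E} (hΩ : IsOpen Ω) {f : E → X} (hfk : ContDiff ℝ k f)
    {V : Set E} (hV : IsOpen V) (hVf : frontier Ω ⊆ V) (hf : ∀ x ∈ V, f x = 0) :
    ContDiff ℝ k (Ω.indicator f) := by
  rw [contDiff_iff_contDiffAt]
  intro x
  rcases loc_ind hΩ hV hVf hf x with ⟨_, h⟩ | ⟨_, h⟩
  · exact hfk.contDiffAt.congr_of_eventuallyEq h
  · exact contDiffAt_const.congr_of_eventuallyEq h

lemma ind_fderiv {E X : Type*} [NormedAddCommGroup E] [NormedSpace ℝ E] [NormedAddCommGroup X] [NormedSpace ℝ X]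
    {Ω : Set E} (hΩ : IsOpen Ω) {f : E → X}
    {V : Set E} (hV : IsOpen V) (hVf : frontier Ω ⊆ V) (hf : ∀ x ∈ V, f x = 0) :
    fderiv ℝ (Ω.indicator f) = Ω.indicator (fderiv ℝ f) := by
  funext x
  rcases loc_ind hΩ hV hVf hf x with ⟨hx, h⟩ | ⟨hx, h⟩
  · rw [h.fderiv_eq, Set.indicator_of_mem hx]
  · rw [h.fderiv_eq, Set.indicator_of_notMem hx, fderiv_const_apply]

variable {m : ℕ} {Ω : Set (EV m)} {p : ℝ≥0∞}

lemma ell_add (hp1 : 1 ≤ p) {M : Matrix (Fin m) (Fin m) ℝ} {D : List (Fin m) → EV m → ℝ}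
    (hD : ∀ l : List (Fin m), l.length ≤ 2 → MemLp (D l) p (volume.restrict Ω))
    {φ ψ : EV m → ℝ} (hφ : ContDiff ℝ 1 φ) (hc : HasCompactSupport φ)
    (hψ : ContDiff ℝ 1 ψ) (hc' : HasCompactSupport ψ) :
    ell Ω M D (fun x => φ x + ψ x) = ell Ω M D φ + ell Ω M D ψ := by
  unfold ell
  simp_rw [← Finset.sum_add_distrib, ← mul_add]
  refine Finset.sum_congr rfl fun i _ => Finset.sum_congr rfl fun j _ => ?_
  congr 1
  have i1 := fun {g : EV m → ℝ} (hg : ContDiff ℝ 1 g) (hcg : HasCompactSupport g) =>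
    (int_mul_cc hp1 (hD [i, j] (by simp)) hg.continuous hcg).add (int_mul_cc hp1 (hD [j] (by simp)) (pd_cont (i := i) hg) (pd_cc hcg))
  refine Eq.trans ?_ (integral_add (i1 hφ hc) (i1 hψ hc'))
  refine integral_congr_ae (Eventually.of_forall fun x => ?_)
  have : partialD i (fun x => φ x + ψ x) x = partialD i φ x + partialD i ψ x := by
    simp only [partialD]
    rw [fderiv_fun_add (hφ.differentiable (by norm_num) x) (hψ.differentiable (by norm_num) x)]
    rfl
  simp only [this, Pi.add_apply]
  ring

/-- no boundary contribution if the test function vanishes near the boundary -/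
lemma ell_out (hΩ : IsOpen Ω) {M : Matrix (Fin m) (Fin m) ℝ}
    {w φ : EV m → ℝ} (hw : ContDiff ℝ 2 w) (hφ : ContDiff ℝ 1 φ) (hc : HasCompactSupport φ)
    {V : Set (EV m)} (hV : IsOpen V) (hVf : frontier Ω ⊆ V) (hf : ∀ x ∈ V, φ x = 0) :
    ell Ω M (fun l => partialDList l w) φ = 0 := by
  unfold ell
  refine Finset.sum_eq_zero fun i _ => Finset.sum_eq_zero fun j _ => ?_
  have hwd : ContDiff ℝ 1 (partialD j w) := pd_contDiff hw
  set X : EV m → ℝ := fun x => partialD j w x * φ x with hX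
  have hX1 : ContDiff ℝ 1 X := hwd.mul hφ
  have hXV : ∀ x ∈ V, X x = 0 := fun x hx => by simp [hX, hf x hx]
  have hXc : HasCompactSupport X := hc.mul_left
  have hY : ContDiff ℝ 1 (Ω.indicator X) := ind_contDiff hΩ hX1 hV hVf hXV
  have hYc : HasCompactSupport (Ω.indicator X) := by
    refine hXc.mono' ?_
    intro x hx
    have : X x ≠ 0 := by
      intro h0; exact hx (Set.indicator_apply_eq_zero.2 fun _ => h0)
    exact subset_closure this
  have h0 := int_fderiv_zero hY hYc (EuclideanSpace.single i (1:ℝ))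
  rw [ind_fderiv hΩ hV hVf hXV] at h0
  have e : ∀ x, (Ω.indicator (fderiv ℝ X) x) (EuclideanSpace.single i (1:ℝ))
      = Ω.indicator (fun x => partialDList [i, j] w x * φ x + partialDList [j] w x * partialD i φ x) x := by
    intro x
    by_cases hx : x ∈ Ω
    · rw [Set.indicator_of_mem hx, Set.indicator_of_mem hx, hX,
        fderiv_fun_mul (hwd.differentiable (by norm_num) x) (hφ.differentiable (by norm_num) x)]
      simp [partialDList, partialD]
      ring
    · rw [Set.indicator_of_notMem hx, Set.indicator_of_notMem hx]; rfl
  simp_rw [e] at h0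
  rw [integral_indicator hΩ.measurableSet] at h0
  rw [h0, mul_zero]

lemma wn_of_nbc {n : ℕ} {Ω : Set (EV (n + 1))} (hΩ : IsGraphDomain 3 Ω) (hcpt : IsCompact (frontier Ω)) (hp1 : 1 ≤ p)
    {M : Matrix (Fin (n + 1)) (Fin (n + 1)) ℝ} (hM : Mᵀ = M) {v : EV (n + 1) → ℝ} (hv : ContDiff ℝ 2 v)
    (hc : HasCompactSupport v) (hN : NBC Ω M v) : MemWN Ω M 2 p v := by
  have hs := sob_classical (Ω := Ω) (p := p) hv hc
  refine ⟨⟨_, hs⟩, (neumann_iff hΩ.1 hp1 hs).2 fun φ hφ hφc => ?_⟩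
  have hφ1 : ContDiff ℝ 1 φ := hφ.of_le (by exact_mod_cast le_top)
  let S : (EV (n + 1) → ℝ) → Prop := fun f => ContDiff ℝ 1 f
  let Q : (EV (n + 1) → ℝ) → Prop := fun χ => ell Ω M (fun l => partialDList l v) (fun x => χ x * φ x) = 0
  have key : Q (fun _ => 1) := by
    refine tele (S := S) (Q := Q) contDiff_const (fun f hf g hg => ContDiff.mul hf hg)
      (fun f hf => contDiff_const.sub hf) ?_ hcpt ?_ ?_
    · intro f hf g hg h1 h2
      have e : (fun x => (f x + g x) * φ x) = fun x => f x * φ x + g x * φ x := by funext x; ring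
      change ell Ω M _ _ = 0
      rw [e, ell_add hp1 hs.2.2 (ContDiff.mul hf hφ1) hφc.mul_left (ContDiff.mul hg hφ1) hφc.mul_left, h1, h2, add_zero]
    · intro z hz
      obtain ⟨U, P, γ, hch, hzU⟩ := exists_ch hΩ hz
      obtain ⟨r, hr, hrU⟩ := Metric.isOpen_iff.1 hch.1 z hzU
      let b : ContDiffBump z := ⟨r / 3, r / 2, by positivity, by linarith⟩
      have hb1 : ContDiff ℝ 1 b := b.contDiff
      refine ⟨b, hb1, b.eventuallyEq_one, fun χ hχ => ?_⟩
      have hbU : ∀ x, x ∉ U → x ∉ tsupport b := by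
        intro x hx h
        rw [b.tsupport_eq] at h
        refine hx (hrU ?_)
        rw [Metric.mem_closedBall] at h
        rw [Metric.mem_ball]
        have : b.rOut = r / 2 := rfl
        linarith
      have hφ' : ContDiff ℝ 1 (fun x => b x * χ x * φ x) := (hb1.mul hχ).mul hφ1
      have hts : tsupport (fun x => b x * χ x * φ x) ⊆ tsupport b := by
        refine closure_mono fun x hx => ?_
        intro h0
        exact hx (by simp [h0])
      change ell Ω M _ _ = 0
      rw [green_ch hch hM hΩ.1 hv hφ' hφc.mul_left]
      · rw [neg_eq_zero]
        refine integral_eq_zero_of_ae (Eventually.of_forall fun z' => ?_)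
        simp only [Pi.zero_apply]
        by_cases hx : shear P γ (z', 0) ∈ U
        · have := hN U P γ hch _ hx (ff_shear _)
          have e : (P.symm (shear P γ (z', 0))).1 = z' := by simp [shear]
          rw [e] at this
          rw [this, mul_zero]
        · have : b (shear P γ (z', 0)) = 0 := image_eq_zero_of_notMem_tsupport (hbU _ hx)
          rw [this]; ring
      · intro x hx
        have hx' : x ∉ tsupport (fun x => b x * χ x * φ x) := fun h => hbU x hx (hts h)
        exact ⟨image_eq_zero_of_notMem_tsupport (f := fun x => b x * χ x * φ x) hx', fderiv_of_notMem_tsupport (𝕜 := ℝ) hx'⟩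
    · rintro χ hχ ⟨V, hV, hVf, h0⟩
      exact ell_out hΩ.1 hv (ContDiff.mul hχ hφ1) hφc.mul_left hV hVf fun x hx => by simp [h0 x hx]
  simpa [Q] using key

end P19

end Part19

section Part20

section P20
variable {m : ℕ} {Ω : Set (EV m)} {p : ℝ≥0∞}

lemma two_le_inf : (2 : WithTop ℕ∞) ≤ ((⊤ : ℕ∞) : WithTop ℕ∞) := by
  exact WithTop.coe_le_coe.2 le_top

lemma ev_sum (z : EV m) : z = ∑ i, z i • EuclideanSpace.single i (1:ℝ) := by
  conv_lhs => rw [← (EuclideanSpace.basisFun (Fin m) ℝ).sum_repr z]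
  simp

lemma jet_ext_coord {s t : Jet (EV m)} (ha : s.a = t.a)
    (hb : ∀ i, s.b (EuclideanSpace.single i 1) = t.b (EuclideanSpace.single i 1))
    (hc : ∀ i j, s.c (EuclideanSpace.single i 1) (EuclideanSpace.single j 1)
      = t.c (EuclideanSpace.single i 1) (EuclideanSpace.single j 1)) : s = t := by
  refine Jet.ext' ha ?_ ?_
  · refine ContinuousLinearMap.ext fun η => ?_
    rw [ev_sum η]
    simp only [map_sum, map_smul, hb]
  · refine ContinuousLinearMap.ext fun η => ContinuousLinearMap.ext fun ζ => ?_
    rw [ev_sum η, ev_sum ζ]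
    simp only [map_sum, map_smul, ContinuousLinearMap.sum_apply, ContinuousLinearMap.smul_apply, hc]

def jB0 (m : ℕ) : Jet (EV m) := mkJ 1 0 0
def jB1 (i : Fin m) : Jet (EV m) := mkJ 0 (EuclideanSpace.proj i) 0
def jB2 (i j : Fin m) : Jet (EV m) :=
  mkJ 0 0 ((EuclideanSpace.proj i : EV m →L[ℝ] ℝ).smulRight (EuclideanSpace.proj j : EV m →L[ℝ] ℝ))

/-- the jet assembled from weak derivatives -/
def jetD (D : List (Fin m) → EV m → ℝ) (x : EV m) : Jet (EV m) :=
  D [] x • jB0 m + ∑ i, D [i] x • jB1 i + ∑ i, ∑ j, D [i, j] x • jB2 i j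

lemma jetD_a (D : List (Fin m) → EV m → ℝ) (x : EV m) : (jetD D x).a = D [] x := by
  rw [← JLa_apply, jetD]
  simp only [map_add, map_sum, map_smul, JLa_apply, jB0, jB1, jB2]
  simp

lemma jetD_b (D : List (Fin m) → EV m → ℝ) (x : EV m) (i : Fin m) :
    (jetD D x).b (EuclideanSpace.single i 1) = D [i] x := by
  rw [← JLb_apply, jetD]
  simp only [map_add, map_sum, map_smul, JLb_apply, jB0, jB1, jB2]
  simp [ContinuousLinearMap.sum_apply]

lemma jetD_c (D : List (Fin m) → EV m → ℝ) (x : EV m) (i j : Fin m) :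
    (jetD D x).c (EuclideanSpace.single i 1) (EuclideanSpace.single j 1) = D [i, j] x := by
  rw [← JLc_apply, jetD]
  simp only [map_add, map_sum, map_smul, JLc_apply, jB0, jB1, jB2]
  simp [ContinuousLinearMap.sum_apply, ContinuousLinearMap.smul_apply]

lemma jetD_memLp {D : List (Fin m) → EV m → ℝ} {μ : Measure (EV m)}
    (hD : ∀ l : List (Fin m), l.length ≤ 2 → MemLp (D l) p μ) : MemLp (jetD D) p μ := by
  have hs : ∀ {f : EV m → ℝ} (B : Jet (EV m)), MemLp f p μ → MemLp (fun x => f x • B) p μ := by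
    intro f B hf
    exact (ContinuousLinearMap.toSpanSingleton ℝ B).comp_memLp' hf
  have h1 : MemLp (fun x => ∑ i, D [i] x • jB1 i) p μ :=
    memLp_finsetSum _ fun i _ => hs _ (hD _ (by simp))
  have h2 : MemLp (fun x => ∑ i, ∑ j, D [i, j] x • jB2 i j) p μ :=
    memLp_finsetSum _ fun i _ => memLp_finsetSum _ fun j _ => hs _ (hD _ (by simp))
  exact ((hs _ (hD [] (by simp))).add h1).add h2

lemma pdl2 {v : EV m → ℝ} (hv : ContDiff ℝ 2 v) (i j : Fin m) (x : EV m) :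
    partialDList [i, j] v x = fderiv ℝ (fderiv ℝ v) x (EuclideanSpace.single i 1) (EuclideanSpace.single j 1) := by
  have h1 : DifferentiableAt ℝ (fderiv ℝ v) x :=
    (hv.fderiv_right (m := 1) (by norm_num)).differentiable (by norm_num) x
  change fderiv ℝ (fun y => fderiv ℝ v y (EuclideanSpace.single j 1)) x (EuclideanSpace.single i 1) = _
  rw [fderiv_clm_apply h1 (by fun_prop)]
  simp

lemma jetD_classical {v : EV m → ℝ} (hv : ContDiff ℝ 2 v) (x : EV m) :
    jetD (fun l => partialDList l v) x = jj v x := by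
  refine jet_ext_coord ?_ ?_ ?_
  · rw [jetD_a]; simp [jj, partialDList]
  · intro i; rw [jetD_b]; simp [jj, partialDList, partialD]
  · intro i j; rw [jetD_c, pdl2 hv]; simp [jj]

lemma ind_memLp {X : Type*} [NormedAddCommGroup X] (hΩ : IsOpen Ω) {f : EV m → X} (hf : MemLp f p (volume.restrict Ω)) :
    MemLp (Ω.indicator f) p volume := (memLp_indicator_iff_restrict hΩ.measurableSet).2 hf

lemma ind_locInt {X : Type*} [NormedAddCommGroup X] (hp1 : 1 ≤ p) (hΩ : IsOpen Ω) {f : EV m → X} (hf : MemLp f p (volume.restrict Ω)) :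
    LocallyIntegrable (Ω.indicator f) := (ind_memLp hΩ hf).locallyIntegrable hp1

lemma cnv_weak (hp1 : 1 ≤ p) (hΩ : IsOpen Ω) {i : Fin m} {f g : EV m → ℝ} (h : WeakDerivOn Ω i f g)
    (hf : MemLp f p (volume.restrict Ω))
    {κ : EV m → ℝ} (hκ : ContDiff ℝ (⊤ : ℕ∞) κ) (hc : HasCompactSupport κ) {x : EV m}
    (hx : ∀ z ∈ tsupport κ, x - z ∈ Ω) :
    partialD i (cnv κ (Ω.indicator f)) x = cnv κ (Ω.indicator g) x := by
  have hκ1 : ContDiff ℝ 1 κ := hκ.of_le (by exact_mod_cast le_top)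
  rw [partialD, cnv_fderiv hκ1 hc (ind_locInt hp1 hΩ hf), cnv_swap]
  set φ : EV m → ℝ := fun z => κ (x - z) with hφ
  have hφs : ContDiff ℝ (⊤ : ℕ∞) φ := hκ.comp (contDiff_const.sub contDiff_id)
  have hφc : HasCompactSupport φ := by
    have := hc.comp_homeomorph (Homeomorph.subLeft x)
    exact this
  have hts : tsupport φ ⊆ Ω := by
    intro z hz
    have h1 : x - z ∈ tsupport κ := by
      have h2 : tsupport φ ⊆ (fun z => x - z) ⁻¹' tsupport κ := by
        refine closure_minimal ?_ ((isClosed_tsupport κ).preimage (by fun_prop))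
        intro z hz; exact subset_closure hz
      exact h2 hz
    have := hx _ h1
    have e : x - (x - z) = z := by abel
    rwa [e] at this
  have hw := h φ hφs hφc hts
  have hd : ∀ z, partialD i φ z = - fderiv ℝ κ (x - z) (EuclideanSpace.single i 1) := by
    intro z
    have h1 : HasFDerivAt φ ((fderiv ℝ κ (x - z)).comp (-(ContinuousLinearMap.id ℝ (EV m)))) z := by
      refine HasFDerivAt.comp (g := κ) (f := fun z => x - z) z (hκ1.differentiable (by norm_num) _).hasFDerivAt ?_
      exact (hasFDerivAt_id z).const_sub x
    rw [partialD, h1.fderiv]; simp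
  have e1 : ∫ z, (fderiv ℝ κ (x - z) (EuclideanSpace.single i 1)) • Ω.indicator f z
      = ∫ z in Ω, (fderiv ℝ κ (x - z) (EuclideanSpace.single i 1)) * f z := by
    rw [← integral_indicator hΩ.measurableSet]
    congr 1; funext z
    by_cases hz : z ∈ Ω <;> simp [hz]
  have e2 : ∫ z, κ (x - z) • Ω.indicator g z = ∫ z in Ω, g z * φ z := by
    rw [← integral_indicator hΩ.measurableSet]
    congr 1; funext z
    by_cases hz : z ∈ Ω <;> simp [hz, hφ, mul_comm]
  rw [e1, e2, ← neg_neg (∫ z in Ω, g z * φ z), ← hw, ← integral_neg]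
  refine integral_congr_ae (Eventually.of_forall fun z => ?_)
  simp only [hd]; ring

lemma shift_open (hΩ : IsOpen Ω) {κ : EV m → ℝ} (hc : HasCompactSupport κ) {x : EV m}
    (hx : ∀ z ∈ tsupport κ, x - z ∈ Ω) : ∀ᶠ y in 𝓝 x, ∀ z ∈ tsupport κ, y - z ∈ Ω := by
  refine hc.isCompact.eventually_forall_of_forall_eventually ?_
  intro z hz
  have : Continuous fun q : EV m × EV m => q.1 - q.2 := by fun_prop
  exact (this.isOpen_preimage _ hΩ).mem_nhds (hx z hz)

/-- mollification of a Sobolev function -/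
lemma cnv_jet (hp1 : 1 ≤ p) (hΩ : IsOpen Ω) {u : EV m → ℝ} {D : List (Fin m) → EV m → ℝ}
    (hD : IsSobDerivs Ω 2 p u D)
    {κ : EV m → ℝ} (hκ : ContDiff ℝ (⊤ : ℕ∞) κ) (hc : HasCompactSupport κ) {x : EV m}
    (hx : ∀ z ∈ tsupport κ, x - z ∈ Ω) :
    jj (cnv κ (Ω.indicator u)) x = cnv κ (Ω.indicator (jetD D)) x := by
  obtain ⟨rfl, hw, hL⟩ := hD
  have hl := fun l hl => ind_locInt hp1 hΩ (hL l hl)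
  have hs : ContDiff ℝ (⊤ : ℕ∞) (cnv κ (Ω.indicator (D []))) := cnv_contDiff hκ hc (hl [] (by simp))
  have hs2 : ContDiff ℝ 2 (cnv κ (Ω.indicator (D []))) := hs.of_le two_le_inf
  have hJ := ind_locInt hp1 hΩ (jetD_memLp hL)
  have key : ∀ (T : Jet (EV m) →L[ℝ] ℝ) (f : EV m → ℝ), (∀ z, T (jetD D z) = f z) →
      T (cnv κ (Ω.indicator (jetD D)) x) = cnv κ (Ω.indicator f) x := by
    intro T f hf
    rw [cnv_clm T hκ.continuous hc hJ]
    congr 1; funext z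
    by_cases hz : z ∈ Ω <;> simp [hz, hf]
  rw [← jetD_classical hs2]
  refine jet_ext_coord ?_ ?_ ?_
  · rw [jetD_a]; exact (key JLa _ (fun z => jetD_a D z)).symm
  · intro i
    rw [jetD_b]
    refine Eq.trans ?_ (key ((ContinuousLinearMap.apply ℝ ℝ (EuclideanSpace.single i (1:ℝ))).comp JLb) _ (fun z => jetD_b D z i)).symm
    exact cnv_weak hp1 hΩ (hw [] (by simp) i) (hL [] (by simp)) hκ hc hx
  · intro i j
    rw [jetD_c]
    refine Eq.trans ?_ (key ((ContinuousLinearMap.apply ℝ ℝ (EuclideanSpace.single j (1:ℝ))).comp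
      ((ContinuousLinearMap.apply ℝ (EV m →L[ℝ] ℝ) (EuclideanSpace.single i (1:ℝ))).comp JLc)) _ (fun z => jetD_c D z i j)).symm
    rw [← cnv_weak hp1 hΩ (hw [j] (by simp) i) (hL [j] (by simp)) hκ hc hx]
    simp only [partialDList, partialD]
    congr 1
    refine Filter.EventuallyEq.fderiv_eq ?_
    filter_upwards [shift_open hΩ hc hx] with y hy
    exact cnv_weak hp1 hΩ (hw [] (by simp) j) (hL [] (by simp)) hκ hc hy

lemma cnv_close {X : Type*} [NormedAddCommGroup X] [NormedSpace ℝ X] [CompleteSpace X] {r η : ℝ} {κ : EV m → ℝ} (hκ : Mol r κ)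
    {f : EV m → X} (hf : Continuous f) {x : EV m} (h : ∀ z, ‖z‖ < r → ‖f (x - z) - f x‖ ≤ η) :
    ‖cnv κ f x - f x‖ ≤ η := by
  obtain ⟨h1, h2, h3, h4, h5⟩ := hκ
  have i0 : Integrable κ := h1.continuous.integrable_of_hasCompactSupport h3
  have i1 : Integrable fun z => κ z • f (x - z) :=
    (h1.continuous.smul (hf.comp (by fun_prop))).integrable_of_hasCompactSupport h3.smul_right
  have e : cnv κ f x - f x = ∫ z, κ z • (f (x - z) - f x) := by
    simp_rw [smul_sub]
    rw [integral_sub i1 (i0.smul_const _), integral_smul_const, h4, one_smul]; rfl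
  rw [e]
  calc ‖∫ z, κ z • (f (x - z) - f x)‖ ≤ ∫ z, κ z * η := by
        refine norm_integral_le_of_norm_le (i0.mul_const _) (Eventually.of_forall fun z => ?_)
        rw [norm_smul, Real.norm_of_nonneg (h2 z)]
        by_cases hz : ‖z‖ < r
        · exact mul_le_mul_of_nonneg_left (h z hz) (h2 z)
        · rw [h5 z (not_lt.1 hz)]; simp
    _ = η := by rw [integral_mul_const, h4, one_mul]

lemma cnv_pd {φ κ : EV m → ℝ} (hφ : ContDiff ℝ 1 φ) (hc : HasCompactSupport φ) (hκ : ContDiff ℝ (⊤ : ℕ∞) κ) (hκc : HasCompactSupport κ)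
    (i : Fin m) (x : EV m) : partialD i (cnv κ φ) x = cnv κ (partialD i φ) x := by
  have := cnv_weak (p := 1) le_rfl isOpen_univ (weak_classical (Ω := Set.univ) hφ i)
    ((hφ.continuous.memLp_of_hasCompactSupport hc)) hκ hκc (x := x) (fun _ _ => Set.mem_univ _)
  simpa using this

lemma ell_C1 (hp1 : 1 ≤ p) {M : Matrix (Fin m) (Fin m) ℝ} {D : List (Fin m) → EV m → ℝ}
    (hD : ∀ l : List (Fin m), l.length ≤ 2 → MemLp (D l) p (volume.restrict Ω))
    (h : ∀ φ : EV m → ℝ, ContDiff ℝ (⊤ : ℕ∞) φ → HasCompactSupport φ → ell Ω M D φ = 0)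
    {φ : EV m → ℝ} (hφ : ContDiff ℝ 1 φ) (hc : HasCompactSupport φ) : ell Ω M D φ = 0 := by
  have hr : ∀ k : ℕ, (0:ℝ) < 1 / ((k:ℝ) + 1) := fun k => by positivity
  choose κ hκ using fun k : ℕ => exists_mol (m := m) (hr k)
  obtain ⟨R, hR⟩ : ∃ R : ℝ, ∀ x, R ≤ ‖x‖ → φ x = 0 := by
    obtain ⟨R, hR⟩ := hc.isCompact.isBounded.subset_ball 0
    refine ⟨R, fun x hx => image_eq_zero_of_notMem_tsupport fun h => ?_⟩
    have := hR h
    rw [mem_ball_zero_iff] at this; linarith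
  have hR' : ∀ i x, R < ‖x‖ → partialD i φ x = 0 := by
    intro i x hx
    have : φ =ᶠ[𝓝 x] fun _ => 0 := by
      filter_upwards [(isOpen_lt continuous_const continuous_norm).mem_nhds hx] with y hy
      exact hR y (le_of_lt hy)
    rw [partialD, this.fderiv_eq]; simp
  have gen : ∀ f : EV m → ℝ, Continuous f → (∀ x, R < ‖x‖ → f x = 0) → HasCompactSupport f →
      (∀ x, Tendsto (fun k => cnv (κ k) f x) atTop (𝓝 (f x))) ∧
      ∃ g : EV m → ℝ, Continuous g ∧ HasCompactSupport g ∧ ∀ k x, ‖cnv (κ k) f x‖ ≤ g x := by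
    intro f hf hfR hfc
    constructor
    · intro x
      rw [Metric.tendsto_atTop]
      intro η hη
      obtain ⟨δ, hδ, hd⟩ := Metric.continuous_iff.1 hf x (η / 2) (by positivity)
      obtain ⟨N, hN⟩ := exists_nat_one_div_lt hδ
      refine ⟨N, fun k hk => ?_⟩
      have hk' : 1 / ((k:ℝ) + 1) ≤ 1 / ((N:ℝ) + 1) := Nat.one_div_le_one_div hk
      rw [dist_eq_norm]
      refine lt_of_le_of_lt (cnv_close (hκ k) hf fun z hz => ?_) (half_lt_self hη)
      have := hd (x - z) (by rw [dist_eq_norm]; simp; linarith)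
      rw [dist_eq_norm] at this; exact this.le
    · obtain ⟨C, hC⟩ := hf.bounded_above_of_compact_support hfc
      have hC0 : 0 ≤ C := (norm_nonneg _).trans (hC 0)
      let b : ContDiffBump (0 : EV m) := ⟨|R| + 2, |R| + 3, by positivity, by linarith⟩
      refine ⟨fun x => 3 * C * b x, continuous_const.mul b.continuous, b.hasCompactSupport.mul_left, fun k x => ?_⟩
      have hk1 : 1 / ((k:ℝ) + 1) ≤ 1 := by
        rw [div_le_one (by positivity)]
        have : (0:ℝ) ≤ k := Nat.cast_nonneg k
        linarith
      by_cases hx : ‖x‖ ≤ |R| + 2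
      · have hb : b x = 1 := b.one_of_mem_closedBall (by simpa using hx)
        simp only [hb]
        have h1 := cnv_close (hκ k) hf (x := x) (η := 2 * C) fun z _ => by
          refine (norm_sub_le _ _).trans ?_
          have := hC (x - z); have := hC x; linarith
        have h2 : ‖cnv (κ k) f x‖ ≤ ‖cnv (κ k) f x - f x‖ + ‖f x‖ := norm_le_norm_sub_add _ _
        have := hC x; linarith
      · have : cnv (κ k) f x = 0 := by
          refine cnv_supp (hκ k).2.2.2.2 fun z hz => hfR _ ?_
          have := norm_sub_norm_le x z
          have := le_abs_self R
          linarith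
        rw [this, norm_zero]
        exact mul_nonneg (by positivity) b.nonneg
  have lim : Tendsto (fun k => ell Ω M D (cnv (κ k) φ)) atTop (𝓝 (ell Ω M D φ)) := by
    unfold ell
    refine tendsto_finsetSum _ fun i _ => tendsto_finsetSum _ fun j _ => Tendsto.const_mul _ ?_
    obtain ⟨t1, g1, hg1, hgc1, hgb1⟩ := gen φ hφ.continuous (fun x hx => hR x hx.le) hc
    obtain ⟨t2, g2, hg2, hgc2, hgb2⟩ := gen (partialD i φ) (pd_cont hφ) (hR' i) (pd_cc hc)
    have i1 := int_mul_cc hp1 (hD [i, j] (by simp)).norm hg1 hgc1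
    have i2 := int_mul_cc hp1 (hD [j] (by simp)).norm hg2 hgc2
    have hcs : ∀ k, ContDiff ℝ (⊤ : ℕ∞) (cnv (κ k) φ) := fun k =>
      cnv_contDiff (hκ k).1 (hκ k).2.2.1 hφ.continuous.locallyIntegrable
    have hcs1 : ∀ k, ContDiff ℝ 1 (cnv (κ k) φ) := fun k => (hcs k).of_le (by exact_mod_cast le_top)
    refine tendsto_integral_of_dominated_convergence _ (fun k => ?_) (i1.add i2) (fun k => ?_) ?_
    · exact ((hD [i, j] (by simp)).1.mul (hcs k).continuous.aestronglyMeasurable).add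
        ((hD [j] (by simp)).1.mul (pd_cont (hcs1 k)).aestronglyMeasurable)
    · refine Eventually.of_forall fun x => ?_
      rw [cnv_pd hφ hc (hκ k).1 (hκ k).2.2.1]
      refine (norm_add_le _ _).trans ?_
      rw [norm_mul, norm_mul]
      exact add_le_add (mul_le_mul_of_nonneg_left (hgb1 k x) (norm_nonneg _))
        (mul_le_mul_of_nonneg_left (hgb2 k x) (norm_nonneg _))
    · refine Eventually.of_forall fun x => ?_
      simp_rw [fun k => cnv_pd hφ hc (hκ k).1 (hκ k).2.2.1 i x]
      exact ((t1 x).const_mul _).add ((t2 x).const_mul _)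
  have z : ∀ k, ell Ω M D (cnv (κ k) φ) = 0 := by
    intro k
    refine h _ (cnv_contDiff (hκ k).1 (hκ k).2.2.1 hφ.continuous.locallyIntegrable) ?_
    have := (hκ k).2.2.1.convolution (ContinuousLinearMap.lsmul ℝ ℝ) hc (μ := volume)
    exact this
  simp_rw [z] at lim
  exact (tendsto_nhds_unique lim tendsto_const_nhds)

end P20

end Part20

section Part21

section P21
variable {n : ℕ} {P : FV n ≃L[ℝ] EV (n + 1)} {γ : EV n → ℝ} {p : ℝ≥0∞}

lemma shift_moll {Ω U : Set (EV (n + 1))} (h : IsCh Ω U P γ) (hΩ : IsOpen Ω) (hp1 : 1 ≤ p) (hp : p ≠ ⊤)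
    {u : EV (n + 1) → ℝ} {D : List (Fin (n + 1)) → EV (n + 1) → ℝ} (hD : IsSobDerivs Ω 2 p u D)
    {z : EV (n + 1)} (hz : z ∈ U) :
    ∃ δ > 0, ∃ w : ℕ → EV (n + 1) → ℝ, (∀ k, ContDiff ℝ 2 (w k)) ∧
      Tendsto (fun k => eLpNorm (fun x => jj (w k) x - jetD D x) p
        (volume.restrict (Ω ∩ Metric.ball z δ))) atTop (𝓝 0) := by
  obtain ⟨hU, hP, hγ, hmem⟩ := id h
  obtain ⟨L, hL0, hL⟩ := hγ.fderiv_bdd (by norm_num)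
  have hγd := hγ.diff (by norm_num)
  have hlip : ∀ a b, |γ a - γ b| ≤ L * ‖a - b‖ := by
    intro a b
    have := Convex.norm_image_sub_le_of_norm_fderiv_le (𝕜 := ℝ) (f := γ) (C := L) (s := Set.univ)
      (fun x _ => hγd x) (fun x _ => hL x) convex_univ (Set.mem_univ b) (Set.mem_univ a)
    simpa using this
  obtain ⟨R, hR, hRU⟩ := Metric.isOpen_iff.1 hU z hz
  set δ := R / 2 with hδ
  have hδ0 : 0 < δ := by positivity
  refine ⟨δ, hδ0, ?_⟩
  have hf := ind_memLp hΩ (jetD_memLp hD.2.2)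
  have step : ∀ k : ℕ, ∃ w : EV (n + 1) → ℝ, ContDiff ℝ 2 w ∧
      eLpNorm (fun x => jj w x - jetD D x) p (volume.restrict (Ω ∩ Metric.ball z δ)) ≤ ENNReal.ofReal (1 / ((k:ℝ) + 1)) := by
    intro k
    obtain ⟨r, hr, hmol⟩ := moll_conv volume p hp1 hp _ hf (ENNReal.ofReal (1 / ((k:ℝ) + 1)))
      (ENNReal.ofReal_pos.2 (by positivity))
    set t := min (r / 4) (δ / 4) with ht
    have ht0 : 0 < t := by positivity
    set c := 1 / (2 * (1 + L)) with hc
    have hc0 : 0 < c := by positivity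
    have hc1 : c ≤ 1 / 2 := by
      rw [hc]; exact one_div_le_one_div_of_le (by norm_num) (by linarith)
    have hcL : c * (1 + L) = 1 / 2 := by rw [hc]; field_simp
    set e := P (0, 1) with he
    have hen : ‖e‖ = 1 := by rw [he, hP.norm_zero_snd]; simp
    obtain ⟨κ, hκs, hκ0, hκc, hκ1, hκz⟩ := exists_mol (m := n + 1) (r := c * t) (by positivity)
    set κ' : EV (n + 1) → ℝ := fun w => κ (w + t • e) with hκ'
    have hte : ‖t • e‖ = t := by rw [norm_smul, hen, Real.norm_of_nonneg ht0.le, mul_one]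
    have s1 : ContDiff ℝ (⊤ : ℕ∞) κ' := hκs.comp (contDiff_id.add contDiff_const)
    have s2 : HasCompactSupport κ' := hκc.comp_homeomorph (Homeomorph.addRight (t • e))
    have s3 : ∫ w, κ' w = 1 := by rw [← hκ1]; exact integral_add_right_eq_self κ (t • e)
    have s4 : ∀ w, c * t < ‖w + t • e‖ → w ∉ tsupport κ' := by
      intro w hw
      rw [notMem_tsupport_iff_eventuallyEq]
      have : IsOpen {w : EV (n + 1) | c * t < ‖w + t • e‖} := isOpen_lt continuous_const (by fun_prop)
      filter_upwards [this.mem_nhds hw] with y hy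
      exact hκz _ (le_of_lt hy)
    refine ⟨cnv κ' (Ω.indicator u), (cnv_contDiff s1 s2 ?_).of_le two_le_inf, ?_⟩
    · have := ind_locInt hp1 hΩ (hD.2.2 [] (by simp))
      rwa [hD.1] at this
    have hm := hmol κ' s1.continuous (fun w => hκ0 _) s2 s3 (by
      intro w hw
      refine hκz _ ?_
      have h1 : ‖w‖ ≤ ‖w + t • e‖ + ‖t • e‖ := by
        have := norm_sub_le (w + t • e) (t • e)
        simpa using this
      have : t ≤ r / 4 := min_le_left _ _
      nlinarith)
    refine le_trans ?_ hm
    refine le_trans (le_of_eq ?_) (eLpNorm_mono_measure _ (Measure.restrict_le_self (s := Ω ∩ Metric.ball z δ)))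
    refine eLpNorm_congr_ae ?_
    filter_upwards [ae_restrict_mem (hΩ.inter Metric.isOpen_ball).measurableSet] with x hx
    rw [Set.indicator_of_mem hx.1]
    congr 1
    refine cnv_jet hp1 hΩ hD s1 s2 ?_
    intro w hw
    have hq : ‖w + t • e‖ ≤ c * t := by
      by_contra hh; exact s4 w (not_le.1 hh) hw
    set q := w + t • e with hqd
    have hxw : x - w = x + (t • e - q) := by rw [hqd]; abel
    have htδ : t ≤ δ / 4 := min_le_right _ _
    have hxz : ‖x - z‖ < δ := by have := hx.2; rwa [mem_ball_iff_norm] at this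
    have hxU : x - w ∈ U := by
      refine hRU ?_
      rw [mem_ball_iff_norm, hxw]
      have h1 : x + (t • e - q) - z = (x - z) + (t • e - q) := by abel
      rw [h1]
      have h2 := norm_add_le (x - z) (t • e - q)
      have h3 := norm_sub_le (t • e) q
      nlinarith
    have hxU0 : x ∈ U := by
      refine hRU ?_
      rw [mem_ball_iff_norm]; linarith
    rw [h.mem_iff hxU]
    have h0 := (h.mem_iff hxU0).1 hx.1
    have e1 : P.symm (x - w) = P.symm x + (t • ((0, 1) : FV n) - P.symm q) := by
      rw [hxw, map_add, map_sub, map_smul, he, P.symm_apply_apply]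
    unfold ff at h0 ⊢
    rw [e1]
    have h1 := hP.fst_le q
    have h2 := hP.snd_le q
    have h3 := hlip ((P.symm x + (t • ((0, 1) : FV n) - P.symm q)).1) (P.symm x).1
    have h4 : (P.symm x + (t • ((0, 1) : FV n) - P.symm q)).1 - (P.symm x).1 = - (P.symm q).1 := by
      simp
    rw [h4, norm_neg] at h3
    have h5 : (P.symm x + (t • ((0, 1) : FV n) - P.symm q)).2 = (P.symm x).2 + (t - (P.symm q).2) := by simp
    rw [h5]
    have h6 := (abs_le.1 h3).2
    have h7 := (abs_le.1 h2).2
    have h8 : L * ‖(P.symm q).1‖ ≤ L * (c * t) := mul_le_mul_of_nonneg_left (h1.trans hq) hL0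
    nlinarith
  choose w hw1 hw2 using step
  refine ⟨w, hw1, ?_⟩
  refine tendsto_of_tendsto_of_tendsto_of_le_of_le tendsto_const_nhds ?_ (fun _ => zero_le) hw2
  have := ENNReal.tendsto_ofReal (tendsto_one_div_add_atTop_nhds_zero_nat (𝕜 := ℝ))
  simpa using this

end P21

end Part21

section Part22

section P22
variable {X Y : Type*} [NormedAddCommGroup X] [NormedSpace ℝ X] [NormedAddCommGroup Y] [NormedSpace ℝ Y]

/-- product of jets -/
def jm (s t : Jet X) : Jet X :=
  mkJ (s.a * t.a) (s.a • t.b + t.a • s.b) (s.a • t.c + t.a • s.c + s.b.smulRight t.b + t.b.smulRight s.b)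

lemma jm_sub_right (s t t' : Jet X) : jm s (t - t') = jm s t - jm s t' := by
  refine Jet.ext' ?_ ?_ ?_
  · simp [jm]; ring
  · refine ContinuousLinearMap.ext fun η => ?_
    simp [jm]; ring
  · refine ContinuousLinearMap.ext fun η => ContinuousLinearMap.ext fun ζ => ?_
    simp [jm]; ring

lemma jm_comm (s t : Jet X) : jm s t = jm t s := by
  refine Jet.ext' ?_ ?_ ?_
  · simp [jm]; ring
  · refine ContinuousLinearMap.ext fun η => ?_
    simp [jm]; ring
  · refine ContinuousLinearMap.ext fun η => ContinuousLinearMap.ext fun ζ => ?_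
    simp [jm]; ring

lemma jm_assoc (s t r : Jet X) : jm (jm s t) r = jm s (jm t r) := by
  refine Jet.ext' ?_ ?_ ?_
  · simp [jm]; ring
  · refine ContinuousLinearMap.ext fun η => ?_
    simp [jm]; ring
  · refine ContinuousLinearMap.ext fun η => ContinuousLinearMap.ext fun ζ => ?_
    simp [jm]; ring

lemma jm_zero_left (t : Jet X) : jm 0 t = 0 := by
  refine Jet.ext' ?_ ?_ ?_
  · simp [jm]
  · refine ContinuousLinearMap.ext fun η => ?_
    simp [jm]
  · refine ContinuousLinearMap.ext fun η => ContinuousLinearMap.ext fun ζ => ?_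
    simp [jm]

lemma jm_zero_right (t : Jet X) : jm t 0 = 0 := by rw [jm_comm, jm_zero_left]

lemma jm_add_left (s s' t : Jet X) : jm (s + s') t = jm s t + jm s' t := by
  refine Jet.ext' ?_ ?_ ?_
  · simp [jm]; ring
  · refine ContinuousLinearMap.ext fun η => ?_
    simp [jm]; ring
  · refine ContinuousLinearMap.ext fun η => ContinuousLinearMap.ext fun ζ => ?_
    simp [jm]; ring

lemma jm_sub_left (s s' t : Jet X) : jm (s - s') t = jm s t - jm s' t := by
  rw [jm_comm, jm_sub_right, jm_comm t s, jm_comm t s']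

lemma norm_add4 {Z : Type*} [NormedAddCommGroup Z] (a b c d : Z) : ‖a + b + c + d‖ ≤ ‖a‖ + ‖b‖ + ‖c‖ + ‖d‖ := by
  have h1 := norm_add_le (a + b + c) d
  have h2 := norm_add_le (a + b) c
  have h3 := norm_add_le a b
  linarith

lemma smul4 {Z : Type*} [NormedAddCommGroup Z] [NormedSpace ℝ Z] {a b : ℝ} {x y c d : Z} {s t : ℝ} (a1 : ‖a‖ ≤ s)
    (a2 : ‖b‖ ≤ t) (c2 : ‖x‖ ≤ t) (c1 : ‖y‖ ≤ s) (hs : 0 ≤ s) (ht : 0 ≤ t) (hc : ‖c‖ ≤ s * t) (hd : ‖d‖ ≤ s * t) :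
    ‖a • x + b • y + c + d‖ ≤ 4 * s * t := by
  have h1 := norm_add4 (a • x) (b • y) c d
  rw [norm_smul, norm_smul] at h1
  have := mul_le_mul a1 c2 (norm_nonneg _) hs
  have := mul_le_mul a2 c1 (norm_nonneg _) ht
  linarith

lemma cont_add4 {Z T : Type*} [TopologicalSpace T] [NormedAddCommGroup Z] {a b c d : T → Z} (ha : Continuous a)
    (hb : Continuous b) (hc : Continuous c) (hd : Continuous d) : Continuous fun q => a q + b q + c q + d q :=
  ((ha.add hb).add hc).add hd

lemma jm_norm (s t : Jet X) : ‖jm s t‖ ≤ 4 * ‖s‖ * ‖t‖ := by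
  have a1 := s.norm_a; have a2 := t.norm_a
  have b1 := s.norm_b; have b2 := t.norm_b
  have c1 := s.norm_c; have c2 := t.norm_c
  have hs := norm_nonneg s; have ht := norm_nonneg t
  have p : ∀ {x y u v : ℝ}, 0 ≤ x → 0 ≤ y → x ≤ u → y ≤ v → x * y ≤ u * v := fun hx hy h1 h2 =>
    mul_le_mul h1 h2 hy (hx.trans h1)
  have q := mul_nonneg hs ht
  refine Jet.norm_le ?_ ?_ ?_
  · simp only [jm, mkJ_a, norm_mul]
    have := p (norm_nonneg _) (norm_nonneg _) a1 a2
    linarith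
  · simp only [jm, mkJ_b]
    refine (norm_add_le _ _).trans ?_
    rw [norm_smul, norm_smul]
    have := p (norm_nonneg _) (norm_nonneg _) a1 b2
    have := p (norm_nonneg _) (norm_nonneg _) a2 b1
    linarith
  · simp only [jm, mkJ_c]
    refine smul4 (Z := X →L[ℝ] X →L[ℝ] ℝ) a1 a2 c2 c1 hs ht ?_ ?_
    · rw [ContinuousLinearMap.norm_smulRight_apply]
      exact p (norm_nonneg _) (norm_nonneg _) b1 b2
    · rw [ContinuousLinearMap.norm_smulRight_apply]
      have := p (norm_nonneg _) (norm_nonneg _) b2 b1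
      linarith

lemma jm_cont : Continuous fun q : Jet X × Jet X => jm q.1 q.2 := by
  have a1 : Continuous fun q : Jet X × Jet X => q.1.a := JLa.continuous.comp continuous_fst
  have a2 : Continuous fun q : Jet X × Jet X => q.2.a := JLa.continuous.comp continuous_snd
  have b1 : Continuous fun q : Jet X × Jet X => q.1.b := JLb.continuous.comp continuous_fst
  have b2 : Continuous fun q : Jet X × Jet X => q.2.b := JLb.continuous.comp continuous_snd
  have c1 : Continuous fun q : Jet X × Jet X => q.1.c := JLc.continuous.comp continuous_fst
  have c2 : Continuous fun q : Jet X × Jet X => q.2.c := JLc.continuous.comp continuous_snd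
  have r : ∀ {f g : Jet X × Jet X → (X →L[ℝ] ℝ)}, Continuous f → Continuous g → Continuous fun q => (f q).smulRight (g q) := by
    intro f g hf hg
    exact ((ContinuousLinearMap.smulRightL ℝ X (X →L[ℝ] ℝ)).continuous.comp hf).clm_apply hg
  exact Jet.continuous_mk (a1.mul a2) ((a1.smul b2).add (a2.smul b1))
    (cont_add4 (Z := X →L[ℝ] X →L[ℝ] ℝ) (a := fun q : Jet X × Jet X => q.1.a • q.2.c) (b := fun q => q.2.a • q.1.c)
      (a1.smul c2) (a2.smul c1) (r b1 b2) (r b2 b1))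

lemma jj_mul {v w : X → ℝ} {x : X} (hv : ContDiffAt ℝ 2 v x) (hw : ContDiffAt ℝ 2 w x) :
    jj (fun y => v y * w y) x = jm (jj v x) (jj w x) := by
  have dv : ∀ᶠ y in 𝓝 x, DifferentiableAt ℝ v y :=
    (hv.eventually (by norm_num)).mono fun y h => h.differentiableAt (by norm_num)
  have dw : ∀ᶠ y in 𝓝 x, DifferentiableAt ℝ w y :=
    (hw.eventually (by norm_num)).mono fun y h => h.differentiableAt (by norm_num)
  have e : fderiv ℝ (fun y => v y * w y) =ᶠ[𝓝 x] fun y => v y • fderiv ℝ w y + w y • fderiv ℝ v y := by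
    filter_upwards [dv, dw] with y h1 h2
    exact fderiv_fun_mul h1 h2
  have ev : DifferentiableAt ℝ (fderiv ℝ v) x := (hv.fderiv_right (m := 1) (by norm_num)).differentiableAt (by norm_num)
  have ew : DifferentiableAt ℝ (fderiv ℝ w) x := (hw.fderiv_right (m := 1) (by norm_num)).differentiableAt (by norm_num)
  refine Jet.ext' rfl ?_ ?_
  · simp only [jj_b, jm, mkJ_b, jj_a]; exact e.self_of_nhds
  · simp only [jj_c, jm, mkJ_c, jj_a, jj_b]
    rw [e.fderiv_eq]
    have h1 := (dv.self_of_nhds.hasFDerivAt.fun_smul ew.hasFDerivAt).add (dw.self_of_nhds.hasFDerivAt.fun_smul ev.hasFDerivAt)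
    refine h1.fderiv.trans ?_
    refine ContinuousLinearMap.ext fun η => ContinuousLinearMap.ext fun ζ => ?_
    simp; ring

lemma jj_comp_le {q : Y → ℝ} {f : X → Y} {x : X} (hq : ContDiffAt ℝ 2 q (f x)) (hf : ContDiffAt ℝ 2 f x) :
    ‖jj (fun y => q (f y)) x‖ ≤ ‖jj q (f x)‖ * (1 + ‖fderiv ℝ f x‖ + ‖fderiv ℝ f x‖ ^ 2 + ‖fderiv ℝ (fderiv ℝ f) x‖) := by
  have df : ∀ᶠ y in 𝓝 x, DifferentiableAt ℝ f y :=
    (hf.eventually (by norm_num)).mono fun y h => h.differentiableAt (by norm_num)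
  have dq : ∀ᶠ y in 𝓝 x, DifferentiableAt ℝ q (f y) :=
    hf.continuousAt.eventually ((hq.eventually (by norm_num)).mono fun y h => h.differentiableAt (by norm_num))
  have e : fderiv ℝ (fun y => q (f y)) =ᶠ[𝓝 x] fun y => (fderiv ℝ q (f y)).comp (fderiv ℝ f y) := by
    filter_upwards [df, dq] with y h1 h2
    exact fderiv_comp y h2 h1
  have ef : DifferentiableAt ℝ (fderiv ℝ f) x := (hf.fderiv_right (m := 1) (by norm_num)).differentiableAt (by norm_num)
  have eq : DifferentiableAt ℝ (fderiv ℝ q) (f x) := (hq.fderiv_right (m := 1) (by norm_num)).differentiableAt (by norm_num)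
  have eqf : HasFDerivAt (fun y => fderiv ℝ q (f y)) ((fderiv ℝ (fderiv ℝ q) (f x)).comp (fderiv ℝ f x)) x :=
    HasFDerivAt.comp (g := fderiv ℝ q) (f := f) x eq.hasFDerivAt df.self_of_nhds.hasFDerivAt
  set F := fderiv ℝ f x
  set J := jj q (f x) with hJ
  have n1 := J.norm_a; have n2 := J.norm_b; have n3 := J.norm_c
  have hJ0 := norm_nonneg J
  have hF := norm_nonneg F
  have hF2 := norm_nonneg (fderiv ℝ (fderiv ℝ f) x)
  have x1 := mul_nonneg hJ0 hF
  have x2 := mul_nonneg hJ0 hF2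
  have x3 := mul_nonneg hJ0 (sq_nonneg ‖F‖)
  refine Jet.norm_le ?_ ?_ ?_
  · have : (jj (fun y => q (f y)) x).a = J.a := rfl
    rw [this]; nlinarith
  · have : (jj (fun y => q (f y)) x).b = J.b.comp F := e.self_of_nhds
    rw [this]
    refine (ContinuousLinearMap.opNorm_comp_le _ _).trans ?_
    have := mul_le_mul_of_nonneg_right n2 hF
    nlinarith
  · have h1 : ∀ η ζ, (jj (fun y => q (f y)) x).c η ζ = J.c (F η) (F ζ) + J.b (fderiv ℝ (fderiv ℝ f) x η ζ) := by
      intro η ζ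
      have h2 := (eqf.clm_comp ef.hasFDerivAt).fderiv
      rw [jj_c, e.fderiv_eq, h2]
      simp [hJ, F]
      ring
    refine ContinuousLinearMap.opNorm_le_bound _ (by positivity) fun η => ?_
    refine ContinuousLinearMap.opNorm_le_bound _ (by positivity) fun ζ => ?_
    rw [h1]
    have h3 : ‖J.c (F η) (F ζ)‖ ≤ ‖J‖ * (‖F‖ * ‖η‖) * (‖F‖ * ‖ζ‖) :=
      (J.c.le_opNorm₂ _ _).trans (by gcongr <;> exact F.le_opNorm _)
    have h4 : ‖J.b (fderiv ℝ (fderiv ℝ f) x η ζ)‖ ≤ ‖J‖ * (‖fderiv ℝ (fderiv ℝ f) x‖ * ‖η‖ * ‖ζ‖) :=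
      (J.b.le_opNorm _).trans (by gcongr; exact (fderiv ℝ (fderiv ℝ f) x).le_opNorm₂ _ _)
    refine (norm_add_le _ _).trans ((add_le_add h3 h4).trans ?_)
    have h5 : 0 ≤ ‖J‖ * (1 + ‖F‖) * (‖η‖ * ‖ζ‖) := by positivity
    nlinarith

variable {n : ℕ} {Ω : Set (EV (n + 1))} {M : Matrix (Fin (n + 1)) (Fin (n + 1)) ℝ} {p : ℝ≥0∞}
  {D : List (Fin (n + 1)) → EV (n + 1) → ℝ}

lemma nbc_const (c : ℝ) : NBC Ω M (fun _ => c) := by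
  intro U P γ _ x _ _; simp

lemma nbc_add {f g : EV (n + 1) → ℝ} (hf : ContDiff ℝ 2 f) (hg : ContDiff ℝ 2 g) (h : NBC Ω M f) (h' : NBC Ω M g) :
    NBC Ω M (fun x => f x + g x) := by
  intro U P γ hc x hx h0
  rw [fderiv_fun_add (hf.differentiable (by norm_num) x) (hg.differentiable (by norm_num) x)]
  simp [h U P γ hc x hx h0, h' U P γ hc x hx h0]

lemma nbc_sub {f g : EV (n + 1) → ℝ} (hf : ContDiff ℝ 2 f) (hg : ContDiff ℝ 2 g) (h : NBC Ω M f) (h' : NBC Ω M g) :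
    NBC Ω M (fun x => f x - g x) := by
  intro U P γ hc x hx h0
  rw [fderiv_fun_sub (hf.differentiable (by norm_num) x) (hg.differentiable (by norm_num) x)]
  simp [h U P γ hc x hx h0, h' U P γ hc x hx h0]

lemma nbc_mul {f g : EV (n + 1) → ℝ} (hf : ContDiff ℝ 2 f) (hg : ContDiff ℝ 2 g) (h : NBC Ω M f) (h' : NBC Ω M g) :
    NBC Ω M (fun x => f x * g x) := by
  intro U P γ hc x hx h0
  rw [fderiv_fun_mul (hf.differentiable (by norm_num) x) (hg.differentiable (by norm_num) x)]
  simp [h U P γ hc x hx h0, h' U P γ hc x hx h0]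

/-- admissible cut-off functions -/
def Cut (Ω : Set (EV (n + 1))) (M : Matrix (Fin (n + 1)) (Fin (n + 1)) ℝ) (θ : EV (n + 1) → ℝ) : Prop :=
  ContDiff ℝ 2 θ ∧ NBC Ω M θ ∧ ∃ C : ℝ, ∀ x, ‖jj θ x‖ ≤ C

lemma jj_const (c : ℝ) (x : X) : jj (fun _ => c) x = mkJ c 0 0 := by
  have h1 : fderiv ℝ (fun _ : X => c) = fun _ => 0 := by funext y; simp
  refine Jet.ext' rfl ?_ ?_
  · simp
  · rw [jj_c, h1, mkJ_c]; simp

lemma cut_const (c : ℝ) : Cut Ω M (fun _ => c) :=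
  ⟨contDiff_const, nbc_const c, ‖(mkJ c 0 0 : Jet (EV (n + 1)))‖, fun x => by rw [jj_const]⟩

lemma cut_mul {f g : EV (n + 1) → ℝ} (hf : Cut Ω M f) (hg : Cut Ω M g) : Cut Ω M (fun x => f x * g x) := by
  obtain ⟨h1, h2, C, hC⟩ := hf
  obtain ⟨h1', h2', C', hC'⟩ := hg
  refine ⟨h1.mul h1', nbc_mul h1 h1' h2 h2', 4 * C * C', fun x => ?_⟩
  rw [jj_mul h1.contDiffAt h1'.contDiffAt]
  refine (jm_norm _ _).trans ?_
  have := (norm_nonneg _).trans (hC x)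
  gcongr
  · exact hC x
  · exact hC' x

lemma cut_sub {f g : EV (n + 1) → ℝ} (hf : Cut Ω M f) (hg : Cut Ω M g) : Cut Ω M (fun x => f x - g x) := by
  obtain ⟨h1, h2, C, hC⟩ := hf
  obtain ⟨h1', h2', C', hC'⟩ := hg
  refine ⟨h1.sub h1', nbc_sub h1 h1' h2 h2', C + C', fun x => ?_⟩
  rw [jj_sub h1 h1']
  exact (norm_sub_le _ _).trans (add_le_add (hC x) (hC' x))

/-- `θ u` can be approximated -/
def Appr (Ω : Set (EV (n + 1))) (M : Matrix (Fin (n + 1)) (Fin (n + 1)) ℝ) (p : ℝ≥0∞)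
    (D : List (Fin (n + 1)) → EV (n + 1) → ℝ) (θ : EV (n + 1) → ℝ) : Prop :=
  ∃ v : ℕ → EV (n + 1) → ℝ, (∀ j, ContDiff ℝ 2 (v j) ∧ HasCompactSupport (v j) ∧ NBC Ω M (v j)) ∧
    (∀ η : ℝ≥0∞, 0 < η → ∃ N, ∀ j ≥ N, ∀ k ≥ N, eLpNorm (fun x => jj (v j) x - jj (v k) x) p volume ≤ η) ∧
    Tendsto (fun j => eLpNorm (fun x => jj (v j) x - jm (jj θ x) (jetD D x)) p (volume.restrict Ω)) atTop (𝓝 0)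

lemma jm_meas {μ : Measure (EV (n + 1))} {θ : EV (n + 1) → ℝ} (hθ : ContDiff ℝ 2 θ)
    {T : EV (n + 1) → Jet (EV (n + 1))} (hT : AEStronglyMeasurable T μ) :
    AEStronglyMeasurable (fun x => jm (jj θ x) (T x)) μ :=
  jm_cont.comp_aestronglyMeasurable ((jj_continuous hθ).aestronglyMeasurable.prodMk hT)

lemma appr_add (hp1 : 1 ≤ p) (hT : AEStronglyMeasurable (jetD D) (volume.restrict Ω)) {f g : EV (n + 1) → ℝ} (hf : Cut Ω M f) (hg : Cut Ω M g)
    (h : Appr Ω M p D f) (h' : Appr Ω M p D g) : Appr Ω M p D (fun x => f x + g x) := by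
  obtain ⟨v, h1, h2, h3⟩ := h
  obtain ⟨w, g1, g2, g3⟩ := h'
  have ms : ∀ {v : EV (n + 1) → ℝ}, ContDiff ℝ 2 v → ∀ {μ : Measure (EV (n + 1))}, AEStronglyMeasurable (jj v) μ :=
    fun hv _ => (jj_continuous hv).aestronglyMeasurable
  refine ⟨fun j x => v j x + w j x, fun j => ⟨(h1 j).1.add (g1 j).1, (h1 j).2.1.add (g1 j).2.1, nbc_add (h1 j).1 (g1 j).1 (h1 j).2.2 (g1 j).2.2⟩, ?_, ?_⟩
  · intro η hη
    obtain ⟨N, hN⟩ := h2 (η / 2) (ENNReal.half_pos hη.ne')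
    obtain ⟨N', hN'⟩ := g2 (η / 2) (ENNReal.half_pos hη.ne')
    refine ⟨max N N', fun j hj k hk => ?_⟩
    have e : (fun x => jj (fun y => v j y + w j y) x - jj (fun y => v k y + w k y) x)
        = (fun x => jj (v j) x - jj (v k) x) + fun x => jj (w j) x - jj (w k) x := by
      funext x
      rw [fderiv2_add (h1 j).1 (g1 j).1, fderiv2_add (h1 k).1 (g1 k).1, Pi.add_apply]; abel
    rw [e]
    refine (eLpNorm_add_le ((ms (h1 j).1).sub (ms (h1 k).1)) ((ms (g1 j).1).sub (ms (g1 k).1)) hp1).trans ?_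
    rw [← ENNReal.add_halves η]
    exact add_le_add (hN j (le_of_max_le_left hj) k (le_of_max_le_left hk))
      (hN' j (le_of_max_le_right hj) k (le_of_max_le_right hk))
  · refine tendsto_of_tendsto_of_tendsto_of_le_of_le tendsto_const_nhds (by simpa using h3.add g3) (fun _ => zero_le) fun j => ?_
    have e : (fun x => jj (fun y => v j y + w j y) x - jm (jj (fun y => f y + g y) x) (jetD D x))
        = (fun x => jj (v j) x - jm (jj f x) (jetD D x)) + fun x => jj (w j) x - jm (jj g x) (jetD D x) := by
      funext x
      rw [fderiv2_add (h1 j).1 (g1 j).1, fderiv2_add hf.1 hg.1, jm_add_left, Pi.add_apply]; abel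
    simp only [e]
    exact eLpNorm_add_le ((ms (h1 j).1).sub (jm_meas hf.1 hT)) ((ms (g1 j).1).sub (jm_meas hg.1 hT)) hp1

end P22

end Part22

section Part23

section P23
variable {n : ℕ}

lemma img_vol {P : FV n ≃L[ℝ] EV (n + 1)} (hP : IsoP P) {Φ : FV n → EV (n + 1)} (hΦ : Differentiable ℝ Φ)
    {S : Set (FV n)} (hS : MeasurableSet S) (hi : Set.InjOn Φ S) :
    volume (Φ '' S) = ∫⁻ y in S, ENNReal.ofReal |((P.symm : EV (n + 1) →L[ℝ] FV n).comp (fderiv ℝ Φ y)).det| := by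
  have h1 : ∀ y ∈ S, HasFDerivWithinAt (fun y => P.symm (Φ y)) ((P.symm : EV (n + 1) →L[ℝ] FV n).comp (fderiv ℝ Φ y)) S y := by
    intro y _
    exact ((P.symm : EV (n + 1) →L[ℝ] FV n).hasFDerivAt.comp y (hΦ y).hasFDerivAt).hasFDerivWithinAt
  have h2 : Set.InjOn (fun y => P.symm (Φ y)) S := fun a ha b hb e => hi ha hb (P.symm.injective e)
  rw [lintegral_abs_det_fderiv_eq_addHaar_image volume hS h1 h2]
  rw [← (hP.mp_symm.symm P.symm.toHomeomorph.toMeasurableEquiv).measure_preimage_emb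
    (P.symm.toHomeomorph.toMeasurableEquiv.symm.measurableEmbedding) (Φ '' S)]
  congr 1
  ext y
  constructor
  · rintro ⟨a, ha, e⟩
    refine ⟨a, ha, ?_⟩
    have e' : Φ a = P y := e
    change P.symm (Φ a) = y
    rw [e']; simp
  · rintro ⟨a, ha, e⟩
    refine ⟨a, ha, ?_⟩
    change Φ a = P y
    rw [← e]; simp

lemma coef_aux {T Z W : Type*} [TopologicalSpace T] [NormedAddCommGroup Z] [NormedAddCommGroup W] {f : T → Z} {g : T → W}
    {x : T} (hf : ContinuousAt f x) (hg : ContinuousAt g x) : ContinuousAt (fun y => 1 + ‖f y‖ + ‖f y‖ ^ 2 + ‖g y‖) x :=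
  ((continuousAt_const.add hf.norm).add (hf.norm.pow 2)).add hg.norm

lemma coef_cont {X Y : Type*} [NormedAddCommGroup X] [NormedSpace ℝ X] [NormedAddCommGroup Y] [NormedSpace ℝ Y]
    {f : X → Y} {x : X} (hf : ContDiffAt ℝ 2 f x) :
    ContinuousAt (fun y => 1 + ‖fderiv ℝ f y‖ + ‖fderiv ℝ f y‖ ^ 2 + ‖fderiv ℝ (fderiv ℝ f) y‖) x := by
  have a1 : ContDiffAt ℝ 1 (fderiv ℝ f) x := hf.fderiv_right (by norm_num)
  have a2 : ContinuousAt (fderiv ℝ (fderiv ℝ f)) x := (a1.fderiv_right (m := 0) (by norm_num)).continuousAt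
  exact coef_aux (Z := X →L[ℝ] Y) (W := X →L[ℝ] X →L[ℝ] Y) a1.continuousAt a2

/-- quantitative inverse function theorem -/
lemma flat_ift {P : FV n ≃L[ℝ] EV (n + 1)} (hP : IsoP P) {Φ : FV n → EV (n + 1)} (hΦ : ContDiff ℝ 2 Φ) {c : FV n}
    (hinj : ∀ η, fderiv ℝ Φ c η = 0 → η = 0) {Q : FV n → Prop} (hQ : ∀ᶠ y in 𝓝 c, Q y) :
    ∃ r > 0, ∃ (Ψ : EV (n + 1) → FV n) (C : ℝ) (K : ℝ≥0∞), K ≠ ⊤ ∧ (∀ y ∈ Metric.ball c r, Q y ∧ Ψ (Φ y) = y ∧ ContDiffAt ℝ 2 Ψ (Φ y)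
        ∧ 1 + ‖fderiv ℝ Φ y‖ + ‖fderiv ℝ Φ y‖ ^ 2 + ‖fderiv ℝ (fderiv ℝ Φ) y‖ ≤ C
        ∧ 1 + ‖fderiv ℝ Ψ (Φ y)‖ + ‖fderiv ℝ Ψ (Φ y)‖ ^ 2 + ‖fderiv ℝ (fderiv ℝ Ψ) (Φ y)‖ ≤ C)
      ∧ IsOpen (Φ '' Metric.ball c r)
      ∧ ∀ S, MeasurableSet S → S ⊆ Metric.ball c r → volume (Φ '' S) ≤ K * volume S ∧ volume S ≤ K * volume (Φ '' S) := by
  have hinj' : Function.Injective (fderiv ℝ Φ c) := (injective_iff_map_eq_zero _).2 hinj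
  have hsur : Function.Surjective (fderiv ℝ Φ c) :=
    (LinearMap.injective_iff_surjective_of_finrank_eq_finrank (f := (fderiv ℝ Φ c : FV n →ₗ[ℝ] EV (n + 1)))
      P.toLinearEquiv.finrank_eq).1 hinj'
  let f' : FV n ≃L[ℝ] EV (n + 1) := ContinuousLinearEquiv.ofBijective (fderiv ℝ Φ c)
    (LinearMap.ker_eq_bot.2 hinj') (LinearMap.range_eq_top.2 hsur)
  have hf' : HasFDerivAt Φ (f' : FV n →L[ℝ] EV (n + 1)) c := by
    have : (f' : FV n →L[ℝ] EV (n + 1)) = fderiv ℝ Φ c := ContinuousLinearEquiv.coe_ofBijective _ _ _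
    rw [this]; exact (hΦ.differentiable (by norm_num) c).hasFDerivAt
  let e := hΦ.contDiffAt.toOpenPartialHomeomorph Φ hf' (by norm_num)
  have he : ∀ y, e y = Φ y := fun y => rfl
  have hce : c ∈ e.source := hΦ.contDiffAt.mem_toOpenPartialHomeomorph_source hf' (by norm_num)
  have hΨ : ContDiffAt ℝ 2 e.symm (Φ c) := hΦ.contDiffAt.to_localInverse hf' (by norm_num)
  have k1 := coef_cont (hΦ.contDiffAt (x := c))
  have k2 := coef_cont hΨ
  have hcont : ContinuousAt Φ c := hΦ.continuous.continuousAt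
  have k3 : Continuous fun y => |((P.symm : EV (n + 1) →L[ℝ] FV n).comp (fderiv ℝ Φ y)).det| :=
    continuous_abs.comp (ContinuousLinearMap.continuous_det.comp
      (continuous_const.clm_comp (hΦ.continuous_fderiv (by norm_num))))
  set d := |((P.symm : EV (n + 1) →L[ℝ] FV n).comp (fderiv ℝ Φ c)).det| with hd
  have hd0 : 0 < d := by
    refine abs_pos.2 fun h0 => ?_
    have h1 : LinearMap.det (((P.symm : EV (n + 1) →L[ℝ] FV n).comp (fderiv ℝ Φ c) : FV n →L[ℝ] FV n) : FV n →ₗ[ℝ] FV n) = 0 := h0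
    have h2 := LinearMap.bot_lt_ker_of_det_eq_zero h1
    refine h2.ne' (LinearMap.ker_eq_bot.2 fun a b h => hinj' (P.symm.injective ?_))
    exact h
  set C1 := 1 + ‖fderiv ℝ Φ c‖ + ‖fderiv ℝ Φ c‖ ^ 2 + ‖fderiv ℝ (fderiv ℝ Φ) c‖
  set C2 := 1 + ‖fderiv ℝ e.symm (Φ c)‖ + ‖fderiv ℝ e.symm (Φ c)‖ ^ 2 + ‖fderiv ℝ (fderiv ℝ e.symm) (Φ c)‖
  have ev : ∀ᶠ y in 𝓝 c, (Q y ∧ e.symm (Φ y) = y ∧ ContDiffAt ℝ 2 e.symm (Φ y)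
        ∧ 1 + ‖fderiv ℝ Φ y‖ + ‖fderiv ℝ Φ y‖ ^ 2 + ‖fderiv ℝ (fderiv ℝ Φ) y‖ ≤ max (C1 + 1) (C2 + 1)
        ∧ 1 + ‖fderiv ℝ e.symm (Φ y)‖ + ‖fderiv ℝ e.symm (Φ y)‖ ^ 2 + ‖fderiv ℝ (fderiv ℝ e.symm) (Φ y)‖ ≤ max (C1 + 1) (C2 + 1))
        ∧ y ∈ e.source ∧ |((P.symm : EV (n + 1) →L[ℝ] FV n).comp (fderiv ℝ Φ y)).det| < 2 * d
        ∧ d / 2 < |((P.symm : EV (n + 1) →L[ℝ] FV n).comp (fderiv ℝ Φ y)).det| := by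
    filter_upwards [hQ, e.open_source.mem_nhds hce, hcont.eventually (hΨ.eventually (by norm_num)),
      k1.eventually_lt continuousAt_const (show C1 < C1 + 1 by linarith),
      hcont.eventually (k2.eventually_lt continuousAt_const (show C2 < C2 + 1 by linarith)),
      k3.continuousAt.eventually_lt (x₀ := c) continuousAt_const (show d < 2 * d by linarith),
      ContinuousAt.eventually_lt (x₀ := c) continuousAt_const k3.continuousAt (show d / 2 < d by linarith)] with y h1 h2 h3 h4 h5 h6 h7
    exact ⟨⟨h1, e.left_inv h2, h3, h4.le.trans (le_max_left _ _), h5.le.trans (le_max_right _ _)⟩, h2, h6, h7⟩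
  obtain ⟨r, hr, hB⟩ := Metric.eventually_nhds_iff_ball.1 ev
  refine ⟨r, hr, e.symm, max (C1 + 1) (C2 + 1), max (ENNReal.ofReal (2 * d)) (ENNReal.ofReal (d / 2)⁻¹),
    (max_lt ENNReal.ofReal_lt_top ENNReal.ofReal_lt_top).ne, fun y hy => (hB y hy).1, ?_, ?_⟩
  · exact e.isOpen_image_of_subset_source Metric.isOpen_ball (fun y hy => (hB y hy).2.1)
  · intro S hS hSB
    have hi : Set.InjOn Φ S := by
      intro a ha b hb h
      rw [← (hB a (hSB ha)).1.2.1, ← (hB b (hSB hb)).1.2.1, h]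
    rw [img_vol hP (hΦ.differentiable (by norm_num)) hS hi]
    have u : ∫⁻ y in S, ENNReal.ofReal |((P.symm : EV (n + 1) →L[ℝ] FV n).comp (fderiv ℝ Φ y)).det|
        ≤ ∫⁻ y in S, ENNReal.ofReal (2 * d) :=
      setLIntegral_mono' hS fun y hy => ENNReal.ofReal_le_ofReal (hB y (hSB hy)).2.2.1.le
    have l : ∫⁻ y in S, ENNReal.ofReal (d / 2) ≤ ∫⁻ y in S, ENNReal.ofReal |((P.symm : EV (n + 1) →L[ℝ] FV n).comp (fderiv ℝ Φ y)).det| :=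
      setLIntegral_mono' hS fun y hy => ENNReal.ofReal_le_ofReal (hB y (hSB hy)).2.2.2.le
    rw [setLIntegral_const] at u l
    refine ⟨u.trans (by gcongr; exact le_max_left _ _), ?_⟩
    calc volume S = ENNReal.ofReal (d / 2)⁻¹ * (ENNReal.ofReal (d / 2) * volume S) := by
          rw [← mul_assoc, ← ENNReal.ofReal_mul (by positivity), inv_mul_cancel₀ (by positivity)]; simp
      _ ≤ _ := by gcongr; exact le_max_right _ _

end P23

end Part23

section Part24

section P24
variable {n : ℕ} {P : FV n ≃L[ℝ] EV (n + 1)} {γ : EV n → ℝ} {M : Matrix (Fin (n + 1)) (Fin (n + 1)) ℝ}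

/-- collar map along the conormal direction -/
def fch (P : FV n ≃L[ℝ] EV (n + 1)) (γ : EV n → ℝ) (M : Matrix (Fin (n + 1)) (Fin (n + 1)) ℝ) (y : FV n) : EV (n + 1) :=
  shear P γ (y.1, 0) + y.2 • mulVecE M (nuv P γ y.1)

lemma nuv_contDiff (hγ : ContDiff ℝ 3 γ) : ContDiff ℝ 2 (nuv P γ) := by
  have hg : ContDiff ℝ 2 (gradient γ) := by
    unfold gradient
    exact (InnerProductSpace.toDual ℝ (EV n)).symm.contDiff.comp (hγ.fderiv_right (by norm_num))
  exact P.contDiff.comp (hg.neg.prodMk contDiff_const)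

lemma conv_contDiff (hγ : ContDiff ℝ 3 γ) : ContDiff ℝ 2 (fun z' => mulVecE M (nuv P γ z')) :=
  (LinearMap.toContinuousLinearMap (mulL M)).contDiff.comp (nuv_contDiff hγ)

lemma fch_contDiff (hγ : ContDiff ℝ 3 γ) : ContDiff ℝ 2 (fch P γ M) :=
  ((shear_contDiff (hγ.of_le (by norm_num))).comp (contDiff_fst.prodMk contDiff_const)).add
    (contDiff_snd.smul ((conv_contDiff hγ).comp contDiff_fst))

lemma fch_fderiv (hγ : ContDiff ℝ 3 γ) (y η : FV n) :
    fderiv ℝ (fch P γ M) y η = P (η.1, fderiv ℝ γ y.1 η.1)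
      + (y.2 • fderiv ℝ (fun z' => mulVecE M (nuv P γ z')) y.1 η.1 + η.2 • mulVecE M (nuv P γ y.1)) := by
  have h1 : HasFDerivAt (fun y : FV n => ((y.1, 0) : FV n))
      ((ContinuousLinearMap.fst ℝ (EV n) ℝ).prod (0 : FV n →L[ℝ] ℝ)) y :=
    hasFDerivAt_fst.prodMk (hasFDerivAt_const _ _)
  have h2 : HasFDerivAt (fun y : FV n => shear P γ (y.1, 0)) _ y :=
    HasFDerivAt.comp (g := shear P γ) (f := fun y : FV n => ((y.1, 0) : FV n)) y (shear_fderiv (hγ.differentiable (by norm_num)) _) h1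
  have h3 : HasFDerivAt (fun y : FV n => mulVecE M (nuv P γ y.1)) _ y :=
    HasFDerivAt.comp (g := fun z' => mulVecE M (nuv P γ z')) (f := fun y : FV n => y.1) y
      (((conv_contDiff hγ).differentiable (by norm_num) y.1).hasFDerivAt) hasFDerivAt_fst
  have h4 : HasFDerivAt (fun y : FV n => y.2 • mulVecE M (nuv P γ y.1)) _ y :=
    HasFDerivAt.fun_smul (hasFDerivAt_snd) h3
  have h5 : HasFDerivAt (fch P γ M) _ y := h2.add h4
  rw [h5.fderiv]
  simp

lemma fch_bd (z' : EV n) : fch P γ M (z', 0) = shear P γ (z', 0) := by simp [fch]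

lemma fch_dn (hγ : ContDiff ℝ 3 γ) (y : FV n) : fderiv ℝ (fch P γ M) y (0, 1) = mulVecE M (nuv P γ y.1) := by
  rw [fch_fderiv hγ]
  have : ((0 : EV n), (0:ℝ)) = 0 := rfl
  simp [this]

/-- flattening chart -/
structure FC (P : FV n ≃L[ℝ] EV (n + 1)) (γ : EV n → ℝ) (M : Matrix (Fin (n + 1)) (Fin (n + 1)) ℝ) (U : Set (EV (n + 1)))
    (Ψ : EV (n + 1) → FV n) (c : FV n) (r C : ℝ) (K : ℝ≥0∞) : Prop where
  hr : 0 < r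
  hc : c.2 = 0
  hK : K ≠ ⊤
  inU : ∀ y ∈ Metric.ball c r, fch P γ M y ∈ U
  pos : ∀ y ∈ Metric.ball c r, (0 < ff P γ (fch P γ M y) ↔ 0 < y.2)
  zr : ∀ y ∈ Metric.ball c r, (ff P γ (fch P γ M y) = 0 ↔ y.2 = 0)
  inv : ∀ y ∈ Metric.ball c r, Ψ (fch P γ M y) = y
  cd : ∀ y ∈ Metric.ball c r, ContDiffAt ℝ 2 Ψ (fch P γ M y)
  c1 : ∀ y ∈ Metric.ball c r, 1 + ‖fderiv ℝ (fch P γ M) y‖ + ‖fderiv ℝ (fch P γ M) y‖ ^ 2 + ‖fderiv ℝ (fderiv ℝ (fch P γ M)) y‖ ≤ C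
  c2 : ∀ y ∈ Metric.ball c r, 1 + ‖fderiv ℝ Ψ (fch P γ M y)‖ + ‖fderiv ℝ Ψ (fch P γ M y)‖ ^ 2 + ‖fderiv ℝ (fderiv ℝ Ψ) (fch P γ M y)‖ ≤ C
  opn : IsOpen (fch P γ M '' Metric.ball c r)
  ms : ∀ S, MeasurableSet S → S ⊆ Metric.ball c r → volume (fch P γ M '' S) ≤ K * volume S ∧ volume S ≤ K * volume (fch P γ M '' S)

lemma flat_chart (hP : IsoP P) (hγ : ContDiff ℝ 3 γ) (hpos : ∀ ν, ν ≠ 0 → 0 < inner ℝ ν (mulVecE M ν))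
    {U : Set (EV (n + 1))} (hU : IsOpen U) {y0 : EV n} (hy0 : shear P γ (y0, 0) ∈ U) :
    ∃ Ψ r C K, FC P γ M U Ψ (y0, 0) r C K := by
  have hγd : Differentiable ℝ γ := hγ.differentiable (by norm_num)
  have hnu : ∀ z', nuv P γ z' ≠ 0 := fun z' h => by have := nuv_ne hP (γ := γ) z'; rw [h] at this; simp at this; linarith
  have hcd := fch_contDiff (P := P) (M := M) hγ
  have hinj : ∀ η, fderiv ℝ (fch P γ M) ((y0, 0) : FV n) η = 0 → η = 0 := by
    intro η h
    rw [fch_fderiv hγ] at h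
    simp only [zero_smul, zero_add] at h
    have h1 : inner ℝ (nuv P γ y0) (P (η.1, fderiv ℝ γ y0 η.1) + η.2 • mulVecE M (nuv P γ y0)) = 0 := by rw [h]; simp
    rw [inner_add_right, nuv_inner hP, inner_smul_right] at h1
    simp only [sub_self, zero_add] at h1
    have h2 : η.2 = 0 := (mul_eq_zero.1 h1).resolve_right (hpos _ (hnu _)).ne'
    rw [h2, zero_smul, add_zero] at h
    have h3 := P.map_eq_zero_iff.1 h
    have h4 : η.1 = 0 := congrArg Prod.fst h3
    exact Prod.ext h4 h2
  have hΦc := hcd.continuous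
  have hk : Continuous fun y : FV n => inner ℝ (nuv P γ (P.symm (fch P γ M y)).1) (mulVecE M (nuv P γ y.1)) :=
    ((nuv_contDiff hγ).continuous.comp (continuous_fst.comp (P.symm.continuous.comp hΦc))).inner
      ((conv_contDiff hγ).continuous.comp continuous_fst)
  have h0 : (P.symm (shear P γ (y0, 0))).1 = y0 := by simp [shear]
  have hQ : ∀ᶠ y in 𝓝 ((y0, 0) : FV n), fch P γ M y ∈ U ∧ 0 < inner ℝ (nuv P γ (P.symm (fch P γ M y)).1) (mulVecE M (nuv P γ y.1)) := by
    refine (hΦc.continuousAt.eventually (hU.mem_nhds (by rw [fch_bd]; exact hy0))).and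
      (ContinuousAt.eventually_lt continuousAt_const hk.continuousAt ?_)
    simp only [fch_bd, h0]
    exact hpos _ (hnu _)
  obtain ⟨r, hr, Ψ, C, K, hK, hB, ho, hm⟩ := flat_ift hP hcd hinj hQ
  have hmono : ∀ y' ∈ Metric.ball y0 r, StrictMonoOn (fun s => ff P γ (fch P γ M (y', s))) (Set.Ioo (-r) r) := by
    intro y' hy'
    have hd : ∀ s, HasDerivAt (fun s => ff P γ (fch P γ M (y', s)))
        (inner ℝ (nuv P γ (P.symm (fch P γ M (y', s))).1) (mulVecE M (nuv P γ y'))) s := by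
      intro s
      have e1 : HasFDerivAt (fun s : ℝ => ((y', s) : FV n)) ((0 : ℝ →L[ℝ] EV n).prod (ContinuousLinearMap.id ℝ ℝ)) s :=
        (hasFDerivAt_const _ _).prodMk (hasFDerivAt_id _)
      have e2 := HasFDerivAt.comp (g := fch P γ M) (f := fun s : ℝ => ((y', s) : FV n)) s
        (hcd.differentiable (by norm_num) _).hasFDerivAt e1
      have e3 := HasFDerivAt.comp (g := ff P γ) (f := fun s : ℝ => fch P γ M ((y', s) : FV n)) s
        (ff_hasFDerivAt hγd _).differentiableAt.hasFDerivAt e2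
      have e4 := e3.hasDerivAt
      refine HasDerivAt.congr_deriv e4 ?_
      change fderiv ℝ (ff P γ) (fch P γ M (y', s)) (fderiv ℝ (fch P γ M) (y', s) (0, 1)) = _
      rw [ff_fderiv hP hγd, fch_dn hγ]
    refine strictMonoOn_of_deriv_pos (convex_Ioo _ _) (fun s _ => (hd s).continuousAt.continuousWithinAt) fun s hs => ?_
    rw [isOpen_Ioo.interior_eq] at hs
    rw [(hd s).deriv]
    refine (hB (y', s) ?_).1.2
    rw [← ball_prod_same]
    exact ⟨hy', by rw [Real.ball_eq_Ioo]; simpa using hs⟩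
  have hz : ∀ y', ff P γ (fch P γ M (y', 0)) = 0 := fun y' => by rw [fch_bd, ff_shear]
  have h00 : (0:ℝ) ∈ Set.Ioo (-r) r := ⟨by linarith, hr⟩
  have hsp : ∀ y ∈ Metric.ball ((y0, 0) : FV n) r, y.1 ∈ Metric.ball y0 r ∧ y.2 ∈ Set.Ioo (-r) r := by
    intro y hy
    rw [← ball_prod_same] at hy
    refine ⟨hy.1, ?_⟩
    have := hy.2
    rw [Real.ball_eq_Ioo] at this; simpa using this
  refine ⟨Ψ, r, C, K, hr, rfl, hK, fun y hy => (hB y hy).1.1, fun y hy => ?_, fun y hy => ?_, fun y hy => (hB y hy).2.1,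
    fun y hy => (hB y hy).2.2.1, fun y hy => (hB y hy).2.2.2.1, fun y hy => (hB y hy).2.2.2.2, ho, hm⟩
  · have := (hmono y.1 (hsp y hy).1).lt_iff_lt h00 (hsp y hy).2
    simp only [hz] at this
    exact this
  · have := (hmono y.1 (hsp y hy).1).injOn.eq_iff h00 (hsp y hy).2
    simp only [hz] at this
    rw [eq_comm, eq_comm (b := (0:ℝ))]
    exact this

end P24

end Part24

section Part25

section P25
variable {n : ℕ} {P : FV n ≃L[ℝ] EV (n + 1)} {γ : EV n → ℝ} {M : Matrix (Fin (n + 1)) (Fin (n + 1)) ℝ}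
  {U : Set (EV (n + 1))} {Ψ : EV (n + 1) → FV n} {c : FV n} {r C : ℝ} {K : ℝ≥0∞} {q : FV n → ℝ}

lemma FC.inj (h : FC P γ M U Ψ c r C K) {S : Set (FV n)} (hS : S ⊆ Metric.ball c r) : Set.InjOn (fch P γ M) S := by
  intro a ha b hb e
  rw [← h.inv a (hS ha), ← h.inv b (hS hb), e]

/-- transported function -/
def xt (Ψ : EV (n + 1) → FV n) (V : Set (EV (n + 1))) (q : FV n → ℝ) : EV (n + 1) → ℝ := V.indicator fun x => q (Ψ x)

/-- support condition -/
def Sp (c : FV n) (r : ℝ) (q : FV n → ℝ) : Prop := ∀ y, y ∉ Metric.closedBall c (r / 2) → q y = 0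

lemma xt_val (h : FC P γ M U Ψ c r C K) (q : FV n → ℝ) {y : FV n} (hy : y ∈ Metric.ball c r) :
    xt Ψ (fch P γ M '' Metric.ball c r) q (fch P γ M y) = q y := by
  rw [xt, Set.indicator_of_mem (Set.mem_image_of_mem _ hy), h.inv y hy]

lemma cb_sub (h : FC P γ M U Ψ c r C K) : Metric.closedBall c (r / 2) ⊆ Metric.ball c r :=
  Metric.closedBall_subset_ball (by have := h.hr; linarith)

lemma xt_off (h : FC P γ M U Ψ c r C K) (hq : Sp c r q) {x : EV (n + 1)} (hx : x ∉ fch P γ M '' Metric.closedBall c (r / 2)) :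
    xt Ψ (fch P γ M '' Metric.ball c r) q x = 0 := by
  by_cases hV : x ∈ fch P γ M '' Metric.ball c r
  · obtain ⟨y, hy, rfl⟩ := hV
    rw [xt_val h q hy]
    exact hq y fun hy' => hx ⟨y, hy', rfl⟩
  · exact Set.indicator_of_notMem hV _

lemma img_cpt (hγ : ContDiff ℝ 3 γ) : IsCompact (fch P γ M '' Metric.closedBall c (r / 2)) :=
  (isCompact_closedBall c (r / 2)).image (fch_contDiff hγ).continuous

lemma xt_ev_zero (h : FC P γ M U Ψ c r C K) (hγ : ContDiff ℝ 3 γ) (hq : Sp c r q) {x : EV (n + 1)}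
    (hx : x ∉ fch P γ M '' Metric.closedBall c (r / 2)) : xt Ψ (fch P γ M '' Metric.ball c r) q =ᶠ[𝓝 x] fun _ => 0 := by
  filter_upwards [(img_cpt hγ).isClosed.isOpen_compl.mem_nhds hx] with x' hx'
  exact xt_off h hq hx'

lemma xt_ev (h : FC P γ M U Ψ c r C K) (q : FV n → ℝ) {y : FV n} (hy : y ∈ Metric.ball c r) :
    xt Ψ (fch P γ M '' Metric.ball c r) q =ᶠ[𝓝 (fch P γ M y)] fun x => q (Ψ x) := by
  filter_upwards [h.opn.mem_nhds ⟨y, hy, rfl⟩] with x' hx'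
  exact Set.indicator_of_mem hx' _

lemma xt_contDiff (h : FC P γ M U Ψ c r C K) (hγ : ContDiff ℝ 3 γ) (hqc : ContDiff ℝ 2 q) (hq : Sp c r q) :
    ContDiff ℝ 2 (xt Ψ (fch P γ M '' Metric.ball c r) q) := by
  rw [contDiff_iff_contDiffAt]
  intro x
  by_cases hx : x ∈ fch P γ M '' Metric.closedBall c (r / 2)
  · obtain ⟨y, hy, rfl⟩ := hx
    have hy' := cb_sub h hy
    exact (hqc.contDiffAt.comp _ (h.cd y hy')).congr_of_eventuallyEq (xt_ev h q hy')
  · exact contDiffAt_const.congr_of_eventuallyEq (xt_ev_zero h hγ hq hx)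

lemma xt_cc (h : FC P γ M U Ψ c r C K) (hγ : ContDiff ℝ 3 γ) (hq : Sp c r q) :
    HasCompactSupport (xt Ψ (fch P γ M '' Metric.ball c r) q) :=
  HasCompactSupport.intro (img_cpt hγ) fun _ hx => xt_off h hq hx

lemma xt_jet_off (h : FC P γ M U Ψ c r C K) (hγ : ContDiff ℝ 3 γ) (hq : Sp c r q) {x : EV (n + 1)}
    (hx : x ∉ fch P γ M '' Metric.closedBall c (r / 2)) : jj (xt Ψ (fch P γ M '' Metric.ball c r) q) x = 0 := by
  rw [jj_congr (xt_ev_zero h hγ hq hx), jj_const]; rfl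

lemma xt_jet_le (h : FC P γ M U Ψ c r C K) (hqc : ContDiff ℝ 2 q) {y : FV n} (hy : y ∈ Metric.ball c r) :
    ‖jj (xt Ψ (fch P γ M '' Metric.ball c r) q) (fch P γ M y)‖ ≤ C * ‖jj q y‖ := by
  rw [jj_congr (xt_ev h q hy)]
  refine (jj_comp_le hqc.contDiffAt (h.cd y hy)).trans ?_
  rw [h.inv y hy, mul_comm]
  gcongr
  exact h.c2 y hy

lemma xt_sub (V : Set (EV (n + 1))) (q q' : FV n → ℝ) (x : EV (n + 1)) : xt Ψ V (fun y => q y - q' y) x = xt Ψ V q x - xt Ψ V q' x := by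
  by_cases hx : x ∈ V
  · simp [xt, hx]
  · simp [xt, hx]

lemma xt_nbc (h : FC P γ M U Ψ c r C K) (hγ : ContDiff ℝ 3 γ) (hqc : ContDiff ℝ 2 q) (hq : Sp c r q)
    {Ω U0 : Set (EV (n + 1))} (hch : IsCh Ω U0 P γ) (hΩ : IsOpen Ω) (hU : U ⊆ U0)
    (hn : ∀ z', fderiv ℝ q (z', 0) (0, 1) = 0) : NBC Ω M (xt Ψ (fch P γ M '' Metric.ball c r) q) := by
  intro U1 P1 γ1 h1 x hx1 e1
  by_cases hx : x ∈ fch P γ M '' Metric.closedBall c (r / 2)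
  · obtain ⟨y, hy, rfl⟩ := hx
    have hy' := cb_sub h hy
    have hx0 : fch P γ M y ∈ U0 := hU (h.inU y hy')
    have e0 : ff P γ (fch P γ M y) = 0 := (hch.frontier_iff hΩ hx0).1 ((h1.frontier_iff hΩ hx1).2 e1)
    have hy2 := (h.zr y hy').1 e0
    obtain ⟨a, ha⟩ := nuv_parallel hch h1 hx0 hx1 e0 e1
    have ey : y = (y.1, 0) := Prod.ext rfl hy2
    have e2 : (P.symm (fch P γ M y)).1 = y.1 := by rw [ey, fch_bd]; simp [shear]
    rw [ha, e2]
    have e3 : mulVecE M (a • nuv P γ y.1) = a • mulVecE M (nuv P γ y.1) := map_smul (mulL M) _ _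
    rw [e3, map_smul, ← fch_dn hγ y]
    have e4 : (fun y => xt Ψ (fch P γ M '' Metric.ball c r) q (fch P γ M y)) =ᶠ[𝓝 y] q := by
      filter_upwards [Metric.isOpen_ball.mem_nhds hy'] with y1 hy1
      exact xt_val h q hy1
    have e5 := HasFDerivAt.comp (g := xt Ψ (fch P γ M '' Metric.ball c r) q) (f := fch P γ M) y
      (((xt_contDiff h hγ hqc hq).differentiable (by norm_num) _).hasFDerivAt)
      (((fch_contDiff hγ).differentiable (by norm_num) y).hasFDerivAt)
    have e6 : fderiv ℝ q y (0, 1) = fderiv ℝ (xt Ψ (fch P γ M '' Metric.ball c r) q) (fch P γ M y) (fderiv ℝ (fch P γ M) y (0, 1)) := by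
      rw [← e4.fderiv_eq]
      exact congrArg (fun T => T (0, 1)) e5.fderiv
    rw [← e6, ey, hn, smul_zero]
  · rw [(xt_ev_zero h hγ hq hx).fderiv_eq]; simp

lemma FC.le1 (h : FC P γ M U Ψ c r C K) (hγ : ContDiff ℝ 3 γ) {S : Set (FV n)} (hS : MeasurableSet S) (hSB : S ⊆ Metric.ball c r) :
    volume.restrict (fch P γ M '' S) ≤ K • Measure.map (fch P γ M) (volume.restrict S) ∧
    Measure.map (fch P γ M) (volume.restrict S) ≤ K • volume.restrict (fch P γ M '' S) := by
  have hm : Measurable (fch P γ M) := (fch_contDiff hγ).continuous.measurable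
  have key : ∀ A : Set (EV (n + 1)), A ∩ fch P γ M '' S = fch P γ M '' (fch P γ M ⁻¹' A ∩ S) := fun A => by
    rw [Set.inter_comm, Set.inter_comm _ S, Set.image_inter_preimage]
  constructor
  · refine Measure.le_iff.2 fun A hA => ?_
    rw [Measure.restrict_apply hA, Measure.smul_apply, Measure.map_apply hm hA, Measure.restrict_apply (hm hA), key]
    exact (h.ms _ ((hm hA).inter hS) (Set.inter_subset_right.trans hSB)).1
  · refine Measure.le_iff.2 fun A hA => ?_
    rw [Measure.smul_apply, Measure.restrict_apply hA, Measure.map_apply hm hA, Measure.restrict_apply (hm hA), key]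
    exact (h.ms _ ((hm hA).inter hS) (Set.inter_subset_right.trans hSB)).2

lemma FC.C0 (h : FC P γ M U Ψ c r C K) : 0 ≤ C :=
  le_trans (by positivity) (h.c1 c (Metric.mem_ball_self h.hr))

lemma xt_Lp (h : FC P γ M U Ψ c r C K) (hγ : ContDiff ℝ 3 γ) (hqc : ContDiff ℝ 2 q) (hq : Sp c r q) (p : ℝ≥0∞)
    {H : Set (FV n)} {O : Set (EV (n + 1))} (hH : MeasurableSet H) (hO : ∀ y ∈ Metric.ball c r, fch P γ M y ∈ O ↔ y ∈ H) :
    eLpNorm (jj (xt Ψ (fch P γ M '' Metric.ball c r) q)) p (volume.restrict O)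
      ≤ (K ^ (1 / p).toReal * ENNReal.ofReal C) * eLpNorm (jj q) p (volume.restrict H) := by
  set V := fch P γ M '' Metric.ball c r with hV
  have hm : Measurable (fch P γ M) := (fch_contDiff hγ).continuous.measurable
  have hs : Function.support (jj (xt Ψ V q)) ⊆ V := by
    intro x hx
    by_contra hxV
    exact hx (xt_jet_off h hγ hq fun ⟨y, hy, e⟩ => hxV ⟨y, cb_sub h hy, e⟩)
  rw [← eLpNorm_restrict_eq_of_support_subset hs, Measure.restrict_restrict h.opn.measurableSet]
  have e : V ∩ O = fch P γ M '' (Metric.ball c r ∩ H) := by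
    ext x; constructor
    · rintro ⟨⟨y, hy, rfl⟩, hx⟩; exact ⟨y, ⟨hy, (hO y hy).1 hx⟩, rfl⟩
    · rintro ⟨y, ⟨hy, hyH⟩, rfl⟩; exact ⟨⟨y, hy, rfl⟩, (hO y hy).2 hyH⟩
  rw [e]
  refine (eLpNorm_le_of_measure_le_smul (h.le1 hγ (measurableSet_ball.inter hH) Set.inter_subset_left).1).trans ?_
  rw [eLpNorm_map_measure (jj_continuous (xt_contDiff h hγ hqc hq)).aestronglyMeasurable hm.aemeasurable, smul_eq_mul, mul_assoc]
  gcongr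
  refine (eLpNorm_le_mul_eLpNorm_of_ae_le_mul (g := jj q) (c := C) ?_ p).trans ?_
  · filter_upwards [ae_restrict_mem (measurableSet_ball.inter hH)] with y hy
    exact xt_jet_le h hqc hy.1
  · gcongr
    exact Set.inter_subset_right

lemma ft_Lp (h : FC P γ M U Ψ c r C K) (hγ : ContDiff ℝ 3 γ) {w : EV (n + 1) → ℝ} (hw : ContDiff ℝ 2 w) (p : ℝ≥0∞)
    (hqw : ∀ y ∈ Metric.ball c r, q y = w (fch P γ M y)) (hq : Sp c r q)
    {H : Set (FV n)} {O : Set (EV (n + 1))} (hH : MeasurableSet H) (hO : ∀ y ∈ Metric.ball c r, fch P γ M y ∈ O ↔ y ∈ H) :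
    eLpNorm (jj q) p (volume.restrict H)
      ≤ (ENNReal.ofReal C * K ^ (1 / p).toReal) * eLpNorm (jj w) p (volume.restrict O) := by
  have hm : Measurable (fch P γ M) := (fch_contDiff hγ).continuous.measurable
  have hs : Function.support (jj q) ⊆ Metric.ball c r := by
    intro y hy
    by_contra hyB
    refine hy ?_
    have : q =ᶠ[𝓝 y] fun _ => 0 := by
      filter_upwards [Metric.isClosed_closedBall.isOpen_compl.mem_nhds (fun hy' => hyB (cb_sub h hy'))] with y' hy'
      exact hq y' hy'
    rw [jj_congr this, jj_const]; rfl
  rw [← eLpNorm_restrict_eq_of_support_subset hs, Measure.restrict_restrict measurableSet_ball, mul_assoc]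
  refine (eLpNorm_le_mul_eLpNorm_of_ae_le_mul (g := jj w ∘ fch P γ M) (c := C) ?_ p).trans ?_
  · filter_upwards [ae_restrict_mem (measurableSet_ball.inter hH)] with y hy
    have : q =ᶠ[𝓝 y] fun y => w (fch P γ M y) := by
      filter_upwards [Metric.isOpen_ball.mem_nhds hy.1] with y' hy'
      exact hqw y' hy'
    rw [jj_congr this]
    refine (jj_comp_le hw.contDiffAt (fch_contDiff hγ).contDiffAt).trans ?_
    rw [mul_comm]
    exact mul_le_mul_of_nonneg_right (h.c1 y hy.1) (norm_nonneg _)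
  · gcongr
    rw [← eLpNorm_map_measure (jj_continuous hw).aestronglyMeasurable hm.aemeasurable]
    refine (eLpNorm_le_of_measure_le_smul (h.le1 hγ (measurableSet_ball.inter hH) Set.inter_subset_left).2).trans ?_
    rw [smul_eq_mul]
    gcongr
    rintro x ⟨y, ⟨hy, hyH⟩, rfl⟩
    exact (hO y hy).2 hyH

end P25

end Part25

section Part26

section P26

lemma ell_diff {m : ℕ} (Ω : Set (EV m)) (hΩ : IsOpen Ω) (M : Matrix (Fin m) (Fin m) ℝ) : ∃ B : ℝ≥0∞, B ≠ ⊤ ∧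
    ∀ (D D' : List (Fin m) → EV m → ℝ) (φ : EV m → ℝ) (A : ℝ) (S : Set (EV m)), MeasurableSet S →
    (∀ l : List (Fin m), l.length ≤ 2 → LocallyIntegrable (D l) (volume.restrict Ω)) →
    (∀ l : List (Fin m), l.length ≤ 2 → LocallyIntegrable (D' l) (volume.restrict Ω)) →
    ContDiff ℝ 1 φ → HasCompactSupport φ → (∀ x, ‖φ x‖ ≤ A) → (∀ x, ‖fderiv ℝ φ x‖ ≤ A) →
    (∀ x, x ∉ S → φ x = 0 ∧ fderiv ℝ φ x = 0) →
    ‖ell Ω M D φ - ell Ω M D' φ‖ₑ ≤ B * ENNReal.ofReal A * ∫⁻ x in Ω ∩ S, ‖jetD D x - jetD D' x‖ₑ := by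
  refine ⟨∑ i, ∑ j, ‖M i j‖ₑ * 2, ?_, ?_⟩
  · refine ENNReal.sum_ne_top.2 fun i _ => ENNReal.sum_ne_top.2 fun j _ => ENNReal.mul_ne_top enorm_ne_top (by norm_num)
  intro D D' φ A S hS hD hD' hφ hc hA hA' hz
  have hA0 : 0 ≤ A := (norm_nonneg _).trans (hA 0)
  have hcp : ∀ i, HasCompactSupport (partialD i φ) := fun i => by
    have := hc.fderiv ℝ
    exact this.comp_left (g := fun T : EV m →L[ℝ] ℝ => T (EuclideanSpace.single i 1)) (by simp)
  have hi : ∀ (D : List (Fin m) → EV m → ℝ), (∀ l : List (Fin m), l.length ≤ 2 → LocallyIntegrable (D l) (volume.restrict Ω)) →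
      ∀ i j, Integrable (fun x => D [i, j] x * φ x + D [j] x * partialD i φ x) (volume.restrict Ω) := by
    intro D hD i j
    have h1 := (hD [i, j] (by simp)).integrable_smul_left_of_hasCompactSupport hφ.continuous hc
    have h2 := (hD [j] (by simp)).integrable_smul_left_of_hasCompactSupport (pd_cont (i := i) hφ) (hcp i)
    refine (h1.add h2).congr (Eventually.of_forall fun x => ?_)
    simp [mul_comm]
  have hpw : ∀ i j x, ‖(D [i, j] x * φ x + D [j] x * partialD i φ x) - (D' [i, j] x * φ x + D' [j] x * partialD i φ x)‖ₑ
      ≤ S.indicator (fun x => 2 * ENNReal.ofReal A * ‖jetD D x - jetD D' x‖ₑ) x := by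
    intro i j x
    by_cases hx : x ∈ S
    · rw [Set.indicator_of_mem hx, ← ofReal_norm_eq_enorm, ← ofReal_norm_eq_enorm]
      have e2 : ENNReal.ofReal (2 * A * ‖jetD D x - jetD D' x‖) = 2 * ENNReal.ofReal A * ENNReal.ofReal ‖jetD D x - jetD D' x‖ := by
        rw [ENNReal.ofReal_mul (by positivity), ENNReal.ofReal_mul (by norm_num)]; simp
      rw [← e2]
      refine ENNReal.ofReal_le_ofReal ?_
      have e : (D [i, j] x * φ x + D [j] x * partialD i φ x) - (D' [i, j] x * φ x + D' [j] x * partialD i φ x)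
          = (jetD D x - jetD D' x).c (EuclideanSpace.single i 1) (EuclideanSpace.single j 1) * φ x
            + (jetD D x - jetD D' x).b (EuclideanSpace.single j 1) * partialD i φ x := by
        rw [Jet.sub_b, Jet.sub_c, ContinuousLinearMap.sub_apply, ContinuousLinearMap.sub_apply, ContinuousLinearMap.sub_apply,
          jetD_c, jetD_c, jetD_b, jetD_b]; ring
      rw [e]
      set T := jetD D x - jetD D' x
      have n1 : ‖T.c (EuclideanSpace.single i 1) (EuclideanSpace.single j 1)‖ ≤ ‖T‖ := by
        refine (ContinuousLinearMap.le_opNorm _ _).trans ?_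
        have := (T.c).le_opNorm (EuclideanSpace.single i 1)
        simp only [PiLp.norm_single, norm_one, mul_one] at this ⊢
        exact this.trans T.norm_c
      have n2 : ‖T.b (EuclideanSpace.single j 1)‖ ≤ ‖T‖ := by
        have := (T.b).le_opNorm (EuclideanSpace.single j 1)
        simp only [PiLp.norm_single, norm_one, mul_one] at this
        exact this.trans T.norm_b
      have n3 : ‖partialD i φ x‖ ≤ A := by
        have := (fderiv ℝ φ x).le_opNorm (EuclideanSpace.single i 1)
        simp only [PiLp.norm_single, norm_one, mul_one] at this
        exact this.trans (hA' x)
      refine (norm_add_le _ _).trans ?_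
      rw [norm_mul, norm_mul]
      have := mul_le_mul n1 (hA x) (norm_nonneg _) (norm_nonneg _)
      have := mul_le_mul n2 n3 (norm_nonneg _) (norm_nonneg _)
      linarith
    · have h0 := hz x hx
      have : partialD i φ x = 0 := by simp [partialD, h0.2]
      simp [h0.1, this, hx]
  have hnt : ∀ i j, ‖(∫ x in Ω, (D [i, j] x * φ x + D [j] x * partialD i φ x)) - ∫ x in Ω, (D' [i, j] x * φ x + D' [j] x * partialD i φ x)‖ₑ
      ≤ 2 * ENNReal.ofReal A * ∫⁻ x in Ω ∩ S, ‖jetD D x - jetD D' x‖ₑ := by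
    intro i j
    rw [← integral_sub (hi D hD i j) (hi D' hD' i j)]
    refine (enorm_integral_le_lintegral_enorm _).trans ((lintegral_mono (hpw i j)).trans ?_)
    rw [lintegral_indicator hS, Measure.restrict_restrict hS, Set.inter_comm, lintegral_const_mul' _ _ (by finiteness)]
  have e : ell Ω M D φ - ell Ω M D' φ = ∑ i, ∑ j, M i j * ((∫ x in Ω, (D [i, j] x * φ x + D [j] x * partialD i φ x)) - ∫ x in Ω, (D' [i, j] x * φ x + D' [j] x * partialD i φ x)) := by
    simp only [ell, ← Finset.sum_sub_distrib, mul_sub]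
  rw [e, mul_assoc, Finset.sum_mul]
  refine (enorm_sum_le _ _).trans (Finset.sum_le_sum fun i _ => ?_)
  rw [Finset.sum_mul]
  refine (enorm_sum_le _ _).trans (Finset.sum_le_sum fun j _ => ?_)
  rw [enorm_mul, mul_assoc, ← mul_assoc 2]
  gcongr
  exact hnt i j

variable {n : ℕ} {P : FV n ≃L[ℝ] EV (n + 1)} {γ : EV n → ℝ} {M : Matrix (Fin (n + 1)) (Fin (n + 1)) ℝ}
  {U U0 Ω : Set (EV (n + 1))} {Ψ : EV (n + 1) → FV n} {c : FV n} {r C : ℝ} {K p : ℝ≥0∞}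

lemma symm_shear (z' : EV n) : (P.symm (shear P γ (z', 0))).1 = z' := by simp [shear]

/-- Normal derivative of the flattened function. -/
lemma dn_flat (h : FC P γ M U Ψ c r C K) (hγ : ContDiff ℝ 3 γ) (hch : IsCh Ω U0 P γ) (hU : U ⊆ U0)
    {Φ w : EV (n + 1) → ℝ} (hΦ : ContDiff ℝ 2 Φ) (hΦN : NBC Ω M Φ)
    (hΦ0 : ∀ x, x ∉ fch P γ M '' Metric.closedBall c (r / 2) → Φ x = 0) (hw : ContDiff ℝ 2 w) {g : FV n → ℝ}
    (hg : ∀ y ∈ Metric.ball c r, g y = Φ (fch P γ M y) * w (fch P γ M y)) (hs : Sp c r g) (z' : EV n) :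
    fderiv ℝ g (z', 0) (0, 1) = Φ (shear P γ (z', 0)) * fderiv ℝ w (shear P γ (z', 0)) (mulVecE M (nuv P γ z')) := by
  by_cases hz : ((z', 0) : FV n) ∈ Metric.ball c r
  · have ev : g =ᶠ[𝓝 (z', 0)] fun y => (fun x => Φ x * w x) (fch P γ M y) := by
      filter_upwards [Metric.isOpen_ball.mem_nhds hz] with y hy using hg y hy
    have hxU := hU (h.inU _ hz)
    have h0 : ff P γ (fch P γ M (z', 0)) = 0 := (h.zr _ hz).2 rfl
    have hN := hΦN U0 P γ hch _ hxU h0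
    rw [fch_bd, symm_shear] at hN
    have hd : HasFDerivAt (fun x => Φ x * w x) _ (fch P γ M (z', 0)) :=
      (hΦ.differentiable (by norm_num) _).hasFDerivAt.mul (hw.differentiable (by norm_num) _).hasFDerivAt
    have hcomp := HasFDerivAt.comp (g := fun x => Φ x * w x) (f := fch P γ M) ((z', 0) : FV n) hd
      ((fch_contDiff (P := P) (M := M) hγ).differentiable (by norm_num) _).hasFDerivAt
    have e := (hcomp.congr_of_eventuallyEq ev).fderiv
    rw [e, ContinuousLinearMap.comp_apply, fch_dn hγ]
    simp only [ContinuousLinearMap.add_apply, ContinuousLinearMap.smul_apply, fch_bd, hN, smul_eq_mul]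
    ring
  · have hz2 : ((z', 0) : FV n) ∉ Metric.closedBall c (r / 2) := fun hm => hz (cb_sub h hm)
    have ev : g =ᶠ[𝓝 (z', 0)] fun _ => 0 := by
      filter_upwards [Metric.isClosed_closedBall.isOpen_compl.mem_nhds hz2] with y hy using hs y hy
    have e1 : fderiv ℝ g (z', 0) = 0 := by rw [ev.fderiv_eq]; simp
    have e2 : Φ (shear P γ (z', 0)) = 0 := by
      refine hΦ0 _ ?_
      rintro ⟨y, hy, he⟩
      have hyb := cb_sub h hy
      have h2 : y.2 = 0 := (h.zr y hyb).1 (by rw [he, ff_shear])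
      have e3 : fch P γ M y = shear P γ (y.1, 0) := by rw [← fch_bd (M := M), ← h2]
      have := symm_shear (P := P) (γ := γ) y.1
      rw [← e3, he, symm_shear] at this
      exact hz (by rw [this, ← h2]; exact hyb)
    rw [e1, e2]; simp

/-- `L^p` convergence of the boundary term. -/
lemma bd_tendsto (h : FC P γ M U Ψ c r C K) (hγ : ContDiff ℝ 3 γ) (hch : IsCh Ω U0 P γ) (hU : U ⊆ U0) (hM : Mᵀ = M)
    (hΩ : IsOpen Ω) (hp1 : 1 ≤ p) {D : List (Fin (n + 1)) → EV (n + 1) → ℝ}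
    (hD : ∀ l : List (Fin (n + 1)), l.length ≤ 2 → MemLp (D l) p (volume.restrict Ω))
    (hell : ∀ φ : EV (n + 1) → ℝ, ContDiff ℝ (⊤ : ℕ∞) φ → HasCompactSupport φ → ell Ω M D φ = 0)
    {Φ : EV (n + 1) → ℝ} {w : ℕ → EV (n + 1) → ℝ} (hΦ : ContDiff ℝ 2 Φ) (hΦN : NBC Ω M Φ)
    (hΦ0 : ∀ x, x ∉ fch P γ M '' Metric.closedBall c (r / 2) → Φ x = 0) (hw : ∀ k, ContDiff ℝ 2 (w k))
    (hwt : Tendsto (fun k => eLpNorm (fun x => jj (w k) x - jetD D x) p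
      (volume.restrict (Ω ∩ fch P γ M '' Metric.closedBall c (r / 2)))) atTop (𝓝 0))
    {g : ℕ → FV n → ℝ} (hg : ∀ k, ∀ y ∈ Metric.ball c r, g k y = Φ (fch P γ M y) * w k (fch P γ M y))
    (hs : ∀ k, Sp c r (g k)) {s : ℝ} {κ : FV n → ℝ} (hκ : Mol s κ) :
    Tendsto (fun k => eLpNorm (bdI κ (fun z => fderiv ℝ (g k) z (0, 1))) p volume) atTop (𝓝 0) := by
  obtain ⟨B, hB, hBd⟩ := ell_diff Ω hΩ M
  set S := fch P γ M '' Metric.closedBall c (r / 2) with hSd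
  have hSc : IsCompact S := img_cpt hγ
  have hΦc : HasCompactSupport Φ := HasCompactSupport.intro hSc hΦ0
  have hκ1 : ContDiff ℝ 1 κ := hκ.1.of_le (by exact_mod_cast le_top)
  have hΦ1 : ContDiff ℝ 1 Φ := hΦ.of_le (by norm_num)
  obtain ⟨a1, ha1⟩ := hκ.1.continuous.bounded_above_of_compact_support hκ.2.2.1
  obtain ⟨a2, ha2⟩ := (hκ1.continuous_fderiv (by norm_num)).bounded_above_of_compact_support (hκ.2.2.1.fderiv ℝ)
  obtain ⟨b1, hb1⟩ := hΦ.continuous.bounded_above_of_compact_support hΦc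
  obtain ⟨b2, hb2⟩ := (hΦ1.continuous_fderiv (by norm_num)).bounded_above_of_compact_support (hΦc.fderiv ℝ)
  have a10 := (norm_nonneg _).trans (ha1 0)
  have a20 := (norm_nonneg _).trans (ha2 0)
  have b10 := (norm_nonneg _).trans (hb1 0)
  have b20 := (norm_nonneg _).trans (hb2 0)
  let L : EV (n + 1) →L[ℝ] FV n := (ContinuousLinearMap.inl ℝ (EV n) ℝ).comp
    ((ContinuousLinearMap.fst ℝ (EV n) ℝ).comp (P.symm : EV (n + 1) →L[ℝ] FV n))
  have hL : ∀ x, L x = ((P.symm x).1, 0) := fun x => rfl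
  let A : ℝ := a1 * b1 + (a1 * b2 + b1 * (a2 * ‖L‖))
  let φ : FV n → EV (n + 1) → ℝ := fun y x => κ (y - L x) * Φ x
  have hφ1 : ∀ y, ContDiff ℝ 1 (φ y) := fun y => (hκ1.comp (contDiff_const.sub L.contDiff)).mul hΦ1
  have hφc : ∀ y, HasCompactSupport (φ y) := fun y => hΦc.mul_left
  have hφA : ∀ y x, ‖φ y x‖ ≤ A := by
    intro y x
    have h1 : ‖φ y x‖ ≤ a1 * b1 := by
      rw [norm_mul]; exact mul_le_mul (ha1 _) (hb1 _) (norm_nonneg _) a10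
    have : 0 ≤ a1 * b2 + b1 * (a2 * ‖L‖) := by positivity
    simp only [A]; linarith
  have hφA' : ∀ y x, ‖fderiv ℝ (φ y) x‖ ≤ A := by
    intro y x
    have hin : HasFDerivAt (fun x => y - L x) (-L) x := L.hasFDerivAt.const_sub y
    have hk := HasFDerivAt.comp (g := κ) (f := fun x => y - L x) x (hκ1.differentiable (by norm_num) _).hasFDerivAt hin
    have hd := hk.mul (hΦ1.differentiable (by norm_num) x).hasFDerivAt
    have e : fderiv ℝ (φ y) x = _ := hd.fderiv
    rw [e]
    refine (norm_add_le _ _).trans ?_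
    have h1 : ‖(κ (y - L x)) • fderiv ℝ Φ x‖ ≤ a1 * b2 := by
      rw [norm_smul]; exact mul_le_mul (ha1 _) (hb2 _) (norm_nonneg _) a10
    have h2 : ‖Φ x • (fderiv ℝ κ (y - L x)).comp (-L)‖ ≤ b1 * (a2 * ‖L‖) := by
      rw [norm_smul]
      refine mul_le_mul (hb1 _) ?_ (norm_nonneg _) b10
      refine (ContinuousLinearMap.opNorm_comp_le _ _).trans ?_
      rw [norm_neg]
      exact mul_le_mul_of_nonneg_right (ha2 _) (norm_nonneg _)
    have : 0 ≤ a1 * b1 := by positivity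
    refine (add_le_add h1 h2).trans ?_
    simp only [A]; linarith
  have hφ0 : ∀ y x, x ∉ S → φ y x = 0 ∧ fderiv ℝ (φ y) x = 0 := by
    intro y x hx
    have ev : φ y =ᶠ[𝓝 x] fun _ => 0 := by
      filter_upwards [hSc.isClosed.isOpen_compl.mem_nhds hx] with x' hx'
      simp only [φ, hΦ0 x' hx', mul_zero]
    exact ⟨ev.eq_of_nhds, by rw [ev.fderiv_eq]; simp⟩
  have hSU : S ⊆ U0 := by
    rintro _ ⟨y, hy, rfl⟩; exact hU (h.inU y (cb_sub h hy))
  let τ : ℕ → ℝ≥0∞ := fun k => B * ENNReal.ofReal A * ∫⁻ x in Ω ∩ S, ‖jj (w k) x - jetD D x‖ₑ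
  have hbI : ∀ k y, ‖bdI κ (fun z => fderiv ℝ (g k) z (0, 1)) y‖ₑ ≤ τ k := by
    intro k y
    have e1 : bdI κ (fun z => fderiv ℝ (g k) z (0, 1)) y = - ell Ω M (fun l => partialDList l (w k)) (φ y) := by
      rw [green_ch hch hM hΩ (hw k) (hφ1 y) (hφc y) (fun x hx => hφ0 y x fun hm => hx (hSU hm)), neg_neg]
      unfold bdI
      congr 1 with z'
      beta_reduce
      rw [dn_flat h hγ hch hU hΦ hΦN hΦ0 (hw k) (hg k) (hs k) z']
      simp only [φ, hL, symm_shear, smul_eq_mul]; ring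
    have e2 : ell Ω M D (φ y) = 0 := ell_C1 hp1 hD hell (hφ1 y) (hφc y)
    have hcl : ∀ l : List (Fin (n + 1)), l.length ≤ 2 → LocallyIntegrable (partialDList l (w k)) (volume.restrict Ω) := by
      intro l hl
      refine Continuous.locallyIntegrable ?_
      match l, hl with
      | [], _ => exact (hw k).continuous
      | [i], _ => exact pd_cont ((hw k).of_le (by norm_num))
      | [i, j], _ =>
        have : partialDList [i, j] (w k) = fun x => fderiv ℝ (fderiv ℝ (w k)) x (EuclideanSpace.single i 1) (EuclideanSpace.single j 1) := by
          funext x; exact pdl2 (hw k) i j x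
        rw [this]
        exact ((((hw k).fderiv_right (m := 1) (by norm_num)).continuous_fderiv (by norm_num)).clm_apply continuous_const).clm_apply continuous_const
      | _ :: _ :: _ :: _, hl => simp at hl
    have := hBd (fun l => partialDList l (w k)) D (φ y) A S hSc.isClosed.measurableSet hcl
      (fun l hl => (hD l hl).locallyIntegrable hp1) (hφ1 y) (hφc y) (hφA y) (hφA' y) (hφ0 y)
    rw [e2, sub_zero] at this
    rw [e1, enorm_neg]
    refine this.trans_eq ?_
    simp only [τ, jetD_classical (hw k)]
  let T : Set (FV n) := Metric.closedBall c (r / 2 + s)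
  have hT : ∀ k y, y ∉ T → bdI κ (fun z => fderiv ℝ (g k) z (0, 1)) y = 0 := by
    intro k y hy
    unfold bdI
    refine integral_eq_zero_of_ae (Eventually.of_forall fun z' => ?_)
    by_cases hz : ((z', 0) : FV n) ∈ Metric.closedBall c (r / 2)
    · have : κ (y - (z', 0)) = 0 := by
        refine hκ.2.2.2.2 _ ?_
        by_contra hlt
        push Not at hlt
        refine hy ?_
        simp only [T, Metric.mem_closedBall] at hz ⊢
        have := dist_triangle y (z', 0) c
        rw [dist_eq_norm y (z', 0)] at this
        linarith
      simp [this]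
    · have ev : g k =ᶠ[𝓝 (z', 0)] fun _ => 0 := by
        filter_upwards [Metric.isClosed_closedBall.isOpen_compl.mem_nhds hz] with y hy using hs k y hy
      have e1 : fderiv ℝ (g k) (z', 0) = 0 := by rw [ev.fderiv_eq]; simp
      simp [e1]
  have hTf : volume T ≠ ⊤ := (isCompact_closedBall c _).measure_lt_top.ne
  have hle : ∀ k, eLpNorm (bdI κ (fun z => fderiv ℝ (g k) z (0, 1))) p volume ≤ τ k * volume T ^ (1 / p.toReal) := by
    intro k
    have h1 : eLpNorm (bdI κ (fun z => fderiv ℝ (g k) z (0, 1))) p volume ≤ eLpNorm (T.indicator fun _ => τ k) p volume := by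
      refine eLpNorm_mono_enorm fun y => ?_
      by_cases hy : y ∈ T
      · rw [Set.indicator_of_mem hy]; exact hbI k y
      · rw [hT k y hy]; simp
    exact h1.trans (eLpNorm_indicator_const_le _ _)
  have hτ : Tendsto τ atTop (𝓝 0) := by
    have h1 : ∀ k, ∫⁻ x in Ω ∩ S, ‖jj (w k) x - jetD D x‖ₑ ≤
        eLpNorm (fun x => jj (w k) x - jetD D x) p (volume.restrict (Ω ∩ S)) * volume (Ω ∩ S) ^ (1 / (1 : ℝ≥0∞).toReal - 1 / p.toReal) := by
      intro k
      have hm : AEStronglyMeasurable (fun x => jj (w k) x - jetD D x) (volume.restrict (Ω ∩ S)) :=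
        (jj_continuous (hw k)).aestronglyMeasurable.sub ((jetD_memLp hD).1.mono_measure (Measure.restrict_mono Set.inter_subset_left le_rfl))
      have := eLpNorm_le_eLpNorm_mul_rpow_measure_univ (p := 1) hp1 hm
      rw [eLpNorm_one_eq_lintegral_enorm, Measure.restrict_apply_univ] at this
      exact this
    have hV : volume (Ω ∩ S) ^ (1 / (1 : ℝ≥0∞).toReal - 1 / p.toReal) ≠ ⊤ := by
      refine ENNReal.rpow_ne_top_of_nonneg ?_ ((measure_mono Set.inter_subset_right).trans_lt hSc.measure_lt_top).ne
      by_cases hp : p = ⊤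
      · simp [hp]
      · have : 1 ≤ p.toReal := by
          have := (ENNReal.toReal_le_toReal (by simp) hp).2 hp1; simpa using this
        simp only [ENNReal.toReal_one, div_one, sub_nonneg]
        exact (div_le_one (by linarith)).2 this
    have h2 := (ENNReal.Tendsto.mul_const hwt (Or.inr hV))
    rw [zero_mul] at h2
    have h3 := tendsto_of_tendsto_of_tendsto_of_le_of_le tendsto_const_nhds h2 (fun k => zero_le) h1
    have h4 := ENNReal.Tendsto.const_mul (a := B * ENNReal.ofReal A) h3 (Or.inr (by finiteness))
    rw [mul_zero] at h4
    exact h4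
  have h5 := ENNReal.Tendsto.mul_const hτ (b := volume T ^ (1 / p.toReal)) (Or.inr (ENNReal.rpow_ne_top_of_nonneg (by positivity) hTf))
  rw [zero_mul] at h5
  exact tendsto_of_tendsto_of_tendsto_of_le_of_le tendsto_const_nhds h5 (fun k => zero_le) hle

end P26

end Part26

section Part27

section P27
variable {n : ℕ} {P : FV n ≃L[ℝ] EV (n + 1)} {γ : EV n → ℝ} {M : Matrix (Fin (n + 1)) (Fin (n + 1)) ℝ}
  {U U0 Ω : Set (EV (n + 1))} {Ψ : EV (n + 1) → FV n} {c : FV n} {r C : ℝ} {K p : ℝ≥0∞}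

lemma bump_flat (hr : 0 < r) (hc : c.2 = 0) : ∃ β : FV n → ℝ, ContDiff ℝ 2 β ∧
    (∀ y, y ∉ Metric.closedBall c (r / 4) → β y = 0) ∧ (∀ᶠ y in 𝓝 c, β y = 1) ∧
    ∀ z', fderiv ℝ β (z', 0) (0, 1) = 0 := by
  let a : ContDiffBump c.1 := ⟨r / 8, r / 4, by positivity, by linarith⟩
  let b : ContDiffBump (0 : ℝ) := ⟨r / 8, r / 4, by positivity, by linarith⟩
  have ha : ContDiff ℝ 2 (a : EV n → ℝ) := a.contDiff
  have hb : ContDiff ℝ 2 (b : ℝ → ℝ) := b.contDiff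
  refine ⟨fun y => a y.1 * b y.2, (ha.comp contDiff_fst).mul (hb.comp contDiff_snd), ?_, ?_, ?_⟩
  · intro y hy
    rw [Metric.mem_closedBall, not_le, Prod.dist_eq, lt_max_iff, hc] at hy
    rcases hy with hy | hy
    · beta_reduce; rw [a.zero_of_le_dist hy.le, zero_mul]
    · beta_reduce; rw [b.zero_of_le_dist hy.le, mul_zero]
  · have h1 : ∀ᶠ y : FV n in 𝓝 c, a y.1 = 1 := (continuous_fst.tendsto c).eventually a.eventuallyEq_one
    have h2 : ∀ᶠ y : FV n in 𝓝 c, b y.2 = 1 := by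
      have := (continuous_snd.tendsto c : Tendsto (Prod.snd : FV n → ℝ) (𝓝 c) (𝓝 c.2))
      rw [hc] at this
      exact this.eventually b.eventuallyEq_one
    filter_upwards [h1, h2] with y e1 e2
    rw [e1, e2, one_mul]
  · intro z'
    have ev : (fun y : FV n => a y.1 * b y.2) =ᶠ[𝓝 (z', 0)] fun y => a y.1 := by
      have h2 : ∀ᶠ y : FV n in 𝓝 (z', 0), b y.2 = 1 :=
        ((continuous_snd.tendsto (z', (0:ℝ)) : Tendsto (Prod.snd : FV n → ℝ) (𝓝 (z', 0)) (𝓝 0))).eventually b.eventuallyEq_one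
      filter_upwards [h2] with y e2
      rw [e2, mul_one]
    rw [ev.fderiv_eq]
    have := HasFDerivAt.comp (g := (a : EV n → ℝ)) (f := fun y : FV n => y.1) ((z', 0) : FV n)
      (ha.differentiable (by norm_num) _).hasFDerivAt hasFDerivAt_fst
    have e : fderiv ℝ (fun y : FV n => a y.1) (z', 0) = _ := this.fderiv
    rw [e]; simp

lemma evm_contDiff {κ g : FV n → ℝ} {s : ℝ} (hκ : Mol s κ) (hg : Continuous g) : ContDiff ℝ 2 (evm κ g) := by
  have h1 : ContDiff ℝ (2 : ℕ∞) (cnvp κ g) := cnvp_contDiff (hκ.1.of_le (by exact_mod_cast le_top)) hκ.2.2.1 hg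
  have h2 : ContDiff ℝ 2 (cnvp κ g) := by exact_mod_cast h1
  exact h2.add (h2.comp (Rf n).contDiff)

lemma evm_Sp {κ g : FV n → ℝ} (hκ : Mol (r / 4) κ) (hc : c.2 = 0)
    (hg : ∀ y, y ∉ Metric.closedBall c (r / 4) → g y = 0) : Sp c r (evm κ g) := by
  have key : ∀ y, y ∉ Metric.closedBall c (r / 2) → cnvp κ g y = 0 := by
    intro y hy
    refine cnv_supp hκ.2.2.2.2 fun z hz => ?_
    have : g (y - z) = 0 := by
      refine hg _ fun hm => hy ?_
      rw [Metric.mem_closedBall] at hm ⊢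
      have h1 := dist_triangle y (y - z) c
      have h2 : dist y (y - z) = ‖z‖ := by rw [dist_eq_norm]; congr 1; abel
      linarith
    by_cases h : y - z ∈ UH n
    · rw [Set.indicator_of_mem h, this]
    · rw [Set.indicator_of_notMem h]
  intro y hy
  have h2 : Rf n y ∉ Metric.closedBall c (r / 2) := by
    have e : dist (Rf n y) c = dist y c := by
      have : Rf n c = c := by ext <;> simp [hc]
      rw [dist_eq_norm, dist_eq_norm, ← Rf_norm (y - c), map_sub, this]
    rw [Metric.mem_closedBall, e]; exact hy
  rw [evm, key y hy, key _ h2, add_zero]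

lemma evm_dn {κ g : FV n → ℝ} {s : ℝ} (hκ : Mol s κ) (he : ∀ y, κ (Rf n y) = κ y) (hg : ContDiff ℝ 2 g) (z' : EV n) :
    fderiv ℝ (evm κ g) (z', 0) (0, 1) = 0 := by
  rw [evm_fderiv (hκ.1.of_le (by exact_mod_cast le_top)) hκ.2.2.1 he (hg.of_le (by norm_num))]
  have e1 : Rf n ((z', 0) : FV n) = (z', 0) := by ext <;> simp
  have e2 : Rf n ((0, 1) : FV n) = -(0, 1) := by ext <;> simp
  rw [ContinuousLinearMap.add_apply, ContinuousLinearMap.comp_apply, e1, e2, map_neg, add_neg_cancel]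

lemma jmS {X : Type*} [NormedAddCommGroup X] [NormedSpace ℝ X] [MeasurableSpace X] [BorelSpace X] {μ : Measure X} {Φ : X → ℝ} {C : ℝ}
    (hC : ∀ x, ‖jj Φ x‖ ≤ C) {S O : Set X} (hS : MeasurableSet S) (h0 : ∀ x, x ∉ S → jj Φ x = 0) (T : X → Jet X) (p : ℝ≥0∞) :
    eLpNorm (fun x => jm (jj Φ x) (T x)) p (μ.restrict O) ≤ ENNReal.ofReal (4 * C) * eLpNorm T p (μ.restrict (O ∩ S)) := by
  have hs : Function.support (fun x => jm (jj Φ x) (T x)) ⊆ S := by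
    intro x hx
    by_contra hn
    exact hx (by simp only [h0 x hn, jm_zero_left])
  rw [← eLpNorm_restrict_eq_of_support_subset hs, Measure.restrict_restrict hS, Set.inter_comm]
  refine eLpNorm_le_mul_eLpNorm_of_ae_le_mul (Eventually.of_forall fun x => ?_) p
  refine (jm_norm _ _).trans ?_
  have := hC x
  gcongr

lemma Jd_meas {g : FV n → ℝ} (hg : ContDiff ℝ 2 g) : AEStronglyMeasurable (Jd g) volume := by
  have hR : Continuous (Rj : Jet (FV n) → Jet (FV n)) := by
    refine LipschitzWith.continuous (K := 1) (LipschitzWith.of_dist_le_mul fun s t => ?_)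
    rw [dist_eq_norm, dist_eq_norm, ← Rj_sub, NNReal.coe_one, one_mul]
    exact Rj_norm _
  exact (Gp_meas hg).add (hR.comp_aestronglyMeasurable ((Gp_meas hg).comp_measurePreserving Rf_mp))

/-- The boundary piece in a flattened chart. -/
lemma bdry_core (h : FC P γ M U Ψ c r C K) (hγ : ContDiff ℝ 3 γ) (hch : IsCh Ω U0 P γ) (hU : U ⊆ U0) (hM : Mᵀ = M)
    (hΩ : IsOpen Ω) (hp1 : 1 ≤ p) (hp : p ≠ ⊤) {D : List (Fin (n + 1)) → EV (n + 1) → ℝ}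
    (hD : ∀ l : List (Fin (n + 1)), l.length ≤ 2 → MemLp (D l) p (volume.restrict Ω))
    (hell : ∀ φ : EV (n + 1) → ℝ, ContDiff ℝ (⊤ : ℕ∞) φ → HasCompactSupport φ → ell Ω M D φ = 0)
    {w : ℕ → EV (n + 1) → ℝ} (hw : ∀ k, ContDiff ℝ 2 (w k))
    (hwt : Tendsto (fun k => eLpNorm (fun x => jj (w k) x - jetD D x) p
      (volume.restrict (Ω ∩ fch P γ M '' Metric.closedBall c (r / 2)))) atTop (𝓝 0))
    {β : FV n → ℝ} (hβ : ContDiff ℝ 2 β) (hβ0 : ∀ y, y ∉ Metric.closedBall c (r / 4) → β y = 0)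
    (hβn : ∀ z', fderiv ℝ β (z', 0) (0, 1) = 0) {χ : EV (n + 1) → ℝ} (hχ : Cut Ω M χ)
    (hψ : Cut Ω M (xt Ψ (fch P γ M '' Metric.ball c r) β)) :
    Appr Ω M p D (fun x => xt Ψ (fch P γ M '' Metric.ball c r) β x * χ x) := by
  set V := fch P γ M '' Metric.ball c r with hV
  set S := fch P γ M '' Metric.closedBall c (r / 2) with hS
  have hSm : MeasurableSet S := (img_cpt hγ).isClosed.measurableSet
  set Φ : EV (n + 1) → ℝ := fun x => xt Ψ V β x * χ x with hΦd
  obtain ⟨hΦ, hΦN, CΦ, hCΦ⟩ : Cut Ω M Φ := cut_mul hψ hχ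
  have hr := h.hr
  have q42 : ∀ {q : FV n → ℝ}, (∀ y, y ∉ Metric.closedBall c (r / 4) → q y = 0) → Sp c r q := fun hq y hy =>
    hq y fun hm => hy (Metric.closedBall_subset_closedBall (by linarith) hm)
  have hβS : Sp c r β := q42 hβ0
  have hΦ0 : ∀ x, x ∉ S → Φ x = 0 := fun x hx => by
    have : xt Ψ V β x = 0 := xt_off h hβS hx
    simp only [hΦd, this, zero_mul]
  have hΦj : ∀ x, x ∉ S → jj Φ x = 0 := by
    intro x hx
    rw [hΦd, jj_mul hψ.1.contDiffAt hχ.1.contDiffAt, xt_jet_off h hγ hβS hx, jm_zero_left]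
  have hO : ∀ y ∈ Metric.ball c r, fch P γ M y ∈ Ω ↔ y ∈ UH n := by
    intro y hy
    rw [hch.mem_iff (hU (h.inU y hy)), h.pos y hy]; rfl
  set g : ℕ → FV n → ℝ := fun k y => β y * (χ (fch P γ M y) * w k (fch P γ M y)) with hgd
  have hfc := fch_contDiff (P := P) (M := M) hγ
  have hg : ∀ k, ContDiff ℝ 2 (g k) := fun k => hβ.mul ((hχ.1.comp hfc).mul ((hw k).comp hfc))
  have hg0 : ∀ k, ∀ y, y ∉ Metric.closedBall c (r / 4) → g k y = 0 := fun k y hy => by simp only [hgd, hβ0 y hy, zero_mul]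
  have hgS : ∀ k, Sp c r (g k) := fun k => q42 (hg0 k)
  have hgc : ∀ k, HasCompactSupport (g k) := fun k => HasCompactSupport.intro (isCompact_closedBall c (r / 4)) (hg0 k)
  have hgv : ∀ k, ∀ y ∈ Metric.ball c r, g k y = Φ (fch P γ M y) * w k (fch P γ M y) := by
    intro k y hy
    simp only [hgd, hΦd, hV, xt_val h β hy]; ring
  have hxg : ∀ k, xt Ψ V (g k) = fun x => Φ x * w k x := by
    intro k; funext x
    by_cases hx : x ∈ V
    · obtain ⟨y, hy, rfl⟩ := hx
      rw [hV, xt_val h _ hy, hgv k y hy]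
    · rw [hΦd]; simp only [xt, Set.indicator_of_notMem hx, zero_mul]
  set a : ℕ → ℝ≥0∞ := fun k => eLpNorm (fun x => jj (w k) x - jetD D x) p (volume.restrict (Ω ∩ S)) with had
  have hTm : AEStronglyMeasurable (jetD D) (volume.restrict (Ω ∩ S)) :=
    (jetD_memLp hD).1.mono_measure (Measure.restrict_mono Set.inter_subset_left le_rfl)
  have mjm : ∀ {v : EV (n + 1) → ℝ}, ContDiff ℝ 2 v → ∀ {μ : Measure (EV (n + 1))}, AEStronglyMeasurable (jj v) μ :=
    fun hv _ => (jj_continuous hv).aestronglyMeasurable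
  have mjF : ∀ {v : FV n → ℝ}, ContDiff ℝ 2 v → ∀ {μ : Measure (FV n)}, AEStronglyMeasurable (jj v) μ :=
    fun hv _ => (jj_continuous hv).aestronglyMeasurable
  have hww : ∀ k l, eLpNorm (fun x => jj (w k) x - jj (w l) x) p (volume.restrict (Ω ∩ S)) ≤ a k + a l := by
    intro k l
    have e : (fun x => jj (w k) x - jj (w l) x) = (fun x => jj (w k) x - jetD D x) - fun x => jj (w l) x - jetD D x := by
      funext x; simp
    rw [e]
    exact eLpNorm_sub_le ((mjm (hw k)).sub hTm) ((mjm (hw l)).sub hTm) hp1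
  set Q : ℝ≥0∞ := (ENNReal.ofReal C * K ^ (1 / p).toReal) * ENNReal.ofReal (4 * CΦ) with hQd
  have hKp : K ^ (1 / p).toReal ≠ ⊤ := ENNReal.rpow_ne_top_of_nonneg ENNReal.toReal_nonneg h.hK
  have hQ : Q ≠ ⊤ := by finiteness
  have hgg : ∀ k l, eLpNorm (fun y => jj (g k) y - jj (g l) y) p (volume.restrict (UH n)) ≤ Q * (a k + a l) := by
    intro k l
    have e1 : (fun y => jj (g k) y - jj (g l) y) = jj (fun y => g k y - g l y) := by
      funext y; rw [jj_sub (hg k) (hg l)]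
    have h1 := ft_Lp h hγ (q := fun y => g k y - g l y) (w := fun x => Φ x * (w k x - w l x)) (hΦ.mul ((hw k).sub (hw l))) p
      (fun y hy => by simp only [hgv k y hy, hgv l y hy]; ring)
      (fun y hy => by simp only [hgS k y hy, hgS l y hy, sub_zero]) UH_meas hO
    rw [e1]
    refine h1.trans ?_
    rw [hQd, mul_assoc (ENNReal.ofReal C * _)]
    gcongr
    have e2 : jj (fun x => Φ x * (w k x - w l x)) = fun x => jm (jj Φ x) (jj (w k) x - jj (w l) x) := by
      funext x
      rw [jj_mul hΦ.contDiffAt ((hw k).sub (hw l)).contDiffAt, jj_sub (hw k) (hw l)]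
    rw [e2]
    refine (jmS hCΦ hSm hΦj _ p).trans ?_
    gcongr
    exact hww k l
  have hat : Tendsto a atTop (𝓝 0) := hwt
  have hCau : ∀ η : ℝ≥0∞, 0 < η → ∃ N, ∀ k ≥ N, ∀ l ≥ N,
      eLpNorm (fun y => jj (g k) y - jj (g l) y) p (volume.restrict (UH n)) ≤ η := by
    intro η hη
    have h1 := ENNReal.Tendsto.const_mul (a := Q) hat (Or.inr hQ)
    rw [mul_zero] at h1
    obtain ⟨N, hN⟩ := eventually_atTop.1 (h1.eventually (ge_mem_nhds (ENNReal.half_pos hη.ne')))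
    refine ⟨N, fun k hk l hl => (hgg k l).trans ?_⟩
    rw [mul_add, ← ENNReal.add_halves η]
    exact add_le_add (hN k hk) (hN l hl)
  have hsel : ∀ j : ℕ, ∃ k ≥ j, ∃ κ : FV n → ℝ, Mol (r / 4) κ ∧ (∀ y, κ (Rf n y) = κ y) ∧
      eLpNorm (jj (evm κ (g k)) - Jd (g k)) p volume ≤ ((j : ℝ≥0∞) + 1)⁻¹ := fun j =>
    flat_select hp1 hp hg hgc hCau (fun s κ hκ => bd_tendsto h hγ hch hU hM hΩ hp1 hD hell hΦ hΦN hΦ0 hw hwt hgv hgS hκ)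
      (by positivity) (ENNReal.inv_pos.2 (by finiteness)) j
  choose k hk κ hκ hκe herr using hsel
  set q : ℕ → FV n → ℝ := fun j => evm (κ j) (g (k j)) with hqd
  have hq : ∀ j, ContDiff ℝ 2 (q j) := fun j => evm_contDiff (hκ j) (hg _).continuous
  have hqS : ∀ j, Sp c r (q j) := fun j => evm_Sp (hκ j) h.hc (hg0 _)
  have hsq : ∀ {f f' : FV n → ℝ}, Sp c r f → Sp c r f' → Sp c r (fun y => f y - f' y) := fun hf hf' y hy => by
    simp only [hf y hy, hf' y hy, sub_zero]
  have hxd : ∀ {f f' : FV n → ℝ}, ContDiff ℝ 2 f → ContDiff ℝ 2 f' → Sp c r f → Sp c r f' →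
      (fun x => jj (xt Ψ V f) x - jj (xt Ψ V f') x) = jj (xt Ψ V fun y => f y - f' y) := by
    intro f f' h1 h2 h3 h4
    funext x
    rw [← jj_sub (xt_contDiff h hγ h1 h3) (xt_contDiff h hγ h2 h4)]
    congr 1
    funext x
    exact (xt_sub V f f' x).symm
  have ha' : Tendsto (fun j => a (k j)) atTop (𝓝 0) :=
    hat.comp (tendsto_atTop_mono hk tendsto_id)
  have he' : Tendsto (fun j : ℕ => ((j : ℝ≥0∞) + 1)⁻¹) atTop (𝓝 0) := by
    have := (ENNReal.tendsto_inv_nat_nhds_zero).comp (tendsto_add_atTop_nat 1)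
    refine this.congr fun j => by simp
  refine ⟨fun j => xt Ψ V (q j), fun j => ⟨xt_contDiff h hγ (hq j) (hqS j), xt_cc h hγ (hqS j),
    xt_nbc h hγ (hq j) (hqS j) hch hΩ hU (evm_dn (hκ j) (hκe j) (hg _))⟩, ?_, ?_⟩
  · set s : ℕ → ℝ≥0∞ := fun j => (K ^ (1 / p).toReal * ENNReal.ofReal C) * (((j : ℝ≥0∞) + 1)⁻¹ + 2 * (Q * a (k j))) with hsd
    have hs : Tendsto s atTop (𝓝 0) := by
      have h1 := ENNReal.Tendsto.const_mul (a := Q) ha' (Or.inr hQ)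
      have h2 := ENNReal.Tendsto.const_mul (a := 2) h1 (Or.inr (by norm_num))
      have h3 := ENNReal.Tendsto.const_mul (a := K ^ (1 / p).toReal * ENNReal.ofReal C) (he'.add h2) (Or.inr (by finiteness))
      rw [mul_zero, mul_zero, add_zero, mul_zero] at h3
      exact h3
    have hle : ∀ i j, eLpNorm (fun x => jj (xt Ψ V (q i)) x - jj (xt Ψ V (q j)) x) p volume ≤ s i + s j := by
      intro i j
      rw [hxd (hq i) (hq j) (hqS i) (hqS j)]
      have h1 := xt_Lp h hγ ((hq i).sub (hq j)) (hsq (hqS i) (hqS j)) p (H := Set.univ) (O := Set.univ) MeasurableSet.univ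
        (fun y _ => by simp)
      rw [Measure.restrict_univ, Measure.restrict_univ] at h1
      refine h1.trans ?_
      have e : jj (fun y => q i y - q j y) = ((jj (q i) - Jd (g (k i))) - (jj (q j) - Jd (g (k j)))) + (Jd (g (k i)) - Jd (g (k j))) := by
        funext y; rw [jj_sub (hq i) (hq j)]; simp only [Pi.add_apply, Pi.sub_apply]; abel
      have h2 : eLpNorm (jj (fun y => q i y - q j y)) p volume ≤ (((i : ℝ≥0∞) + 1)⁻¹ + ((j : ℝ≥0∞) + 1)⁻¹) + 2 * (Q * (a (k i) + a (k j))) := by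
        rw [e]
        have m1 : ∀ i, AEStronglyMeasurable (jj (q i) - Jd (g (k i))) volume := fun i => (mjF (hq i)).sub (Jd_meas (hg _))
        refine (eLpNorm_add_le ((m1 i).sub (m1 j)) ((Jd_meas (hg _)).sub (Jd_meas (hg _))) hp1).trans ?_
        refine add_le_add ((eLpNorm_sub_le (m1 i) (m1 j) hp1).trans (add_le_add (herr i) (herr j))) ?_
        refine (Jd_sub_Lp hp1 (hg _) (hg _)).trans ?_
        gcongr
        exact hgg _ _
      calc _ ≤ (K ^ (1 / p).toReal * ENNReal.ofReal C) * ((((i : ℝ≥0∞) + 1)⁻¹ + ((j : ℝ≥0∞) + 1)⁻¹) + 2 * (Q * (a (k i) + a (k j)))) := by gcongr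
        _ = s i + s j := by simp only [hsd]; ring
    intro η hη
    obtain ⟨N, hN⟩ := eventually_atTop.1 (hs.eventually (ge_mem_nhds (ENNReal.half_pos hη.ne')))
    refine ⟨N, fun i hi j hj => (hle i j).trans ?_⟩
    rw [← ENNReal.add_halves η]
    exact add_le_add (hN i hi) (hN j hj)
  · have hle : ∀ j, eLpNorm (fun x => jj (xt Ψ V (q j)) x - jm (jj Φ x) (jetD D x)) p (volume.restrict Ω)
        ≤ (K ^ (1 / p).toReal * ENNReal.ofReal C) * ((j : ℝ≥0∞) + 1)⁻¹ + ENNReal.ofReal (4 * CΦ) * a (k j) := by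
      intro j
      have e : (fun x => jj (xt Ψ V (q j)) x - jm (jj Φ x) (jetD D x)) = (fun x => jj (xt Ψ V (q j)) x - jj (xt Ψ V (g (k j))) x)
          + fun x => jm (jj Φ x) (jj (w (k j)) x - jetD D x) := by
        funext x
        have : jj (xt Ψ V (g (k j))) x = jm (jj Φ x) (jj (w (k j)) x) := by
          rw [hxg, jj_mul hΦ.contDiffAt (hw _).contDiffAt]
        rw [Pi.add_apply, this, jm_sub_right]; abel
      rw [e]
      refine (eLpNorm_add_le ((mjm (xt_contDiff h hγ (hq j) (hqS j))).sub (mjm (xt_contDiff h hγ (hg _) (hgS _))))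
        (jm_meas hΦ ((mjm (hw _)).sub (jetD_memLp hD).1)) hp1).trans (add_le_add ?_ (jmS hCΦ hSm hΦj _ p))
      refine le_trans (le_of_eq (congrArg (fun f => eLpNorm f p (volume.restrict Ω)) (hxd (hq j) (hg (k j)) (hqS j) (hgS (k j))))) ?_
      refine (xt_Lp h hγ ((hq j).sub (hg _)) (hsq (hqS j) (hgS _)) p UH_meas hO).trans ?_
      gcongr
      refine le_trans (le_of_eq ?_) ((eLpNorm_mono_measure _ (Measure.restrict_le_self (s := UH n))).trans (herr j))
      refine eLpNorm_congr_ae ?_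
      refine (ae_restrict_iff' UH_meas).2 (Eventually.of_forall fun y hy => ?_)
      rw [jj_sub (hq j) (hg _), Pi.sub_apply, Jd_UH _ hy]
    have h1 := (ENNReal.Tendsto.const_mul (a := K ^ (1 / p).toReal * ENNReal.ofReal C) he' (Or.inr (by finiteness))).add
      (ENNReal.Tendsto.const_mul (a := ENNReal.ofReal (4 * CΦ)) ha' (Or.inr (by finiteness)))
    rw [mul_zero, mul_zero, add_zero] at h1
    exact tendsto_of_tendsto_of_tendsto_of_le_of_le tendsto_const_nhds h1 (fun k => zero_le) hle

lemma jj_bdd {X : Type*} [NormedAddCommGroup X] [NormedSpace ℝ X] {v : X → ℝ} (hv : ContDiff ℝ 2 v)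
    (hc : HasCompactSupport v) : ∃ C : ℝ, ∀ x, ‖jj v x‖ ≤ C :=
  (jj_continuous hv).bounded_above_of_compact_support (jj_compact hc)

lemma bdry_piece (hΩ : IsGraphDomain 3 Ω) (hM : Mᵀ = M) (hpos : ∀ ν, ν ≠ 0 → 0 < inner ℝ ν (mulVecE M ν))
    (hp1 : 1 ≤ p) (hp : p ≠ ⊤) {u : EV (n + 1) → ℝ} {D : List (Fin (n + 1)) → EV (n + 1) → ℝ}
    (hD : IsSobDerivs Ω 2 p u D) (hN : NeumannBC Ω M p u) {z : EV (n + 1)} (hz : z ∈ frontier Ω) :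
    ∃ ψ, Cut Ω M ψ ∧ (∀ᶠ x in 𝓝 z, ψ x = 1) ∧ ∀ χ, Cut Ω M χ → Appr Ω M p D (fun x => ψ x * χ x) := by
  obtain ⟨U0, P, γ, hch, hzU⟩ := exists_ch hΩ hz
  have hγ : ContDiff ℝ 3 γ := hch.2.2.1.1
  obtain ⟨δ, hδ, w, hw, hwt⟩ := shift_moll hch hΩ.1 hp1 hp hD hzU
  have hff : ff P γ z = 0 := (hch.frontier_iff hΩ.1 hzU).1 hz
  have hze : shear P γ ((P.symm z).1, 0) = z := by rw [← hff]; exact shear_ff z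
  have hy0 : shear P γ ((P.symm z).1, 0) ∈ U0 ∩ Metric.ball z δ := by
    rw [hze]; exact ⟨hzU, Metric.mem_ball_self hδ⟩
  obtain ⟨Ψ, r, C, K, h⟩ := flat_chart hch.2.1 hγ hpos (hch.1.inter Metric.isOpen_ball) hy0
  set c : FV n := ((P.symm z).1, 0) with hcd
  obtain ⟨β, hβ, hβ0, hβ1, hβn⟩ := bump_flat (n := n) h.hr h.hc
  have hr := h.hr
  have hβS : Sp c r β := fun y hy => hβ0 y fun hm => hy (Metric.closedBall_subset_closedBall (by linarith) hm)
  have hcU : U0 ∩ Metric.ball z δ ⊆ U0 := Set.inter_subset_left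
  have hψ : Cut Ω M (xt Ψ (fch P γ M '' Metric.ball c r) β) :=
    ⟨xt_contDiff h hγ hβ hβS, xt_nbc h hγ hβ hβS hch hΩ.1 hcU hβn, jj_bdd (xt_contDiff h hγ hβ hβS) (xt_cc h hγ hβS)⟩
  have hcb : c ∈ Metric.ball c r := Metric.mem_ball_self hr
  have hfz : fch P γ M c = z := by rw [hcd, fch_bd, hze]
  refine ⟨_, hψ, ?_, fun χ hχ => ?_⟩
  · have h1 := xt_ev h β hcb
    have h2 := (h.cd c hcb).continuousAt
    rw [ContinuousAt, h.inv c hcb] at h2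
    rw [hfz] at h1 h2
    filter_upwards [h1, h2.eventually hβ1] with x e1 e2
    rw [e1, e2]
  · refine bdry_core h hγ hch hcU hM hΩ.1 hp1 hp hD.2.2 ((neumann_iff hΩ.1 hp1 hD).1 hN) hw ?_ hβ hβ0 hβn hχ hψ
    refine tendsto_of_tendsto_of_tendsto_of_le_of_le tendsto_const_nhds hwt (fun k => zero_le) fun k => ?_
    refine eLpNorm_mono_measure _ (Measure.restrict_mono ?_ le_rfl)
    rintro _ ⟨hx, y, hy, rfl⟩
    exact ⟨hx, (h.inU y (cb_sub h hy)).2⟩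

end P27

end Part27

section Part28

section P28

lemma tail_small {m : ℕ} {X : Type*} [NormedAddCommGroup X] [NormedSpace ℝ X] {p : ℝ≥0∞} (hp : p ≠ ⊤) {G : EV m → X} (hG : MemLp G p volume)
    {η : ℝ≥0∞} (hη : η ≠ 0) : ∃ R : ℝ, 1 ≤ R ∧ eLpNorm G p (volume.restrict (Metric.ball 0 R)ᶜ) ≤ η := by
  obtain ⟨g, gc, gn, -, -⟩ := hG.exists_hasCompactSupport_eLpNorm_sub_le hp hη
  obtain ⟨r, hr⟩ := gc.isCompact.isBounded.subset_ball (0 : EV m)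
  refine ⟨max r 1, le_max_right _ _, ?_⟩
  refine le_trans (le_of_eq ?_) (le_trans (eLpNorm_mono_measure (G - g) (Measure.restrict_le_self (s := (Metric.ball 0 (max r 1))ᶜ))) gn)
  refine eLpNorm_congr_ae ?_
  filter_upwards [ae_restrict_mem measurableSet_ball.compl] with x hx
  have : g x = 0 := by
    by_contra h
    exact hx (Metric.ball_subset_ball (le_max_left _ _) (hr (subset_tsupport _ h)))
  simp [this]

lemma nfc {X Z : Type*} [NormedAddCommGroup X] [NormedSpace ℝ X] [NormedAddCommGroup Z] [NormedSpace ℝ Z] (c : Z) (x : X) :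
    ‖fderiv ℝ (fun _ : X => c) x‖ = 0 := by simp

lemma jj_clm_le {X Y : Type*} [NormedAddCommGroup X] [NormedSpace ℝ X] [NormedAddCommGroup Y] [NormedSpace ℝ Y]
    {q : Y → ℝ} (hq : ContDiff ℝ 2 q) (A : X →L[ℝ] Y) (x : X) :
    ‖jj (fun y => q (A y)) x‖ ≤ ‖jj q (A x)‖ * (1 + ‖A‖ + ‖A‖ ^ 2) := by
  have h := jj_comp_le (x := x) (f := A) hq.contDiffAt A.contDiff.contDiffAt
  have h1 : fderiv ℝ A = fun _ => A := by ext1 x; exact A.fderiv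
  rw [h1, nfc, add_zero] at h
  exact h

lemma cutR (m : ℕ) : ∃ C : ℝ, ∀ R : ℝ, 1 ≤ R → ∃ ζ : EV m → ℝ, ContDiff ℝ 2 ζ ∧
    (∀ x ∈ Metric.ball 0 R, ζ x = 1) ∧ (∀ x, x ∉ Metric.closedBall 0 (2 * R) → ζ x = 0) ∧ ∀ x, ‖jj ζ x‖ ≤ C := by
  let b : ContDiffBump (0 : EV m) := ⟨1, 2, by norm_num, by norm_num⟩
  have hb : ContDiff ℝ 2 b := b.contDiff
  obtain ⟨C, hC⟩ := jj_bdd hb b.hasCompactSupport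
  refine ⟨C * 3, fun R hR => ?_⟩
  have hR0 : 0 < R := by linarith
  let A : EV m →L[ℝ] EV m := R⁻¹ • ContinuousLinearMap.id ℝ (EV m)
  have hA : ∀ x, A x = R⁻¹ • x := fun x => rfl
  have hA1 : ‖A‖ ≤ 1 := by
    refine ContinuousLinearMap.opNorm_le_bound _ zero_le_one fun x => ?_
    rw [hA, norm_smul, Real.norm_of_nonneg (by positivity)]
    exact mul_le_mul_of_nonneg_right (inv_le_one_of_one_le₀ hR) (norm_nonneg _)
  have hn : ∀ x, ‖A x‖ = ‖x‖ / R := by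
    intro x
    rw [hA, norm_smul, Real.norm_of_nonneg (by positivity)]; field_simp
  refine ⟨fun x => b (A x), hb.comp A.contDiff, fun x hx => ?_, fun x hx => ?_, fun x => ?_⟩
  · refine b.one_of_mem_closedBall ?_
    rw [mem_closedBall_zero_iff, hn, div_le_iff₀ hR0]
    rw [mem_ball_zero_iff] at hx
    show ‖x‖ ≤ 1 * R
    linarith
  · refine b.zero_of_le_dist ?_
    rw [dist_zero_right, hn, le_div_iff₀ hR0]
    rw [mem_closedBall_zero_iff, not_le] at hx
    exact hx.le
  · refine (jj_clm_le hb A x).trans ?_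
    have := norm_nonneg A
    have h4 := (norm_nonneg _).trans (hC (A x))
    exact mul_le_mul (hC _) (by nlinarith) (by positivity) h4

variable {n : ℕ} {M : Matrix (Fin (n + 1)) (Fin (n + 1)) ℝ} {Ω V : Set (EV (n + 1))} {p : ℝ≥0∞}
  {u χ : EV (n + 1) → ℝ} {D : List (Fin (n + 1)) → EV (n + 1) → ℝ}

lemma nbc_vanish (hΩ : IsOpen Ω) (hV : IsOpen V) (hVf : frontier Ω ⊆ V) {v : EV (n + 1) → ℝ} (hv : ∀ x ∈ V, v x = 0) :
    NBC Ω M v := by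
  intro U P γ h x hx hf
  have hxV : x ∈ V := hVf ((h.frontier_iff hΩ hx).2 hf)
  have : v =ᶠ[𝓝 x] fun _ => 0 := by
    filter_upwards [hV.mem_nhds hxV] with y hy using hv y hy
  rw [this.fderiv_eq]; simp

lemma int_step (hΩ : IsOpen Ω) (hp1 : 1 ≤ p) (hp : p ≠ ⊤) (hD : IsSobDerivs Ω 2 p u D)
    (hχ : Cut Ω M χ) (hV : IsOpen V) (hVf : frontier Ω ⊆ V) (h0 : ∀ x ∈ V, χ x = 0) {η : ℝ≥0∞} (hη : η ≠ 0) :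
    ∃ v : EV (n + 1) → ℝ, ContDiff ℝ 2 v ∧ HasCompactSupport v ∧ NBC Ω M v ∧
      eLpNorm (fun x => jj v x - jm (jj (Ω.indicator χ) x) (Ω.indicator (jetD D) x)) p volume ≤ η := by
  obtain ⟨hχ2, -, C, hC⟩ := hχ
  have hC0 : 0 ≤ C := (norm_nonneg _).trans (hC 0)
  set Θ := Ω.indicator χ with hΘ
  set G := Ω.indicator (jetD D) with hG
  have hT := jetD_memLp hD.2.2
  have hGL : MemLp G p volume := ind_memLp hΩ hT
  have hGm := hGL.aestronglyMeasurable
  have hΘ2 : ContDiff ℝ 2 Θ := ind_contDiff hΩ hχ2 hV hVf h0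
  have hΘV : ∀ x ∈ V, Θ x = 0 := fun x hx => by
    by_cases hxΩ : x ∈ Ω
    · rw [hΘ, Set.indicator_of_mem hxΩ]; exact h0 x hx
    · rw [hΘ, Set.indicator_of_notMem hxΩ]
  have hΘC : ∀ x, ‖jj Θ x‖ ≤ C := by
    intro x
    rcases loc_ind hΩ hV hVf h0 x with ⟨-, h⟩ | ⟨-, h⟩
    · rw [jj_congr h]; exact hC x
    · rw [jj_congr h, jj_const]
      exact (norm_zero (E := Jet (EV (n + 1)))).le.trans hC0
  obtain ⟨C', hC'⟩ := cutR (n + 1)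
  have hC'0 : 0 ≤ C' := by
    obtain ⟨ζ, -, -, -, h⟩ := hC' 1 le_rfl
    exact (norm_nonneg _).trans (h 0)
  set C1 := 4 * C * C'
  have hC1 : 0 ≤ C1 := by positivity
  set a : ℝ≥0∞ := ENNReal.ofReal (4 * C1) + ENNReal.ofReal (4 * (C1 + C)) + 1 with ha
  have hat : a ≠ ⊤ := by rw [ha]; finiteness
  have hη1 : 0 < η / a := ENNReal.div_pos hη hat
  obtain ⟨R, hR, hRt⟩ := tail_small hp hGL hη1.ne'
  obtain ⟨ζ, ζ2, ζ1, ζ0, ζC⟩ := hC' R hR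
  obtain ⟨r, hr, hmol⟩ := moll_conv volume p hp1 hp G hGL _ hη1
  let Φ : EV (n + 1) → ℝ := fun x => Θ x * ζ x
  have hΦ2 : ContDiff ℝ 2 Φ := hΘ2.mul ζ2
  have hΦj : ∀ x, jj Φ x = jm (jj Θ x) (jj ζ x) := fun x => jj_mul hΘ2.contDiffAt ζ2.contDiffAt
  have hΦC : ∀ x, ‖jj Φ x‖ ≤ C1 := by
    intro x
    rw [hΦj]
    refine (jm_norm _ _).trans ?_
    exact mul_le_mul (by linarith [hΘC x]) (ζC x) (norm_nonneg _) (by positivity)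
  have hΦc : HasCompactSupport Φ := by
    refine HasCompactSupport.of_support_subset_isCompact (isCompact_closedBall (0 : EV (n + 1)) (2 * R)) fun x hx => ?_
    by_contra h
    exact hx (by simp [Φ, ζ0 x h])
  have hSΩ : tsupport Φ ⊆ Ω := by
    have h1 : Function.support Φ ⊆ closure Ω ∩ Vᶜ := by
      intro x hx
      have hx' : Θ x ≠ 0 := fun h => hx (by simp [Φ, h])
      refine ⟨subset_closure ?_, fun h => hx' (hΘV x h)⟩
      by_contra h
      exact hx' (Set.indicator_of_notMem h _)
    intro x hx
    have h2 : x ∈ closure Ω ∩ Vᶜ := closure_minimal h1 (isClosed_closure.inter hV.isClosed_compl) hx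
    by_contra h
    exact h2.2 (hVf (by rw [hΩ.frontier_eq]; exact ⟨h2.1, h⟩))
  obtain ⟨δ, hδ, hδΩ⟩ := hΦc.isCompact.exists_thickening_subset_open hΩ hSΩ
  obtain ⟨κ, k1, k2, k3, k4, k5⟩ := exists_mol (m := n + 1) (lt_min (half_pos hδ) hr)
  have hκs : ∀ z ∈ tsupport κ, ‖z‖ ≤ δ / 2 := by
    intro z hz
    have : tsupport κ ⊆ Metric.closedBall 0 (δ / 2) := by
      refine closure_minimal (fun y hy => ?_) Metric.isClosed_closedBall
      by_contra h
      rw [mem_closedBall_zero_iff, not_le] at h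
      exact hy (k5 y ((min_le_left _ _).trans h.le))
    simpa using this hz
  have huL : LocallyIntegrable (Ω.indicator u) := ind_locInt hp1 hΩ (hD.1 ▸ hD.2.2 [] (by simp))
  have hGl : LocallyIntegrable G := ind_locInt hp1 hΩ hT
  let w := cnv κ (Ω.indicator u)
  have hw : ContDiff ℝ 2 w := (cnv_contDiff (k := ⊤) k1 k3 huL).of_le two_le_inf
  have hGc : Continuous (cnv κ G) := (cnv_contDiff (k := ⊤) k1 k3 hGl).continuous
  have hwj : ∀ x ∈ tsupport Φ, jj w x = cnv κ G x := by
    intro x hx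
    refine cnv_jet hp1 hΩ hD k1 k3 fun z hz => hδΩ ?_
    rw [Metric.mem_thickening_iff]
    refine ⟨x, hx, ?_⟩
    rw [dist_eq_norm, sub_sub_cancel_left, norm_neg]
    linarith [hκs z hz]
  refine ⟨fun x => Φ x * w x, hΦ2.mul hw, hΦc.mul_right, nbc_vanish hΩ hV hVf fun x hx => by simp [Φ, hΘV x hx], ?_⟩
  have hsplit : (fun x => jj (fun x => Φ x * w x) x - jm (jj Θ x) (G x))
      = (fun x => jm (jj Φ x) (cnv κ G x - G x)) + fun x => jm (jj Φ x - jj Θ x) (G x) := by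
    ext1 x
    rw [Pi.add_apply, jj_mul hΦ2.contDiffAt hw.contDiffAt, jm_sub_right, jm_sub_left]
    by_cases hx : x ∈ tsupport Φ
    · rw [hwj x hx]; abel
    · have : jj Φ x = 0 := by
        have h : Φ =ᶠ[𝓝 x] fun _ => 0 := notMem_tsupport_iff_eventuallyEq.1 hx
        rw [jj_congr h, jj_const]; rfl
      rw [this]; simp only [jm_zero_left]; abel
  have hm1 : AEStronglyMeasurable (fun x => jm (jj Φ x) (cnv κ G x - G x)) volume :=
    jm_meas hΦ2 (hGc.aestronglyMeasurable.sub hGm)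
  have hm2 : AEStronglyMeasurable (fun x => jm (jj Φ x - jj Θ x) (G x)) volume := by
    simp only [jm_sub_left]
    exact (jm_meas hΦ2 hGm).sub (jm_meas hΘ2 hGm)
  rw [hsplit]
  refine (eLpNorm_add_le hm1 hm2 hp1).trans ?_
  have e1 : eLpNorm (fun x => jm (jj Φ x) (cnv κ G x - G x)) p volume ≤ ENNReal.ofReal (4 * C1) * (η / a) := by
    refine (eLpNorm_le_mul_eLpNorm_of_ae_le_mul (g := fun x => cnv κ G x - G x) (c := 4 * C1) (ae_of_all _ fun x => ?_) p).trans ?_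
    · refine (jm_norm _ _).trans (mul_le_mul_of_nonneg_right ?_ (norm_nonneg _))
      linarith [hΦC x]
    · exact mul_le_mul_right (hmol κ k1.continuous k2 k3 k4 fun z hz => k5 z ((min_le_right _ _).trans hz)) _
  have e2 : eLpNorm (fun x => jm (jj Φ x - jj Θ x) (G x)) p volume ≤ ENNReal.ofReal (4 * (C1 + C)) * (η / a) := by
    have hs : Function.support (fun x => jm (jj Φ x - jj Θ x) (G x)) ⊆ (Metric.ball 0 R)ᶜ := by
      intro x hx hxb
      apply hx
      have h : Φ =ᶠ[𝓝 x] Θ := by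
        filter_upwards [Metric.isOpen_ball.mem_nhds hxb] with y hy
        simp [Φ, ζ1 y hy]
      beta_reduce
      rw [jj_congr h, sub_self, jm_zero_left]
    rw [← eLpNorm_restrict_eq_of_support_subset hs]
    refine (eLpNorm_le_mul_eLpNorm_of_ae_le_mul (g := G) (c := 4 * (C1 + C)) (ae_of_all _ fun x => ?_) p).trans ?_
    · refine (jm_norm _ _).trans (mul_le_mul_of_nonneg_right ?_ (norm_nonneg _))
      linarith [norm_sub_le (jj Φ x) (jj Θ x), hΦC x, hΘC x]
    · exact mul_le_mul_right hRt _
  calc _ ≤ ENNReal.ofReal (4 * C1) * (η / a) + ENNReal.ofReal (4 * (C1 + C)) * (η / a) := add_le_add e1 e2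
    _ ≤ a * (η / a) := by rw [← add_mul]; exact mul_le_mul_left (by rw [ha]; exact le_self_add) _
    _ ≤ η := ENNReal.mul_div_le

lemma int_piece (hΩ : IsOpen Ω) (hp1 : 1 ≤ p) (hp : p ≠ ⊤) (hD : IsSobDerivs Ω 2 p u D)
    (hχ : Cut Ω M χ) (hV : IsOpen V) (hVf : frontier Ω ⊆ V) (h0 : ∀ x ∈ V, χ x = 0) : Appr Ω M p D χ := by
  have hstep : ∀ j : ℕ, _ := fun j : ℕ => int_step hΩ hp1 hp hD hχ hV hVf h0
    (η := ((j : ℝ≥0∞) + 1)⁻¹) (ENNReal.inv_ne_zero.2 (by finiteness))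
  choose v v1 v2 v3 v4 using hstep
  have hlim : Tendsto (fun j : ℕ => ((j : ℝ≥0∞) + 1)⁻¹) atTop (𝓝 0) := by
    have := (tendsto_add_atTop_iff_nat 1).2 ENNReal.tendsto_inv_nat_nhds_zero
    simpa using this
  have hΘ2 : ContDiff ℝ 2 (Ω.indicator χ) := ind_contDiff hΩ hχ.1 hV hVf h0
  have hGm := (ind_memLp hΩ (jetD_memLp hD.2.2)).aestronglyMeasurable
  have hm := jm_meas hΘ2 hGm
  refine ⟨v, fun j => ⟨v1 j, v2 j, v3 j⟩, fun η hη => ?_, ?_⟩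
  · obtain ⟨N, hN⟩ := eventually_atTop.1 (hlim.eventually (ge_mem_nhds (ENNReal.half_pos hη.ne')))
    refine ⟨N, fun j hj k hk => ?_⟩
    have e : (fun x => jj (v j) x - jj (v k) x)
        = (fun x => jj (v j) x - jm (jj (Ω.indicator χ) x) (Ω.indicator (jetD D) x))
          - fun x => jj (v k) x - jm (jj (Ω.indicator χ) x) (Ω.indicator (jetD D) x) := by
      ext1 x; simp
    rw [e]
    refine (eLpNorm_sub_le ((jj_continuous (v1 j)).aestronglyMeasurable.sub hm)
      ((jj_continuous (v1 k)).aestronglyMeasurable.sub hm) hp1).trans ?_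
    rw [← ENNReal.add_halves η]
    exact add_le_add ((v4 j).trans (hN j hj)) ((v4 k).trans (hN k hk))
  · refine tendsto_of_tendsto_of_tendsto_of_le_of_le tendsto_const_nhds hlim (fun k => zero_le) fun j => ?_
    refine le_trans (le_of_eq ?_) ((eLpNorm_mono_measure _ (Measure.restrict_le_self (s := Ω))).trans (v4 j))
    refine eLpNorm_congr_ae ?_
    filter_upwards [ae_restrict_mem hΩ.measurableSet] with x hx
    rcases loc_ind hΩ hV hVf h0 x with ⟨-, h⟩ | ⟨h, -⟩
    · rw [jj_congr h, Set.indicator_of_mem hx]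
    · exact absurd hx h

lemma appr_one (hΩ : IsGraphDomain 3 Ω) (hcpt : IsCompact (frontier Ω)) (hM : Mᵀ = M)
    (hpos : ∀ ν, ν ≠ 0 → 0 < inner ℝ ν (mulVecE M ν))
    (hp1 : 1 ≤ p) (hp : p ≠ ⊤) (hD : IsSobDerivs Ω 2 p u D) (hN : NeumannBC Ω M p u) :
    Appr Ω M p D (fun _ => 1) := by
  refine tele (S := Cut Ω M) (Q := Appr Ω M p D) (cut_const 1) (fun f hf g hg => cut_mul hf hg)
    (fun f hf => cut_sub (cut_const 1) hf)
    (fun f hf g hg h h' => appr_add hp1 (jetD_memLp hD.2.2).aestronglyMeasurable hf hg h h') hcpt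
    (fun z hz => bdry_piece hΩ hM hpos hp1 hp hD hN hz) ?_
  rintro χ hχ ⟨V, hV, hVf, h0⟩
  exact int_piece hΩ.1 hp1 hp hD hχ hV hVf h0

lemma jm_one {X : Type*} [NormedAddCommGroup X] [NormedSpace ℝ X] (t : Jet X) (x : X) : jm (jj (fun _ : X => (1:ℝ)) x) t = t := by
  rw [jj_const]
  refine Jet.ext' ?_ ?_ ?_
  · simp [jm, mkJ, Jet.a]
  · refine ContinuousLinearMap.ext fun η => ?_
    simp [jm, mkJ, Jet.a, Jet.b]
  · refine ContinuousLinearMap.ext fun η => ContinuousLinearMap.ext fun ζ => ?_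
    simp [jm, mkJ, Jet.a, Jet.b, Jet.c]

end P28

end Part28

section Part29

section P29
variable {m : ℕ} {p : ℝ≥0∞} {μ : Measure (EV m)}

lemma mom_facts {A B : Matrix (Fin m) (Fin m) ℝ} (hA : A.PosDef) (h : A * A = B) :
    Bᵀ = B ∧ ∀ ν : EV m, ν ≠ 0 → 0 < inner ℝ ν (mulVecE B ν) := by
  have hT : Aᵀ = A := by
    have := hA.1.eq
    rwa [Matrix.conjTranspose_eq_transpose_of_trivial] at this
  refine ⟨by rw [← h, Matrix.transpose_mul, hT], fun ν hν => ?_⟩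
  rw [← h, mulVecE_mul, mulVecE_inner, hT]
  refine real_inner_self_pos.2 fun h0 => hν ?_
  have h1 : A.mulVec ν.ofLp = 0 := by
    have := congrArg WithLp.ofLp h0
    simpa [mulVecE] using this
  have h2 : A.mulVec ν.ofLp = A.mulVec 0 := by rw [h1, Matrix.mulVec_zero]
  have h3 := Matrix.mulVec_injective_iff_isUnit.2 hA.isUnit h2
  ext i
  simpa using congrFun h3 i

lemma jetD_le (D : List (Fin m) → EV m → ℝ) (l : List (Fin m)) (hl : l.length ≤ 2) (x : EV m) :
    ‖D l x‖ ≤ ‖jetD D x‖ := by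
  match l, hl with
  | [], _ => rw [← jetD_a D x]; exact Jet.norm_a _
  | [i], _ =>
    rw [← jetD_b D x i]
    refine ((jetD D x).b.le_opNorm _).trans ?_
    simpa using Jet.norm_b (jetD D x)
  | [i, j], _ =>
    rw [← jetD_c D x i j]
    refine ((jetD D x).c.le_opNorm₂ _ _).trans ?_
    simpa using Jet.norm_c (jetD D x)

lemma wnorm_le (m : ℕ) : ∃ K : ℝ≥0∞, K ≠ ⊤ ∧ ∀ (p : ℝ≥0∞) (μ : Measure (EV m)) (D : List (Fin m) → EV m → ℝ),
    WNormD 2 p μ D ≤ K * eLpNorm (jetD D) p μ := by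
  have hf : {l : List (Fin m) | l.length ≤ 2}.Finite := List.finite_length_le _ 2
  refine ⟨(hf.toFinset.card : ℝ≥0∞), ENNReal.natCast_ne_top _, fun p μ D => ?_⟩
  unfold WNormD
  rw [tsum_eq_sum (s := hf.toFinset)]
  · rw [← nsmul_eq_mul]
    refine Finset.sum_le_card_nsmul _ _ _ fun l hl => ?_
    have hl' : l.length ≤ 2 := by simpa using hl
    rw [if_pos hl']
    exact eLpNorm_mono fun x => jetD_le D l hl' x
  · intro l hl
    have hl' : ¬ l.length ≤ 2 := by simpa using hl
    rw [if_neg hl']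

lemma jetD_sub_classical (D : List (Fin m) → EV m → ℝ) {v : EV m → ℝ} (hv : ContDiff ℝ 2 v) (x : EV m) :
    jetD (fun l y => 1 * D l y + (-1) * partialDList l v y) x = jetD D x - jj v x := by
  rw [← jetD_classical hv]
  refine jet_ext_coord ?_ (fun i => ?_) (fun i j => ?_)
  · change _ = (jetD D x).a - (jetD (fun l => partialDList l v) x).a
    simp only [jetD_a]; ring
  · change _ = (jetD D x).b _ - (jetD (fun l => partialDList l v) x).b _
    simp only [jetD_b]; ring
  · change _ = (jetD D x).c _ _ - (jetD (fun l => partialDList l v) x).c _ _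
    simp only [jetD_c]; ring

/-- the second order term -/
def so (M : Matrix (Fin m) (Fin m) ℝ) (D : List (Fin m) → EV m → ℝ) (x : EV m) : ℝ :=
  ∑ i : Fin m, ∑ j : Fin m, M i j * D [i, j] x

lemma so_memLp (M : Matrix (Fin m) (Fin m) ℝ) {D : List (Fin m) → EV m → ℝ}
    (hD : ∀ l : List (Fin m), l.length ≤ 2 → MemLp (D l) p μ) : MemLp (so M D) p μ := by
  refine memLp_finsetSum _ fun i _ => memLp_finsetSum _ fun j _ => ?_
  exact (hD [i, j] (by simp)).const_mul _

lemma so_classical (M : Matrix (Fin m) (Fin m) ℝ) {v : EV m → ℝ} (hv : ContDiff ℝ 2 v) (x : EV m) :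
    so M (fun l => partialDList l v) x = contr M (fderiv ℝ (fderiv ℝ v) x) := by
  unfold so contr
  simp only [pdl2 hv]

lemma so_le (M : Matrix (Fin m) (Fin m) ℝ) (D : List (Fin m) → EV m → ℝ) (x : EV m) :
    ‖so M D x‖ ≤ (∑ i : Fin m, ∑ j : Fin m, ‖M i j‖) * ‖jetD D x‖ := by
  unfold so
  rw [Finset.sum_mul]
  refine (norm_sum_le _ _).trans (Finset.sum_le_sum fun i _ => ?_)
  rw [Finset.sum_mul]
  refine (norm_sum_le _ _).trans (Finset.sum_le_sum fun j _ => ?_)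
  rw [norm_mul]
  exact mul_le_mul_of_nonneg_left (jetD_le D [i, j] (by simp) x) (norm_nonneg _)

variable {n : ℕ} {Ω : Set (EV (n + 1))} {ρ : EV (n + 1) → ℝ} {u : EV (n + 1) → ℝ} {D : List (Fin (n + 1)) → EV (n + 1) → ℝ}

lemma nl_classical (hΩ : IsOpen Ω) (h1 : A1 ρ) {ε c : ℝ} (hε : 0 < ε) {L : (EV (n + 1) → ℝ) → EV (n + 1) → ℝ}
    (hL : IsNLExtOn Ω (momentum ρ) ρ p ε c L) {v : EV (n + 1) → ℝ} (hv : ContDiff ℝ 2 v) (hc : HasCompactSupport v)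
    (hW : MemWN Ω (momentum ρ) 2 p v) :
    L v =ᵐ[volume.restrict Ω] fun x => Rop Ω ρ ε v x - fderiv ℝ v x (bvec Ω ρ ε x) := by
  filter_upwards [hL.1 v hv hc hW, ae_restrict_mem hΩ.measurableSet] with x hx hxΩ
  exact pv_eq h1 hε hΩ hv hc hxΩ hx

lemma nl_cauchy (hΩ : IsGraphDomain 3 Ω) (hcpt : IsCompact (frontier Ω)) (h1 : A1 ρ)
    (hM : (momentum ρ)ᵀ = momentum ρ) (hp1 : 1 ≤ p)
    {K : ℝ≥0∞} (hK : ∀ ε : ℝ, 0 < ε → ∀ v : EV (n + 1) → ℝ, ContDiff ℝ 2 v → HasCompactSupport v →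
      NBC Ω (momentum ρ) v →
      eLpNorm (fun x => Rop Ω ρ ε v x - fderiv ℝ v x (bvec Ω ρ ε x)) p (volume.restrict Ω)
        ≤ K * eLpNorm (jj v) p volume)
    (hD : IsSobDerivs Ω 2 p u D) (hu : MemWN Ω (momentum ρ) 2 p u)
    {v : ℕ → EV (n + 1) → ℝ} (hv : ∀ j, ContDiff ℝ 2 (v j) ∧ HasCompactSupport (v j) ∧ NBC Ω (momentum ρ) (v j))
    (hlim : Tendsto (fun j => eLpNorm (fun x => jetD D x - jj (v j) x) p (volume.restrict Ω)) atTop (𝓝 0))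
    {η : ℝ≥0∞} {N : ℕ} (hN : ∀ j ≥ N, ∀ k ≥ N, eLpNorm (fun x => jj (v j) x - jj (v k) x) p volume ≤ η)
    {ε c : ℝ} (hε : 0 < ε) {L : (EV (n + 1) → ℝ) → EV (n + 1) → ℝ}
    (hL : IsNLExtOn Ω (momentum ρ) ρ p ε c L) {k : ℕ} (hk : N ≤ k) :
    eLpNorm (fun x => L u x - L (v k) x) p (volume.restrict Ω) ≤ K * η := by
  have hW : ∀ j, MemWN Ω (momentum ρ) 2 p (v j) := fun j => wn_of_nbc hΩ hcpt hp1 hM (hv j).1 (hv j).2.1 (hv j).2.2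
  obtain ⟨K', hK't, hK'⟩ := wnorm_le (n + 1)
  have e1 : ∀ j, eLpNorm (fun x => L u x - L (v j) x) p (volume.restrict Ω)
      ≤ ENNReal.ofReal c * K' * eLpNorm (fun x => jetD D x - jj (v j) x) p (volume.restrict Ω) := by
    intro j
    have h2 := hL.2.1 u (v j) hu (hW j) 1 (-1)
    have h3 : (fun x => L u x - L (v j) x) =ᵐ[volume.restrict Ω] L (fun x => 1 * u x + (-1) * v j x) := by
      filter_upwards [h2] with x hx
      rw [hx]; ring
    rw [eLpNorm_congr_ae h3]
    refine (hL.2.2.2 _ _ (neumann_lin hΩ.1 hp1 hu (hW j) 1 (-1))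
      (sob_lin hp1 hD (sob_classical (hv j).1 (hv j).2.1) 1 (-1))).trans ?_
    rw [mul_assoc]
    refine mul_le_mul_right ((hK' _ _ _).trans (le_of_eq ?_)) _
    congr 2
    ext1 x
    exact jetD_sub_classical D (hv j).1 x
  have e2 : ∀ j ≥ N, eLpNorm (fun x => L (v j) x - L (v k) x) p (volume.restrict Ω) ≤ K * η := by
    intro j hj
    have h2 := hL.2.1 (v j) (v k) (hW j) (hW k) 1 (-1)
    have hw : (fun x => 1 * v j x + (-1) * v k x) = fun x => v j x - v k x := by ext1 x; ring
    have hw2 : ContDiff ℝ 2 (fun x => v j x - v k x) := (hv j).1.sub (hv k).1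
    have hwc : HasCompactSupport (fun x => v j x - v k x) := (hv j).2.1.sub (hv k).2.1
    have hwN : NBC Ω (momentum ρ) (fun x => v j x - v k x) := nbc_sub (hv j).1 (hv k).1 (hv j).2.2 (hv k).2.2
    rw [hw] at h2
    have h3 : (fun x => L (v j) x - L (v k) x) =ᵐ[volume.restrict Ω]
        fun x => Rop Ω ρ ε (fun x => v j x - v k x) x - fderiv ℝ (fun x => v j x - v k x) x (bvec Ω ρ ε x) := by
      filter_upwards [h2, nl_classical hΩ.1 h1 hε hL hw2 hwc (wn_of_nbc hΩ hcpt hp1 hM hw2 hwc hwN)] with x hx hx'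
      rw [← hx', hx]; ring
    rw [eLpNorm_congr_ae h3]
    refine (hK ε hε _ hw2 hwc hwN).trans (mul_le_mul_right (le_trans (le_of_eq ?_) (hN j hj k hk)) _)
    congr 1
    ext1 x
    exact jj_sub (hv j).1 (hv k).1 x
  have hlim2 : Tendsto (fun j => ENNReal.ofReal c * K' * eLpNorm (fun x => jetD D x - jj (v j) x) p (volume.restrict Ω) + K * η)
      atTop (𝓝 (K * η)) := by
    have := (ENNReal.Tendsto.const_mul (a := ENNReal.ofReal c * K') hlim (Or.inr (by finiteness))).add_const (K * η)
    simpa using this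
  refine ge_of_tendsto hlim2 ?_
  filter_upwards [eventually_ge_atTop N] with j hj
  have e : (fun x => L u x - L (v k) x) = (fun x => L u x - L (v j) x) + fun x => L (v j) x - L (v k) x := by
    ext1 x; simp
  have hmu := (hL.2.2.1 u hu).aestronglyMeasurable
  have hmj := fun j => (hL.2.2.1 (v j) (hW j)).aestronglyMeasurable
  rw [e]
  exact (eLpNorm_add_le (hmu.sub (hmj j)) ((hmj j).sub (hmj k)) hp1).trans (add_le_add (e1 j) (e2 j hj))

lemma main_aux (hΩ : IsGraphDomain 3 Ω) (hcpt : IsCompact (frontier Ω))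
    (hρ1 : A1 ρ) (hρ2 : A2 ρ) (hp1 : 1 ≤ p) (hp : p ≠ ⊤)
    (L : ℝ → (EV (n + 1) → ℝ) → EV (n + 1) → ℝ)
    (hL : ∀ ε : ℝ, 0 < ε → ε ≤ 1 → ∃ c : ℝ, 0 < c ∧
      IsNLExtOn Ω (momentum ρ) ρ p ε c (L ε))
    (hbc : NeumannBC Ω (momentum ρ) p u)
    (hD : IsSobDerivs Ω 2 p u D) :
    Tendsto (fun ε : ℝ => eLpNorm (fun x => L ε u x + so (momentum ρ) D x) p (volume.restrict Ω))
      (𝓝[>] 0) (𝓝 0) := by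
  obtain ⟨A, hA, hAA, -⟩ := hρ2.2.2
  obtain ⟨hM, hpos⟩ := mom_facts hA hAA
  obtain ⟨K, hKt, hK⟩ := UE hρ1 hρ2 hΩ hcpt hp1 hp
  obtain ⟨v, hv, hcau, hlim⟩ := appr_one hΩ hcpt hM hpos hp1 hp hD hbc
  have hW : ∀ j, MemWN Ω (momentum ρ) 2 p (v j) := fun j => wn_of_nbc hΩ hcpt hp1 hM (hv j).1 (hv j).2.1 (hv j).2.2
  have hu : MemWN Ω (momentum ρ) 2 p u := ⟨⟨D, hD⟩, hbc⟩
  have hlim' : Tendsto (fun j => eLpNorm (fun x => jetD D x - jj (v j) x) p (volume.restrict Ω)) atTop (𝓝 0) := by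
    refine hlim.congr fun j => ?_
    rw [← eLpNorm_neg]
    congr 1
    ext1 x
    rw [Pi.neg_apply, jm_one, neg_sub]
  set C : ℝ := ∑ i : Fin (n + 1), ∑ j : Fin (n + 1), ‖momentum ρ i j‖
  have hso : ∀ k, eLpNorm (fun x => so (momentum ρ) D x - so (momentum ρ) (fun l => partialDList l (v k)) x) p (volume.restrict Ω)
      ≤ ENNReal.ofReal C * eLpNorm (fun x => jetD D x - jj (v k) x) p (volume.restrict Ω) := by
    intro k
    refine eLpNorm_le_mul_eLpNorm_of_ae_le_mul (ae_of_all _ fun x => ?_) p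
    rw [← jetD_sub_classical D (hv k).1]
    refine le_trans (le_of_eq (congrArg _ ?_)) (so_le (momentum ρ) _ x)
    unfold so
    simp only [← Finset.sum_sub_distrib]
    refine Finset.sum_congr rfl fun i _ => Finset.sum_congr rfl fun j _ => by ring
  rw [ENNReal.tendsto_nhds_zero]
  intro η hη
  have hη3 : 0 < η / 3 := ENNReal.div_pos hη.ne' (by finiteness)
  have hη1 : 0 < η / 3 / (K + 1) := ENNReal.div_pos hη3.ne' (by finiteness)
  obtain ⟨N, hN⟩ := hcau _ hη1
  have hlim3 : Tendsto (fun k => ENNReal.ofReal C * eLpNorm (fun x => jetD D x - jj (v k) x) p (volume.restrict Ω)) atTop (𝓝 0) := by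
    have := ENNReal.Tendsto.const_mul (a := ENNReal.ofReal C) hlim' (Or.inr (by finiteness))
    simpa using this
  obtain ⟨k, hk3, hkN⟩ := ((hlim3.eventually (ge_mem_nhds hη3)).and (eventually_ge_atTop N)).exists
  have hCV := CV hρ1 hρ2 hΩ hcpt hp1 hp (hv k).1 (hv k).2.1 (hv k).2.2
  filter_upwards [hCV.eventually (ge_mem_nhds hη3), self_mem_nhdsWithin,
    mem_nhdsWithin_of_mem_nhds (Iic_mem_nhds (zero_lt_one (α := ℝ)))] with ε he hε hε1
  obtain ⟨c, -, hLε⟩ := hL ε hε hε1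
  have e1 := nl_cauchy hΩ hcpt hρ1 hM hp1 hK hD hu hv hlim' hN hε hLε hkN
  have e1' : K * (η / 3 / (K + 1)) ≤ η / 3 :=
    (mul_le_mul_left (le_self_add (a := K) (b := 1)) _).trans ENNReal.mul_div_le
  have hmu := (hLε.2.2.1 u hu).aestronglyMeasurable
  have hmk := (hLε.2.2.1 (v k) (hW k)).aestronglyMeasurable
  have hmD := (so_memLp (momentum ρ) hD.2.2).aestronglyMeasurable
  have hmv := (so_memLp (momentum ρ) (sob_classical (Ω := Ω) (p := p) (hv k).1 (hv k).2.1).2.2).aestronglyMeasurable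
  have e2 : eLpNorm (fun x => L ε (v k) x + so (momentum ρ) (fun l => partialDList l (v k)) x) p (volume.restrict Ω) ≤ η / 3 := by
    refine le_trans (le_of_eq (eLpNorm_congr_ae ?_)) he
    filter_upwards [nl_classical hΩ.1 hρ1 hε hLε (hv k).1 (hv k).2.1 (hW k)] with x hx
    rw [hx, so_classical _ (hv k).1]
  have e : (fun x => L ε u x + so (momentum ρ) D x) = ((fun x => L ε u x - L ε (v k) x)
      + (fun x => L ε (v k) x + so (momentum ρ) (fun l => partialDList l (v k)) x))
      + (fun x => so (momentum ρ) D x - so (momentum ρ) (fun l => partialDList l (v k)) x) := by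
    ext1 x; simp only [Pi.add_apply]; ring
  rw [e]
  calc _ ≤ η / 3 + η / 3 + η / 3 := by
        refine (eLpNorm_add_le ((hmu.sub hmk).add (hmk.add hmv)) (hmD.sub hmv) hp1).trans ?_
        refine add_le_add ((eLpNorm_add_le (hmu.sub hmk) (hmk.add hmv) hp1).trans ?_) ((hso k).trans hk3)
        exact add_le_add (e1.trans e1') e2
    _ = η := ENNReal.add_thirds η

end P29

end Part29

/-- nonlocal-to-local convergence on a domain with compact `C³`
boundary: let `Ω ⊂ ℝⁿ` be a domain with compact boundary of class `C³`, `p ∈ [1,∞)`,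
and let `ρ` satisfy (A1) and (A2). Then for every `u ∈ W^{2,p}_M(Ω)`,
`L_ε^Ω u → L^Ω u = -div(M∇u)` strongly in `L^p(Ω)` as `ε → 0`, where
`-div(M∇u) = -∑_{i,j} M_{ij} ∂ᵢ∂ⱼ u` is expressed through the weak derivatives `D`,
and `L_ε^Ω` is (any choice of) the bounded linear extension of the nonlocal operator
to `W^{2,p}_M(Ω)`. -/
theorem nlOp_convergence_domain (n : ℕ) (Ω : Set (EV (n + 1)))
    (hΩ : IsGraphDomain 3 Ω) (hconn : IsConnected Ω) (hcpt : IsCompact (frontier Ω))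
    (ρ : EV (n + 1) → ℝ) (hρ1 : A1 ρ) (hρ2 : A2 ρ)
    (p : ℝ≥0∞) (hp1 : 1 ≤ p) (hp : p ≠ ⊤)
    (L : ℝ → (EV (n + 1) → ℝ) → EV (n + 1) → ℝ)
    (hL : ∀ ε : ℝ, 0 < ε → ε ≤ 1 → ∃ c : ℝ, 0 < c ∧
      IsNLExtOn Ω (momentum ρ) ρ p ε c (L ε))
    (u : EV (n + 1) → ℝ) (D : List (Fin (n + 1)) → EV (n + 1) → ℝ)
    (hbc : NeumannBC Ω (momentum ρ) p u)
    (hD : IsSobDerivs Ω 2 p u D) :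
    Tendsto
      (fun ε : ℝ =>
        eLpNorm
          (fun x => L ε u x
            + ∑ i : Fin (n + 1), ∑ j : Fin (n + 1), momentum ρ i j * D [i, j] x)
          p (volume.restrict Ω))
      (𝓝[>] 0) (𝓝 0) := by
  exact main_aux hΩ hcpt hρ1 hρ2 hp1 hp L hL hbc hD
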